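/- Let α = 1/2 and α < β < 1. Let f : I × I → ℝ be Hölder continuous with ∫ f dν = 0 and c := ∫₀¹ f(0,ω) dω ≠ 0. Then the distributions of S_n f / √(c² A n ln n) under ν converge weakly, as n → ∞, to the standard Gaussian law N(0,1), where A = (1/4)(α p₁)^{-1/α} ∫₀¹ h(1/2,ω) dω. -/

import Mathlib

open MeasureTheory Filter Set Topology

noncomputable section

/-- The Liverani–Saussol–Vaienti map `T_a` on `[0,1]`. -/
def lsv (a x : ℝ) : ℝ := if x ≤ 1 / 2 then x * (1 + (2 : ℝ) ^ a * x ^ a) else 2 * x - 1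

/-- Random parameter selection: `α` on `[0,p₁)`, `β` on `[p₁,1]`. -/
def alphaOf (α β p₁ ω : ℝ) : ℝ := if ω < p₁ then α else β

/-- The noise dynamics `φ` on `[0,1]`. -/
def phiMap (p₁ ω : ℝ) : ℝ := if ω < p₁ then ω / p₁ else (ω - p₁) / (1 - p₁)

/-- The skew product `S(x,ω) = (T_{α(ω)} x, φ ω)`. -/
def skewLSV (α β p₁ : ℝ) (p : ℝ × ℝ) : ℝ × ℝ :=
  (lsv (alphaOf α β p₁ p.2) p.1, phiMap p₁ p.2)

/-- The base of inducing, `Δ₀ = (1/2,1] × [0,1]`. -/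
def Δ0 : Set (ℝ × ℝ) := Ioc (1 / 2 : ℝ) 1 ×ˢ Icc (0 : ℝ) 1

/-- Birkhoff sums `S_n f` of the skew product. -/
def birkhoff (α β p₁ : ℝ) (f : ℝ × ℝ → ℝ) (n : ℕ) (p : ℝ × ℝ) : ℝ :=
  ∑ k ∈ Finset.range n, f ((skewLSV α β p₁)^[k] p)

/-- The constant `A = (1/4)(α p₁)^{-1/α} ∫₀¹ h(1/2,ω) dω`. -/
def Aconst (α p₁ : ℝ) (h : ℝ × ℝ → ℝ) : ℝ :=
  (1 / 4 : ℝ) * (α * p₁) ^ (-(1 / α)) * ∫ ω in Icc (0 : ℝ) 1, h (1 / 2, ω)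

section AbstractCLT

variable {Ω : Type*} [MeasurableSpace Ω]

/-- A bounded measurable function on a finite measure space is integrable. -/
theorem integrable_of_bdd {E : Type*} [NormedAddCommGroup E] [MeasurableSpace E] [BorelSpace E]
    [SecondCountableTopology E] {m : Measure Ω} [IsFiniteMeasure m] {v : Ω → E}
    (hv : Measurable v) {C : ℝ} (hC : ∀ x, ‖v x‖ ≤ C) : Integrable v m :=
  Integrable.of_bound hv.aestronglyMeasurable C (ae_of_all _ hC)

theorem _root_.MeasureTheory.MeasurePreserving.integral_comp_of_measurable {E : Type*}
    [NormedAddCommGroup E] [NormedSpace ℝ E] [MeasurableSpace E] [BorelSpace E]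
    [SecondCountableTopology E] {m : Measure Ω} {F : Ω → Ω} (hF : MeasurePreserving F m m)
    {g : Ω → E} (hg : Measurable g) : ∫ x, g (F x) ∂m = ∫ x, g x ∂m := by
  rw [← integral_map (φ := F) hF.measurable.aemeasurable
    (by rw [hF.map_eq]; exact hg.aestronglyMeasurable), hF.map_eq]

/-- Variance growth of Birkhoff sums under geometric decay of correlations. -/
theorem integral_sum_sq_le {m : Measure Ω} [IsProbabilityMeasure m] {F : Ω → Ω}
    (hF : MeasurePreserving F m m) {v : Ω → ℝ} (hv : Measurable v) {C : ℝ}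
    (hC : ∀ x, |v x| ≤ C) {B θ : ℝ} (hB : 0 ≤ B) (hθ0 : 0 ≤ θ) (hθ : θ < 1)
    (hcor : ∀ n : ℕ, |∫ x, v x * v (F^[n + 1] x) ∂m| ≤ B * θ ^ n) (k : ℕ) :
    ∫ x, (∑ j ∈ Finset.range k, v (F^[j] x)) ^ 2 ∂m
      ≤ k * ((∫ x, v x ^ 2 ∂m) + 2 * B / (1 - θ)) := by
  have hFm : ∀ j : ℕ, Measurable (F^[j]) := fun j => hF.measurable.iterate j
  have hSm : ∀ k : ℕ, Measurable fun x => ∑ j ∈ Finset.range k, v (F^[j] x) := fun k =>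
    Finset.measurable_sum _ fun j _ => hv.comp (hFm j)
  have hSb : ∀ (k : ℕ) x, |∑ j ∈ Finset.range k, v (F^[j] x)| ≤ k * C := fun k x => by
    refine (Finset.abs_sum_le_sum_abs _ _).trans ?_
    simpa using Finset.sum_le_sum (fun j (_ : j ∈ Finset.range k) => hC (F^[j] x))
  induction k with
  | zero => simp
  | succ k ih =>
    set S : Ω → ℝ := fun x => ∑ j ∈ Finset.range k, v (F^[j] x) with hS
    have hdec : ∀ x, (∑ j ∈ Finset.range (k + 1), v (F^[j] x)) ^ 2
        = v x ^ 2 + 2 * (v x * S (F x)) + S (F x) ^ 2 := by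
      intro x
      rw [Finset.sum_range_succ']
      simp only [Function.iterate_succ_apply, Function.iterate_zero, id, hS]
      ring
    have hi1 : Integrable (fun x => v x ^ 2) m :=
      integrable_of_bdd (hv.pow_const 2) (C := C ^ 2) fun x => by
        simpa using pow_le_pow_left₀ (abs_nonneg _) (hC x) 2
    have hi2 : Integrable (fun x => v x * S (F x)) m :=
      integrable_of_bdd (hv.mul ((hSm k).comp hF.measurable)) (C := C * (k * C)) fun x => by
        rw [Real.norm_eq_abs, abs_mul]
        exact mul_le_mul (hC x) (hSb k _) (abs_nonneg _) ((abs_nonneg _).trans (hC x))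
    have hi3 : Integrable (fun x => S (F x) ^ 2) m :=
      integrable_of_bdd (((hSm k).comp hF.measurable).pow_const 2) (C := (k * C) ^ 2) fun x => by
        simpa using pow_le_pow_left₀ (abs_nonneg _) (hSb k (F x)) 2
    have hcross : ∫ x, v x * S (F x) ∂m ≤ B / (1 - θ) := by
      have h1 : ∫ x, v x * S (F x) ∂m
          = ∑ j ∈ Finset.range k, ∫ x, v x * v (F^[j + 1] x) ∂m := by
        rw [← integral_finsetSum]
        · refine integral_congr_ae (ae_of_all _ fun x => ?_)
          simp only [hS, Finset.mul_sum, Function.iterate_succ_apply]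
        · intro j _
          refine integrable_of_bdd (hv.mul (hv.comp (hFm _))) (C := C * C) fun x => ?_
          rw [Real.norm_eq_abs, abs_mul]
          exact mul_le_mul (hC x) (hC _) (abs_nonneg _) ((abs_nonneg _).trans (hC x))
      rw [h1]
      calc _ ≤ ∑ j ∈ Finset.range k, B * θ ^ j :=
            Finset.sum_le_sum fun j _ => (le_abs_self _).trans (hcor j)
        _ = B * ∑ j ∈ Finset.range k, θ ^ j := by rw [Finset.mul_sum]
        _ ≤ B * (1 - θ)⁻¹ := by
            refine mul_le_mul_of_nonneg_left ?_ hB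
            rw [← tsum_geometric_of_lt_one hθ0 hθ]
            exact (summable_geometric_of_lt_one hθ0 hθ).sum_le_tsum _ fun i _ => by positivity
        _ = B / (1 - θ) := by rw [div_eq_mul_inv]
    have hst : ∫ x, S (F x) ^ 2 ∂m = ∫ x, S x ^ 2 ∂m :=
      hF.integral_comp_of_measurable ((hSm k).pow_const 2)
    simp_rw [hdec]
    have hi12 : Integrable (fun x => v x ^ 2 + 2 * (v x * S (F x))) m := hi1.add (hi2.const_mul 2)
    rw [integral_add hi12 hi3, integral_add hi1 (hi2.const_mul 2),
      integral_const_mul, hst]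
    push_cast
    have : 2 * B / (1 - θ) = 2 * (B / (1 - θ)) := by ring
    rw [this] at ih ⊢
    linarith

/-- `a` represents the conditional expectation of `u` given `F`: it is the transfer operator of
`F` applied to `u`, tested against bounded measurable functions. -/
def IsTransfer (m : Measure Ω) (F : Ω → Ω) (u a : Ω → ℝ) : Prop :=
  ∀ w : Ω → ℂ, Measurable w → (∃ C : ℝ, ∀ x, ‖w x‖ ≤ C) →
    ∫ x, (u x : ℂ) * w (F x) ∂m = ∫ x, (a x : ℂ) * w x ∂m

theorem IsTransfer.real {m : Measure Ω} {F : Ω → Ω} {u a : Ω → ℝ} (h : IsTransfer m F u a)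
    {w : Ω → ℝ} (hw : Measurable w) {C : ℝ} (hC : ∀ x, |w x| ≤ C) :
    ∫ x, u x * w (F x) ∂m = ∫ x, a x * w x ∂m := by
  have := h (fun x => (w x : ℂ)) (Complex.measurable_ofReal.comp hw) ⟨C, fun x => by simpa using hC x⟩
  have e1 := integral_ofReal (μ := m) (𝕜 := ℂ) (f := fun x => u x * w (F x))
  have e2 := integral_ofReal (μ := m) (𝕜 := ℂ) (f := fun x => a x * w x)
  push_cast at e1 e2
  simp only [Complex.coe_algebraMap] at e1 e2
  exact_mod_cast (e1.symm.trans this).trans e2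

/-- One-step estimate for the characteristic function of a reverse martingale. -/
theorem norm_exp_mul_one_sub_sub_one_le {x : ℝ} (hx : |x| ≤ 1) :
    |Real.exp x * (1 - x) - 1| ≤ 3 * x ^ 2 := by
  have h := Real.abs_exp_sub_one_sub_id_le hx
  have h2 : Real.exp x * (1 - x) - 1 = (Real.exp x - 1 - x) * (1 - x) - x ^ 2 := by ring
  rw [h2]
  have h3 : |1 - x| ≤ 2 := by rw [abs_le] at *; constructor <;> linarith
  calc _ ≤ |(Real.exp x - 1 - x) * (1 - x)| + |x ^ 2| := abs_sub _ _
    _ ≤ x ^ 2 * 2 + x ^ 2 := by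
        rw [abs_mul, abs_of_nonneg (sq_nonneg x)]
        gcongr
    _ = 3 * x ^ 2 := by ring

theorem norm_exp_I_sub_taylor_two_le (y : ℝ) :
    ‖Complex.exp (y * Complex.I) - (1 + y * Complex.I - y ^ 2 / 2)‖ ≤ 4 * |y| ^ 3 := by
  have hn : ‖(y : ℂ) * Complex.I‖ = |y| := by simp
  rcases le_or_gt |y| 1 with h | h
  · have := Complex.exp_bound (x := y * Complex.I) (hn.le.trans h) (n := 3) (by norm_num)
    have e : ∑ i ∈ Finset.range 3, ((y : ℂ) * Complex.I) ^ i / (i.factorial : ℂ)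
        = 1 + y * Complex.I - y ^ 2 / 2 := by
      simp [Finset.sum_range_succ, mul_pow, Nat.factorial]
      ring
    rw [e, hn] at this
    refine this.trans ?_
    norm_num [Nat.factorial]
    nlinarith [pow_nonneg (abs_nonneg y) 3]
  · calc _ ≤ ‖Complex.exp (y * Complex.I)‖ + (‖(1 : ℂ)‖ + ‖(y : ℂ) * Complex.I‖
          + ‖(y : ℂ) ^ 2 / 2‖) := by
          refine (norm_sub_le _ _).trans (add_le_add le_rfl ?_)
          refine (norm_sub_le _ _).trans (add_le_add (norm_add_le _ _) le_rfl)
      _ = 1 + (1 + |y| + |y| ^ 2 / 2) := by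
          rw [Complex.norm_exp_ofReal_mul_I, hn]
          simp
      _ ≤ 4 * |y| ^ 3 := by
          nlinarith [mul_pos (sub_pos.2 h) (sub_pos.2 h), mul_pos (mul_pos (sub_pos.2 h) (sub_pos.2 h)) (sub_pos.2 h)]

/-- Quantitative control of the characteristic function of a bounded reverse martingale with
bounded conditional variances `V`. -/
theorem norm_integral_exp_martingale_sub_one_le {m : Measure Ω} [IsProbabilityMeasure m]
    {F : Ω → Ω} (hF : MeasurePreserving F m m) {M V : Ω → ℝ} (hM : Measurable M)
    (hV : Measurable V) {B C : ℝ} (hMB : ∀ x, |M x| ≤ B) (hVC : ∀ x, |V x| ≤ C)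
    (h1 : IsTransfer m F M 0) (h2 : IsTransfer m F (fun x => M x ^ 2) V) (s : ℝ)
    (hs : s ^ 2 * C / 2 ≤ 1) (k : ℕ) :
    ‖(∫ x, Complex.exp (∑ j ∈ Finset.range k,
        ((s * M (F^[j] x) : ℝ) * Complex.I + (s ^ 2 / 2 * V (F^[j + 1] x) : ℝ))) ∂m) - 1‖
      ≤ k * (Real.exp (k * (s ^ 2 * C / 2)) *
        (3 * (s ^ 2 * C / 2) ^ 2 + 4 * |s| ^ 3 * B * C)) := by
  obtain ⟨x0⟩ : Nonempty Ω := nonempty_of_isProbabilityMeasure m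
  have hB0 : 0 ≤ B := (abs_nonneg _).trans (hMB x0)
  have hC0 : 0 ≤ C := (abs_nonneg _).trans (hVC x0)
  have hv0 : 0 ≤ s ^ 2 * C / 2 := by positivity
  set v0 := s ^ 2 * C / 2 with hv0_def
  have hFm : ∀ j : ℕ, Measurable (F^[j]) := fun j => hF.measurable.iterate j
  set T : ℕ → Ω → ℂ := fun k x => ∑ j ∈ Finset.range k,
        ((s * M (F^[j] x) : ℝ) * Complex.I + (s ^ 2 / 2 * V (F^[j + 1] x) : ℝ)) with hT
  have hTm : ∀ k, Measurable (T k) := fun k => by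
    refine Finset.measurable_sum _ fun j _ => ?_
    have := hM.comp (hFm j)
    have := hV.comp (hFm (j + 1))
    simp only [Function.comp_def] at *
    fun_prop
  have hVs : ∀ x, |s ^ 2 / 2 * V x| ≤ v0 := fun x => by
    rw [abs_mul, abs_of_nonneg (by positivity : (0 : ℝ) ≤ s ^ 2 / 2), hv0_def]
    nlinarith [hVC x, sq_nonneg s]
  have hTre : ∀ k x, ‖Complex.exp (T k x)‖ ≤ Real.exp (k * v0) := fun k x => by
    rw [Complex.norm_exp, Real.exp_le_exp]
    simp only [hT, Complex.re_sum, Complex.add_re, Complex.mul_I_re, Complex.ofReal_im,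
      Complex.ofReal_re, neg_zero, zero_add]
    calc _ ≤ ∑ j ∈ Finset.range k, v0 :=
          Finset.sum_le_sum fun j _ => (le_abs_self _).trans (hVs _)
      _ = k * v0 := by simp
  have hstep : ∀ k, ‖(∫ x, Complex.exp (T (k + 1) x) ∂m) - ∫ x, Complex.exp (T k x) ∂m‖
      ≤ Real.exp ((k + 1) * v0) * (3 * v0 ^ 2 + 4 * |s| ^ 3 * B * C) := by
    intro k
    set w : Ω → ℂ := fun x => Complex.exp ((s ^ 2 / 2 * V x : ℝ) : ℂ) * Complex.exp (T k x)
      with hw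
    have hwm : Measurable w := by
      have := hTm k
      fun_prop
    have hwb : ∀ x, ‖w x‖ ≤ Real.exp ((k + 1) * v0) := fun x => by
      rw [hw, norm_mul, add_mul, one_mul, add_comm, Real.exp_add]
      refine mul_le_mul ?_ (hTre k x) (norm_nonneg _) (Real.exp_nonneg _)
      rw [Complex.norm_exp_ofReal, Real.exp_le_exp]
      exact (le_abs_self _).trans (hVs x)
    set E := Real.exp ((k + 1) * v0) with hE
    set ρ : Ω → ℂ := fun x => Complex.exp ((s * M x : ℝ) * Complex.I)
      - (1 + (s * M x : ℝ) * Complex.I - (s * M x : ℝ) ^ 2 / 2) with hρ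
    have hρm : Measurable ρ := by fun_prop
    have hρb : ∀ x, ‖ρ x‖ ≤ 4 * |s| ^ 3 * B * M x ^ 2 := fun x => by
      refine (norm_exp_I_sub_taylor_two_le _).trans ?_
      rw [abs_mul, mul_pow, pow_succ |M x| 2, sq_abs]
      have := hMB x
      have h3 : 0 ≤ |s| ^ 3 * M x ^ 2 := by positivity
      nlinarith
    have hM2b : ∀ x, |M x ^ 2| ≤ B ^ 2 := fun x => by
      rw [abs_pow]; exact pow_le_pow_left₀ (abs_nonneg _) (hMB x) 2
    have hM2 : ∀ x, M x ^ 2 ≤ B ^ 2 := fun x => (le_abs_self _).trans (hM2b x)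
    have hwF : Measurable fun x => w (F x) := hwm.comp hF.measurable
    have hdec : ∀ x, Complex.exp (T (k + 1) x) = w (F x) + (s * Complex.I) * ((M x : ℂ) * w (F x))
        - (s ^ 2 / 2 : ℂ) * (((M x ^ 2 : ℝ) : ℂ) * w (F x)) + ρ x * w (F x) := by
      intro x
      have : T (k + 1) x = (s * M x : ℝ) * Complex.I + (((s ^ 2 / 2 * V (F x) : ℝ) : ℂ)
          + T k (F x)) := by
        simp only [hT]
        rw [Finset.sum_range_succ']
        simp only [Function.iterate_succ_apply, Function.iterate_zero, id]
        ring
      rw [this, Complex.exp_add, Complex.exp_add]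
      simp only [hw, hρ]
      push_cast
      ring
    have i1 : Integrable (fun x => w (F x)) m := integrable_of_bdd hwF fun x => hwb _
    have i2 : Integrable (fun x => (M x : ℂ) * w (F x)) m := by
      refine integrable_of_bdd ((Complex.measurable_ofReal.comp hM).mul hwF) (C := B * E) fun x => ?_
      rw [norm_mul, Complex.norm_real]
      exact mul_le_mul (hMB x) (hwb _) (norm_nonneg _) hB0
    have i3 : Integrable (fun x => ((M x ^ 2 : ℝ) : ℂ) * w (F x)) m := by
      refine integrable_of_bdd ((Complex.measurable_ofReal.comp (hM.pow_const 2)).mul hwF)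
        (C := B ^ 2 * E) fun x => ?_
      rw [norm_mul, Complex.norm_real]
      exact mul_le_mul (hM2b x) (hwb _) (norm_nonneg _) (by positivity)
    have i4 : Integrable (fun x => ρ x * w (F x)) m := by
      refine integrable_of_bdd (hρm.mul hwF) (C := 4 * |s| ^ 3 * B * B ^ 2 * E) fun x => ?_
      rw [norm_mul]
      refine mul_le_mul ((hρb x).trans ?_) (hwb _) (norm_nonneg _) (by positivity)
      exact mul_le_mul_of_nonneg_left (hM2 x) (by positivity)
    have j1 : ∫ x, w (F x) ∂m = ∫ x, w x ∂m := hF.integral_comp_of_measurable hwm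
    have j2 : ∫ x, (M x : ℂ) * w (F x) ∂m = 0 := by
      rw [h1 w hwm ⟨_, hwb⟩]; simp
    have j3 : ∫ x, ((M x ^ 2 : ℝ) : ℂ) * w (F x) ∂m = ∫ x, (V x : ℂ) * w x ∂m := h2 w hwm ⟨_, hwb⟩
    have i5 : Integrable w m := integrable_of_bdd hwm hwb
    have i6 : Integrable (fun x => (V x : ℂ) * w x) m := by
      refine integrable_of_bdd ((Complex.measurable_ofReal.comp hV).mul hwm) (C := C * E) fun x => ?_
      rw [norm_mul, Complex.norm_real]
      exact mul_le_mul (hVC x) (hwb _) (norm_nonneg _) hC0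
    have i7 : Integrable (fun x => Complex.exp (T k x)) m :=
      integrable_of_bdd (by have := hTm k; fun_prop) (hTre k)
    have hMV : ∫ x, M x ^ 2 ∂m ≤ C := by
      have := h2.real (w := fun _ => 1) measurable_const (C := 1) (by simp)
      simp only [mul_one] at this
      rw [this]
      have : ∫ x, V x ∂m ≤ ∫ _, C ∂m := integral_mono
        (integrable_of_bdd hV hVC) (integrable_const C) fun x => (le_abs_self _).trans (hVC x)
      simpa using this
    have key : (∫ x, Complex.exp (T (k + 1) x) ∂m) - ∫ x, Complex.exp (T k x) ∂m
        = (∫ x, (w x - (s ^ 2 / 2 : ℂ) * ((V x : ℂ) * w x) - Complex.exp (T k x)) ∂m)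
          + ∫ x, ρ x * w (F x) ∂m := by
      simp_rw [hdec]
      have a1 : Integrable (fun x => w (F x) + (s * Complex.I) * ((M x : ℂ) * w (F x))) m :=
        i1.add (i2.const_mul _)
      have a2 : Integrable (fun x => w (F x) + (s * Complex.I) * ((M x : ℂ) * w (F x))
        - (s ^ 2 / 2 : ℂ) * (((M x ^ 2 : ℝ) : ℂ) * w (F x))) m := a1.sub (i3.const_mul _)
      have a3 : Integrable (fun x => w x - (s ^ 2 / 2 : ℂ) * ((V x : ℂ) * w x)) m :=
        i5.sub (i6.const_mul _)
      rw [integral_add a2 i4, integral_sub a1 (i3.const_mul _), integral_add i1 (i2.const_mul _),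
        integral_const_mul, integral_const_mul, integral_sub a3 i7, integral_sub i5 (i6.const_mul _),
        integral_const_mul, j1, j2, j3]
      ring
    rw [key]
    have b1 : ‖∫ x, (w x - (s ^ 2 / 2 : ℂ) * ((V x : ℂ) * w x) - Complex.exp (T k x)) ∂m‖
        ≤ E * (3 * v0 ^ 2) := by
      refine (norm_integral_le_of_norm_le_const (C := E * (3 * v0 ^ 2)) (ae_of_all _ fun x => ?_)).trans (by simp)
      have : w x - (s ^ 2 / 2 : ℂ) * ((V x : ℂ) * w x) - Complex.exp (T k x)
          = ((Real.exp (s ^ 2 / 2 * V x) * (1 - s ^ 2 / 2 * V x) - 1 : ℝ) : ℂ)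
            * Complex.exp (T k x) := by
        simp only [hw]
        push_cast
        ring
      rw [this, norm_mul, Complex.norm_real, mul_comm E]
      refine mul_le_mul ((norm_exp_mul_one_sub_sub_one_le ((hVs x).trans hs)).trans ?_)
        ((hTre k x).trans ?_) (norm_nonneg _) (by positivity)
      · have := sq_le_sq' (abs_le.1 (hVs x)).1 (abs_le.1 (hVs x)).2
        linarith
      · rw [hE, Real.exp_le_exp]; nlinarith
    have b2 : ‖∫ x, ρ x * w (F x) ∂m‖ ≤ E * (4 * |s| ^ 3 * B * C) := by
      calc _ ≤ ∫ x, ‖ρ x * w (F x)‖ ∂m := norm_integral_le_integral_norm _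
        _ ≤ ∫ x, E * (4 * |s| ^ 3 * B) * M x ^ 2 ∂m := by
            refine integral_mono i4.norm ((integrable_of_bdd (hM.pow_const 2) hM2b).const_mul _)
              fun x => ?_
            simp only [norm_mul]
            calc _ ≤ 4 * |s| ^ 3 * B * M x ^ 2 * E :=
                  mul_le_mul (hρb x) (hwb _) (norm_nonneg _) (by positivity)
              _ = _ := by ring
        _ = E * (4 * |s| ^ 3 * B) * ∫ x, M x ^ 2 ∂m := by rw [integral_const_mul]
        _ ≤ E * (4 * |s| ^ 3 * B) * C := by gcongr
        _ = _ := by ring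
    calc _ ≤ _ := norm_add_le _ _
      _ ≤ E * (3 * v0 ^ 2) + E * (4 * |s| ^ 3 * B * C) := add_le_add b1 b2
      _ = _ := by ring
  change ‖(∫ x, Complex.exp (T k x) ∂m) - 1‖ ≤ _
  have hfin : ∀ l ≤ k, ‖(∫ x, Complex.exp (T l x) ∂m) - 1‖
      ≤ l * (Real.exp (k * v0) * (3 * v0 ^ 2 + 4 * |s| ^ 3 * B * C)) := by
    intro l
    induction l with
    | zero => intro _; simp [hT]
    | succ l ih =>
      intro hl
      have h3 := ih (by omega)
      have h4 := hstep l
      have h5 : Real.exp ((l + 1) * v0) ≤ Real.exp (k * v0) := by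
        rw [Real.exp_le_exp]
        have : ((l + 1 : ℕ) : ℝ) ≤ k := by exact_mod_cast hl
        push_cast at this
        gcongr
      calc _ = ‖((∫ x, Complex.exp (T (l + 1) x) ∂m) - ∫ x, Complex.exp (T l x) ∂m)
            + ((∫ x, Complex.exp (T l x) ∂m) - 1)‖ := by congr 1; ring
        _ ≤ _ := norm_add_le _ _
        _ ≤ Real.exp (k * v0) * (3 * v0 ^ 2 + 4 * |s| ^ 3 * B * C)
          + l * (Real.exp (k * v0) * (3 * v0 ^ 2 + 4 * |s| ^ 3 * B * C)) := by
            refine add_le_add (h4.trans ?_) h3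
            exact mul_le_mul_of_nonneg_right h5 (by positivity)
        _ = _ := by push_cast; ring
  exact hfin k le_rfl

end AbstractCLT

section AbstractCLT

variable {Ω : Type*} [MeasurableSpace Ω]

theorem abs_exp_sub_exp_le {a b c : ℝ} (ha : a ≤ c) (hb : b ≤ c) :
    |Real.exp a - Real.exp b| ≤ Real.exp c * |a - b| := by
  wlog h : b ≤ a generalizing a b
  · rw [abs_sub_comm, abs_sub_comm a b]
    exact this hb ha (le_of_not_ge h)
  rw [abs_of_nonneg (sub_nonneg.2 (Real.exp_le_exp.2 h)), abs_of_nonneg (sub_nonneg.2 h)]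
  have h1 := Real.add_one_le_exp (b - a)
  have h2 : Real.exp b = Real.exp a * Real.exp (b - a) := by rw [← Real.exp_add]; ring_nf
  have h3 := Real.exp_le_exp.2 ha
  rw [h2]
  nlinarith [Real.exp_pos a, sub_nonneg.2 h]

theorem IsTransfer.martingale {m : Measure Ω} [IsProbabilityMeasure m] {F : Ω → Ω}
    (hF : MeasurePreserving F m m) {Z A : Ω → ℝ} (hZ : Measurable Z) (hA : Measurable A)
    {B C : ℝ} (hZB : ∀ x, |Z x| ≤ B) (hAC : ∀ x, |A x| ≤ C) (h : IsTransfer m F Z A) :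
    IsTransfer m F (fun x => Z x - A (F x)) 0 := by
  intro w hw ⟨D, hD⟩
  have hZc : Measurable fun x => (Z x : ℂ) := Complex.measurable_ofReal.comp hZ
  have hAc : Measurable fun x => (A x : ℂ) := Complex.measurable_ofReal.comp hA
  have hwF := hw.comp hF.measurable
  have i1 : Integrable (fun x => (Z x : ℂ) * w (F x)) m := by
    refine integrable_of_bdd (hZc.mul hwF) (C := B * D) fun x => ?_
    rw [norm_mul, Complex.norm_real]
    exact mul_le_mul (hZB x) (hD _) (norm_nonneg _) ((abs_nonneg _).trans (hZB x))
  have i2 : Integrable (fun x => (A (F x) : ℂ) * w (F x)) m := by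
    refine integrable_of_bdd ((hAc.comp hF.measurable).mul hwF) (C := C * D) fun x => ?_
    rw [norm_mul, Complex.norm_real]
    exact mul_le_mul (hAC _) (hD _) (norm_nonneg _) ((abs_nonneg _).trans (hAC x))
  have e : ∀ x, ((Z x - A (F x) : ℝ) : ℂ) * w (F x)
      = (Z x : ℂ) * w (F x) - (A (F x) : ℂ) * w (F x) := fun x => by push_cast; ring
  simp_rw [e]
  rw [integral_sub i1 i2, h w hw ⟨D, hD⟩,
    hF.integral_comp_of_measurable (g := fun x => (A x : ℂ) * w x) (hAc.mul hw)]
  simp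

theorem IsTransfer.martingale_sq {m : Measure Ω} [IsProbabilityMeasure m] {F : Ω → Ω}
    (hF : MeasurePreserving F m m) {Z A A₂ : Ω → ℝ} (hZ : Measurable Z) (hA : Measurable A)
    (hA₂ : Measurable A₂) {B C C₂ : ℝ} (hZB : ∀ x, |Z x| ≤ B) (hAC : ∀ x, |A x| ≤ C)
    (hAC₂ : ∀ x, |A₂ x| ≤ C₂)
    (h : IsTransfer m F Z A) (h2 : IsTransfer m F (fun x => Z x ^ 2) A₂) :
    IsTransfer m F (fun x => (Z x - A (F x)) ^ 2) (fun x => A₂ x - A x ^ 2) := by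
  intro w hw ⟨D, hD⟩
  have hZc : Measurable fun x => (Z x : ℂ) := Complex.measurable_ofReal.comp hZ
  have hAc : Measurable fun x => (A x : ℂ) := Complex.measurable_ofReal.comp hA
  have hA₂c : Measurable fun x => (A₂ x : ℂ) := Complex.measurable_ofReal.comp hA₂
  have hwF : Measurable fun x => w (F x) := hw.comp hF.measurable
  have hAF : Measurable fun x => (A (F x) : ℂ) := hAc.comp hF.measurable
  have hAwb : ∀ x, ‖(A x : ℂ) * w x‖ ≤ C * D := fun x => by
    rw [norm_mul, Complex.norm_real]
    exact mul_le_mul (hAC x) (hD _) (norm_nonneg _) ((abs_nonneg _).trans (hAC x))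
  have hA2wb : ∀ x, ‖(A x : ℂ) ^ 2 * w x‖ ≤ C * (C * D) := fun x => by
    rw [pow_two, mul_assoc, norm_mul, Complex.norm_real]
    exact mul_le_mul (hAC x) (hAwb _) (norm_nonneg _) ((abs_nonneg _).trans (hAC x))
  have i1 : Integrable (fun x => ((Z x ^ 2 : ℝ) : ℂ) * w (F x)) m := by
    refine integrable_of_bdd (C := B ^ 2 * D)
      ((Complex.measurable_ofReal.comp (hZ.pow_const 2)).mul hwF) fun x => ?_
    rw [norm_mul, Complex.norm_real, Real.norm_eq_abs, abs_pow]
    exact mul_le_mul (pow_le_pow_left₀ (abs_nonneg _) (hZB x) 2) (hD _) (norm_nonneg _)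
      (by positivity)
  have i2 : Integrable (fun x => (Z x : ℂ) * ((A (F x) : ℂ) * w (F x))) m := by
    refine integrable_of_bdd (hZc.mul (hAF.mul hwF)) (C := B * (C * D)) fun x => ?_
    rw [norm_mul, Complex.norm_real]
    exact mul_le_mul (hZB x) (hAwb _) (norm_nonneg _) ((abs_nonneg _).trans (hZB x))
  have i3 : Integrable (fun x => (A (F x) : ℂ) ^ 2 * w (F x)) m :=
    integrable_of_bdd ((hAF.pow_const 2).mul hwF) fun x => hA2wb _
  have i4 : Integrable (fun x => (A₂ x : ℂ) * w x) m := by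
    refine integrable_of_bdd (hA₂c.mul hw) (C := C₂ * D) fun x => ?_
    rw [norm_mul, Complex.norm_real]
    exact mul_le_mul (hAC₂ x) (hD _) (norm_nonneg _) ((abs_nonneg _).trans (hAC₂ x))
  have i5 : Integrable (fun x => (A x : ℂ) ^ 2 * w x) m :=
    integrable_of_bdd ((hAc.pow_const 2).mul hw) fun x => hA2wb _
  have e : ∀ x, (((Z x - A (F x)) ^ 2 : ℝ) : ℂ) * w (F x)
      = ((Z x ^ 2 : ℝ) : ℂ) * w (F x) - 2 * ((Z x : ℂ) * ((A (F x) : ℂ) * w (F x)))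
        + (A (F x) : ℂ) ^ 2 * w (F x) := fun x => by push_cast; ring
  have e' : ∀ x, ((A₂ x - A x ^ 2 : ℝ) : ℂ) * w x
      = (A₂ x : ℂ) * w x - (A x : ℂ) ^ 2 * w x := fun x => by push_cast; ring
  have i12 : Integrable (fun x => ((Z x ^ 2 : ℝ) : ℂ) * w (F x)
    - 2 * ((Z x : ℂ) * ((A (F x) : ℂ) * w (F x)))) m := i1.sub (i2.const_mul _)
  have k1 := h2 w hw ⟨D, hD⟩
  have k2 := h (fun x => (A x : ℂ) * w x) (hAc.mul hw) ⟨_, hAwb⟩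
  have k3 := hF.integral_comp_of_measurable (g := fun x => (A x : ℂ) ^ 2 * w x)
    ((hAc.pow_const 2).mul hw)
  have k4 : ∫ x, (A x : ℂ) * ((A x : ℂ) * w x) ∂m = ∫ x, (A x : ℂ) ^ 2 * w x ∂m := by
    congr 1; ext x; ring
  simp_rw [e, e']
  rw [integral_add i12 i3, integral_sub i1 (i2.const_mul _), integral_sub i4 i5,
    integral_const_mul, k1, k2, k3, k4]
  ring

theorem integral_abs_le_sqrt {m : Measure Ω} [IsProbabilityMeasure m] {v : Ω → ℝ}
    (hv : Measurable v) {C : ℝ} (hC : ∀ x, |v x| ≤ C) {q : ℝ} (hq : ∫ x, v x ^ 2 ∂m ≤ q) :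
    ∫ x, |v x| ∂m ≤ √q := by
  refine Real.le_sqrt_of_sq_le (le_trans ?_ hq)
  have i1 : Integrable (fun x => |v x|) m := (integrable_of_bdd hv hC).abs
  have i2 : Integrable (fun x => v x ^ 2) m := integrable_of_bdd (hv.pow_const 2) (C := C ^ 2)
    fun x => by simpa using pow_le_pow_left₀ (abs_nonneg _) (hC x) 2
  set μ := ∫ x, |v x| ∂m
  have : 0 ≤ ∫ x, (|v x| - μ) ^ 2 ∂m := integral_nonneg fun x => sq_nonneg _
  have e : ∀ x, (|v x| - μ) ^ 2 = v x ^ 2 - 2 * μ * |v x| + μ ^ 2 := fun x => by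
    rw [sub_sq, sq_abs]; ring
  simp_rw [e] at this
  have i3 : Integrable (fun x => v x ^ 2 - 2 * μ * |v x|) m := i2.sub (i1.const_mul _)
  rw [integral_add i3 (integrable_const _), integral_sub i2 (i1.const_mul _), integral_const_mul]
    at this
  simp at this
  nlinarith

theorem norm_charFun_array_le {m : Measure Ω} [IsProbabilityMeasure m] {F : Ω → Ω}
    (hF : MeasurePreserving F m m) {Z A₁ A₂ : Ω → ℝ} (hZ : Measurable Z) (hA₁ : Measurable A₁)
    (hA₂ : Measurable A₂) {B C ℓ θ b : ℝ} (hC0 : 0 ≤ C) (hℓ : 1 ≤ ℓ)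
    (hθ0 : 0 ≤ θ) (hθ1 : θ < 1) (hb : 0 < b) (hZB : ∀ x, |Z x| ≤ B) (hA₁C : ∀ x, |A₁ x| ≤ C)
    (hA₂C : ∀ x, |A₂ x| ≤ C * ℓ) (h1 : IsTransfer m F Z A₁)
    (h2 : IsTransfer m F (fun x => Z x ^ 2) A₂)
    (hc1 : ∀ j : ℕ, |∫ x, A₁ x * A₁ (F^[j + 1] x) ∂m| ≤ C * θ ^ j)
    (hc2 : ∀ j : ℕ, |∫ x, (A₂ x - ∫ z, A₂ z ∂m) * (A₂ (F^[j + 1] x) - ∫ z, A₂ z ∂m) ∂m|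
      ≤ C * ℓ ^ 2 * θ ^ j) (k : ℕ) (s σ : ℝ)
    (hs : (s / b) ^ 2 * ((C + C ^ 2) * ℓ) / 2 ≤ 1) :
    ‖(Real.exp (s ^ 2 / 2 * σ) : ℂ) * (∫ x, Complex.exp
        ((s / b * ∑ j ∈ Finset.range k, Z (F^[j] x) : ℝ) * Complex.I) ∂m) - 1‖
      ≤ k * (Real.exp (k * ((s / b) ^ 2 * ((C + C ^ 2) * ℓ) / 2)) *
          (3 * ((s / b) ^ 2 * ((C + C ^ 2) * ℓ) / 2) ^ 2
            + 4 * |s / b| ^ 3 * (B + C) * ((C + C ^ 2) * ℓ)))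
        + Real.exp (s ^ 2 / 2 * (k * ((C + C ^ 2) * ℓ) / b ^ 2 + |σ|)) * (s ^ 2 / 2 *
          (|k * (∫ x, Z x ^ 2 ∂m) / b ^ 2 - σ| + k * C ^ 2 / b ^ 2
            + √(k * (4 * C ^ 2 * ℓ ^ 2 + 2 * (C * ℓ ^ 2) / (1 - θ))) / b ^ 2))
        + Real.exp (s ^ 2 / 2 * σ) * (|s / b| * √(k * (C ^ 2 + 2 * C / (1 - θ)))) := by
  set C₁ := (C + C ^ 2) * ℓ with hC₁
  have hFm : ∀ j : ℕ, Measurable (F^[j]) := fun j => hF.measurable.iterate j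
  set M : Ω → ℝ := fun x => Z x - A₁ (F x) with hM
  set V : Ω → ℝ := fun x => A₂ x - A₁ x ^ 2 with hV
  set a : ℝ := ∫ z, A₂ z ∂m with ha
  have hA₁F : Measurable fun x => A₁ (F x) := hA₁.comp hF.measurable
  have hMm : Measurable M := hZ.sub hA₁F
  have hVm : Measurable V := hA₂.sub (hA₁.pow_const 2)
  have hMB : ∀ x, |M x| ≤ B + C := fun x =>
    (abs_sub _ _).trans (add_le_add (hZB x) (hA₁C _))
  have hA₁sq : ∀ x, A₁ x ^ 2 ≤ C ^ 2 := fun x => by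
    rw [← sq_abs]; exact pow_le_pow_left₀ (abs_nonneg _) (hA₁C x) 2
  have hVC : ∀ x, |V x| ≤ C₁ := fun x => by
    refine (abs_sub _ _).trans ?_
    rw [abs_of_nonneg (sq_nonneg (A₁ x)), hC₁]
    nlinarith [hA₂C x, hA₁sq x, sq_nonneg C]
  have hmain := norm_integral_exp_martingale_sub_one_le hF hMm hVm hMB hVC
    (h1.martingale hF hZ hA₁ hZB hA₁C) (h1.martingale_sq hF hZ hA₁ hA₂ hZB hA₁C hA₂C h2)
    (s / b) hs k
  set SM : Ω → ℝ := fun x => ∑ j ∈ Finset.range k, M (F^[j] x) with hSM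
  set SZ : Ω → ℝ := fun x => ∑ j ∈ Finset.range k, Z (F^[j] x) with hSZ
  set U : Ω → ℝ := fun x => (∑ j ∈ Finset.range k, V (F^[j + 1] x)) / b ^ 2 with hU
  have hSMm : Measurable SM := Finset.measurable_sum _ fun j _ => hMm.comp (hFm j)
  have hSZm : Measurable SZ := Finset.measurable_sum _ fun j _ => hZ.comp (hFm j)
  have hUm : Measurable U :=
    (Finset.measurable_sum _ fun j _ => hVm.comp (hFm (j + 1))).div_const _
  have hexp : ∀ x, (∑ j ∈ Finset.range k, (((s / b * M (F^[j] x) : ℝ) : ℂ) * Complex.I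
      + (((s / b) ^ 2 / 2 * V (F^[j + 1] x) : ℝ) : ℂ)))
      = ((s / b * SM x : ℝ) : ℂ) * Complex.I + ((s ^ 2 / 2 * U x : ℝ) : ℂ) := by
    intro x
    rw [Finset.sum_add_distrib, ← Finset.sum_mul, ← Complex.ofReal_sum, ← Complex.ofReal_sum,
      ← Finset.mul_sum, ← Finset.mul_sum]
    have hUx : U x = (∑ j ∈ Finset.range k, V (F^[j + 1] x)) / b ^ 2 := rfl
    rw [hUx]
    congr 2
    field_simp
  simp_rw [hexp] at hmain
  set e₁ := k * (Real.exp (k * ((s / b) ^ 2 * C₁ / 2)) *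
          (3 * ((s / b) ^ 2 * C₁ / 2) ^ 2 + 4 * |s / b| ^ 3 * (B + C) * C₁)) with he₁
  have hUb : ∀ x, |U x| ≤ k * C₁ / b ^ 2 := fun x => by
    simp only [hU]
    rw [abs_div, abs_of_pos (by positivity : 0 < b ^ 2)]
    gcongr
    refine (Finset.abs_sum_le_sum_abs _ _).trans ?_
    simpa using Finset.sum_le_sum (fun j (_ : j ∈ Finset.range k) => hVC (F^[j + 1] x))
  set c₃ := k * C₁ / b ^ 2 + |σ| with hc₃
  -- the variance estimate
  have hEZ : ∫ x, Z x ^ 2 ∂m = a := by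
    have := h2.real (w := fun _ => 1) measurable_const (C := 1) (by simp)
    simpa using this
  set D : Ω → ℝ := fun x => ∑ j ∈ Finset.range k, (A₂ (F^[j] x) - a) with hD
  have hDm : Measurable D :=
    Finset.measurable_sum _ fun j _ => (hA₂.comp (hFm j)).sub_const _
  have hab : |a| ≤ C * ℓ := by
    have := norm_integral_le_of_norm_le_const (μ := m) (f := A₂) (C := C * ℓ) (ae_of_all _ hA₂C)
    simpa using this
  have hA₂a : ∀ x, |A₂ x - a| ≤ 2 * (C * ℓ) := fun x =>
    (abs_sub _ _).trans (by linarith [hA₂C x])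
  have hDb : ∀ x, |D x| ≤ k * (2 * (C * ℓ)) := fun x => by
    refine (Finset.abs_sum_le_sum_abs _ _).trans ?_
    simpa using Finset.sum_le_sum (fun j (_ : j ∈ Finset.range k) => hA₂a (F^[j] x))
  have hD2 : ∫ x, |D x| ∂m ≤ √(k * (4 * C ^ 2 * ℓ ^ 2 + 2 * (C * ℓ ^ 2) / (1 - θ))) := by
    refine integral_abs_le_sqrt hDm hDb ?_
    refine (integral_sum_sq_le hF (hA₂.sub_const a) hA₂a (by positivity) hθ0 hθ1 hc2 k).trans ?_
    gcongr
    have : ∫ x, (A₂ x - a) ^ 2 ∂m ≤ ∫ _, 4 * C ^ 2 * ℓ ^ 2 ∂m := by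
      refine integral_mono (integrable_of_bdd ((hA₂.sub_const a).pow_const 2)
        (C := (2 * (C * ℓ)) ^ 2) fun x => ?_) (integrable_const _) fun x => ?_
      · simpa using pow_le_pow_left₀ (abs_nonneg _) (hA₂a x) 2
      · have := pow_le_pow_left₀ (abs_nonneg _) (hA₂a x) 2
        rw [sq_abs] at this
        simp only
        nlinarith
    simpa using this
  have hUσ : ∫ x, |U x - σ| ∂m ≤ |k * (∫ x, Z x ^ 2 ∂m) / b ^ 2 - σ| + k * C ^ 2 / b ^ 2
            + √(k * (4 * C ^ 2 * ℓ ^ 2 + 2 * (C * ℓ ^ 2) / (1 - θ))) / b ^ 2 := by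
    rw [hEZ]
    have hpt : ∀ x, |U x - σ| ≤ |k * a / b ^ 2 - σ| + k * C ^ 2 / b ^ 2 + |D (F x)| / b ^ 2 := by
      intro x
      have e : U x - σ = (k * a / b ^ 2 - σ) - (∑ j ∈ Finset.range k, A₁ (F^[j + 1] x) ^ 2) / b ^ 2
          + D (F x) / b ^ 2 := by
        simp only [hU, hD, hV, Finset.sum_sub_distrib, Function.iterate_succ_apply]
        simp
        ring
      rw [e]
      refine (abs_add_le _ _).trans (add_le_add ((abs_sub _ _).trans (add_le_add le_rfl ?_)) ?_)
      · rw [abs_of_nonneg (div_nonneg (Finset.sum_nonneg fun j _ => sq_nonneg _) (by positivity))]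
        gcongr
        simpa using Finset.sum_le_sum (fun j (_ : j ∈ Finset.range k) => hA₁sq (F^[j + 1] x))
      · rw [abs_div, abs_of_pos (by positivity : 0 < b ^ 2)]
    have iD : Integrable (fun x => |D (F x)|) m :=
      (integrable_of_bdd (hDm.comp hF.measurable) fun x => hDb _).abs
    calc _ ≤ ∫ x, (|k * a / b ^ 2 - σ| + k * C ^ 2 / b ^ 2 + |D (F x)| / b ^ 2) ∂m :=
          integral_mono_of_nonneg (ae_of_all _ fun x => abs_nonneg _)
            ((integrable_const _).add (iD.div_const _)) (ae_of_all _ hpt)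
      _ = |k * a / b ^ 2 - σ| + k * C ^ 2 / b ^ 2 + (∫ x, |D x| ∂m) / b ^ 2 := by
          rw [integral_add (integrable_const _) (iD.div_const _), integral_div,
            hF.integral_comp_of_measurable (g := fun x => |D x|) hDm.abs]
          simp
      _ ≤ _ := by gcongr
  -- the coboundary
  have hE₁ : ∫ x, |∑ j ∈ Finset.range k, A₁ (F^[j] x)| ∂m ≤ √(k * (C ^ 2 + 2 * C / (1 - θ))) := by
    refine integral_abs_le_sqrt (C := k * C) (Finset.measurable_sum _ fun j _ => hA₁.comp (hFm j))
      (fun x => ?_) ?_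
    · refine (Finset.abs_sum_le_sum_abs _ _).trans ?_
      simpa using Finset.sum_le_sum (fun j (_ : j ∈ Finset.range k) => hA₁C (F^[j] x))
    refine (integral_sum_sq_le hF hA₁ hA₁C hC0 hθ0 hθ1 hc1 k).trans ?_
    gcongr
    have : ∫ x, A₁ x ^ 2 ∂m ≤ ∫ _, C ^ 2 ∂m :=
      integral_mono (integrable_of_bdd (hA₁.pow_const 2) (C := C ^ 2) fun x => by
        simpa using hA₁sq x) (integrable_const _) hA₁sq
    simpa using this
  have nI : ∀ y : ℝ, ‖Complex.exp ((y : ℂ) * Complex.I)‖ = 1 := Complex.norm_exp_ofReal_mul_I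
  have iM : Integrable (fun x => Complex.exp ((s / b * SM x : ℝ) * Complex.I)) m :=
    integrable_of_bdd (by fun_prop) fun x => (nI _).le
  have iZ : Integrable (fun x => Complex.exp ((s / b * SZ x : ℝ) * Complex.I)) m :=
    integrable_of_bdd (by fun_prop) fun x => (nI _).le
  have iW : Integrable (fun x => Complex.exp ((s / b * SM x : ℝ) * Complex.I
      + (s ^ 2 / 2 * U x : ℝ))) m :=
    integrable_of_bdd (C := Real.exp (s ^ 2 / 2 * (k * C₁ / b ^ 2))) (by fun_prop) fun x => by
      rw [Complex.exp_add, norm_mul, nI, one_mul, Complex.norm_exp_ofReal, Real.exp_le_exp]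
      gcongr
      exact (le_abs_self _).trans (hUb x)
  have hstep1 : ‖(Real.exp (s ^ 2 / 2 * σ) : ℂ) *
      (∫ x, Complex.exp ((s / b * SM x : ℝ) * Complex.I) ∂m)
      - ∫ x, Complex.exp ((s / b * SM x : ℝ) * Complex.I + (s ^ 2 / 2 * U x : ℝ)) ∂m‖
      ≤ Real.exp (s ^ 2 / 2 * c₃) * (s ^ 2 / 2 * ∫ x, |U x - σ| ∂m) := by
    rw [← integral_const_mul, ← integral_sub (iM.const_mul _) iW]
    refine (norm_integral_le_integral_norm _).trans ?_
    rw [← integral_const_mul, ← integral_const_mul]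
    refine integral_mono_of_nonneg (ae_of_all _ fun x => norm_nonneg _) ?_ (ae_of_all _ fun x => ?_)
    · refine Integrable.const_mul (Integrable.const_mul ?_ _) _
      exact (integrable_of_bdd (hUm.sub_const σ) (C := k * C₁ / b ^ 2 + |σ|) fun x =>
        (abs_sub _ _).trans (add_le_add (hUb x) le_rfl)).abs
    · simp only
      rw [Complex.exp_add, mul_comm, ← mul_sub, norm_mul, nI, one_mul, ← Complex.ofReal_exp,
        ← Complex.ofReal_sub, Complex.norm_real]
      have hs0 : 0 ≤ s ^ 2 / 2 := by positivity
      have p1 : s ^ 2 / 2 * σ ≤ s ^ 2 / 2 * c₃ := by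
        gcongr
        have : 0 ≤ k * C₁ / b ^ 2 := by positivity
        linarith [le_abs_self σ]
      have p2 : s ^ 2 / 2 * U x ≤ s ^ 2 / 2 * c₃ := by
        gcongr
        linarith [le_abs_self (U x), hUb x, abs_nonneg σ]
      refine (abs_exp_sub_exp_le p1 p2).trans ?_
      rw [← mul_sub, abs_mul, abs_of_nonneg hs0, abs_sub_comm]
  have hstep2 : ‖(∫ x, Complex.exp ((s / b * SZ x : ℝ) * Complex.I) ∂m)
      - ∫ x, Complex.exp ((s / b * SM x : ℝ) * Complex.I) ∂m‖
      ≤ |s / b| * √(k * (C ^ 2 + 2 * C / (1 - θ))) := by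
    rw [← integral_sub iZ iM]
    refine (norm_integral_le_integral_norm _).trans ?_
    set Q : Ω → ℝ := fun x => ∑ j ∈ Finset.range k, A₁ (F^[j] x) with hQ
    have hQm : Measurable Q := Finset.measurable_sum _ fun j _ => hA₁.comp (hFm j)
    have hQb : ∀ x, |Q x| ≤ k * C := fun x => by
      refine (Finset.abs_sum_le_sum_abs _ _).trans ?_
      simpa using Finset.sum_le_sum (fun j (_ : j ∈ Finset.range k) => hA₁C (F^[j] x))
    have iQ : Integrable (fun x => |Q (F x)|) m :=
      (integrable_of_bdd (hQm.comp hF.measurable) fun x => hQb _).abs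
    calc _ ≤ ∫ x, |s / b| * |Q (F x)| ∂m := by
          refine integral_mono_of_nonneg (ae_of_all _ fun x => norm_nonneg _) (iQ.const_mul _)
            (ae_of_all _ fun x => ?_)
          have e : SZ x = SM x + Q (F x) := by
            simp only [hSZ, hSM, hM, hQ, Finset.sum_sub_distrib]
            simp only [← Function.iterate_succ_apply, Function.iterate_succ_apply']
            ring
          have e2 : Complex.exp ((s / b * SZ x : ℝ) * Complex.I)
              - Complex.exp ((s / b * SM x : ℝ) * Complex.I)
              = Complex.exp ((s / b * SM x : ℝ) * Complex.I) *
                (Complex.exp (Complex.I * (s / b * Q (F x) : ℝ)) - 1) := by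
            rw [mul_sub, mul_one, ← Complex.exp_add, e]
            congr 2
            push_cast
            ring
          simp only
          rw [e2, norm_mul, nI, one_mul, ← abs_mul]
          exact Real.norm_exp_I_mul_ofReal_sub_one_le
      _ ≤ _ := by
          rw [integral_const_mul, hF.integral_comp_of_measurable (g := fun x => |Q x|) hQm.abs]
          gcongr
  set IZ := ∫ x, Complex.exp ((s / b * SZ x : ℝ) * Complex.I) ∂m
  set IM := ∫ x, Complex.exp ((s / b * SM x : ℝ) * Complex.I) ∂m
  set IW := ∫ x, Complex.exp ((s / b * SM x : ℝ) * Complex.I + (s ^ 2 / 2 * U x : ℝ)) ∂m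
  have e : (Real.exp (s ^ 2 / 2 * σ) : ℂ) * IZ - 1 = (IW - 1)
      + ((Real.exp (s ^ 2 / 2 * σ) : ℂ) * IM - IW)
      + (Real.exp (s ^ 2 / 2 * σ) : ℂ) * (IZ - IM) := by ring
  rw [e]
  refine (norm_add_le _ _).trans (add_le_add ((norm_add_le _ _).trans (add_le_add hmain ?_)) ?_)
  · refine hstep1.trans ?_
    gcongr
  · rw [norm_mul, Complex.norm_real, Real.norm_eq_abs, abs_of_pos (Real.exp_pos _)]
    gcongr


/-- A central limit theorem for arrays of observables of a measure preserving map with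
exponential decay of correlations. -/
theorem tendsto_charFun_array {m : Measure Ω} [IsProbabilityMeasure m] {F : Ω → Ω}
    (hF : MeasurePreserving F m m) {Z A₁ A₂ : ℕ → Ω → ℝ} (hZ : ∀ n, Measurable (Z n))
    (hA₁ : ∀ n, Measurable (A₁ n)) (hA₂ : ∀ n, Measurable (A₂ n)) {B ℓ b : ℕ → ℝ} {k : ℕ → ℕ}
    {C θ σ : ℝ} (hB0 : ∀ n, 0 ≤ B n) (hC0 : 0 ≤ C) (hℓ : ∀ n, 1 ≤ ℓ n)
    (hθ0 : 0 ≤ θ) (hθ1 : θ < 1) (hZB : ∀ n x, |Z n x| ≤ B n)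
    (hA₁C : ∀ n x, |A₁ n x| ≤ C) (hA₂C : ∀ n x, |A₂ n x| ≤ C * ℓ n)
    (h1 : ∀ n, IsTransfer m F (Z n) (A₁ n))
    (h2 : ∀ n, IsTransfer m F (fun x => Z n x ^ 2) (A₂ n))
    (hc1 : ∀ n j : ℕ, |∫ x, A₁ n x * A₁ n (F^[j + 1] x) ∂m| ≤ C * θ ^ j)
    (hc2 : ∀ n j : ℕ, |∫ x, (A₂ n x - ∫ z, A₂ n z ∂m) *
      (A₂ n (F^[j + 1] x) - ∫ z, A₂ n z ∂m) ∂m| ≤ C * ℓ n ^ 2 * θ ^ j)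
    (hb : Tendsto b atTop atTop) (hk : Tendsto k atTop atTop)
    (hkℓ : ∀ᶠ n in atTop, k n * ℓ n ≤ C * b n ^ 2)
    (hkb : Tendsto (fun n => k n / b n ^ 2) atTop (𝓝 0))
    (hBb : Tendsto (fun n => B n / b n) atTop (𝓝 0))
    (hσ : Tendsto (fun n => k n * (∫ x, Z n x ^ 2 ∂m) / b n ^ 2) atTop (𝓝 σ)) (s : ℝ) :
    Tendsto (fun n => ∫ x, Complex.exp
        ((s / b n * ∑ j ∈ Finset.range (k n), Z n (F^[j] x) : ℝ) * Complex.I) ∂m) atTop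
      (𝓝 (Real.exp (-(s ^ 2 / 2 * σ)) : ℂ)) := by
  set K : ℕ → ℝ := fun n => (k n : ℝ) with hKdef
  have hK : Tendsto K atTop atTop := tendsto_natCast_atTop_atTop.comp hk
  set Q := s ^ 2 * ((C + C ^ 2) * C) / 2 with hQ
  have hQ0 : 0 ≤ Q := by positivity
  set G : ℕ → ℝ := fun n => Real.exp Q * (3 * Q ^ 2 / K n
      + 4 * |s| ^ 3 * ((C + C ^ 2) * C) * (B n / b n + C / b n))
    + Real.exp (s ^ 2 / 2 * ((C + C ^ 2) * C + |σ|)) * (s ^ 2 / 2 *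
      (|K n * (∫ x, Z n x ^ 2 ∂m) / b n ^ 2 - σ| + K n / b n ^ 2 * C ^ 2
        + √(4 * C ^ 2 + 2 * C / (1 - θ)) * (C / √(K n))))
    + Real.exp (s ^ 2 / 2 * σ) * (|s| * √(K n / b n ^ 2 * (C ^ 2 + 2 * C / (1 - θ)))) with hG
  have hG0 : Tendsto G atTop (𝓝 0) := by
    have l1 : Tendsto (fun n => 3 * Q ^ 2 / K n) atTop (𝓝 0) := hK.const_div_atTop _
    have l2 : Tendsto (fun n => C / b n) atTop (𝓝 0) := hb.const_div_atTop _
    have l3 : Tendsto (fun n => |K n * (∫ x, Z n x ^ 2 ∂m) / b n ^ 2 - σ|) atTop (𝓝 0) := by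
      have := (hσ.sub_const σ).abs
      simpa using this
    have l4 : Tendsto (fun n => C / √(K n)) atTop (𝓝 0) :=
      (Real.tendsto_sqrt_atTop.comp hK).const_div_atTop _
    have l5 := (hkb.mul_const (C ^ 2 + 2 * C / (1 - θ))).sqrt
    have := (((l1.add ((hBb.add l2).const_mul (4 * |s| ^ 3 * ((C + C ^ 2) * C)))).const_mul
      (Real.exp Q)).add ((((l3.add (hkb.mul_const (C ^ 2))).add
        (l4.const_mul (√(4 * C ^ 2 + 2 * C / (1 - θ))))).const_mul (s ^ 2 / 2)).const_mul
          (Real.exp (s ^ 2 / 2 * ((C + C ^ 2) * C + |σ|))))).add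
      ((l5.const_mul |s|).const_mul (Real.exp (s ^ 2 / 2 * σ)))
    simpa using this
  have hv : ∀ᶠ n in atTop, Q / K n ≤ 1 :=
    (hK.const_div_atTop Q).eventually (eventually_le_nhds one_pos)
  have hbound : ∀ᶠ n in atTop, ‖(Real.exp (s ^ 2 / 2 * σ) : ℂ) * (∫ x, Complex.exp
        ((s / b n * ∑ j ∈ Finset.range (k n), Z n (F^[j] x) : ℝ) * Complex.I) ∂m) - 1‖
        ≤ G n := by
    filter_upwards [hv, hkℓ, hb.eventually_gt_atTop 0, hK.eventually_gt_atTop 0]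
      with n hvn hkn hbn hKn
    change K n * ℓ n ≤ C * b n ^ 2 at hkn
    have q1 : K n * ((C + C ^ 2) * ℓ n) / b n ^ 2 ≤ (C + C ^ 2) * C := by
      rw [div_le_iff₀ (by positivity)]
      nlinarith [sq_nonneg C, mul_le_mul_of_nonneg_left hkn (by positivity : 0 ≤ C + C ^ 2)]
    have hℓn := hℓ n
    set v := (s / b n) ^ 2 * ((C + C ^ 2) * ℓ n) / 2 with hvdef
    have hv0 : 0 ≤ v := by positivity
    have q2 : K n * v ≤ Q := by
      have : K n * v = s ^ 2 * (K n * ((C + C ^ 2) * ℓ n) / b n ^ 2) / 2 := by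
        rw [hvdef]; field_simp
      rw [this, hQ]; gcongr
    have q3 : v ≤ Q / K n := by rw [le_div_iff₀ hKn]; linarith
    refine (norm_charFun_array_le hF (hZ n) (hA₁ n) (hA₂ n) hC0 (hℓ n) hθ0 hθ1 hbn
      (hZB n) (hA₁C n) (hA₂C n) (h1 n) (h2 n) (hc1 n) (hc2 n) (k n) s σ
      (q3.trans hvn)).trans ?_
    rw [hG]
    refine add_le_add (add_le_add ?_ ?_) (mul_le_mul_of_nonneg_left ?_ (Real.exp_nonneg _))
    · have r1 : K n * (3 * v ^ 2) ≤ 3 * Q ^ 2 / K n := by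
        rw [le_div_iff₀ hKn]
        have := pow_le_pow_left₀ (by positivity) q2 2
        nlinarith
      have r2 : K n * (4 * |s / b n| ^ 3 * (B n + C) * ((C + C ^ 2) * ℓ n))
          ≤ 4 * |s| ^ 3 * ((C + C ^ 2) * C) * (B n / b n + C / b n) := by
        have : K n * (4 * |s / b n| ^ 3 * (B n + C) * ((C + C ^ 2) * ℓ n))
          = 4 * |s| ^ 3 * (K n * ((C + C ^ 2) * ℓ n) / b n ^ 2) * (B n / b n + C / b n) := by
          rw [abs_div, abs_of_pos hbn]; field_simp
        rw [this]
        have := hB0 n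
        gcongr
      change K n * (Real.exp (K n * v) * (3 * v ^ 2 + _)) ≤ _
      rw [mul_left_comm, mul_add]
      have hBn := hB0 n
      refine mul_le_mul (Real.exp_le_exp.2 q2) (add_le_add r1 r2) ?_ (Real.exp_nonneg _)
      positivity
    · have r3 : √(k n * (4 * C ^ 2 * ℓ n ^ 2 + 2 * (C * ℓ n ^ 2) / (1 - θ))) / b n ^ 2
          ≤ √(4 * C ^ 2 + 2 * C / (1 - θ)) * (C / √(K n)) := by
        have : (k n * (4 * C ^ 2 * ℓ n ^ 2 + 2 * (C * ℓ n ^ 2) / (1 - θ)) : ℝ)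
            = (4 * C ^ 2 + 2 * C / (1 - θ)) * (K n * ℓ n ^ 2) := by ring
        rw [this, Real.sqrt_mul' _ (by positivity), mul_div_assoc]
        refine mul_le_mul_of_nonneg_left ?_ (Real.sqrt_nonneg _)
        rw [Real.sqrt_mul hKn.le, Real.sqrt_sq (by linarith), div_le_div_iff₀ (by positivity)
          (Real.sqrt_pos.2 hKn), mul_right_comm, Real.mul_self_sqrt hKn.le]
        exact hkn
      have r4 : (k n : ℝ) * C ^ 2 / b n ^ 2 = K n / b n ^ 2 * C ^ 2 := by
        simp only [hKdef]; ring
      rw [r4]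
      gcongr
    · rw [abs_div, abs_of_pos hbn, Real.sqrt_mul' _ (by
        have : 0 < 1 - θ := by linarith
        positivity), Real.sqrt_mul' _ (by
        have : 0 < 1 - θ := by linarith
        positivity), Real.sqrt_div' _ (by positivity), Real.sqrt_sq hbn.le]
      apply le_of_eq
      simp only [hKdef]
      field_simp
  have hlim : Tendsto (fun n => (Real.exp (s ^ 2 / 2 * σ) : ℂ) * (∫ x, Complex.exp
        ((s / b n * ∑ j ∈ Finset.range (k n), Z n (F^[j] x) : ℝ) * Complex.I) ∂m))
        atTop (𝓝 1) :=
    tendsto_iff_norm_sub_tendsto_zero.2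
      (squeeze_zero' (Eventually.of_forall fun _ => norm_nonneg _) hbound hG0)
  have := hlim.const_mul (Real.exp (-(s ^ 2 / 2 * σ)) : ℂ)
  rw [mul_one] at this
  refine this.congr fun n => ?_
  rw [← mul_assoc, ← Complex.ofReal_mul, ← Real.exp_add]
  simp

end AbstractCLT

section MarkovSystem

variable {X W : Type*} [PseudoMetricSpace X] [MeasurableSpace X]

/-- A full-branched expanding Markov map `F` on `Y` with inverse branches `b w` and normalized
weights `G w` (a Gibbs–Markov system) preserving the probability measure `m`. -/
structure MarkovSystem (m : Measure X) (F : X → X) (Y : Set X) (G : W → X → ℝ) (b : W → X → X)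
    (D t lam : ℝ) : Prop where
  measurableSet : MeasurableSet Y
  nonempty : Y.Nonempty
  null : m Yᶜ = 0
  measurable_map : Measurable F
  measurable_branch : ∀ w, Measurable (b w)
  measurable_weight : ∀ w, Measurable (G w)
  mapsTo : ∀ w, ∀ y ∈ Y, b w y ∈ Y
  map_branch : ∀ w, ∀ y ∈ Y, F (b w y) = y
  weight_nonneg : ∀ w y, 0 ≤ G w y
  hasSum : ∀ y ∈ Y, HasSum (fun w => G w y) 1
  D_nonneg : 0 ≤ D
  t_pos : 0 < t
  lam_nonneg : 0 ≤ lam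
  lam_lt : lam < 1
  distortion : ∀ w, ∀ x ∈ Y, ∀ y ∈ Y, G w x ≤ Real.exp (D * dist x y ^ t) * G w y
  contraction : ∀ w, ∀ x ∈ Y, ∀ y ∈ Y, dist (b w x) (b w y) ≤ lam * dist x y
  dist_le : ∀ x ∈ Y, ∀ y ∈ Y, dist x y ≤ 1
  dual : m = Measure.sum fun w => (m.withDensity fun y => ENNReal.ofReal (G w y)).map (b w)

namespace MarkovSystem

variable {m : Measure X} {F : X → X} {Y : Set X} {G : W → X → ℝ} {b : W → X → X} {D t lam : ℝ}

/-- The transfer operator of a Markov system. -/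
def transfer (Y : Set X) (G : W → X → ℝ) (b : W → X → X) (v : X → ℝ) : X → ℝ :=
  Y.indicator fun y => ∑' w, G w y * v (b w y)

theorem ae_mem (H : MarkovSystem m F Y G b D t lam) : ∀ᵐ x ∂m, x ∈ Y :=
  mem_ae_iff.2 H.null

omit [PseudoMetricSpace X] [MeasurableSpace X] in
theorem transfer_apply {v : X → ℝ} {y : X} (hy : y ∈ Y) :
    transfer Y G b v y = ∑' w, G w y * v (b w y) := indicator_of_mem hy _

theorem summable (H : MarkovSystem m F Y G b D t lam) {v : X → ℝ} {C : ℝ}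
    (hC : ∀ x ∈ Y, |v x| ≤ C) {y : X} (hy : y ∈ Y) : Summable fun w => G w y * v (b w y) := by
  refine Summable.of_norm_bounded ((H.hasSum y hy).summable.mul_right C) fun w => ?_
  rw [norm_mul, Real.norm_of_nonneg (H.weight_nonneg w y)]
  exact mul_le_mul_of_nonneg_left (hC _ (H.mapsTo w y hy)) (H.weight_nonneg w y)

theorem abs_transfer_le (H : MarkovSystem m F Y G b D t lam) {v : X → ℝ} {C : ℝ}
    (hC : ∀ x ∈ Y, |v x| ≤ C) (y : X) : |transfer Y G b v y| ≤ C := by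
  obtain ⟨y₀, hy₀⟩ := H.nonempty
  by_cases hy : y ∈ Y
  · rw [transfer_apply hy]
    have h1 := (H.hasSum y hy).mul_right C
    rw [one_mul] at h1
    rw [← Real.norm_eq_abs]
    refine tsum_of_norm_bounded h1 fun w => ?_
    rw [norm_mul, Real.norm_of_nonneg (H.weight_nonneg w y)]
    exact mul_le_mul_of_nonneg_left (hC _ (H.mapsTo w y hy)) (H.weight_nonneg w y)
  · rw [transfer, indicator_of_notMem hy, abs_zero]
    exact (abs_nonneg _).trans (hC y₀ hy₀)

theorem measurable_transfer [Countable W] (H : MarkovSystem m F Y G b D t lam) {v : X → ℝ}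
    (hv : Measurable v) {C : ℝ} (hC : ∀ x ∈ Y, |v x| ≤ C) : Measurable (transfer Y G b v) := by
  refine measurable_of_tendsto_metrizable' (atTop : Filter (Finset W))
    (f := fun s => Y.indicator fun y => ∑ w ∈ s, G w y * v (b w y)) (fun s => ?_) ?_
  · exact (Finset.measurable_sum _ fun w _ => (H.measurable_weight w).mul
      (hv.comp (H.measurable_branch w))).indicator H.measurableSet
  · rw [tendsto_pi_nhds]
    intro y
    by_cases hy : y ∈ Y
    · simp only [transfer, indicator_of_mem hy]
      exact (H.summable hC hy).hasSum
    · simp only [transfer, indicator_of_notMem hy]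
      exact tendsto_const_nhds

theorem isTransfer [Countable W] [IsProbabilityMeasure m] (H : MarkovSystem m F Y G b D t lam)
    {v : X → ℝ} (hv : Measurable v) {C : ℝ} (hC : ∀ x, |v x| ≤ C) :
    IsTransfer m F v (transfer Y G b v) := by
  intro w hw ⟨E, hE⟩
  have hwF : Measurable fun x => w (F x) := hw.comp H.measurable_map
  have hvc : Measurable fun x => (v x : ℂ) := Complex.measurable_ofReal.comp hv
  have hi : Integrable (fun x => (v x : ℂ) * w (F x)) m :=
    integrable_of_bdd (hvc.mul hwF) (C := C * E) fun x => by
      rw [norm_mul, Complex.norm_real]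
      exact mul_le_mul (hC x) (hE _) (norm_nonneg _) ((abs_nonneg _).trans (hC x))
  have hs := hasSum_integral_measure (μ := fun w =>
    (m.withDensity fun y => ENNReal.ofReal (G w y)).map (b w)) (f := fun x => (v x : ℂ) * w (F x))
    (by rw [← H.dual]; exact hi)
  rw [← H.dual] at hs
  have e : ∀ a, ∫ x, (v x : ℂ) * w (F x)
      ∂((m.withDensity fun y => ENNReal.ofReal (G a y)).map (b a))
      = ∫ y, ((G a y * v (b a y) : ℝ) : ℂ) * w y ∂m := by
    intro a
    rw [integral_map (f := fun x => (v x : ℂ) * w (F x)) (H.measurable_branch a).aemeasurable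
      (hvc.mul hwF).aestronglyMeasurable, integral_withDensity_eq_integral_toReal_smul
      (H.measurable_weight a).ennreal_ofReal (by simp)]
    refine integral_congr_ae (H.ae_mem.mono fun y hy => ?_)
    simp only
    rw [H.map_branch a y hy, ENNReal.toReal_ofReal (H.weight_nonneg a y), Complex.real_smul]
    push_cast
    ring
  simp_rw [e] at hs
  have hs2 : HasSum (fun a => ∫ y, ((G a y * v (b a y) : ℝ) : ℂ) * w y ∂m)
      (∫ y, (transfer Y G b v y : ℂ) * w y ∂m) := by
    refine hasSum_integral_of_dominated_convergence (fun a y => G a y * (C * E))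
      (fun a => ?_) (fun a => ?_) ?_ ?_ ?_
    · exact ((Complex.measurable_ofReal.comp ((H.measurable_weight a).mul
        (hv.comp (H.measurable_branch a)))).mul hw).aestronglyMeasurable
    · refine ae_of_all _ fun y => ?_
      rw [norm_mul, Complex.norm_real, norm_mul, Real.norm_of_nonneg (H.weight_nonneg a y), mul_assoc]
      refine mul_le_mul_of_nonneg_left ?_ (H.weight_nonneg a y)
      exact mul_le_mul (hC _) (hE _) (norm_nonneg _) ((abs_nonneg _).trans (hC y))
    · exact H.ae_mem.mono fun y hy => (H.hasSum y hy).summable.mul_right _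
    · refine (integrable_const (C * E)).congr (H.ae_mem.mono fun y hy => ?_)
      simp only
      rw [tsum_mul_right, (H.hasSum y hy).tsum_eq, one_mul]
    · refine H.ae_mem.mono fun y hy => ?_
      rw [transfer_apply hy]
      exact (Complex.hasSum_ofReal.2 (H.summable (fun x _ => hC x) hy).hasSum).mul_right _
  exact hs.unique hs2

theorem measurePreserving [Countable W] [IsProbabilityMeasure m]
    (H : MarkovSystem m F Y G b D t lam) : MeasurePreserving F m m := by
  refine ⟨H.measurable_map, ?_⟩
  ext s hs
  rw [Measure.map_apply H.measurable_map hs]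
  have h1 : ∫ x, (F ⁻¹' s).indicator (fun _ => (1 : ℝ)) x ∂m = ∫ x, s.indicator (fun _ => 1) x ∂m := by
    have := (H.isTransfer (v := fun _ => 1) measurable_const (C := 1) (by simp)).real
      (w := s.indicator fun _ => 1) (measurable_const.indicator hs) (C := 1) (fun x => by
        by_cases hx : x ∈ s <;> simp [hx])
    simp only [one_mul] at this
    refine Eq.trans ?_ (this.trans (integral_congr_ae (H.ae_mem.mono fun y hy => ?_)))
    · rfl
    · simp only [transfer_apply hy, mul_one]
      rw [(H.hasSum y hy).tsum_eq, one_mul]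
  rw [integral_indicator_const _ (H.measurable_map hs), integral_indicator_const _ hs] at h1
  simpa [Measure.real, ENNReal.toReal_eq_toReal_iff' (measure_ne_top m _) (measure_ne_top m _)]
    using h1

theorem integral_transfer [Countable W] [IsProbabilityMeasure m]
    (H : MarkovSystem m F Y G b D t lam) {v : X → ℝ} (hv : Measurable v) {C : ℝ}
    (hC : ∀ x, |v x| ≤ C) : ∫ x, transfer Y G b v x ∂m = ∫ x, v x ∂m := by
  have := (H.isTransfer hv hC).real (w := fun _ => 1) measurable_const (C := 1) (by simp)
  simpa using this.symm

omit [PseudoMetricSpace X] [MeasurableSpace X] in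
theorem exists_lower_bound {v : X → ℝ} {a : ℝ} (hY : Y.Nonempty)
    (h : ∀ x ∈ Y, ∀ y ∈ Y, |v x - v y| ≤ a) : ∃ l, ∀ x ∈ Y, l ≤ v x ∧ v x ≤ l + a := by
  obtain ⟨y₀, hy₀⟩ := hY
  have hbdd : BddBelow (v '' Y) := ⟨v y₀ - a, by
    rintro _ ⟨x, hx, rfl⟩
    linarith [(abs_le.1 (h y₀ hy₀ x hx)).2]⟩
  refine ⟨sInf (v '' Y), fun x hx => ⟨csInf_le hbdd ⟨x, hx, rfl⟩, ?_⟩⟩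
  have : v x - a ≤ sInf (v '' Y) := by
    refine le_csInf ⟨_, y₀, hy₀, rfl⟩ ?_
    rintro _ ⟨y, hy, rfl⟩
    linarith [(abs_le.1 (h x hx y hy)).2]
  linarith

/-- The modulus of continuity contracted by the transfer operator. -/
def modulus (E t d : ℝ) : ℝ := 1 - Real.exp (-(E * d ^ t))

theorem one_sub_rpow_le {E κ δ : ℝ} (hE : 0 < E) (hκ0 : 0 ≤ κ) (hκ1 : κ ≤ 1) (hδ0 : 0 ≤ δ)
    (hδ1 : δ ≤ 1) : 1 - Real.exp (-(κ * E * δ)) ≤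
      (1 - Real.exp (-(κ * E))) / (1 - Real.exp (-E)) * (1 - Real.exp (-(E * δ))) := by
  have hz0 : Real.exp (-E) < 1 := by rw [Real.exp_lt_one_iff]; linarith
  have hd : 0 < 1 - Real.exp (-E) := by linarith
  set z := Real.exp (-(E * δ)) with hz
  have hz1 : z ≤ 1 := by rw [hz, Real.exp_le_one_iff]; nlinarith
  have hze : Real.exp (-E) ≤ z := by rw [hz, Real.exp_le_exp]; nlinarith
  have e1 : Real.exp (-(κ * E * δ)) = z ^ κ := by
    rw [hz, ← Real.exp_mul]; ring_nf
  have e2 : Real.exp (-(κ * E)) = Real.exp (-E) ^ κ := by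
    rw [← Real.exp_mul]; ring_nf
  rw [e1, e2]
  have hc := (Real.concaveOn_rpow hκ0 hκ1).2 (mem_Ici.2 (Real.exp_nonneg (-E)))
    (mem_Ici.2 zero_le_one)
    (show 0 ≤ (1 - z) / (1 - Real.exp (-E)) from div_nonneg (by linarith) hd.le)
    (show 0 ≤ (z - Real.exp (-E)) / (1 - Real.exp (-E)) from div_nonneg (by linarith) hd.le) (by
      rw [← add_div]; rw [div_eq_one_iff_eq hd.ne']; ring)
  simp only [smul_eq_mul, Real.one_rpow] at hc
  have e3 : (1 - z) / (1 - Real.exp (-E)) * Real.exp (-E)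
      + (z - Real.exp (-E)) / (1 - Real.exp (-E)) * 1 = z := by
    field_simp; ring
  rw [e3] at hc
  have e4 : (1 - Real.exp (-E) ^ κ) / (1 - Real.exp (-E)) * (1 - z)
      = 1 - ((1 - z) / (1 - Real.exp (-E)) * Real.exp (-E) ^ κ
        + (z - Real.exp (-E)) / (1 - Real.exp (-E)) * 1) := by
    field_simp; ring
  rw [e4]
  linarith

theorem abs_transfer_sub_le (H : MarkovSystem m F Y G b D t lam) {E : ℝ} (hE : 0 < E)
    (hDE : D + E * lam ^ t ≤ E) {v : X → ℝ} {a : ℝ} (ha : 0 ≤ a)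
    (hv : ∀ x ∈ Y, ∀ y ∈ Y, |v x - v y| ≤ a * modulus E t (dist x y)) :
    ∀ x ∈ Y, ∀ y ∈ Y, |transfer Y G b v x - transfer Y G b v y|
      ≤ (1 - Real.exp (-(D + E * lam ^ t))) / (1 - Real.exp (-E)) * a
        * modulus E t (dist x y) := by
  have hmod : ∀ d : ℝ, 0 ≤ d → modulus E t d ≤ 1 := fun d _ => by
    have := Real.exp_pos (-(E * d ^ t)); unfold modulus; linarith
  obtain ⟨l, hl⟩ := exists_lower_bound H.nonempty (v := v) (a := a) fun x hx y hy =>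
    (hv x hx y hy).trans (mul_le_of_le_one_right ha (hmod _ dist_nonneg))
  have hvb : ∀ x ∈ Y, |v x| ≤ |l| + a := fun x hx => by
    rw [abs_le]; constructor <;> cases abs_cases l <;> linarith [(hl x hx).1, (hl x hx).2]
  have hone : ∀ x ∈ Y, ∀ y ∈ Y, transfer Y G b v x - transfer Y G b v y
      ≤ (1 - Real.exp (-(D + E * lam ^ t))) / (1 - Real.exp (-E)) * a
        * modulus E t (dist x y) := by
    intro x hx y hy
    set δ := dist x y ^ t with hδ
    have hδ0 : 0 ≤ δ := Real.rpow_nonneg dist_nonneg _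
    have hδ1 : δ ≤ 1 := Real.rpow_le_one dist_nonneg (H.dist_le x hx y hy) H.t_pos.le
    set q := Real.exp (-(D * δ)) with hq
    have hq1 : q ≤ 1 := by
      rw [hq, Real.exp_le_one_iff]; have := mul_nonneg H.D_nonneg hδ0; linarith
    have hlt : lam ^ t ≤ 1 := Real.rpow_le_one H.lam_nonneg H.lam_lt.le H.t_pos.le
    have hlt0 : 0 ≤ lam ^ t := Real.rpow_nonneg H.lam_nonneg _
    have hqx : ∀ w, q * G w y ≤ G w x := fun w => by
      have := H.distortion w y hy x hx
      rw [dist_comm] at this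
      calc q * G w y ≤ q * (Real.exp (D * δ) * G w x) := by gcongr
        _ = G w x := by rw [hq, ← mul_assoc, ← Real.exp_add]; simp
    have sx := (H.summable hvb hx).hasSum
    have sy := (H.summable hvb hy).hasSum
    rw [← transfer_apply hx] at sx
    rw [← transfer_apply hy] at sy
    set p := modulus E t (lam * dist x y) with hp
    -- termwise bound
    have hterm : ∀ w, G w x * v (b w x) - G w y * v (b w y)
        ≤ q * G w y * (a * p) + (G w x - q * G w y) * (l + a) - (G w y - q * G w y) * l := by
      intro w
      have h1 : v (b w x) - v (b w y) ≤ a * p := by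
        refine (le_abs_self _).trans ((hv _ (H.mapsTo w x hx) _ (H.mapsTo w y hy)).trans ?_)
        refine mul_le_mul_of_nonneg_left ?_ ha
        rw [hp]
        unfold modulus
        gcongr
        · exact H.t_pos.le
        · exact H.contraction w x hx y hy
      have g0 := H.weight_nonneg w y
      have h2 := (hl _ (H.mapsTo w x hx)).2
      have h3 := (hl _ (H.mapsTo w y hy)).1
      have h4 : q * G w y ≤ G w y := mul_le_of_le_one_left g0 hq1
      have k1 := mul_le_mul_of_nonneg_left h1 (mul_nonneg (Real.exp_nonneg (-(D * δ))) g0)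
      have k2 := mul_le_mul_of_nonneg_left h2 (sub_nonneg.2 (hqx w))
      have k3 := mul_le_mul_of_nonneg_left h3 (sub_nonneg.2 h4)
      rw [← hq] at k1
      nlinarith
    have hs2 : HasSum (fun w => q * G w y * (a * p) + (G w x - q * G w y) * (l + a)
        - (G w y - q * G w y) * l) (q * 1 * (a * p) + (1 - q * 1) * (l + a) - (1 - q * 1) * l) :=
      ((((H.hasSum y hy).mul_left q).mul_right (a * p)).add
        (((H.hasSum x hx).sub ((H.hasSum y hy).mul_left q)).mul_right (l + a))).sub
        (((H.hasSum y hy).sub ((H.hasSum y hy).mul_left q)).mul_right l)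
    have h5 := hasSum_le hterm (sx.sub sy) hs2
    have h6 : q * 1 * (a * p) + (1 - q * 1) * (l + a) - (1 - q * 1) * l
        = a * (1 - Real.exp (-((D + E * lam ^ t) / E * E * δ))) := by
      rw [hp, modulus, Real.mul_rpow H.lam_nonneg dist_nonneg, ← hδ, div_mul_cancel₀ _ hE.ne']
      have : Real.exp (-((D + E * lam ^ t) * δ)) = q * Real.exp (-(E * (lam ^ t * δ))) := by
        rw [hq, ← Real.exp_add]; ring_nf
      rw [this]; ring
    rw [h6] at h5
    have hκ0 : 0 ≤ (D + E * lam ^ t) / E := div_nonneg (add_nonneg H.D_nonneg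
      (mul_nonneg hE.le hlt0)) hE.le
    have h7 := one_sub_rpow_le hE hκ0 ((div_le_one hE).2 hDE) hδ0 hδ1
    rw [div_mul_cancel₀ _ hE.ne'] at h7 h5
    refine h5.trans ((mul_le_mul_of_nonneg_left h7 ha).trans (le_of_eq ?_))
    unfold modulus
    ring
  intro x hx y hy
  rw [abs_le]
  have h1 := hone x hx y hy
  have h2 := hone y hy x hx
  rw [dist_comm y x] at h2
  constructor <;> linarith

omit [PseudoMetricSpace X] in
theorem _root_.IsTransfer.comp_iterate {m : Measure X} {F : X → X} (hF : Measurable F)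
    {u a a' : X → ℝ} {n : ℕ} (h : IsTransfer m F u a) (h' : IsTransfer m (F^[n]) a a') :
    IsTransfer m (F^[n + 1]) u a' := by
  intro w hw ⟨C, hC⟩
  have h1 := h (fun x => w (F^[n] x)) (hw.comp (hF.iterate n)) ⟨C, fun x => hC _⟩
  have h2 := h' w hw ⟨C, hC⟩
  simpa [Function.iterate_succ_apply] using h1.trans h2

theorem iterate_transfer [Countable W] [IsProbabilityMeasure m]
    (H : MarkovSystem m F Y G b D t lam) {E : ℝ} (hE : 0 < E) (hDE : D + E * lam ^ t ≤ E)
    (n : ℕ) : ∀ {v : X → ℝ} {a C : ℝ}, 0 ≤ a → Measurable v → (∀ x, |v x| ≤ C) →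
    (∀ x ∈ Y, ∀ y ∈ Y, |v x - v y| ≤ a * modulus E t (dist x y)) →
    ∃ v' : X → ℝ, Measurable v' ∧ (∀ x, |v' x| ≤ C) ∧ IsTransfer m (F^[n]) v v' ∧
      ∫ x, v' x ∂m = ∫ x, v x ∂m ∧ ∀ x ∈ Y, ∀ y ∈ Y, |v' x - v' y| ≤
        ((1 - Real.exp (-(D + E * lam ^ t))) / (1 - Real.exp (-E))) ^ n * a
          * modulus E t (dist x y) := by
  have hlt0 : 0 ≤ lam ^ t := Real.rpow_nonneg H.lam_nonneg _
  have hθ : 0 ≤ (1 - Real.exp (-(D + E * lam ^ t))) / (1 - Real.exp (-E)) := by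
    refine div_nonneg (sub_nonneg.2 (Real.exp_le_one_iff.2 ?_))
      (sub_nonneg.2 (Real.exp_le_one_iff.2 (by linarith)))
    have := H.D_nonneg
    have := mul_nonneg hE.le hlt0
    linarith
  induction n with
  | zero =>
    intro v a C ha hv hC hva
    exact ⟨v, hv, hC, fun w hw hb => by simp, rfl, by simpa using hva⟩
  | succ n ih =>
    intro v a C ha hv hC hva
    obtain ⟨v', h1, h2, h3, h4, h5⟩ := ih (mul_nonneg hθ ha)
      (H.measurable_transfer hv fun x _ => hC x) (H.abs_transfer_le fun x _ => hC x)
      (H.abs_transfer_sub_le hE hDE ha hva)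
    refine ⟨v', h1, h2, (H.isTransfer hv hC).comp_iterate H.measurable_map h3,
      h4.trans (H.integral_transfer hv hC), ?_⟩
    simpa only [pow_succ, mul_assoc] using h5

/-- Regularization by the transfer operator and exponential decay of correlations. -/
theorem exists_decay [Countable W] [IsProbabilityMeasure m]
    (H : MarkovSystem m F Y G b D t lam) : ∃ C₀ θ : ℝ, 0 ≤ C₀ ∧ 0 ≤ θ ∧ θ < 1 ∧
    ∀ (u : X → ℝ) (U : W → ℝ) (N C : ℝ), Measurable u → (∀ x, |u x| ≤ N) →
      (∀ w, ∀ y ∈ Y, |u (b w y)| ≤ U w) →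
      (∀ w, ∀ x ∈ Y, ∀ y ∈ Y, |u (b w x) - u (b w y)| ≤ U w * dist x y ^ t) →
      (∀ y ∈ Y, Summable (fun w => G w y * U w) ∧ ∑' w, G w y * U w ≤ C) →
      ∃ a : X → ℝ, Measurable a ∧ (∀ x, |a x| ≤ C) ∧ IsTransfer m F u a ∧
        (∀ j : ℕ, |∫ x, (a x - ∫ z, u z ∂m) * (a (F^[j + 1] x) - ∫ z, u z ∂m) ∂m|
          ≤ C₀ * C ^ 2 * θ ^ j) ∧
        ∀ (n : ℕ) (w : X → ℂ), Measurable w → (∀ x, ‖w x‖ ≤ 1) →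
          ‖(∫ x, (u x : ℂ) * w (F^[n + 1] x) ∂m) - (∫ x, (u x : ℂ) ∂m) * ∫ x, w x ∂m‖
            ≤ C₀ * C * θ ^ n := by
  have hlt0 : 0 ≤ lam ^ t := Real.rpow_nonneg H.lam_nonneg _
  have hlt1 : lam ^ t < 1 := Real.rpow_lt_one H.lam_nonneg H.lam_lt H.t_pos
  have hD0 := H.D_nonneg
  set E := (D + 1) / (1 - lam ^ t) with hEdef
  have hE : 0 < E := div_pos (by linarith) (by linarith)
  have hEe : D + E * lam ^ t = E - 1 := by
    have : E * (1 - lam ^ t) = D + 1 := div_mul_cancel₀ _ (by linarith)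
    linarith
  have hE1 : 0 ≤ E - 1 := by rw [← hEe]; positivity
  have hDE : D + E * lam ^ t ≤ E := by linarith
  have hd : 0 < 1 - Real.exp (-E) := by
    have : Real.exp (-E) < 1 := by rw [Real.exp_lt_one_iff]; linarith
    linarith
  set θ := (1 - Real.exp (-(D + E * lam ^ t))) / (1 - Real.exp (-E)) with hθdef
  have hθ0 : 0 ≤ θ := by
    refine div_nonneg (sub_nonneg.2 (Real.exp_le_one_iff.2 ?_)) hd.le
    rw [hEe]; linarith
  have hθ1 : θ < 1 := by
    rw [hθdef, div_lt_one hd, hEe]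
    have : Real.exp (-E) < Real.exp (-(E - 1)) := Real.exp_lt_exp.2 (by linarith)
    linarith
  set L := (D * Real.exp D + 1) / (1 - Real.exp (-E)) with hL
  have hL0 : 0 ≤ L := by positivity
  refine ⟨2 * L, θ, by positivity, hθ0, hθ1, ?_⟩
  intro u U N C hu hN hU hU' hsum
  obtain ⟨y₀, hy₀⟩ := H.nonempty
  have hU0 : ∀ w, 0 ≤ U w := fun w => (abs_nonneg _).trans (hU w y₀ hy₀)
  have hC0 : 0 ≤ C := (tsum_nonneg fun w => mul_nonneg (H.weight_nonneg w y₀) (hU0 w)).trans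
    (hsum y₀ hy₀).2
  have hmod1 : ∀ d : ℝ, 0 ≤ d → modulus E t d ≤ 1 := fun d _ => by
    have := Real.exp_pos (-(E * d ^ t)); unfold modulus; linarith
  set a := transfer Y G b u with ha
  have ham : Measurable a := H.measurable_transfer hu fun x _ => hN x
  have haC : ∀ x, |a x| ≤ C := by
    intro x
    by_cases hx : x ∈ Y
    · rw [ha, transfer_apply hx, ← Real.norm_eq_abs]
      refine (tsum_of_norm_bounded (hsum x hx).1.hasSum fun w => ?_).trans (hsum x hx).2
      rw [norm_mul, Real.norm_of_nonneg (H.weight_nonneg w x)]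
      exact mul_le_mul_of_nonneg_left (hU w x hx) (H.weight_nonneg w x)
    · rw [ha, transfer, indicator_of_notMem hx, abs_zero]; exact hC0
  have hT : IsTransfer m F u a := H.isTransfer hu hN
  have hia : ∫ x, a x ∂m = ∫ x, u x ∂m := H.integral_transfer hu hN
  have hLa : ∀ x ∈ Y, ∀ y ∈ Y, |a x - a y| ≤ L * C * modulus E t (dist x y) := by
    intro x hx y hy
    set δ := dist x y ^ t with hδ
    have hδ0 : 0 ≤ δ := Real.rpow_nonneg dist_nonneg _
    have hδ1 : δ ≤ 1 := Real.rpow_le_one dist_nonneg (H.dist_le x hx y hy) H.t_pos.le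
    have hG : ∀ w, |G w x - G w y| ≤ D * Real.exp D * δ * G w y := by
      intro w
      have g0 := H.weight_nonneg w y
      have h1 := H.distortion w x hx y hy
      have h2 := H.distortion w y hy x hx
      rw [dist_comm y x] at h2
      rw [← hδ] at h1 h2
      have hDδ : 0 ≤ D * δ := mul_nonneg hD0 hδ0
      have h3 : Real.exp (D * δ) - 1 ≤ D * Real.exp D * δ := by
        have := Real.add_one_le_exp (-(D * δ))
        have e : Real.exp (-(D * δ)) * Real.exp (D * δ) = 1 := by rw [← Real.exp_add]; simp
        have e2 : Real.exp (D * δ) ≤ Real.exp D := Real.exp_le_exp.2 (by nlinarith)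
        nlinarith [Real.exp_pos (D * δ), mul_le_mul_of_nonneg_left e2 hDδ]
      have h4 : (1 - D * Real.exp D * δ) * G w y ≤ G w x := by
        have e : Real.exp (-(D * δ)) * Real.exp (D * δ) = 1 := by rw [← Real.exp_add]; simp
        have h5 : Real.exp (-(D * δ)) * G w y ≤ G w x := by
          calc _ ≤ Real.exp (-(D * δ)) * (Real.exp (D * δ) * G w x) := by gcongr
            _ = G w x := by rw [← mul_assoc, e, one_mul]
        refine le_trans (mul_le_mul_of_nonneg_right ?_ g0) h5
        have h6 := Real.add_one_le_exp (-(D * δ))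
        have h7 : D * δ ≤ D * Real.exp D * δ := by
          nlinarith [Real.add_one_le_exp D]
        linarith
      rw [abs_le]
      constructor <;> nlinarith
    have hterm : ∀ w, ‖G w x * u (b w x) - G w y * u (b w y)‖
        ≤ (D * Real.exp D + 1) * δ * (G w y * U w) := by
      intro w
      have e : G w x * u (b w x) - G w y * u (b w y)
          = (G w x - G w y) * u (b w x) + G w y * (u (b w x) - u (b w y)) := by ring
      have g0 := H.weight_nonneg w y
      rw [e]
      refine (norm_add_le _ _).trans ?_
      rw [norm_mul, norm_mul, Real.norm_of_nonneg g0, Real.norm_eq_abs, Real.norm_eq_abs,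
        Real.norm_eq_abs]
      calc _ ≤ (D * Real.exp D * δ * G w y) * U w + G w y * (U w * δ) := by
            gcongr
            · exact hG w
            · exact hU w x hx
            · exact hU' w x hx y hy
        _ = _ := by ring
    have sx := (H.summable (fun x _ => hN x) hx).hasSum
    have sy := (H.summable (fun x _ => hN x) hy).hasSum
    have h1 : |a x - a y| ≤ (D * Real.exp D + 1) * δ * C := by
      rw [ha, transfer_apply hx, transfer_apply hy, ← (sx.sub sy).tsum_eq, ← Real.norm_eq_abs]
      refine (tsum_of_norm_bounded ((hsum y hy).1.hasSum.mul_left _) hterm).trans ?_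
      exact mul_le_mul_of_nonneg_left (hsum y hy).2 (by positivity)
    have h2 := one_sub_rpow_le (E := E) (κ := 1) hE zero_le_one le_rfl hδ0 hδ1
    have h3 : (1 - Real.exp (-E)) * δ ≤ modulus E t (dist x y) := by
      have hc := convexOn_exp.2 (mem_univ (-E)) (mem_univ 0) hδ0 (by linarith : 0 ≤ 1 - δ)
        (by ring)
      simp only [smul_eq_mul, mul_zero, add_zero, Real.exp_zero, mul_one] at hc
      unfold modulus
      rw [← hδ, show -(E * δ) = δ * -E by ring]
      linarith
    refine h1.trans ?_
    calc (D * Real.exp D + 1) * δ * C = L * C * ((1 - Real.exp (-E)) * δ) := by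
          rw [hL]; field_simp
      _ ≤ _ := by gcongr
  have hit : ∀ n : ℕ, ∃ a' : X → ℝ, Measurable a' ∧ (∀ x, |a' x| ≤ C) ∧
      IsTransfer m (F^[n]) a a' ∧ ∀ x ∈ Y, |a' x - ∫ z, u z ∂m| ≤ θ ^ n * (L * C) := by
    intro n
    obtain ⟨a', h1, h2, h3, h4, h5⟩ := H.iterate_transfer hE hDE n (by positivity) ham haC hLa
    refine ⟨a', h1, h2, h3, fun x hx => ?_⟩
    have ia' : Integrable a' m := integrable_of_bdd h1 h2
    have e : a' x - ∫ z, u z ∂m = ∫ z, (a' x - a' z) ∂m := by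
      rw [integral_sub (integrable_const _) ia', h4, hia]; simp
    rw [e, ← Real.norm_eq_abs]
    refine (norm_integral_le_of_norm_le_const (C := θ ^ n * (L * C))
      (H.ae_mem.mono fun z hz => ?_)).trans (by simp)
    refine (h5 x hx z hz).trans (mul_le_of_le_one_right (by positivity) (hmod1 _ dist_nonneg))
  have hum : |∫ z, u z ∂m| ≤ C := by
    rw [← hia]
    have := norm_integral_le_of_norm_le_const (μ := m) (f := a) (C := C) (ae_of_all _ haC)
    simpa using this
  refine ⟨a, ham, haC, hT, fun j => ?_, fun n w hw hw1 => ?_⟩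
  · obtain ⟨a', h1, h2, h3, h4⟩ := hit (j + 1)
    set e := ∫ z, u z ∂m with he
    have hae : ∀ x, |a x - e| ≤ 2 * C := fun x => (abs_sub _ _).trans (by linarith [haC x])
    have hFj : Measurable (F^[j + 1]) := H.measurable_map.iterate _
    have k1 := h3.real (w := fun x => a x - e) (ham.sub_const e) hae
    have i1 : Integrable (fun x => a x - e) m := integrable_of_bdd (ham.sub_const e) hae
    have i0 : Integrable (fun x => a (F^[j + 1] x) - e) m :=
      integrable_of_bdd ((ham.comp hFj).sub_const e) fun x => hae _
    have i2 : Integrable (fun x => a x * (a (F^[j + 1] x) - e)) m :=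
      integrable_of_bdd (ham.mul ((ham.comp hFj).sub_const e)) (C := C * (2 * C)) fun x => by
        rw [norm_mul]; exact mul_le_mul (haC x) (hae _) (norm_nonneg _) hC0
    have i3 : Integrable (fun x => a' x * (a x - e)) m :=
      integrable_of_bdd (h1.mul (ham.sub_const e)) (C := C * (2 * C)) fun x => by
        rw [norm_mul]; exact mul_le_mul (h2 x) (hae _) (norm_nonneg _) hC0
    have k2 : ∫ x, (a (F^[j + 1] x) - e) ∂m = ∫ x, (a x - e) ∂m :=
      (H.measurePreserving.iterate (j + 1)).integral_comp_of_measurable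
        (g := fun x => a x - e) (ham.sub_const e)
    have k3 : ∫ x, (a x - e) * (a (F^[j + 1] x) - e) ∂m = ∫ x, (a' x - e) * (a x - e) ∂m := by
      simp_rw [sub_mul _ e]
      rw [integral_sub i2 (i0.const_mul e), integral_sub i3 (i1.const_mul e), integral_const_mul,
        integral_const_mul, k1, k2]
    rw [k3, ← Real.norm_eq_abs]
    refine (norm_integral_le_of_norm_le_const (C := θ ^ (j + 1) * (L * C) * (2 * C))
      (H.ae_mem.mono fun z hz => ?_)).trans ?_
    · rw [norm_mul]
      exact mul_le_mul (h4 z hz) (hae z) (norm_nonneg _) (by positivity)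
    · simp only [probReal_univ, mul_one]
      have : θ ^ (j + 1) ≤ θ ^ j := pow_le_pow_of_le_one hθ0 hθ1.le (Nat.le_succ j)
      calc _ ≤ θ ^ j * (L * C) * (2 * C) := by gcongr
        _ = _ := by ring
  · obtain ⟨a', h1, h2, h3, h4⟩ := hit n
    have k1 := hT.comp_iterate H.measurable_map h3 w hw ⟨1, hw1⟩
    have iw : Integrable w m := integrable_of_bdd hw hw1
    have i1 : Integrable (fun x => (a' x : ℂ) * w x) m :=
      integrable_of_bdd ((Complex.measurable_ofReal.comp h1).mul hw) (C := C * 1) fun x => by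
        rw [norm_mul, Complex.norm_real]; exact mul_le_mul (h2 x) (hw1 x) (norm_nonneg _) hC0
    have e1 : (∫ x, (u x : ℂ) ∂m) = ((∫ x, u x ∂m : ℝ) : ℂ) := integral_ofReal
    rw [k1, e1, ← integral_const_mul, ← integral_sub i1 (iw.const_mul _)]
    refine (norm_integral_le_of_norm_le_const (C := θ ^ n * (L * C))
      (H.ae_mem.mono fun z hz => ?_)).trans ?_
    · rw [← sub_mul, norm_mul, ← Complex.ofReal_sub, Complex.norm_real]
      exact (mul_le_of_le_one_right (norm_nonneg _) (hw1 z)).trans (h4 z hz)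
    · simp only [probReal_univ, mul_one]
      have : 0 ≤ θ ^ n * (L * C) := by positivity
      linarith

end MarkovSystem
end MarkovSystem

section Branches

/-- The left branch of the LSV map. -/
def leftBranch (a x : ℝ) : ℝ := x * (1 + (2 : ℝ) ^ a * x ^ a)

/-- The derivative of the left branch of the LSV map. -/
def leftDeriv (a x : ℝ) : ℝ := 1 + (1 + a) * ((2 : ℝ) ^ a * x ^ a)

/-- The inverse of the left branch of the LSV map. -/
def leftInv (a y : ℝ) : ℝ := sSup {x | x ∈ Icc (0 : ℝ) (1 / 2) ∧ leftBranch a x ≤ y}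

variable {a x y : ℝ}

theorem two_rpow_mul_rpow (hx : 0 ≤ x) : (2 : ℝ) ^ a * x ^ a = (2 * x) ^ a :=
  (Real.mul_rpow zero_le_two hx).symm

theorem leftBranch_zero : leftBranch a 0 = 0 := by simp [leftBranch]

theorem leftBranch_half : leftBranch a (1 / 2) = 1 := by
  rw [leftBranch, two_rpow_mul_rpow (by norm_num)]; norm_num

theorem le_leftBranch (hx : 0 ≤ x) : x ≤ leftBranch a x := by
  unfold leftBranch
  have : 0 ≤ (2 : ℝ) ^ a * x ^ a := by positivity
  nlinarith

theorem sub_le_leftBranch_sub (ha : 0 < a) (hx : 0 ≤ x) (hxy : x ≤ y) :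
    y - x ≤ leftBranch a y - leftBranch a x := by
  unfold leftBranch
  have h1 : x ^ a ≤ y ^ a := Real.rpow_le_rpow hx hxy ha.le
  have h2 : x * x ^ a ≤ y * y ^ a :=
    mul_le_mul hxy h1 (Real.rpow_nonneg hx _) (hx.trans hxy)
  have h3 : (0 : ℝ) ≤ 2 ^ a := by positivity
  nlinarith [mul_le_mul_of_nonneg_left h2 h3]

theorem continuous_leftBranch (ha : 0 < a) : Continuous (leftBranch a) := by
  unfold leftBranch
  have := Real.continuous_rpow_const ha.le
  fun_prop

theorem exists_leftBranch_eq (ha : 0 < a) (hy : y ∈ Icc (0 : ℝ) 1) :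
    ∃ x ∈ Icc (0 : ℝ) (1 / 2), leftBranch a x = y := by
  have := intermediate_value_Icc (by norm_num : (0 : ℝ) ≤ 1 / 2)
    (continuous_leftBranch ha).continuousOn
  rw [leftBranch_zero, leftBranch_half] at this
  exact this hy

theorem leftInv_leftBranch (ha : 0 < a) (hx : x ∈ Icc (0 : ℝ) (1 / 2)) :
    leftInv a (leftBranch a x) = x := by
  refine IsGreatest.csSup_eq ⟨⟨hx, le_rfl⟩, fun z hz => ?_⟩
  by_contra h
  have := sub_le_leftBranch_sub ha hx.1 (not_le.1 h).le
  linarith [hz.2, not_le.1 h]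

theorem leftInv_mem (ha : 0 < a) (hy : y ∈ Icc (0 : ℝ) 1) :
    leftInv a y ∈ Icc (0 : ℝ) (1 / 2) := by
  obtain ⟨x, hx, rfl⟩ := exists_leftBranch_eq ha hy
  rwa [leftInv_leftBranch ha hx]

theorem leftBranch_leftInv (ha : 0 < a) (hy : y ∈ Icc (0 : ℝ) 1) :
    leftBranch a (leftInv a y) = y := by
  obtain ⟨x, hx, rfl⟩ := exists_leftBranch_eq ha hy
  rw [leftInv_leftBranch ha hx]

theorem leftInv_pos (ha : 0 < a) (hy : y ∈ Ioc (0 : ℝ) 1) : 0 < leftInv a y := by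
  have h1 := leftBranch_leftInv ha (Ioc_subset_Icc_self hy)
  have h2 := leftInv_mem ha (Ioc_subset_Icc_self hy)
  rcases h2.1.eq_or_lt with h | h
  · rw [← h, leftBranch_zero] at h1; linarith [hy.1]
  · exact h

theorem leftInv_sub_le (ha : 0 < a) (hx : x ∈ Icc (0 : ℝ) 1) (hy : y ∈ Icc (0 : ℝ) 1)
    (hxy : x ≤ y) : 0 ≤ leftInv a y - leftInv a x ∧ leftInv a y - leftInv a x ≤ y - x := by
  have h1 := leftBranch_leftInv ha hx
  have h2 := leftBranch_leftInv ha hy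
  have h3 := leftInv_mem ha hx
  have h4 := leftInv_mem ha hy
  rcases le_total (leftInv a x) (leftInv a y) with h | h
  · have := sub_le_leftBranch_sub ha h3.1 h
    constructor <;> linarith
  · have := sub_le_leftBranch_sub ha h4.1 h
    constructor <;> linarith

theorem abs_leftInv_sub_le (ha : 0 < a) (hx : x ∈ Icc (0 : ℝ) 1) (hy : y ∈ Icc (0 : ℝ) 1) :
    |leftInv a x - leftInv a y| ≤ |x - y| := by
  rcases le_total x y with h | h
  · have := leftInv_sub_le ha hx hy h
    rw [abs_sub_comm, abs_sub_comm x, abs_of_nonneg this.1, abs_of_nonneg (by linarith)]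
    exact this.2
  · have := leftInv_sub_le ha hy hx h
    rw [abs_of_nonneg this.1, abs_of_nonneg (by linarith)]
    exact this.2

theorem monotone_leftInv : Monotone (leftInv a) := by
  intro y z hyz
  have hbdd : ∀ u, BddAbove {x | x ∈ Icc (0 : ℝ) (1 / 2) ∧ leftBranch a x ≤ u} :=
    fun u => ⟨1 / 2, fun x hx => hx.1.2⟩
  rcases (show Set.Nonempty {x | x ∈ Icc (0 : ℝ) (1 / 2) ∧ leftBranch a x ≤ y} ∨ _ from
    (eq_empty_or_nonempty _).symm) with h | h
  · exact csSup_le_csSup (hbdd z) h fun x hx => ⟨hx.1, hx.2.trans hyz⟩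
  · rw [leftInv, h, Real.sSup_empty]
    exact Real.sSup_nonneg fun x hx => hx.1.1

theorem measurable_leftInv : Measurable (leftInv a) := monotone_leftInv.measurable

theorem one_le_leftDeriv (ha : 0 < a) (hx : 0 ≤ x) : 1 ≤ leftDeriv a x := by
  unfold leftDeriv
  have : 0 ≤ (1 + a) * ((2 : ℝ) ^ a * x ^ a) := by positivity
  linarith

theorem leftDeriv_mono (ha : 0 < a) (hx : 0 ≤ x) (hxy : x ≤ y) : leftDeriv a x ≤ leftDeriv a y := by
  unfold leftDeriv
  gcongr

theorem hasDerivAt_leftBranch (hx : 0 < x) : HasDerivAt (leftBranch a) (leftDeriv a x) x := by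
  have h1 : HasDerivAt (fun x : ℝ => x ^ a) (a * x ^ (a - 1)) x :=
    Real.hasDerivAt_rpow_const (Or.inl hx.ne')
  have h2 := (hasDerivAt_id x).mul ((h1.const_mul ((2 : ℝ) ^ a)).const_add 1)
  refine h2.congr_deriv ?_
  have : x * x ^ (a - 1) = x ^ a := by
    rw [Real.rpow_sub_one hx.ne']; field_simp
  simp only [id, one_mul, leftDeriv]
  linear_combination (a * 2 ^ a) * this

/-- The comparison function `v² / (g(v)² T'(g v))` is monotone. -/
theorem sq_div_leftDeriv_mono (ha : 0 < a) (ha1 : a ≤ 1) (hx : 0 < x) (hxy : x ≤ y) :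
    leftBranch a x ^ 2 / (x ^ 2 * leftDeriv a x) ≤ leftBranch a y ^ 2 / (y ^ 2 * leftDeriv a y) := by
  have hy := hx.trans_le hxy
  set s := (2 : ℝ) ^ a * x ^ a with hs
  set r := (2 : ℝ) ^ a * y ^ a with hr
  have hs0 : 0 ≤ s := by positivity
  have hsr : s ≤ r := by rw [hs, hr]; gcongr
  have e1 : leftBranch a x ^ 2 / (x ^ 2 * leftDeriv a x) = (1 + s) ^ 2 / (1 + (1 + a) * s) := by
    rw [leftBranch, leftDeriv, ← hs]; field_simp
  have e2 : leftBranch a y ^ 2 / (y ^ 2 * leftDeriv a y) = (1 + r) ^ 2 / (1 + (1 + a) * r) := by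
    rw [leftBranch, leftDeriv, ← hr]; field_simp
  rw [e1, e2, div_le_div_iff₀ (by positivity) (by nlinarith)]
  have : (1 + r) ^ 2 * (1 + (1 + a) * s) - (1 + s) ^ 2 * (1 + (1 + a) * r)
      = (r - s) * ((1 - a) + (r + s) + (1 + a) * r * s) := by ring
  have h2 : 0 ≤ (r - s) * ((1 - a) + (r + s) + (1 + a) * r * s) := by
    refine mul_nonneg (by linarith) ?_
    have : 0 ≤ (1 + a) * r * s := by
      have : 0 ≤ r := hs0.trans hsr
      positivity
    linarith
  linarith

theorem one_div_leftInv_ge (ha : 0 < a) (ha1 : a ≤ 1) (hy : y ∈ Ioc (0 : ℝ) 1) :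
    1 / y + 1 ≤ 1 / leftInv a y := by
  have hx := leftInv_pos ha hy
  have hx2 := (leftInv_mem ha (Ioc_subset_Icc_self hy)).2
  have h := leftBranch_leftInv ha (Ioc_subset_Icc_self hy)
  set x := leftInv a y
  have h1 : 2 * x ≤ (2 : ℝ) ^ a * x ^ a := by
    rw [two_rpow_mul_rpow hx.le]
    exact Real.self_le_rpow_of_le_one (by linarith) (by linarith) ha1
  have h2 : x * (1 + 2 * x) ≤ y := by
    rw [← h, leftBranch]; gcongr
  have h3 : 1 / y ≤ 1 / (x * (1 + 2 * x)) := one_div_le_one_div_of_le (by positivity) h2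
  have h4 : 1 / (x * (1 + 2 * x)) + 1 ≤ 1 / x := by
    rw [div_add_one (by positivity), div_le_div_iff₀ (by positivity) hx]
    nlinarith [mul_nonneg (sq_nonneg x) (by linarith : 0 ≤ 1 - 2 * x)]
  linarith

theorem leftBranch_mem (ha : 0 < a) (hx : x ∈ Ioc (0 : ℝ) (1 / 2)) :
    leftBranch a x ∈ Ioc (0 : ℝ) 1 := by
  refine ⟨hx.1.trans_le (le_leftBranch hx.1.le), ?_⟩
  have := sub_le_leftBranch_sub ha hx.1.le hx.2
  rw [leftBranch_half] at this
  linarith [hx.2]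

/-- Change of variables for the left branch. -/
theorem map_leftInv (ha : 0 < a) :
    ((volume.restrict (Ioc (0 : ℝ) 1)).withDensity
      fun y => ENNReal.ofReal (leftDeriv a (leftInv a y))⁻¹).map (leftInv a)
      = volume.restrict (Ioc (0 : ℝ) (1 / 2)) := by
  have himg : leftBranch a '' Ioc 0 (1 / 2) = Ioc 0 1 := by
    ext y
    constructor
    · rintro ⟨x, hx, rfl⟩; exact leftBranch_mem ha hx
    · intro hy
      exact ⟨leftInv a y, ⟨leftInv_pos ha hy, (leftInv_mem ha (Ioc_subset_Icc_self hy)).2⟩,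
        leftBranch_leftInv ha (Ioc_subset_Icc_self hy)⟩
  have hinj : InjOn (leftBranch a) (Ioc 0 (1 / 2)) := fun x hx z hz h => by
    rw [← leftInv_leftBranch ha (Ioc_subset_Icc_self hx), h,
      leftInv_leftBranch ha (Ioc_subset_Icc_self hz)]
  ext s hs
  rw [Measure.map_apply measurable_leftInv hs, withDensity_apply _ (measurable_leftInv hs),
    Measure.restrict_apply hs, ← lintegral_indicator (measurable_leftInv hs), ← himg,
    lintegral_image_eq_lintegral_abs_deriv_mul measurableSet_Ioc
      (fun x hx => (hasDerivAt_leftBranch hx.1).hasDerivWithinAt) hinj]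
  have : ∀ x ∈ Ioc (0 : ℝ) (1 / 2), ENNReal.ofReal |leftDeriv a x| *
      (leftInv a ⁻¹' s).indicator (fun y => ENNReal.ofReal (leftDeriv a (leftInv a y))⁻¹)
        (leftBranch a x) = s.indicator 1 x := by
    intro x hx
    have e := leftInv_leftBranch ha (Ioc_subset_Icc_self hx)
    have h1 := one_le_leftDeriv ha hx.1.le
    by_cases hxs : x ∈ s
    · rw [indicator_of_mem (by rw [mem_preimage, e]; exact hxs), indicator_of_mem hxs, e,
        abs_of_nonneg (by linarith), ← ENNReal.ofReal_mul (by linarith),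
        mul_inv_cancel₀ (by linarith)]
      simp
    · rw [indicator_of_notMem (by rw [mem_preimage, e]; exact hxs), indicator_of_notMem hxs,
        mul_zero]
  rw [setLIntegral_congr_fun measurableSet_Ioc this, lintegral_indicator_one hs,
    Measure.restrict_apply hs]

end Branches

section FirstReturn

variable {X : Type*} {S : X → X} {Y : Set X}

open Classical in
/-- The first return time to `Y`, with value `1` at points which never return. -/
def returnTime (S : X → X) (Y : Set X) (p : X) : ℕ :=
  Nat.find (p := fun n => S^[n + 1] p ∈ Y ∨ ∀ k, S^[k + 1] p ∉ Y)
    (by by_cases h : ∃ n, S^[n + 1] p ∈ Y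
        · exact h.imp fun n hn => Or.inl hn
        · exact ⟨0, Or.inr (not_exists.1 h)⟩) + 1

/-- The first return map to `Y`. -/
def firstReturn (S : X → X) (Y : Set X) (p : X) : X := S^[returnTime S Y p] p

/-- The sum of `f` along an excursion from `Y`, including the return point. -/
def excursionSum (S : X → X) (Y : Set X) (f : X → ℝ) (p : X) : ℝ :=
  ∑ l ∈ Finset.range (returnTime S Y p), f (S^[l + 1] p)

theorem one_le_returnTime (p : X) : 1 ≤ returnTime S Y p := Nat.le_add_left _ _

theorem returnTime_eq_iff {p : X} (hp : ∃ n, S^[n + 1] p ∈ Y) (n : ℕ) :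
    returnTime S Y p = n + 1 ↔ S^[n + 1] p ∈ Y ∧ ∀ k < n, S^[k + 1] p ∉ Y := by
  have h : ∀ k, (S^[k + 1] p ∈ Y ∨ ∀ k, S^[k + 1] p ∉ Y) ↔ S^[k + 1] p ∈ Y := fun k =>
    ⟨fun h => h.resolve_right fun h => hp.elim fun n hn => h n hn, Or.inl⟩
  unfold returnTime
  classical
  rw [Nat.add_right_cancel_iff, Nat.find_eq_iff, h]
  simp only [h]

theorem lt_returnTime_iff {p : X} (hp : ∃ n, S^[n + 1] p ∈ Y) (n : ℕ) :
    n < returnTime S Y p ↔ ∀ k < n, S^[k + 1] p ∉ Y := by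
  have h : ∀ k, (S^[k + 1] p ∈ Y ∨ ∀ k, S^[k + 1] p ∉ Y) ↔ S^[k + 1] p ∈ Y := fun k =>
    ⟨fun h => h.resolve_right fun h => hp.elim fun n hn => h n hn, Or.inl⟩
  unfold returnTime
  classical
  rw [Nat.lt_succ_iff, Nat.le_find_iff]
  simp only [h]

theorem firstReturn_mem {p : X} (hp : ∃ n, S^[n + 1] p ∈ Y) : firstReturn S Y p ∈ Y := by
  obtain ⟨k, hk⟩ := Nat.exists_eq_add_of_le' (one_le_returnTime (S := S) (Y := Y) p)
  rw [firstReturn, hk]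
  exact ((returnTime_eq_iff hp k).1 hk).1

theorem abs_excursionSum_le {f : X → ℝ} {M : ℝ} (hf : ∀ x, |f x| ≤ M) (p : X) :
    |excursionSum S Y f p| ≤ M * returnTime S Y p := by
  refine (Finset.abs_sum_le_sum_abs _ _).trans ((Finset.sum_le_sum fun l _ => hf _).trans ?_)
  simp [mul_comm]

variable [MeasurableSpace X]

theorem measurable_returnTime (hS : Measurable S) (hY : MeasurableSet Y) :
    Measurable (returnTime S Y) := by
  classical
  have hm : ∀ k, MeasurableSet {p | S^[k + 1] p ∈ Y} := fun k => hS.iterate (k + 1) hY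
  refine Measurable.add_const ?_ 1
  exact measurable_find (p := fun p n => S^[n + 1] p ∈ Y ∨ ∀ k, S^[k + 1] p ∉ Y) _ fun k =>
    (hm k).union (by
      have : {p | ∀ k, S^[k + 1] p ∉ Y} = ⋂ k, {p | S^[k + 1] p ∈ Y}ᶜ := by ext; simp
      exact (this ▸ MeasurableSet.iInter fun k => (hm k).compl :
        MeasurableSet {p | ∀ k, S^[k + 1] p ∉ Y}))

theorem measurable_of_returnTime {E : Type*} [MeasurableSpace E] (hS : Measurable S)
    (hY : MeasurableSet Y) {g : ℕ → X → E} (hg : ∀ n, Measurable (g n)) :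
    Measurable fun p => g (returnTime S Y p) p :=
  measurable_from_prod_countable_right (f := fun q : ℕ × X => g q.1 q.2) hg |>.comp
    ((measurable_returnTime hS hY).prodMk measurable_id)

theorem measurable_firstReturn (hS : Measurable S) (hY : MeasurableSet Y) :
    Measurable (firstReturn S Y) :=
  measurable_of_returnTime hS hY fun n => hS.iterate n

theorem measurable_excursionSum (hS : Measurable S) (hY : MeasurableSet Y) {f : X → ℝ}
    (hf : Measurable f) : Measurable (excursionSum S Y f) :=
  measurable_of_returnTime hS hY (g := fun n p => ∑ l ∈ Finset.range n, f (S^[l + 1] p)) fun _ =>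
    Finset.measurable_sum _ fun l _ => hf.comp (hS.iterate (l + 1))

variable {ν : Measure X} [IsFiniteMeasure ν]

/-- The tower formula: the invariant measure is spread from `Y` along excursions. -/
theorem tower_formula (hS : MeasurePreserving S ν ν) (hY : MeasurableSet Y)
    (hret : ∀ p ∈ Y, ∃ n, S^[n + 1] p ∈ Y) (hhit : ∀ᵐ p ∂ν, ∃ n, S^[n] p ∈ Y) :
    ν = Measure.sum fun n => (ν.restrict (Y ∩ {p | n < returnTime S Y p})).map S^[n + 1] := by
  set V : ℕ → Set X := fun n => {p | ∀ j < n, S^[j] p ∉ Y} with hV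
  have hVs : ∀ n, V (n + 1) = Yᶜ ∩ S ⁻¹' V n := by
    intro n; ext p
    simp only [hV, mem_ofPred_eq, mem_inter_iff, mem_compl_iff, mem_preimage]
    constructor
    · intro h
      exact ⟨h 0 (by omega), fun j hj => by
        rw [← Function.iterate_succ_apply]; exact h (j + 1) (by omega)⟩
    · rintro ⟨h0, h1⟩ j hj
      rcases j with _ | j
      · exact h0
      · rw [Function.iterate_succ_apply]; exact h1 j (by omega)
  have hVm : ∀ n, MeasurableSet (V n) := by
    intro n
    induction n with
    | zero => simp [hV]
    | succ n ih => rw [hVs]; exact hY.compl.inter (hS.measurable ih)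
  have hYR : ∀ n, Y ∩ {p | n < returnTime S Y p} = Y ∩ S ⁻¹' V n := by
    intro n; ext p
    simp only [mem_inter_iff, mem_ofPred_eq, mem_preimage, hV, and_congr_right_iff]
    intro hp
    rw [lt_returnTime_iff (hret p hp)]
    rfl
  have hlim : Tendsto (fun n => ν (V n)) atTop (𝓝 0) := by
    have : ν (⋂ n, V n) = 0 := by
      refine measure_mono_null (fun p hp => ?_) hhit
      rintro ⟨n, hn⟩
      exact (mem_iInter.1 hp (n + 1)) n (by omega) hn
    rw [← this]
    refine tendsto_measure_iInter_atTop (fun n => (hVm n).nullMeasurableSet)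
      (fun a b hab p hp j hj => hp j (hj.trans_le hab)) ⟨0, measure_ne_top _ _⟩
  ext E hE
  have hterm : ∀ n, ((ν.restrict (Y ∩ {p | n < returnTime S Y p})).map S^[n + 1]) E
      = ν (Y ∩ (S ⁻¹' (V n ∩ S^[n] ⁻¹' E))) := by
    intro n
    rw [Measure.map_apply (hS.measurable.iterate _) hE,
      Measure.restrict_apply (hS.measurable.iterate _ hE), hYR]
    congr 1
    ext p
    simp only [mem_inter_iff, mem_preimage, Function.iterate_succ_apply]
    tauto
  have hsum : ∀ N, (∑ n ∈ Finset.range N, ν (Y ∩ (S ⁻¹' (V n ∩ S^[n] ⁻¹' E))))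
      + ν (V N ∩ S^[N] ⁻¹' E) = ν E := by
    intro N
    induction N with
    | zero => simp [hV]
    | succ N ih =>
      have hm : MeasurableSet (V N ∩ S^[N] ⁻¹' E) := (hVm N).inter (hS.measurable.iterate _ hE)
      rw [Finset.sum_range_succ, ← ih, add_assoc, ← hS.measure_preimage hm.nullMeasurableSet,
        ← measure_inter_add_sdiff (S ⁻¹' (V N ∩ S^[N] ⁻¹' E)) hY, inter_comm _ Y]
      congr 3
      rw [hVs]
      ext p
      simp only [mem_inter_iff, mem_preimage, mem_compl_iff, Set.mem_sdiff, Function.iterate_succ_apply]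
      tauto
  rw [Measure.sum_apply _ hE]
  simp only [hterm]
  refine tendsto_nhds_unique (f := fun N => (∑ n ∈ Finset.range N,
    ν (Y ∩ (S ⁻¹' (V n ∩ S^[n] ⁻¹' E)))) + ν (V N ∩ S^[N] ⁻¹' E)) (l := atTop) ?_ ?_
  · simp only [hsum]; exact tendsto_const_nhds
  · have h0 : Tendsto (fun N => ν (V N ∩ S^[N] ⁻¹' E)) atTop (𝓝 0) :=
      tendsto_of_tendsto_of_tendsto_of_le_of_le tendsto_const_nhds hlim (fun _ => bot_le)
        fun _ => measure_mono inter_subset_left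
    simpa using (ENNReal.tendsto_nat_tsum fun n =>
      ν (Y ∩ (S ⁻¹' (V n ∩ S^[n] ⁻¹' E)))).add h0

/-- The first return map preserves the restriction of the invariant measure. -/
theorem measurePreserving_firstReturn (hS : MeasurePreserving S ν ν) (hY : MeasurableSet Y)
    (hret : ∀ p ∈ Y, ∃ n, S^[n + 1] p ∈ Y) (hhit : ∀ᵐ p ∂ν, ∃ n, S^[n] p ∈ Y) :
    MeasurePreserving (firstReturn S Y) (ν.restrict Y) (ν.restrict Y) := by
  have hF := measurable_firstReturn hS.measurable hY
  have hRm := measurable_returnTime hS.measurable hY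
  refine ⟨hF, ?_⟩
  ext E hE
  rw [Measure.map_apply hF hE, Measure.restrict_apply (hF hE), Measure.restrict_apply hE]
  conv_rhs => rw [tower_formula hS hY hret hhit]
  rw [Measure.sum_apply _ (hE.inter hY)]
  have : firstReturn S Y ⁻¹' E ∩ Y = ⋃ n, (S^[n + 1] ⁻¹' (E ∩ Y)) ∩
      (Y ∩ {p | n < returnTime S Y p}) := by
    ext p
    simp only [mem_inter_iff, mem_preimage, mem_iUnion, mem_ofPred_eq]
    constructor
    · rintro ⟨h1, h2⟩
      obtain ⟨k, hk⟩ := Nat.exists_eq_add_of_le' (one_le_returnTime (S := S) (Y := Y) p)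
      have h3 := firstReturn_mem (hret p h2)
      rw [firstReturn, hk] at h1 h3
      exact ⟨k, ⟨h1, h3⟩, h2, by omega⟩
    · rintro ⟨k, ⟨h1, h2⟩, h3, h4⟩
      have : returnTime S Y p = k + 1 :=
        (returnTime_eq_iff (hret p h3) k).2 ⟨h2, (lt_returnTime_iff (hret p h3) k).1 h4⟩
      rw [firstReturn, this]
      exact ⟨h1, h3⟩
  rw [this, measure_iUnion]
  · refine tsum_congr fun n => ?_
    rw [Measure.map_apply (hS.measurable.iterate _) (hE.inter hY),
      Measure.restrict_apply (hS.measurable.iterate _ (hE.inter hY))]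
  · intro i j hij
    rw [Function.onFun, Set.disjoint_left]
    rintro p ⟨⟨h1, h2⟩, h3, h4⟩ ⟨⟨h1', h2'⟩, h3', h4'⟩
    have e1 := (returnTime_eq_iff (hret p h3) i).2 ⟨h2, (lt_returnTime_iff (hret p h3) i).1 h4⟩
    have e2 := (returnTime_eq_iff (hret p h3) j).2 ⟨h2', (lt_returnTime_iff (hret p h3) j).1 h4'⟩
    omega
  · intro n
    exact (hS.measurable.iterate _ (hE.inter hY)).inter (hY.inter (measurableSet_lt measurable_const hRm))

section Kac

variable (hS : MeasurePreserving S ν ν) (hY : MeasurableSet Y)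
  (hret : ∀ p ∈ Y, ∃ n, S^[n + 1] p ∈ Y) (hhit : ∀ᵐ p ∂ν, ∃ n, S^[n] p ∈ Y)

include hS hY hret hhit

theorem hasSum_integral_tower {E : Type*} [NormedAddCommGroup E] [NormedSpace ℝ E]
    {f : X → E} (hf : Integrable f ν) :
    HasSum (fun n => ∫ p in Y ∩ {p | n < returnTime S Y p}, f (S^[n + 1] p) ∂ν) (∫ p, f p ∂ν) := by
  have ht := tower_formula hS hY hret hhit
  have h1 : Integrable f (Measure.sum fun n =>
    (ν.restrict (Y ∩ {p | n < returnTime S Y p})).map S^[n + 1]) := ht ▸ hf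
  have h2 := hasSum_integral_measure h1
  rw [← ht] at h2
  refine (funext fun n => ?_ : (fun n => ∫ p in Y ∩ {p | n < returnTime S Y p},
    f (S^[n + 1] p) ∂ν) = _) ▸ h2
  refine (integral_map (hS.measurable.iterate _).aemeasurable ?_).symm
  exact (h1.mono_measure (Measure.le_sum _ n)).aestronglyMeasurable

theorem hasSum_measureReal_lt_returnTime :
    HasSum (fun n => ν.real (Y ∩ {p | n < returnTime S Y p})) (ν.real univ) := by
  simpa using hasSum_integral_tower hS hY hret hhit (integrable_const (1 : ℝ))

theorem measure_pos_of_tower (hν : ν univ ≠ 0) : ν Y ≠ 0 := by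
  intro h0
  have := hasSum_measureReal_lt_returnTime hS hY hret hhit
  have h1 : ∀ n, ν.real (Y ∩ {p | n < returnTime S Y p}) = 0 := fun n => by
    rw [measureReal_def, measure_mono_null inter_subset_left h0, ENNReal.toReal_zero]
  simp only [h1] at this
  have h2 := this.unique hasSum_zero
  rw [measureReal_eq_zero_iff] at h2
  exact hν h2

omit [MeasurableSpace X] [IsFiniteMeasure ν] hS hret hhit hY in
theorem hasSum_lt_returnTime (p : X) :
    HasSum (fun n => {p | n < returnTime S Y p}.indicator (fun _ => (1 : ℝ)) p)
      (returnTime S Y p) := by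
  have := hasSum_sum_of_ne_finset_zero (L := SummationFilter.unconditional ℕ) (s := Finset.range (returnTime S Y p))
    (f := fun n => {p | n < returnTime S Y p}.indicator (fun _ => (1 : ℝ)) p) fun n hn => by
      rw [indicator_of_notMem]
      simpa using hn
  convert this using 1
  rw [Finset.sum_congr rfl (g := fun _ => (1 : ℝ)) fun n hn => by
    rw [indicator_of_mem]
    simpa using hn]
  simp

theorem integrable_returnTime :
    Integrable (fun p => (returnTime S Y p : ℝ)) (ν.restrict Y) := by
  have hm := measurable_returnTime hS.measurable hY
  have hset : ∀ n, MeasurableSet {p | n < returnTime S Y p} := fun n =>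
    measurableSet_lt measurable_const hm
  have hK := hasSum_measureReal_lt_returnTime hS hY hret hhit
  refine ⟨(measurable_from_nat.comp hm : Measurable fun p => (returnTime S Y p : ℝ)).aestronglyMeasurable, ?_⟩
  have e : ∀ p, ‖(returnTime S Y p : ℝ)‖ₑ =
      ∑' n, {p | n < returnTime S Y p}.indicator (fun _ => (1 : ENNReal)) p := by
    intro p
    have := hasSum_lt_returnTime (S := S) (Y := Y) p
    rw [Real.enorm_eq_ofReal (by positivity), ← this.tsum_eq,
      ENNReal.ofReal_tsum_of_nonneg (fun n => indicator_nonneg (fun _ _ => zero_le_one) _)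
        this.summable]
    refine tsum_congr fun n => ?_
    by_cases h : p ∈ {p | n < returnTime S Y p} <;> simp [h]
  rw [HasFiniteIntegral]
  simp only [e]
  rw [lintegral_tsum fun n => (measurable_const.indicator (hset n)).aemeasurable]
  have : ∀ n, ∫⁻ p in Y, {p | n < returnTime S Y p}.indicator (fun _ => (1 : ENNReal)) p ∂ν
      = ENNReal.ofReal (ν.real (Y ∩ {p | n < returnTime S Y p})) := by
    intro n
    rw [lintegral_indicator (hset n), lintegral_one, Measure.restrict_apply MeasurableSet.univ,
      univ_inter, Measure.restrict_apply (hset n), inter_comm, ofReal_measureReal]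
  simp only [this]
  rw [← ENNReal.ofReal_tsum_of_nonneg (fun n => measureReal_nonneg) hK.summable]
  exact ENNReal.ofReal_lt_top

/-- Integrals of excursion sums (with `f = 1` this is Kac's formula). -/
theorem integral_excursionSum {f : X → ℝ} (hf : Measurable f) {M : ℝ} (hM : ∀ x, |f x| ≤ M) :
    ∫ p in Y, excursionSum S Y f p ∂ν = ∫ p, f p ∂ν := by
  have hm := measurable_returnTime hS.measurable hY
  have hset : ∀ n, MeasurableSet {p | n < returnTime S Y p} := fun n =>
    measurableSet_lt measurable_const hm
  have h1 := hasSum_integral_tower hS hY hret hhit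
    (integrable_of_bdd (m := ν) hf (fun x => by rw [Real.norm_eq_abs]; exact hM x))
  have hR := integrable_returnTime hS hY hret hhit
  have h2 := hasSum_integral_of_dominated_convergence (μ := ν.restrict Y)
    (F := fun n => {p | n < returnTime S Y p}.indicator fun p => f (S^[n + 1] p))
    (f := excursionSum S Y f)
    (fun n p => M * {p | n < returnTime S Y p}.indicator (fun _ => (1 : ℝ)) p)
    (fun n => ((hf.comp (hS.measurable.iterate _)).indicator (hset n)).aestronglyMeasurable)
    (fun n => ae_of_all _ fun p => by
      by_cases h : p ∈ {p | n < returnTime S Y p}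
      · rw [indicator_of_mem h, indicator_of_mem h, mul_one]; exact hM _
      · rw [indicator_of_notMem h, indicator_of_notMem h]; simp)
    (ae_of_all _ fun p => (hasSum_lt_returnTime p).summable.mul_left M)
    (by simp only [fun p => ((hasSum_lt_returnTime (S := S) (Y := Y) p).mul_left M).tsum_eq]
        exact hR.const_mul M)
    (ae_of_all _ fun p => by
      have := hasSum_sum_of_ne_finset_zero (L := SummationFilter.unconditional ℕ) (s := Finset.range (returnTime S Y p))
        (f := fun n => {p | n < returnTime S Y p}.indicator (fun p => f (S^[n + 1] p)) p)
        fun n hn => by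
          rw [indicator_of_notMem]
          simpa using hn
      have e : excursionSum S Y f p = ∑ n ∈ Finset.range (returnTime S Y p),
          {p | n < returnTime S Y p}.indicator (fun p => f (S^[n + 1] p)) p :=
        Finset.sum_congr rfl fun n hn => by
          rw [indicator_of_mem]
          simpa using hn
      exact e ▸ this)
  refine h2.unique ?_
  convert h1 using 2 with n
  rw [integral_indicator (hset n), Measure.restrict_restrict (hset n), inter_comm]

end Kac

end FirstReturn

section Truncation

theorem integral_sum_sq_le_of_isTransfer {Ω : Type*} [MeasurableSpace Ω] {m : Measure Ω}
    [IsProbabilityMeasure m] {F : Ω → Ω} (hF : MeasurePreserving F m m) {v a : Ω → ℝ}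
    (hv : Measurable v) (ha : Measurable a) {N C : ℝ} (hN : ∀ x, |v x| ≤ N) (hC : ∀ x, |a x| ≤ C)
    (h : IsTransfer m F v a) {B θ : ℝ} (hB : 0 ≤ B) (hθ0 : 0 ≤ θ) (hθ : θ < 1)
    (hcor : ∀ n : ℕ, |∫ x, a x * a (F^[n + 1] x) ∂m| ≤ B * θ ^ n) (k : ℕ) :
    ∫ x, (∑ j ∈ Finset.range k, v (F^[j] x)) ^ 2 ∂m
      ≤ k * (4 * (∫ x, v x ^ 2 ∂m) + 6 * C ^ 2 + 4 * B / (1 - θ)) := by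
  have hFm : ∀ j : ℕ, Measurable (F^[j]) := fun j => hF.measurable.iterate j
  set M : Ω → ℝ := fun x => v x - a (F x) with hM
  have hMm : Measurable M := hv.sub (ha.comp hF.measurable)
  have hMb : ∀ x, |M x| ≤ N + C := fun x => (abs_sub _ _).trans (add_le_add (hN x) (hC _))
  have hMt := h.martingale hF hv ha hN hC
  have haFm : Measurable fun x => a (F x) := ha.comp hF.measurable
  have ia2 : Integrable (fun x => a x ^ 2) m := integrable_of_bdd (ha.pow_const 2) (C := C ^ 2)
    fun x => by rw [Real.norm_of_nonneg (sq_nonneg _), ← sq_abs]; gcongr; exact hC x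
  have iv2 : Integrable (fun x => v x ^ 2) m := integrable_of_bdd (hv.pow_const 2) (C := N ^ 2)
    fun x => by rw [Real.norm_of_nonneg (sq_nonneg _), ← sq_abs]; gcongr; exact hN x
  have iaF2 : Integrable (fun x => a (F x) ^ 2) m := hF.integrable_comp_of_integrable ia2
  have ea : ∫ x, a x ^ 2 ∂m ≤ C ^ 2 := by
    have := integral_mono ia2 (integrable_const (C ^ 2)) fun x => by
      simp only; rw [← sq_abs]; gcongr; exact hC x
    simpa using this
  have eaF : ∫ x, a (F x) ^ 2 ∂m = ∫ x, a x ^ 2 ∂m :=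
    hF.integral_comp_of_measurable (g := fun x => a x ^ 2) (ha.pow_const 2)
  have h1 := integral_sum_sq_le hF hMm hMb (B := 0) le_rfl hθ0 hθ (fun n => by
    have := hMt.real (w := fun x => M (F^[n] x)) (hMm.comp (hFm n)) (C := N + C) fun x => hMb _
    simp only [← Function.iterate_succ_apply] at this
    rw [this]; simp) k
  have h2 := integral_sum_sq_le hF haFm (fun x => hC _) hB hθ0 hθ (fun n => by
    have := hF.integral_comp_of_measurable (g := fun x => a x * a (F^[n + 1] x))
      (ha.mul (ha.comp (hFm _)))
    have e : (fun x => a (F x) * a (F (F^[n + 1] x))) =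
        fun x => (fun x => a x * a (F^[n + 1] x)) (F x) := by
      funext x; simp only [← Function.iterate_succ_apply, ← Function.iterate_succ_apply']
    rw [e, this]
    exact hcor n) k
  have hMsq : ∫ x, M x ^ 2 ∂m ≤ 2 * (∫ x, v x ^ 2 ∂m) + 2 * C ^ 2 := by
    have := integral_mono (f := fun x => M x ^ 2) (μ := m)
      (g := fun x => 2 * v x ^ 2 + 2 * a (F x) ^ 2)
      (integrable_of_bdd (hMm.pow_const 2) (C := (N + C) ^ 2) fun x => by
        rw [Real.norm_of_nonneg (sq_nonneg _), ← sq_abs]; gcongr; exact hMb x)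
      ((iv2.const_mul 2).add (iaF2.const_mul 2)) fun x => by
        simp only [hM]; nlinarith [sq_nonneg (v x + a (F x))]
    rw [integral_add (iv2.const_mul 2) (iaF2.const_mul 2), integral_const_mul, integral_const_mul,
      eaF] at this
    linarith
  have hint : ∀ (g : Ω → ℝ) (N : ℝ), Measurable g → (∀ x, |g x| ≤ N) →
      Integrable (fun x => (∑ j ∈ Finset.range k, g (F^[j] x)) ^ 2) m := fun g N hg hgN => by
    refine integrable_of_bdd ((Finset.measurable_sum _ fun j _ => hg.comp (hFm j)).pow_const 2)
      (C := (k * N) ^ 2) fun x => ?_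
    rw [Real.norm_of_nonneg (sq_nonneg _), ← sq_abs]
    gcongr
    refine (Finset.abs_sum_le_sum_abs _ _).trans ((Finset.sum_le_sum fun j _ => hgN _).trans ?_)
    simp
  have h3 := integral_mono (μ := m) (hint v N hv hN)
    (((hint M _ hMm hMb).const_mul 2).add ((hint (fun x => a (F x)) _ haFm fun x => hC _).const_mul 2))
    fun x => by
      have : ∑ j ∈ Finset.range k, v (F^[j] x) = (∑ j ∈ Finset.range k, M (F^[j] x))
          + ∑ j ∈ Finset.range k, a (F (F^[j] x)) := by
        rw [← Finset.sum_add_distrib]; simp [hM]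
      simp only [Pi.add_apply]
      rw [this]
      nlinarith [sq_nonneg ((∑ j ∈ Finset.range k, M (F^[j] x))
          - ∑ j ∈ Finset.range k, a (F (F^[j] x)))]
  simp only [Pi.add_apply] at h3
  rw [integral_add ((hint M _ hMm hMb).const_mul 2)
    ((hint (fun x => a (F x)) _ haFm fun x => hC _).const_mul 2), integral_const_mul,
    integral_const_mul] at h3
  refine h3.trans ((add_le_add (mul_le_mul_of_nonneg_left h1 zero_le_two)
    (mul_le_mul_of_nonneg_left h2 zero_le_two)).trans ?_)
  have hk : (0 : ℝ) ≤ k := Nat.cast_nonneg k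
  have e : 4 * B / (1 - θ) = 2 * (2 * B / (1 - θ)) := by ring
  have : (2 * ((∫ x, M x ^ 2 ∂m) + 2 * 0 / (1 - θ)) + 2 * ((∫ x, a (F x) ^ 2 ∂m) + 2 * B / (1 - θ)))
      ≤ 4 * (∫ x, v x ^ 2 ∂m) + 6 * C ^ 2 + 4 * B / (1 - θ) := by
    rw [e, eaF, mul_zero, zero_div]; linarith
  calc _ = k * (2 * ((∫ x, M x ^ 2 ∂m) + 2 * 0 / (1 - θ)) +
        2 * ((∫ x, a (F x) ^ 2 ∂m) + 2 * B / (1 - θ))) := by ring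
    _ ≤ _ := mul_le_mul_of_nonneg_left this hk

variable {X W : Type*} [PseudoMetricSpace X] [MeasurableSpace X]
  {m : Measure X} {F : X → X} {Y : Set X} {G : W → X → ℝ} {b : W → X → X} {D t lam : ℝ}

/-- Conditional sums over branches of a function of a branch-constant observable. -/
theorem MarkovSystem.tsum_weight_le [Countable W] [IsProbabilityMeasure m]
    (H : MarkovSystem m F Y G b D t lam) {R : X → ℕ} (hR : Measurable R) {Rw : W → ℕ}
    (hRw : ∀ w, ∀ y ∈ Y, R (b w y) = Rw w) {r : ℕ → ℝ} (hr : ∀ n, 0 ≤ r n)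
    (hi : Integrable (fun x => r (R x)) m) {y : X} (hy : y ∈ Y) :
    Summable (fun w => G w y * r (Rw w)) ∧
      ∑' w, G w y * r (Rw w) ≤ Real.exp D * ∫ x, r (R x) ∂m := by
  have hmr : Measurable fun x => ENNReal.ofReal (r (R x)) :=
    ENNReal.measurable_ofReal.comp (measurable_from_nat.comp hR)
  have h1 : ∫⁻ x, ENNReal.ofReal (r (R x)) ∂m =
      ∑' w, ENNReal.ofReal (r (Rw w)) * ∫⁻ y, ENNReal.ofReal (G w y) ∂m := by
    conv_lhs => rw [H.dual]
    rw [lintegral_sum_measure]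
    refine tsum_congr fun w => ?_
    have hG : Measurable fun y => ENNReal.ofReal (G w y) :=
      ENNReal.measurable_ofReal.comp (H.measurable_weight w)
    rw [lintegral_map hmr (H.measurable_branch w), lintegral_withDensity_eq_lintegral_mul _ hG
      (show Measurable fun z => ENNReal.ofReal (r (R (b w z))) from
        hmr.comp (H.measurable_branch w)), ← lintegral_const_mul _ hG]
    refine lintegral_congr_ae ?_
    filter_upwards [H.ae_mem] with z hz
    simp only [Pi.mul_apply, hRw w z hz, mul_comm]
  have h2 : ∀ w, ENNReal.ofReal (Real.exp (-D) * (G w y * r (Rw w))) ≤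
      ENNReal.ofReal (r (Rw w)) * ∫⁻ y, ENNReal.ofReal (G w y) ∂m := by
    intro w
    rw [← mul_assoc, ENNReal.ofReal_mul (by have := H.weight_nonneg w y; positivity), mul_comm]
    gcongr
    calc ENNReal.ofReal (Real.exp (-D) * G w y) = ∫⁻ _, ENNReal.ofReal (Real.exp (-D) * G w y) ∂m := by
          simp
      _ ≤ _ := by
        refine lintegral_mono_ae ?_
        filter_upwards [H.ae_mem] with z hz
        refine ENNReal.ofReal_le_ofReal ?_
        have h3 := H.distortion w y hy z hz
        have h4 : Real.exp (D * dist y z ^ t) ≤ Real.exp D := by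
          refine Real.exp_le_exp.2 (mul_le_of_le_one_right H.D_nonneg ?_)
          exact Real.rpow_le_one dist_nonneg (H.dist_le y hy z hz) H.t_pos.le
        have h5 := H.weight_nonneg w z
        rw [Real.exp_neg, inv_mul_le_iff₀ (Real.exp_pos _)]
        exact h3.trans (by gcongr)
  have h3 := ENNReal.tsum_le_tsum h2
  rw [← h1, ← ofReal_integral_eq_lintegral_ofReal hi (ae_of_all _ fun x => hr _)] at h3
  have hnn : ∀ w, 0 ≤ Real.exp (-D) * (G w y * r (Rw w)) := fun w => by
    have := H.weight_nonneg w y; have := hr (Rw w); positivity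
  have hs : Summable fun w => Real.exp (-D) * (G w y * r (Rw w)) := by
    have := ENNReal.summable_toReal (h3.trans_lt ENNReal.ofReal_lt_top).ne
    simpa only [ENNReal.toReal_ofReal (hnn _)] using this
  have hs' : Summable fun w => G w y * r (Rw w) :=
    (summable_mul_left_iff (Real.exp_pos _).ne').1 hs
  refine ⟨hs', ?_⟩
  rw [← ENNReal.ofReal_tsum_of_nonneg hnn hs, tsum_mul_left,
    ENNReal.ofReal_le_ofReal_iff (integral_nonneg fun x => hr _), Real.exp_neg,
    inv_mul_le_iff₀ (Real.exp_pos _)] at h3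
  exact h3

end Truncation

section Tails

theorem apply_min_eq_sum (φ : ℕ → ℝ) (r K : ℕ) :
    φ (min r K) = φ 0 + ∑ n ∈ Finset.range K, if n < r then φ (n + 1) - φ n else 0 := by
  induction K with
  | zero => simp
  | succ K ih =>
    rw [Finset.sum_range_succ, ← add_assoc, ← ih]
    split_ifs with h
    · rw [min_eq_right (by omega), min_eq_right (by omega)]; ring
    · rw [min_eq_left (by omega), min_eq_left (by omega)]; ring

theorem sum_range_inv_le_one_add_log (K : ℕ) :
    ∑ n ∈ Finset.range K, (1 : ℝ) / (n + 1) ≤ 1 + Real.log K := by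
  have := harmonic_le_one_add_log K
  rw [harmonic] at this
  push_cast at this
  simpa [one_div] using this

variable {X : Type*} [MeasurableSpace X] {m : Measure X} [IsProbabilityMeasure m] {R : X → ℕ}

theorem integral_apply_min (hR : Measurable R) (φ : ℕ → ℝ) (K : ℕ) :
    ∫ x, φ (min (R x) K) ∂m =
      φ 0 + ∑ n ∈ Finset.range K, (φ (n + 1) - φ n) * m.real {x | n < R x} := by
  have hset : ∀ n, MeasurableSet {x | n < R x} := fun n => measurableSet_lt measurable_const hR
  have e : ∀ x, φ (min (R x) K) = φ 0 + ∑ n ∈ Finset.range K,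
      {x | n < R x}.indicator (fun _ => φ (n + 1) - φ n) x := by
    intro x
    rw [apply_min_eq_sum φ]
    congr 1
    refine Finset.sum_congr rfl fun n _ => ?_
    by_cases h : n < R x
    · rw [if_pos h, indicator_of_mem (show x ∈ {x | n < R x} from h)]
    · rw [if_neg h, indicator_of_notMem (show x ∉ {x | n < R x} from h)]
  have hi : ∀ n, Integrable ({x | n < R x}.indicator (fun _ => φ (n + 1) - φ n)) m := fun n =>
    (integrable_const _).indicator (hset n)
  simp only [e]
  rw [integral_add (integrable_const _) (integrable_finsetSum _ fun n _ => hi n),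
    integral_finsetSum _ fun n _ => hi n]
  congr 1
  · simp
  · refine Finset.sum_congr rfl fun n _ => ?_
    rw [integral_indicator_const _ (hset n), smul_eq_mul, mul_comm]

theorem integral_min_sq_le (hR : Measurable R) {Cr : ℝ} (hCr : 0 ≤ Cr)
    (htail : ∀ n : ℕ, m.real {x | n < R x} ≤ Cr / (n + 1) ^ 2) (K : ℕ) :
    ∫ x, ((min (R x) K : ℕ) : ℝ) ^ 2 ∂m ≤ 2 * Cr * (1 + Real.log K) := by
  have h := integral_apply_min (m := m) hR (fun n => (n : ℝ) ^ 2) K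
  rw [h, Nat.cast_zero, zero_pow two_ne_zero, zero_add]
  calc ∑ n ∈ Finset.range K, (((n + 1 : ℕ) : ℝ) ^ 2 - (n : ℝ) ^ 2) * m.real {x | n < R x}
      ≤ ∑ n ∈ Finset.range K, 2 * Cr * (1 / (n + 1)) := by
        refine Finset.sum_le_sum fun n _ => ?_
        have h0 : (0 : ℝ) ≤ n := Nat.cast_nonneg n
        calc _ ≤ (2 * ((n : ℝ) + 1)) * (Cr / (n + 1) ^ 2) := by
              refine mul_le_mul ?_ (htail n) measureReal_nonneg (by positivity)
              push_cast; nlinarith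
          _ = _ := by field_simp
    _ = 2 * Cr * ∑ n ∈ Finset.range K, (1 : ℝ) / (n + 1) := by rw [Finset.mul_sum]
    _ ≤ _ := by
      gcongr
      exact sum_range_inv_le_one_add_log K

theorem sum_Ico_inv_sq_le {K J : ℕ} (hK : 1 ≤ K) (hJ : K ≤ J) :
    ∑ n ∈ Finset.Ico K J, (1 : ℝ) / ((n : ℝ) + 1) ^ 2 ≤ 1 / (K : ℝ) - 1 / (J : ℝ) := by
  induction J, hJ using Nat.le_induction with
  | base => simp
  | succ J hJ ih =>
    rw [Finset.sum_Ico_succ_top hJ]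
    have h0 : (0 : ℝ) < J := by exact_mod_cast hK.trans hJ
    have : (1 : ℝ) / (J + 1) ^ 2 ≤ 1 / J - 1 / ((J + 1 : ℕ) : ℝ) := by
      push_cast
      rw [div_sub_div _ _ h0.ne' (by positivity), div_le_div_iff₀ (by positivity) (by positivity)]
      nlinarith
    linarith

theorem integral_tail_le (hR : Measurable R) (hRi : Integrable (fun x => (R x : ℝ)) m) {Cr : ℝ}
    (hCr : 0 ≤ Cr) (htail : ∀ n : ℕ, m.real {x | n < R x} ≤ Cr / (n + 1) ^ 2) {K : ℕ}
    (hK : 1 ≤ K) : ∫ x in {x | K < R x}, (R x : ℝ) ∂m ≤ 2 * Cr / K := by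
  have hset : ∀ n, MeasurableSet {x | n < R x} := fun n => measurableSet_lt measurable_const hR
  have hK0 : (0 : ℝ) < K := by exact_mod_cast hK
  set φ : ℕ → ℝ := fun n => if K < n then (n : ℝ) else 0 with hφ
  have hφs : ∀ n, φ (n + 1) - φ n = if n < K then 0 else if n = K then (K : ℝ) + 1 else 1 := by
    intro n
    simp only [hφ]
    split_ifs <;> first | omega | (push_cast; simp_all)
  have hJ : ∀ J, K < J → ∫ x, φ (min (R x) J) ∂m ≤ 2 * Cr / K := by
    intro J hJ
    rw [integral_apply_min hR, Finset.range_eq_Ico, ← Finset.sum_Ico_consecutive _ (Nat.zero_le K)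
      hJ.le, Finset.sum_eq_zero fun n hn => by rw [hφs, if_pos (Finset.mem_Ico.1 hn).2, zero_mul],
      show φ 0 = 0 by simp [hφ], zero_add, zero_add]
    have h1 : ∀ n ∈ Finset.Ico K J, (φ (n + 1) - φ n) * m.real {x | n < R x} ≤
        Cr * (1 / ((n : ℝ) + 1) ^ 2) + if n = K then Cr / K else 0 := by
      intro n hn
      have h2 := htail n
      rw [hφs, if_neg (by have := (Finset.mem_Ico.1 hn).1; omega)]
      split_ifs with h
      · subst h
        have h3 : (n : ℝ) * m.real {x | n < R x} ≤ Cr / n := by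
          calc _ ≤ (n : ℝ) * (Cr / (n + 1) ^ 2) := by gcongr
            _ ≤ _ := by
              rw [mul_div_assoc', div_le_div_iff₀ (by positivity) hK0]
              nlinarith
        rw [add_mul, one_mul, mul_one_div]
        linarith
      · rw [one_mul, add_zero, mul_one_div]; exact h2
    refine (Finset.sum_le_sum h1).trans ?_
    rw [Finset.sum_add_distrib, ← Finset.mul_sum, Finset.sum_ite_eq' _ _ fun _ => Cr / (K : ℝ),
      if_pos (Finset.mem_Ico.2 ⟨le_rfl, hJ⟩)]
    have h3 := sum_Ico_inv_sq_le hK hJ.le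
    have h4 : (0 : ℝ) ≤ 1 / J := by positivity
    have h5 : Cr * (∑ n ∈ Finset.Ico K J, (1 : ℝ) / (n + 1) ^ 2) ≤ Cr * (1 / K) := by
      gcongr; linarith
    calc _ ≤ Cr * (1 / K) + Cr / K := by linarith
      _ = _ := by ring
  have hlim : Tendsto (fun J => ∫ x, φ (min (R x) J) ∂m) atTop (𝓝 (∫ x, φ (R x) ∂m)) := by
    refine tendsto_integral_of_dominated_convergence (fun x => (R x : ℝ))
      (fun J => ((measurable_from_nat (f := fun r => φ (min r J))).comp hR).aestronglyMeasurable)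
      hRi (fun J => ae_of_all _ fun x => ?_) (ae_of_all _ fun x => ?_)
    · simp only [hφ]
      split_ifs
      · rw [Real.norm_of_nonneg (by positivity)]; exact_mod_cast min_le_left _ _
      · simp
    · refine tendsto_const_nhds.congr' ?_
      filter_upwards [eventually_ge_atTop (R x)] with J hJ
      rw [min_eq_left hJ]
  have he : ∫ x, φ (R x) ∂m = ∫ x in {x | K < R x}, (R x : ℝ) ∂m := by
    rw [← integral_indicator (hset K)]
    refine integral_congr_ae (ae_of_all _ fun x => ?_)
    by_cases h : K < R x
    · rw [indicator_of_mem (show x ∈ {x | K < R x} from h)]; simp [hφ, h]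
    · rw [indicator_of_notMem (show x ∉ {x | K < R x} from h)]; simp [hφ, h]
  rw [← he]
  refine le_of_tendsto hlim ?_
  filter_upwards [eventually_gt_atTop K] with J h using hJ J h

end Tails

section TruncatedObservable

/-- The observable `u` truncated where `R > K`. -/
def truncObs {X : Type*} (R : X → ℕ) (u : X → ℝ) (K : ℕ) (x : X) : ℝ :=
  if R x ≤ K then u x else 0

/-- The centered truncated observable. -/
def truncCenter {X : Type*} [MeasurableSpace X] (m : Measure X) (R : X → ℕ) (u : X → ℝ) (K : ℕ)
    (x : X) : ℝ := truncObs R u K x - ∫ z, truncObs R u K z ∂m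

variable {X W : Type*} [PseudoMetricSpace X] [MeasurableSpace X]
  {m : Measure X} {F : X → X} {Y : Set X} {G : W → X → ℝ} {b : W → X → X} {D t lam : ℝ}
  {R : X → ℕ} {u : X → ℝ}

omit [PseudoMetricSpace X] in
theorem measurable_truncObs (hR : Measurable R) (hu : Measurable u) (K : ℕ) :
    Measurable (truncObs R u K) :=
  Measurable.ite (measurableSet_le hR measurable_const) hu measurable_const

omit [PseudoMetricSpace X] [MeasurableSpace X] in
theorem abs_truncObs_le {M : ℝ} (hM : 0 ≤ M) (huM : ∀ x, |u x| ≤ M * R x) (K : ℕ) (x : X) :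
    |truncObs R u K x| ≤ M * (min (R x) K : ℕ) := by
  unfold truncObs
  split_ifs with h
  · rw [min_eq_left h]; exact huM x
  · rw [abs_zero]; positivity

omit [PseudoMetricSpace X] in
theorem measurable_truncCenter (hR : Measurable R) (hu : Measurable u) (K : ℕ) :
    Measurable (truncCenter m R u K) := (measurable_truncObs hR hu K).sub_const _

omit [PseudoMetricSpace X] in
theorem integrable_truncObs [IsFiniteMeasure m] (hR : Measurable R) (hu : Measurable u) {M : ℝ}
    (hM : 0 ≤ M) (huM : ∀ x, |u x| ≤ M * R x) (K : ℕ) : Integrable (truncObs R u K) m :=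
  integrable_of_bdd (measurable_truncObs hR hu K) (C := M * K) fun x =>
    (abs_truncObs_le hM huM K x).trans (by gcongr; exact min_le_right _ _)

omit [PseudoMetricSpace X] in
theorem integral_truncCenter [IsProbabilityMeasure m] (hR : Measurable R) (hu : Measurable u)
    {M : ℝ} (hM : 0 ≤ M) (huM : ∀ x, |u x| ≤ M * R x) (K : ℕ) :
    ∫ x, truncCenter m R u K x ∂m = 0 := by
  unfold truncCenter
  rw [integral_sub (integrable_truncObs hR hu hM huM K) (integrable_const _)]
  simp

theorem exists_truncCenter_bounds [Countable W] [IsProbabilityMeasure m]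
    (H : MarkovSystem m F Y G b D t lam) (hR : Measurable R) (hR1 : ∀ x, 1 ≤ R x)
    {Rw : W → ℕ} (hRw : ∀ w, ∀ y ∈ Y, R (b w y) = Rw w)
    (hRi : Integrable (fun x => (R x : ℝ)) m) {Cr : ℝ} (hCr : 0 ≤ Cr)
    (htail : ∀ n : ℕ, m.real {x | n < R x} ≤ Cr / (n + 1) ^ 2)
    (hu : Measurable u) {M : ℝ} (hM : 0 ≤ M) (huM : ∀ x, |u x| ≤ M * R x)
    (huL : ∀ w, ∀ x ∈ Y, ∀ y ∈ Y, |u (b w x) - u (b w y)| ≤ M * Rw w * dist x y ^ t) :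
    ∃ C θ : ℝ, 0 ≤ C ∧ 0 ≤ θ ∧ θ < 1 ∧ ∀ K : ℕ, 1 ≤ K →
      (∀ x, |truncCenter m R u K x| ≤ C * K) ∧
      (∀ k : ℕ, ∫ x, (∑ j ∈ Finset.range k, truncCenter m R u K (F^[j] x)) ^ 2 ∂m
        ≤ C * k * (1 + Real.log K)) ∧
      ∃ A₁ A₂ : X → ℝ, Measurable A₁ ∧ Measurable A₂ ∧ (∀ x, |A₁ x| ≤ C) ∧
        (∀ x, |A₂ x| ≤ C * (1 + Real.log K)) ∧
        IsTransfer m F (truncCenter m R u K) A₁ ∧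
        IsTransfer m F (fun x => truncCenter m R u K x ^ 2) A₂ ∧
        (∀ j : ℕ, |∫ x, A₁ x * A₁ (F^[j + 1] x) ∂m| ≤ C * θ ^ j) ∧
        (∀ j : ℕ, |∫ x, (A₂ x - ∫ z, A₂ z ∂m) * (A₂ (F^[j + 1] x) - ∫ z, A₂ z ∂m) ∂m|
          ≤ C * (1 + Real.log K) ^ 2 * θ ^ j) := by
  obtain ⟨C₀, θ, hC₀, hθ0, hθ1, hdec⟩ := H.exists_decay
  have hF := H.measurePreserving
  set E := ∫ x, (R x : ℝ) ∂m with hE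
  have hE0 : 0 ≤ E := integral_nonneg fun x => Nat.cast_nonneg _
  set M1 := M + M * E with hM1
  have hM10 : 0 ≤ M1 := by positivity
  set Ca := (M1 + M) * (Real.exp D * E) with hCa
  have hCa0 : 0 ≤ Ca := by positivity
  set Cb := 2 * M1 * (M1 + M) * (Real.exp D * (2 * Cr)) with hCb
  have hCb0 : 0 ≤ Cb := by positivity
  have hθ' : 0 ≤ 4 * (C₀ * Ca ^ 2) / (1 - θ) := div_nonneg (by positivity) (by linarith)
  have hp1 : 0 ≤ C₀ * Ca ^ 2 := by positivity
  have hp2 : 0 ≤ C₀ * Cb ^ 2 := by positivity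
  have hp3 : 0 ≤ 6 * Ca ^ 2 := by positivity
  set C := M1 + Ca + C₀ * Ca ^ 2 + C₀ * Cb ^ 2 + (4 * Cb + 6 * Ca ^ 2 + 4 * (C₀ * Ca ^ 2) / (1 - θ))
    with hC
  refine ⟨C, θ, by positivity, hθ0, hθ1, fun K hK => ?_⟩
  have hlog : 0 ≤ Real.log K := Real.log_natCast_nonneg K
  set Z := truncCenter m R u K with hZ
  have hZm : Measurable Z := measurable_truncCenter hR hu K
  have he : |∫ z, truncObs R u K z ∂m| ≤ M * E := by
    refine (abs_integral_le_integral_abs).trans ?_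
    rw [hE, ← integral_const_mul]
    refine integral_mono (integrable_truncObs hR hu hM huM K).abs (hRi.const_mul M) fun x => ?_
    exact (abs_truncObs_le hM huM K x).trans (by gcongr; exact min_le_left _ _)
  have hmin1 : ∀ x, (1 : ℝ) ≤ (min (R x) K : ℕ) := fun x => by exact_mod_cast le_min (hR1 x) hK
  have hZb : ∀ x, |Z x| ≤ M1 * (min (R x) K : ℕ) := fun x => by
    refine (abs_sub _ _).trans ((add_le_add (abs_truncObs_le hM huM K x) he).trans ?_)
    rw [hM1, add_mul]
    exact add_le_add le_rfl (le_mul_of_one_le_right (by positivity) (hmin1 x))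
  have hZL : ∀ w, ∀ x ∈ Y, ∀ y ∈ Y,
      |Z (b w x) - Z (b w y)| ≤ M * (min (Rw w) K : ℕ) * dist x y ^ t := fun w x hx y hy => by
    have hd : 0 ≤ dist x y ^ t := Real.rpow_nonneg dist_nonneg _
    simp only [hZ, truncCenter, sub_sub_sub_cancel_right, truncObs, hRw w x hx, hRw w y hy]
    split_ifs with h
    · rw [min_eq_left h]; exact huL w x hx y hy
    · rw [sub_zero, abs_zero]; positivity
  have hZK : ∀ x, |Z x| ≤ M1 * K := fun x => (hZb x).trans (by gcongr; exact min_le_right _ _)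
  have hIZ : ∫ x, Z x ∂m = 0 := integral_truncCenter hR hu hM huM K
  have hs1 := fun y (hy : y ∈ Y) => H.tsum_weight_le hR hRw (r := fun n => (n : ℝ))
    (fun n => Nat.cast_nonneg n) hRi hy
  have hmi : Integrable (fun x => ((min (R x) K : ℕ) : ℝ) ^ 2) m :=
    integrable_of_bdd ((measurable_from_nat (f := fun r => ((min r K : ℕ) : ℝ) ^ 2)).comp hR)
      (C := (K : ℝ) ^ 2) fun x => by
        rw [Real.norm_of_nonneg (by positivity)]; gcongr; exact min_le_right _ _
  have hs2 := fun y (hy : y ∈ Y) => H.tsum_weight_le hR hRw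
    (r := fun n => ((min n K : ℕ) : ℝ) ^ 2) (fun n => by positivity) hmi hy
  obtain ⟨A₁, hA₁m, hA₁b, hA₁t, hA₁c, -⟩ := hdec Z (fun w => (M1 + M) * Rw w) (M1 * K) Ca hZm hZK
    (fun w y hy => (hZb _).trans (by
      rw [hRw w y hy]
      exact mul_le_mul (by linarith) (by exact_mod_cast min_le_left _ _) (by positivity)
        (by positivity)))
    (fun w x hx y hy => (hZL w x hx y hy).trans (by
      refine mul_le_mul_of_nonneg_right ?_ (Real.rpow_nonneg dist_nonneg _)
      exact mul_le_mul (by linarith) (by exact_mod_cast min_le_left _ _) (by positivity)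
        (by positivity)))
    (fun y hy => by
      have h := hs1 y hy
      have e : (fun w => G w y * ((M1 + M) * Rw w)) = fun w => (M1 + M) * (G w y * Rw w) := by
        funext w; ring
      rw [e, tsum_mul_left]
      exact ⟨h.1.mul_left _, by rw [hCa]; gcongr; exact h.2⟩)
  have hlip2 : ∀ w, ∀ x ∈ Y, ∀ y ∈ Y, |Z (b w x) ^ 2 - Z (b w y) ^ 2| ≤
      2 * M1 * (M1 + M) * ((min (Rw w) K : ℕ) : ℝ) ^ 2 * dist x y ^ t := fun w x hx y hy => by
    have hd : 0 ≤ dist x y ^ t := Real.rpow_nonneg dist_nonneg _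
    rw [sq_sub_sq, abs_mul]
    have h1 : |Z (b w x) + Z (b w y)| ≤ 2 * M1 * (min (Rw w) K : ℕ) := by
      have h2 := hZb (b w x)
      have h3 := hZb (b w y)
      rw [hRw w x hx] at h2
      rw [hRw w y hy] at h3
      exact (abs_add_le _ _).trans (by linarith)
    calc _ ≤ (2 * M1 * (min (Rw w) K : ℕ)) * (M * (min (Rw w) K : ℕ) * dist x y ^ t) :=
          mul_le_mul h1 (hZL w x hx y hy) (abs_nonneg _) (by positivity)
      _ = 2 * M1 * M * ((min (Rw w) K : ℕ) : ℝ) ^ 2 * dist x y ^ t := by ring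
      _ ≤ _ := by gcongr; linarith
  obtain ⟨A₂, hA₂m, hA₂b, hA₂t, hA₂c, -⟩ := hdec (fun x => Z x ^ 2)
    (fun w => 2 * M1 * (M1 + M) * ((min (Rw w) K : ℕ) : ℝ) ^ 2) ((M1 * K) ^ 2)
    (Cb * (1 + Real.log K)) (hZm.pow_const 2)
    (fun x => by rw [abs_pow]; gcongr; exact hZK x)
    (fun w y hy => by
      have h2 := hZb (b w y)
      rw [hRw w y hy] at h2
      rw [abs_pow]
      calc _ ≤ (M1 * (min (Rw w) K : ℕ)) ^ 2 := by gcongr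
        _ = M1 * M1 * ((min (Rw w) K : ℕ) : ℝ) ^ 2 := by ring
        _ ≤ _ := by gcongr <;> linarith) hlip2
    (fun y hy => by
      have h := hs2 y hy
      have e : (fun w => G w y * (2 * M1 * (M1 + M) * ((min (Rw w) K : ℕ) : ℝ) ^ 2)) =
          fun w => 2 * M1 * (M1 + M) * (G w y * ((min (Rw w) K : ℕ) : ℝ) ^ 2) := by
        funext w; ring
      rw [e, tsum_mul_left]
      refine ⟨h.1.mul_left _, ?_⟩
      rw [hCb, mul_assoc _ (Real.exp D * (2 * Cr)), mul_assoc (Real.exp D)]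
      gcongr
      refine h.2.trans ?_
      gcongr
      exact integral_min_sq_le hR hCr htail K)
  have hIA : ∫ x, A₂ x ∂m = ∫ x, Z x ^ 2 ∂m := by
    have := hA₂t.real (w := fun _ => 1) measurable_const (C := 1) (by simp)
    simpa using this.symm
  have hZ2 : ∫ x, Z x ^ 2 ∂m ≤ Cb * (1 + Real.log K) := by
    rw [← hIA]
    have := integral_mono (integrable_of_bdd (m := m) hA₂m hA₂b)
      (integrable_const (Cb * (1 + Real.log K))) fun x => (le_abs_self _).trans (hA₂b x)
    simpa using this
  simp only [hIZ, sub_zero] at hA₁c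
  refine ⟨fun x => (hZK x).trans (by gcongr; linarith), fun k => ?_, A₁, A₂, hA₁m, hA₂m,
    fun x => (hA₁b x).trans (by linarith), fun x => (hA₂b x).trans (by gcongr; linarith), hA₁t, hA₂t,
    fun j => (hA₁c j).trans (by gcongr; linarith), fun j => ?_⟩
  · refine (integral_sum_sq_le_of_isTransfer hF hZm hA₁m hZK hA₁b hA₁t hp1 hθ0 hθ1 hA₁c k).trans ?_
    rw [mul_comm C, mul_assoc]
    gcongr
    calc _ ≤ 4 * (Cb * (1 + Real.log K)) + (6 * Ca ^ 2 + 4 * (C₀ * Ca ^ 2) / (1 - θ)) * 1 := by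
          linarith
      _ ≤ 4 * (Cb * (1 + Real.log K)) +
          (6 * Ca ^ 2 + 4 * (C₀ * Ca ^ 2) / (1 - θ)) * (1 + Real.log K) := by gcongr; linarith
      _ = (4 * Cb + 6 * Ca ^ 2 + 4 * (C₀ * Ca ^ 2) / (1 - θ)) * (1 + Real.log K) := by ring
      _ ≤ _ := by gcongr; linarith
  · have h := hA₂c j
    rw [← hIA] at h
    refine h.trans ?_
    rw [mul_pow, ← mul_assoc]
    gcongr
    linarith

end TruncatedObservable

section ReturnSums

/-- A square majorant of the partial sums of `z` over windows starting at `k` of length at most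
`2 L ^ 2`. -/
def windowBound (z : ℕ → ℝ) (k L : ℕ) : ℝ :=
  2 * ∑ q ∈ Finset.range (2 * L + 1), ((∑ i ∈ Finset.range (q * L), z (k + i)) ^ 2 +
    (∑ i ∈ Finset.range L, |z (k + q * L + i)|) ^ 2)

theorem windowBound_nonneg (z : ℕ → ℝ) (k L : ℕ) : 0 ≤ windowBound z k L := by
  unfold windowBound; positivity

theorem abs_sum_le_sqrt_windowBound (z : ℕ → ℝ) (k : ℕ) {L j : ℕ} (hL : 1 ≤ L)
    (hj : j ≤ 2 * L ^ 2) :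
    |∑ i ∈ Finset.range j, z (k + i)| ≤ √(windowBound z k L) := by
  refine Real.abs_le_sqrt ?_
  set q := j / L
  set r := j % L
  have hjq : j = q * L + r := (Nat.div_add_mod' j L).symm
  have hr : r < L := Nat.mod_lt _ hL
  have hq : q < 2 * L + 1 := by
    rw [Nat.lt_succ_iff]
    exact Nat.div_le_of_le_mul (by nlinarith)
  have hle := Finset.single_le_sum (f := fun q => (∑ i ∈ Finset.range (q * L), z (k + i)) ^ 2 +
    (∑ i ∈ Finset.range L, |z (k + q * L + i)|) ^ 2) (fun q _ => by positivity)
    (Finset.mem_range.2 hq)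
  unfold windowBound
  refine le_trans ?_ (mul_le_mul_of_nonneg_left hle two_pos.le)
  rw [hjq, Finset.sum_range_add]
  have h2 : |∑ x ∈ Finset.range r, z (k + (q * L + x))| ≤
      ∑ i ∈ Finset.range L, |z (k + q * L + i)| := by
    simp only [← add_assoc]
    exact (Finset.abs_sum_le_sum_abs _ _).trans (Finset.sum_le_sum_of_subset_of_nonneg
      (Finset.range_subset_range.2 hr.le) fun _ _ _ => abs_nonneg _)
  refine (add_sq_le).trans ?_
  have := sq_le_sq.2 (h2.trans (le_abs_self _))
  linarith

theorem abs_sub_sum_le_of_window {r : ℕ → ℕ} {φ zr zφ : ℕ → ℝ} {eR eφ a M : ℝ} {n k K L : ℕ}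
    (hL : 1 ≤ L) (hM : 0 ≤ M)
    (hzr : ∀ i < k + 2 * L ^ 2, zr i = r i - eR) (hzφ : ∀ i < k + 2 * L ^ 2, zφ i = φ i - eφ)
    (hr : ∀ i < k + 2 * L ^ 2, r i ≤ K)
    (hQ : |∑ i ∈ Finset.range k, zr i| ≤ (L : ℝ) ^ 2 / 4)
    (hQ' : |∑ i ∈ Finset.range (k + 2 * L ^ 2), zr i| ≤ (L : ℝ) ^ 2 / 4)
    (hk : k * eR + (L : ℝ) ^ 2 / 4 ≤ n)
    (hk' : n + (L : ℝ) ^ 2 / 4 < (k + 2 * L ^ 2 : ℕ) * eR)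
    (ha : ∀ j, ∑ i ∈ Finset.range j, r i ≤ n → n < ∑ i ∈ Finset.range (j + 1), r i →
      |a - ∑ i ∈ Finset.range j, φ i| ≤ M * r j) :
    |a - ∑ i ∈ Finset.range k, zφ i| ≤
      M * K + (k + 2 * L ^ 2 : ℕ) * |eφ| + √(windowBound zφ k L) := by
  have hsum : ∀ j ≤ k + 2 * L ^ 2, (∑ i ∈ Finset.range j, zr i) =
      ((∑ i ∈ Finset.range j, r i : ℕ) : ℝ) - j * eR := fun j hj => by
    rw [Finset.sum_congr rfl fun i hi => hzr i ((Finset.mem_range.1 hi).trans_le hj)]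
    simp
  have hsumφ : ∀ j ≤ k + 2 * L ^ 2, (∑ i ∈ Finset.range j, φ i) =
      (∑ i ∈ Finset.range j, zφ i) + j * eφ := fun j hj => by
    rw [Finset.sum_congr rfl fun i hi => hzφ i ((Finset.mem_range.1 hi).trans_le hj)]
    simp
  rw [hsum _ (by omega), abs_le] at hQ
  rw [hsum _ le_rfl, abs_le] at hQ'
  have h1 : ∑ i ∈ Finset.range k, r i ≤ n := by
    have : ((∑ i ∈ Finset.range k, r i : ℕ) : ℝ) ≤ n := by linarith
    exact_mod_cast this
  have h2 : n < ∑ i ∈ Finset.range (k + 2 * L ^ 2), r i := by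
    have : (n : ℝ) < ((∑ i ∈ Finset.range (k + 2 * L ^ 2), r i : ℕ) : ℝ) := by linarith
    exact_mod_cast this
  obtain ⟨j, hjJ, hj1, hj2⟩ : ∃ j < 2 * L ^ 2, ∑ i ∈ Finset.range (k + j), r i ≤ n ∧
      n < ∑ i ∈ Finset.range (k + j + 1), r i := by
    have hex : ∃ j, n < ∑ i ∈ Finset.range (k + j), r i := ⟨_, h2⟩
    have hs := Nat.find_spec hex
    have h0 : Nat.find hex ≠ 0 := fun h => by
      rw [h] at hs; exact absurd h1 (not_le.2 hs)
    obtain ⟨j, hj⟩ := Nat.exists_eq_succ_of_ne_zero h0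
    rw [Nat.succ_eq_add_one] at hj
    refine ⟨j, ?_, ?_, ?_⟩
    · have := Nat.find_min' hex h2; omega
    · exact not_lt.1 (Nat.find_min hex (by omega))
    · rw [hj] at hs; exact hs
  have h3 := ha _ hj1 hj2
  rw [hsumφ _ (by omega), Finset.sum_range_add] at h3
  have h4 := abs_sum_le_sqrt_windowBound zφ k hL hjJ.le
  have h5 : M * r (k + j) ≤ M * K := by
    have := hr (k + j) (by omega)
    gcongr
  have h6 : |((k + j : ℕ) : ℝ) * eφ| ≤ (k + 2 * L ^ 2 : ℕ) * |eφ| := by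
    rw [abs_mul, abs_of_nonneg (by positivity)]
    gcongr
  rw [abs_le] at h3 h4 h6 ⊢
  constructor <;> linarith [h3.1, h3.2, h4.1, h4.2, h6.1, h6.2]

variable {X : Type*} {S : X → X} {Y : Set X}

theorem iterate_sum_returnTime (p : X) (j : ℕ) :
    S^[∑ i ∈ Finset.range j, returnTime S Y ((firstReturn S Y)^[i] p)] p =
      (firstReturn S Y)^[j] p := by
  induction j with
  | zero => rfl
  | succ j ih =>
    rw [Finset.sum_range_succ, add_comm, Function.iterate_add_apply, ih,
      Function.iterate_succ_apply']
    rfl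

theorem sum_excursionSum (f : X → ℝ) (p : X) (j : ℕ) :
    ∑ i ∈ Finset.range j, excursionSum S Y f ((firstReturn S Y)^[i] p) =
      ∑ l ∈ Finset.range (∑ i ∈ Finset.range j, returnTime S Y ((firstReturn S Y)^[i] p)),
        f (S^[l + 1] p) := by
  induction j with
  | zero => rfl
  | succ j ih =>
    rw [Finset.sum_range_succ, ih, Finset.sum_range_succ, Finset.sum_range_add]
    congr 1
    refine Finset.sum_congr rfl fun l _ => ?_
    rw [← iterate_sum_returnTime, ← Function.iterate_add_apply]
    congr 2
    ring

theorem abs_sum_iterate_sub_sum_excursionSum_le {f : X → ℝ} {M : ℝ} (hf : ∀ x, |f x| ≤ M) (p : X)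
    {n j : ℕ} (h1 : ∑ i ∈ Finset.range j, returnTime S Y ((firstReturn S Y)^[i] p) ≤ n)
    (h2 : n < ∑ i ∈ Finset.range (j + 1), returnTime S Y ((firstReturn S Y)^[i] p)) :
    |∑ l ∈ Finset.range n, f (S^[l + 1] p) -
      ∑ i ∈ Finset.range j, excursionSum S Y f ((firstReturn S Y)^[i] p)| ≤
      M * returnTime S Y ((firstReturn S Y)^[j] p) := by
  rw [sum_excursionSum]
  set τ := ∑ i ∈ Finset.range j, returnTime S Y ((firstReturn S Y)^[i] p)
  rw [Finset.sum_range_succ] at h2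
  obtain ⟨e, rfl⟩ := Nat.exists_eq_add_of_le h1
  rw [Finset.sum_range_add, add_sub_cancel_left]
  have hM : 0 ≤ M := (abs_nonneg _).trans (hf p)
  refine (Finset.abs_sum_le_sum_abs _ _).trans ((Finset.sum_le_sum fun l _ => hf _).trans ?_)
  rw [Finset.sum_const, Finset.card_range, nsmul_eq_mul, mul_comm]
  gcongr
  omega

theorem abs_sum_iterate_shift_le {f : X → ℝ} {M : ℝ} (hf : ∀ x, |f x| ≤ M) (F : X → X) (p : X)
    (n l : ℕ) : |∑ j ∈ Finset.range n, f (F^[j + l] p) - ∑ j ∈ Finset.range n, f (F^[j] p)| ≤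
      2 * l * M := by
  have h1 := Finset.sum_range_add (fun j => f (F^[j] p)) n l
  have h2 := Finset.sum_range_add (fun j => f (F^[j] p)) l n
  rw [add_comm l n] at h2
  have h3 : ∑ j ∈ Finset.range n, f (F^[j + l] p) = ∑ j ∈ Finset.range n, f (F^[l + j] p) :=
    Finset.sum_congr rfl fun j _ => by rw [add_comm]
  have hb : ∀ g : ℕ → X, |∑ j ∈ Finset.range l, f (g j)| ≤ l * M := fun g => by
    refine (Finset.abs_sum_le_sum_abs _ _).trans ((Finset.sum_le_sum fun l _ => hf _).trans ?_)
    simp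
  rw [h3, show ∑ j ∈ Finset.range n, f (F^[l + j] p) - ∑ j ∈ Finset.range n, f (F^[j] p) =
    ∑ j ∈ Finset.range l, f (F^[n + j] p) - ∑ j ∈ Finset.range l, f (F^[j] p) by linarith]
  refine (abs_sub _ _).trans ?_
  linarith [hb fun j => F^[n + j] p, hb fun j => F^[j] p]

end ReturnSums

section BlockApproximation

theorem norm_exp_mul_I_sub_le (x y : ℝ) :
    ‖Complex.exp ((x : ℝ) * Complex.I) - Complex.exp ((y : ℝ) * Complex.I)‖ ≤ |x - y| := by
  have e : Complex.exp ((x : ℝ) * Complex.I) - Complex.exp ((y : ℝ) * Complex.I) =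
      Complex.exp ((y : ℝ) * Complex.I) * (Complex.exp (Complex.I * (x - y : ℝ)) - 1) := by
    rw [mul_sub, mul_one, ← Complex.exp_add]
    congr 2
    push_cast
    ring
  rw [e, norm_mul, Complex.norm_exp_ofReal_mul_I, one_mul]
  exact Real.norm_exp_I_mul_ofReal_sub_one_le

theorem norm_exp_mul_I_sub_le_two (x y : ℝ) :
    ‖Complex.exp ((x : ℝ) * Complex.I) - Complex.exp ((y : ℝ) * Complex.I)‖ ≤ 2 := by
  refine (norm_sub_le _ _).trans ?_
  rw [Complex.norm_exp_ofReal_mul_I, Complex.norm_exp_ofReal_mul_I]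
  norm_num

variable {X : Type*} [MeasurableSpace X] {m : Measure X} [IsProbabilityMeasure m] {F : X → X}

theorem integral_windowBound_le (hF : MeasurePreserving F m m) {Z : X → ℝ} (hZ : Measurable Z)
    {B V : ℝ} (hB : ∀ x, |Z x| ≤ B) (hV0 : 0 ≤ V)
    (hV : ∀ k : ℕ, ∫ x, (∑ j ∈ Finset.range k, Z (F^[j] x)) ^ 2 ∂m ≤ V * k) (k : ℕ) {L : ℕ}
    (hL : 1 ≤ L) :
    Integrable (fun x => windowBound (fun j => Z (F^[j] x)) k L) m ∧
    ∫ x, windowBound (fun j => Z (F^[j] x)) k L ∂m ≤ 18 * V * L ^ 3 := by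
  have hm : ∀ j, Measurable fun x => Z (F^[j] x) := fun j => hZ.comp (hF.measurable.iterate j)
  have hi1 : ∀ e n : ℕ, Integrable (fun x => (∑ i ∈ Finset.range n, Z (F^[e + i] x)) ^ 2) m :=
    fun e n => integrable_of_bdd ((Finset.measurable_sum _ fun j _ => hm _).pow_const 2)
      (C := (n * B) ^ 2) fun x => by
      rw [Real.norm_eq_abs, abs_pow]
      gcongr
      refine (Finset.abs_sum_le_sum_abs _ _).trans ((Finset.sum_le_sum fun l _ => hB _).trans ?_)
      simp
  have hi2 : ∀ e n : ℕ, Integrable (fun x => (∑ i ∈ Finset.range n, |Z (F^[e + i] x)|) ^ 2) m :=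
    fun e n => integrable_of_bdd ((Finset.measurable_sum _ fun j _ => (hm _).abs).pow_const 2)
      (C := (n * B) ^ 2) fun x => by
      rw [Real.norm_eq_abs, abs_pow, abs_of_nonneg (Finset.sum_nonneg fun _ _ => abs_nonneg _)]
      gcongr
      refine (Finset.sum_le_sum fun l _ => hB _).trans ?_
      simp
  have hb1 : ∀ e n : ℕ, ∫ x, (∑ i ∈ Finset.range n, Z (F^[e + i] x)) ^ 2 ∂m ≤ V * n :=
    fun e n => by
      have := (hF.iterate e).integral_comp_of_measurable
        (g := fun x => (∑ i ∈ Finset.range n, Z (F^[i] x)) ^ 2)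
        ((Finset.measurable_sum _ fun j _ => hm _).pow_const 2)
      simp only [← Function.iterate_add_apply] at this
      simp only [add_comm e]
      rw [this]
      exact hV n
  have hb2 : ∀ e n : ℕ, ∫ x, (∑ i ∈ Finset.range n, |Z (F^[e + i] x)|) ^ 2 ∂m ≤ V * n ^ 2 :=
    fun e n => by
      have hsq : ∀ i, Integrable (fun x => Z (F^[e + i] x) ^ 2) m := fun i => by
        simpa using hi1 (e + i) 1
      calc _ ≤ ∫ x, n * ∑ i ∈ Finset.range n, Z (F^[e + i] x) ^ 2 ∂m := by
            refine integral_mono (hi2 e n) ((integrable_finsetSum _ fun i _ => hsq i).const_mul _)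
              fun x => ?_
            have := sq_sum_le_card_mul_sum_sq (s := Finset.range n)
              (f := fun i => |Z (F^[e + i] x)|)
            simpa using this
        _ = n * ∑ i ∈ Finset.range n, ∫ x, Z (F^[e + i] x) ^ 2 ∂m := by
            rw [integral_const_mul, integral_finsetSum _ fun i _ => hsq i]
        _ ≤ n * ∑ i ∈ Finset.range n, V := by
            gcongr with i
            simpa using hb1 (e + i) 1
        _ = _ := by simp; ring
  unfold windowBound
  refine ⟨(integrable_finsetSum _ fun q _ => (hi1 _ _).add ?_).const_mul 2, ?_⟩
  · simpa only [add_assoc] using hi2 (k + q * L) L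
  dsimp only
  rw [integral_const_mul, integral_finsetSum _ fun q _ => (hi1 _ _).fun_add (hi2 _ _)]
  have hL' : (1 : ℝ) ≤ L := by exact_mod_cast hL
  calc _ ≤ 2 * ∑ q ∈ Finset.range (2 * L + 1), 3 * V * (L : ℝ) ^ 2 := by
        gcongr with q hq
        rw [integral_add (hi1 _ _) (hi2 _ _)]
        have h1 := hb1 k (q * L)
        have h2 := hb2 (k + q * L) L
        have hq' : (q : ℝ) ≤ 2 * L := by
          exact_mod_cast Nat.lt_succ_iff.1 (Finset.mem_range.1 hq)
        have h3 : V * ((q * L : ℕ) : ℝ) ≤ V * (2 * L * L) := by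
          push_cast; gcongr
        linarith
    _ = 6 * V * L ^ 2 * (2 * L + 1) := by simp; ring
    _ ≤ 6 * V * L ^ 2 * (3 * L) := by gcongr; linarith
    _ = _ := by ring

/-- Comparison of a flow-time sum `a` with the centered truncated sum over a fixed number of
returns. -/
theorem integral_norm_exp_sub_le (hF : MeasurePreserving F m m) {R : X → ℕ} (hR : Measurable R)
    {u a : X → ℝ} (hu : Measurable u) {M : ℝ} (hM : 0 ≤ M)
    (huM : ∀ x, |u x| ≤ M * R x) {n k K L : ℕ} (hL : 1 ≤ L)
    (ha : ∀ x j, ∑ i ∈ Finset.range j, R (F^[i] x) ≤ n →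
      n < ∑ i ∈ Finset.range (j + 1), R (F^[i] x) →
      |a x - ∑ i ∈ Finset.range j, u (F^[i] x)| ≤ M * R (F^[j] x))
    {V e T : ℝ} (hV0 : 0 ≤ V)
    (hV : ∀ k : ℕ, ∫ x, (∑ j ∈ Finset.range k, truncCenter m R u K (F^[j] x)) ^ 2 ∂m ≤ V * k)
    (hVR : ∀ k : ℕ,
      ∫ x, (∑ j ∈ Finset.range k, truncCenter m R (fun x => (R x : ℝ)) K (F^[j] x)) ^ 2 ∂m
        ≤ V * k)
    (he : |∫ x, truncObs R u K x ∂m| ≤ e) (hT : m.real {x | K < R x} ≤ T)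
    (hk : k * (∫ x, truncObs R (fun x => (R x : ℝ)) K x ∂m) + (L : ℝ) ^ 2 / 4 ≤ n)
    (hk' : n + (L : ℝ) ^ 2 / 4 <
      (k + 2 * L ^ 2 : ℕ) * ∫ x, truncObs R (fun x => (R x : ℝ)) K x ∂m) (s : ℝ) {b : ℝ}
    (hb : 0 < b) :
    ∫ x, ‖Complex.exp ((s / b * a x : ℝ) * Complex.I) -
        Complex.exp ((s / b * ∑ j ∈ Finset.range k, truncCenter m R u K (F^[j] x) : ℝ) *
          Complex.I)‖ ∂m ≤
      2 * (k + 2 * L ^ 2 : ℕ) * T + 64 * V * (k + 2 * L ^ 2 : ℕ) / L ^ 4 +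
        |s| / b * (M * K + (k + 2 * L ^ 2 : ℕ) * e + √(18 * V * L ^ 3)) := by
  set N := k + 2 * L ^ 2 with hN
  have hL0 : (0 : ℝ) < L := by exact_mod_cast hL
  set eR := ∫ x, truncObs R (fun x => (R x : ℝ)) K x ∂m with heR
  set Z := truncCenter m R u K with hZ
  set ZR := truncCenter m R (fun x => (R x : ℝ)) K with hZR
  have hRm : Measurable (fun x => (R x : ℝ)) := measurable_from_nat.comp hR
  have hZm : Measurable Z := measurable_truncCenter hR hu K
  have hZRm : Measurable ZR := measurable_truncCenter hR hRm K
  have hFm : ∀ j, Measurable F^[j] := fun j => hF.measurable.iterate j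
  have hbd : ∀ {v : X → ℝ} {M' : ℝ}, 0 ≤ M' → (∀ x, |v x| ≤ M' * R x) →
      ∃ B, ∀ x, |truncCenter m R v K x| ≤ B := fun {v M'} hM' hv =>
    ⟨M' * K + |∫ z, truncObs R v K z ∂m|, fun x => (abs_sub _ _).trans (by
      gcongr
      refine (abs_truncObs_le hM' hv K x).trans ?_
      gcongr
      exact min_le_right _ _)⟩
  obtain ⟨B, hZB⟩ := hbd hM huM
  obtain ⟨B', hZRB⟩ := hbd (v := fun x => (R x : ℝ)) zero_le_one (fun x => by simp)
  have hSq : ∀ j, Integrable (fun x => (∑ i ∈ Finset.range j, ZR (F^[i] x)) ^ 2) m :=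
    fun j => integrable_of_bdd ((Finset.measurable_sum _ fun j _ =>
      hZRm.comp (hFm _)).pow_const 2) (C := (j * B') ^ 2) fun x => by
      rw [Real.norm_eq_abs, abs_pow]
      gcongr
      refine (Finset.abs_sum_le_sum_abs _ _).trans ((Finset.sum_le_sum fun l _ => hZRB _).trans ?_)
      simp
  obtain ⟨hWi, hWb⟩ := integral_windowBound_le hF hZm hZB hV0 hV k hL
  set Wb := fun x => windowBound (fun j => Z (F^[j] x)) k L with hWbdef
  have hWm : Measurable Wb := by
    rw [hWbdef]
    unfold windowBound
    refine (Finset.measurable_sum _ fun q _ => ?_).const_mul 2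
    exact ((Finset.measurable_sum _ fun j _ => hZm.comp (hFm _)).pow_const 2).add
      ((Finset.measurable_sum _ fun j _ => (hZm.comp (hFm _)).abs).pow_const 2)
  have hWs : Integrable (fun x => √(Wb x)) m := by
    refine Integrable.mono' (hWi.add (integrable_const 1)) hWm.sqrt.aestronglyMeasurable
      (ae_of_all _ fun x => ?_)
    rw [Real.norm_of_nonneg (Real.sqrt_nonneg _)]
    have := Real.sq_sqrt (windowBound_nonneg (fun j => Z (F^[j] x)) k L)
    show √(Wb x) ≤ Wb x + 1
    nlinarith [sq_nonneg (√(Wb x) - 1)]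
  have hWs2 : ∫ x, √(Wb x) ∂m ≤ √(18 * V * L ^ 3) := by
    refine le_trans ?_ (Real.sqrt_le_sqrt hWb)
    have h1 : (∫ x, √(Wb x) ∂m) ^ 2 ≤ ∫ x, Wb x ∂m := by
      have h2 : 0 ≤ ∫ x, (√(Wb x) - ∫ z, √(Wb z) ∂m) ^ 2 ∂m := integral_nonneg fun x => sq_nonneg _
      have h3 : ∀ x, (√(Wb x) - ∫ z, √(Wb z) ∂m) ^ 2 =
          Wb x - (2 * ∫ z, √(Wb z) ∂m) * √(Wb x) + (∫ z, √(Wb z) ∂m) ^ 2 := fun x => by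
        rw [sub_sq, Real.sq_sqrt (windowBound_nonneg _ k L)]; ring
      simp only [h3] at h2
      have h4 : Integrable (fun x => Wb x - (2 * ∫ z, √(Wb z) ∂m) * √(Wb x)) m :=
        Integrable.sub hWi (hWs.const_mul _)
      rw [integral_add h4 (integrable_const _), integral_sub hWi (hWs.const_mul _),
        integral_const_mul, integral_const, probReal_univ, one_smul] at h2
      linarith
    exact Real.le_sqrt_of_sq_le h1
  have hind : ∀ j, Integrable (fun x => {x | K < R x}.indicator (fun _ => (1 : ℝ)) (F^[j] x)) m :=
    fun j => integrable_of_bdd ((measurable_const.indicator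
      (measurableSet_lt measurable_const hR)).comp (hFm j)) (C := 1) fun x => by
        unfold indicator; split_ifs <;> simp
  have hindb : ∀ j, ∫ x, {x | K < R x}.indicator (fun _ => (1 : ℝ)) (F^[j] x) ∂m ≤ T := fun j => by
    rw [(hF.iterate j).integral_comp_of_measurable (measurable_const.indicator
      (measurableSet_lt measurable_const hR)), integral_indicator
      (measurableSet_lt measurable_const hR)]
    simpa using hT
  have hsb : 0 ≤ |s| / b := by positivity
  set c := M * K + N * e with hc
  have hpt : ∀ x, ‖Complex.exp ((s / b * a x : ℝ) * Complex.I) -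
        Complex.exp ((s / b * ∑ j ∈ Finset.range k, Z (F^[j] x) : ℝ) * Complex.I)‖ ≤
      2 * ∑ j ∈ Finset.range N, {x | K < R x}.indicator (fun _ => (1 : ℝ)) (F^[j] x) +
      32 / L ^ 4 * ((∑ i ∈ Finset.range k, ZR (F^[i] x)) ^ 2 +
        (∑ i ∈ Finset.range N, ZR (F^[i] x)) ^ 2) + |s| / b * (c + √(Wb x)) := fun x => by
    have hc0 : 0 ≤ c := by
      have : 0 ≤ e := (abs_nonneg _).trans he
      positivity
    have t1 : 0 ≤ ∑ j ∈ Finset.range N, {x | K < R x}.indicator (fun _ => (1 : ℝ)) (F^[j] x) :=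
      Finset.sum_nonneg fun j _ => indicator_nonneg (fun _ _ => zero_le_one) _
    have t2 : 0 ≤ 32 / (L : ℝ) ^ 4 * ((∑ i ∈ Finset.range k, ZR (F^[i] x)) ^ 2 +
        (∑ i ∈ Finset.range N, ZR (F^[i] x)) ^ 2) := by positivity
    have t3 : 0 ≤ |s| / b * (c + √(Wb x)) := by positivity
    by_cases hg1 : ∃ j < N, K < R (F^[j] x)
    · obtain ⟨j, hj, hjK⟩ := hg1
      have := Finset.single_le_sum (f := fun j => {x | K < R x}.indicator (fun _ => (1 : ℝ))
        (F^[j] x)) (fun j _ => indicator_nonneg (fun _ _ => zero_le_one) _) (Finset.mem_range.2 hj)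
      rw [indicator_of_mem (by exact hjK)] at this
      exact (norm_exp_mul_I_sub_le_two _ _).trans (by linarith)
    push Not at hg1
    have hbig : ∀ q : ℝ, ¬ |q| ≤ (L : ℝ) ^ 2 / 4 → 2 ≤ 32 / (L : ℝ) ^ 4 * q ^ 2 := fun q hq => by
      have h1 : ((L : ℝ) ^ 2 / 4) ^ 2 ≤ q ^ 2 := by
        rw [← sq_abs q]
        exact pow_le_pow_left₀ (by positivity) (not_le.1 hq).le 2
      calc (2 : ℝ) = 32 / (L : ℝ) ^ 4 * ((L : ℝ) ^ 2 / 4) ^ 2 := by field_simp; norm_num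
        _ ≤ _ := by gcongr
    have hL4 : 0 ≤ 32 / (L : ℝ) ^ 4 := by positivity
    by_cases hg2 : |∑ i ∈ Finset.range k, ZR (F^[i] x)| ≤ (L : ℝ) ^ 2 / 4
    swap
    · refine (norm_exp_mul_I_sub_le_two _ _).trans ?_
      have := hbig _ hg2
      nlinarith [mul_nonneg hL4 (sq_nonneg (∑ i ∈ Finset.range N, ZR (F^[i] x)))]
    by_cases hg3 : |∑ i ∈ Finset.range N, ZR (F^[i] x)| ≤ (L : ℝ) ^ 2 / 4
    swap
    · refine (norm_exp_mul_I_sub_le_two _ _).trans ?_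
      have := hbig _ hg3
      nlinarith [mul_nonneg hL4 (sq_nonneg (∑ i ∈ Finset.range k, ZR (F^[i] x)))]
    have hmain := abs_sub_sum_le_of_window (r := fun i => R (F^[i] x)) (φ := fun i => u (F^[i] x))
      (zr := fun i => ZR (F^[i] x)) (zφ := fun i => Z (F^[i] x)) (eR := eR)
      (eφ := ∫ x, truncObs R u K x ∂m) (a := a x) (M := M) (K := K) hL hM
      (fun i hi => by simp only [hZR, truncCenter, heR, truncObs, if_pos (hg1 i hi)])
      (fun i hi => by simp only [hZ, truncCenter, truncObs, if_pos (hg1 i hi)])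
      hg1 hg2 hg3 hk hk' (ha x)
    refine (norm_exp_mul_I_sub_le _ _).trans ?_
    rw [← mul_sub, abs_mul, abs_div, abs_of_pos hb]
    have : |s| / b * |a x - ∑ j ∈ Finset.range k, Z (F^[j] x)| ≤ |s| / b * (c + √(Wb x)) := by
      refine mul_le_mul_of_nonneg_left (hmain.trans ?_) hsb
      rw [hc]
      gcongr
    linarith
  have hj1 := integrable_finsetSum (Finset.range N) fun j _ => hind j
  refine (integral_mono_of_nonneg (ae_of_all _ fun x => norm_nonneg _)
    (((hj1.const_mul 2).add (((hSq k).add (hSq N)).const_mul _)).add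
      (((integrable_const c).add hWs).const_mul _)) (ae_of_all _ hpt)).trans ?_
  simp only [Pi.add_apply]
  rw [integral_add ((hj1.const_mul 2).fun_add (((hSq k).fun_add (hSq N)).const_mul _))
    (((integrable_const c).fun_add hWs).const_mul _), integral_add (hj1.const_mul 2)
    (((hSq k).fun_add (hSq N)).const_mul _), integral_const_mul, integral_const_mul,
    integral_const_mul, integral_add (hSq k) (hSq N), integral_add (integrable_const c) hWs,
    integral_finsetSum _ fun j _ => hind j]
  have e1 : 2 * ∑ j ∈ Finset.range N, ∫ x, {x | K < R x}.indicator (fun _ => (1 : ℝ)) (F^[j] x) ∂m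
      ≤ 2 * N * T := by
    rw [mul_assoc]
    gcongr
    refine (Finset.sum_le_sum fun j _ => hindb j).trans ?_
    simp
  have e2 : 32 / (L : ℝ) ^ 4 * (∫ x, (∑ i ∈ Finset.range k, ZR (F^[i] x)) ^ 2 ∂m +
      ∫ x, (∑ i ∈ Finset.range N, ZR (F^[i] x)) ^ 2 ∂m) ≤ 64 * V * N / L ^ 4 := by
    rw [show 64 * V * (N : ℝ) / L ^ 4 = 32 / L ^ 4 * (V * N + V * N) by ring]
    gcongr
    · refine (hVR k).trans ?_
      gcongr
      omega
    · exact hVR N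
  have e3 : ∫ _, c ∂m = c := by simp
  rw [e3]
  gcongr

end BlockApproximation

section Scales

theorem tendsto_log_div_pow_atTop {k : ℕ} (hk : k ≠ 0) :
    Tendsto (fun x : ℝ => Real.log x / x ^ k) atTop (𝓝 0) := by
  have := (isLittleO_log_rpow_atTop (r := k) (by positivity)).tendsto_div_nhds_zero
  simpa using this

/-- Truncation and window scales used for the blocks. -/
theorem exists_scales : ∃ K L : ℕ → ℕ, (∀ n, 1 ≤ K n) ∧ (∀ n, 1 ≤ L n) ∧
    Tendsto (fun n => (K n : ℝ) / √(n * Real.log n)) atTop (𝓝 0) ∧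
    Tendsto (fun n : ℕ => (n : ℝ) / (K n) ^ 2) atTop (𝓝 0) ∧
    Tendsto (fun n : ℕ => Real.log (K n) / Real.log n) atTop (𝓝 (1 / 2)) ∧
    Tendsto (fun n : ℕ => (n : ℝ) * Real.log n / (L n) ^ 4) atTop (𝓝 0) ∧
    Tendsto (fun n : ℕ => (L n : ℝ) ^ 3 / n) atTop (𝓝 0) := by
  have hlog : Tendsto (fun n : ℕ => Real.log n) atTop atTop :=
    Real.tendsto_log_atTop.comp tendsto_natCast_atTop_atTop
  set q : ℕ → ℝ := fun n => √√(Real.log n) with hq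
  set z : ℕ → ℝ := fun n => (n : ℝ) ^ (1 / 16 : ℝ) with hz
  have hqt : Tendsto q atTop atTop :=
    Real.tendsto_sqrt_atTop.comp (Real.tendsto_sqrt_atTop.comp hlog)
  have hzt : Tendsto z atTop atTop :=
    (tendsto_rpow_atTop (by norm_num)).comp tendsto_natCast_atTop_atTop
  have hceil : ∀ x : ℝ, 1 ≤ x → x ≤ ⌈x⌉₊ ∧ (⌈x⌉₊ : ℝ) ≤ 2 * x := fun x hx =>
    ⟨Nat.le_ceil x, (Nat.ceil_lt_add_one (by linarith)).le.trans (by linarith)⟩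
  have hq4 : ∀ n, q n ^ 4 = Real.log n := fun n => by
    rw [show q n ^ 4 = (q n ^ 2) ^ 2 by ring, Real.sq_sqrt (Real.sqrt_nonneg _),
      Real.sq_sqrt (Real.log_natCast_nonneg n)]
  have hz16 : ∀ n, z n ^ 16 = n := fun n => by
    rw [hz]; dsimp only
    rw [← Real.rpow_natCast, ← Real.rpow_mul (Nat.cast_nonneg n)]; norm_num
  have hK : ∀ᶠ n : ℕ in atTop, √n * q n ≤ (max 1 ⌈√n * q n⌉₊ : ℕ) ∧
      ((max 1 ⌈√n * q n⌉₊ : ℕ) : ℝ) ≤ 2 * (√n * q n) ∧ 1 ≤ q n ∧ 1 ≤ √n := by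
    filter_upwards [hqt.eventually_ge_atTop 1, eventually_ge_atTop 1] with n h1 h2
    have h3 : 1 ≤ √(n : ℝ) := Real.one_le_sqrt.2 (by exact_mod_cast h2)
    have h4 : 1 ≤ √(n : ℝ) * q n := by nlinarith
    rw [max_eq_right (Nat.one_le_ceil_iff.2 (by linarith))]
    exact ⟨(hceil _ h4).1, (hceil _ h4).2, h1, h3⟩
  have hL : ∀ᶠ n : ℕ in atTop, z n ^ 5 ≤ (max 1 ⌈z n ^ 5⌉₊ : ℕ) ∧
      ((max 1 ⌈z n ^ 5⌉₊ : ℕ) : ℝ) ≤ 2 * z n ^ 5 ∧ 1 ≤ z n := by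
    filter_upwards [hzt.eventually_ge_atTop 1] with n h1
    have h4 : 1 ≤ z n ^ 5 := one_le_pow₀ h1
    rw [max_eq_right (Nat.one_le_ceil_iff.2 (by linarith))]
    exact ⟨(hceil _ h4).1, (hceil _ h4).2, h1⟩
  refine ⟨fun n => max 1 ⌈√n * q n⌉₊, fun n => max 1 ⌈z n ^ 5⌉₊, fun n => le_max_left _ _,
    fun n => le_max_left _ _, ?_, ?_, ?_, ?_, ?_⟩
  · refine squeeze_zero' (Eventually.of_forall fun n => by positivity) ?_
      (hqt.const_div_atTop 2)
    filter_upwards [hK] with n ⟨h1, h2, h3, h4⟩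
    have e : √((n : ℝ) * Real.log n) = √n * q n ^ 2 := by
      rw [Real.sqrt_mul (Nat.cast_nonneg n), Real.sq_sqrt (Real.sqrt_nonneg _)]
    rw [e, div_le_div_iff₀ (by positivity) (by positivity)]
    nlinarith
  · refine squeeze_zero' (Eventually.of_forall fun n => by positivity) ?_
      (((tendsto_pow_atTop two_ne_zero).comp hqt).const_div_atTop 1)
    filter_upwards [hK] with n ⟨h1, h2, h3, h4⟩
    have h5 : (√n * q n) ^ 2 ≤ ((max 1 ⌈√n * q n⌉₊ : ℕ) : ℝ) ^ 2 := by gcongr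
    rw [mul_pow, Real.sq_sqrt (Nat.cast_nonneg n)] at h5
    simp only [Function.comp]
    rw [div_le_div_iff₀ (by positivity) (by positivity)]
    linarith
  · have hlq : Tendsto (fun n => Real.log (q n) / q n ^ 4) atTop (𝓝 0) :=
      (tendsto_log_div_pow_atTop four_ne_zero).comp hqt
    have hc : Tendsto (fun n => Real.log 2 / q n ^ 4) atTop (𝓝 0) :=
      ((tendsto_pow_atTop four_ne_zero).comp hqt).const_div_atTop _
    have l1 : Tendsto (fun n => 1 / 2 + Real.log (q n) / q n ^ 4) atTop (𝓝 (1 / 2)) := by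
      simpa only [add_zero] using hlq.const_add (1 / 2)
    have l2 : Tendsto (fun n => 1 / 2 + Real.log (q n) / q n ^ 4 + Real.log 2 / q n ^ 4) atTop
      (𝓝 (1 / 2)) := by simpa only [add_zero] using l1.add hc
    have key : ∀ᶠ n : ℕ in atTop, 1 / 2 + Real.log (q n) / q n ^ 4 =
        Real.log (√n * q n) / Real.log n := by
      filter_upwards [hK] with n ⟨h1, h2, h3, h4⟩
      rw [Real.log_mul (by positivity) (by positivity), Real.log_sqrt (Nat.cast_nonneg n), hq4]
      have h6 : Real.log n ≠ 0 := by rw [← hq4]; positivity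
      field_simp
    refine tendsto_of_tendsto_of_tendsto_of_le_of_le' l1 l2 ?_ ?_
    · filter_upwards [hK, key] with n ⟨h1, h2, h3, h4⟩ h5
      rw [h5]
      have h6 : 0 < Real.log n := by rw [← hq4]; positivity
      gcongr
    · filter_upwards [hK, key] with n ⟨h1, h2, h3, h4⟩ h5
      have h6 : 0 < Real.log n := by rw [← hq4]; positivity
      rw [h5, hq4, ← add_div, ← Real.log_mul (by positivity) two_ne_zero]
      gcongr
      linarith
  · have l : Tendsto (fun n => 16 * (Real.log (z n) / z n ^ 4)) atTop (𝓝 0) := by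
      simpa using ((tendsto_log_div_pow_atTop four_ne_zero).comp hzt).const_mul 16
    refine squeeze_zero' (Eventually.of_forall fun n => by
      have := Real.log_natCast_nonneg n; positivity) ?_ l
    filter_upwards [hL] with n ⟨h1, h2, h3⟩
    have h5 : (z n ^ 5) ^ 4 ≤ ((max 1 ⌈z n ^ 5⌉₊ : ℕ) : ℝ) ^ 4 := by gcongr
    have h6 : Real.log n = 16 * Real.log (z n) := by
      rw [← hz16 n, Real.log_pow]; norm_num
    have h7 := Real.log_nonneg h3
    calc (n : ℝ) * Real.log n / ((max 1 ⌈z n ^ 5⌉₊ : ℕ) : ℝ) ^ 4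
        ≤ (n : ℝ) * Real.log n / (z n ^ 5) ^ 4 := by
          have := Real.log_natCast_nonneg n; gcongr
      _ = z n ^ 16 * (16 * Real.log (z n)) / (z n ^ 5) ^ 4 := by rw [hz16, h6]
      _ = _ := by field_simp
  · refine squeeze_zero' (Eventually.of_forall fun n => by positivity) ?_
      (hzt.const_div_atTop 8)
    filter_upwards [hL] with n ⟨h1, h2, h3⟩
    calc ((max 1 ⌈z n ^ 5⌉₊ : ℕ) : ℝ) ^ 3 / n ≤ (2 * z n ^ 5) ^ 3 / z n ^ 16 := by
          rw [hz16]; gcongr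
      _ = 8 / z n := by field_simp; norm_num

end Scales

section BlockCLT

theorem tendsto_zero_of_sq {u : ℕ → ℝ} (h : Tendsto (fun n => u n ^ 2) atTop (𝓝 0)) :
    Tendsto u atTop (𝓝 0) := by
  have h1 := h.sqrt
  simp only [Real.sqrt_sq_eq_abs, Real.sqrt_zero] at h1
  exact (tendsto_zero_iff_abs_tendsto_zero u).2 h1

theorem abs_integral_sub_integral_truncObs_le {X : Type*} [MeasurableSpace X] {m : Measure X}
    [IsProbabilityMeasure m] {R : X → ℕ} (hR : Measurable R)
    (hRi : Integrable (fun x => (R x : ℝ)) m) {Cr : ℝ} (hCr : 0 ≤ Cr)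
    (htail : ∀ n : ℕ, m.real {x | n < R x} ≤ Cr / (n + 1) ^ 2) {u : X → ℝ} (hu : Measurable u)
    {M : ℝ} (hM : 0 ≤ M) (huM : ∀ x, |u x| ≤ M * R x) {K : ℕ} (hK : 1 ≤ K) :
    |∫ x, u x ∂m - ∫ x, truncObs R u K x ∂m| ≤ M * (2 * Cr / K) := by
  have hui : Integrable u m := (hRi.const_mul M).mono' hu.aestronglyMeasurable
    (ae_of_all _ huM)
  have hset : MeasurableSet {x | K < R x} := measurableSet_lt measurable_const hR
  rw [← integral_sub hui (integrable_truncObs hR hu hM huM K)]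
  have e : (fun x => u x - truncObs R u K x) = {x | K < R x}.indicator u := by
    funext x
    by_cases hx : R x ≤ K
    · rw [indicator_of_notMem (by simpa using hx), truncObs, if_pos hx, sub_self]
    · rw [indicator_of_mem (by simpa using hx), truncObs, if_neg hx, sub_zero]
  rw [e, integral_indicator hset]
  calc _ ≤ ∫ x in {x | K < R x}, |u x| ∂m := abs_integral_le_integral_abs
    _ ≤ ∫ x in {x | K < R x}, M * (R x : ℝ) ∂m :=
        integral_mono hui.abs.restrict (hRi.const_mul M).restrict huM
    _ ≤ _ := by
        rw [integral_const_mul]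
        exact mul_le_mul_of_nonneg_left (integral_tail_le hR hRi hCr htail hK) hM

variable {X W : Type*} [PseudoMetricSpace X] [MeasurableSpace X]
  {m : Measure X} {F : X → X} {Y : Set X} {G : W → X → ℝ} {b : W → X → X} {D t lam : ℝ}
  {R : X → ℕ} {u : X → ℝ}

set_option maxHeartbeats 2000000 in
theorem tendsto_integral_exp_block [Countable W] [IsProbabilityMeasure m]
    (H : MarkovSystem m F Y G b D t lam) (hR : Measurable R) (hR1 : ∀ x, 1 ≤ R x)
    {Rw : W → ℕ} (hRw : ∀ w, ∀ y ∈ Y, R (b w y) = Rw w)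
    (hRi : Integrable (fun x => (R x : ℝ)) m) {Cr : ℝ} (hCr : 0 ≤ Cr)
    (htail : ∀ n : ℕ, m.real {x | n < R x} ≤ Cr / (n + 1) ^ 2)
    (hu : Measurable u) {M : ℝ} (hM : 0 ≤ M) (huM : ∀ x, |u x| ≤ M * R x)
    (huL : ∀ w, ∀ x ∈ Y, ∀ y ∈ Y, |u (b w x) - u (b w y)| ≤ M * Rw w * dist x y ^ t)
    (hu0 : ∫ x, u x ∂m = 0) {σ : ℝ}
    (hσ : Tendsto (fun K : ℕ => (∫ x, truncObs R u K x ^ 2 ∂m) / Real.log K) atTop (𝓝 σ))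
    {M' : ℝ} (hM' : 0 ≤ M') (huM' : ∀ x, |u x| ≤ M' * R x)
    {a : ℕ → X → ℝ} (ham : ∀ n, Measurable (a n))
    (ha : ∀ n x j, ∑ i ∈ Finset.range j, R (F^[i] x) ≤ n →
      n < ∑ i ∈ Finset.range (j + 1), R (F^[i] x) →
      |a n x - ∑ i ∈ Finset.range j, u (F^[i] x)| ≤ M' * R (F^[j] x))
    {g : X → ℝ} (hg : Measurable g) (hg1 : ∀ x, |g x| ≤ 1)
    (hgw : ∀ w, ∀ x ∈ Y, ∀ y ∈ Y, g (b w x) = g (b w y)) (s : ℝ) :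
    Tendsto (fun n : ℕ => ∫ x, (g x : ℂ) *
        Complex.exp ((s / √(n * Real.log n) * a n x : ℝ) * Complex.I) ∂m) atTop
      (𝓝 ((∫ x, (g x : ℂ) ∂m) *
        (Real.exp (-(s ^ 2 / 2 * (σ / (2 * ∫ x, (R x : ℝ) ∂m)))) : ℂ))) := by
  have hF := H.measurePreserving
  have hFm : ∀ j, Measurable F^[j] := fun j => hF.measurable.iterate j
  obtain ⟨K, L, hK1, hL1, hKb, hnK, hKn, hnL, hLn⟩ := exists_scales
  have hRm : Measurable (fun x => (R x : ℝ)) := measurable_from_nat.comp hR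
  obtain ⟨C₁, θ, hC₁, hθ0, hθ1, hbd⟩ :=
    exists_truncCenter_bounds H hR hR1 hRw hRi hCr htail hu hM huM huL
  obtain ⟨C₂, θ₂, hC₂, hθ₂0, hθ₂1, hbdR⟩ := exists_truncCenter_bounds H hR hR1 hRw hRi hCr htail hRm
    zero_le_one (fun x => by simp) (fun w x hx y hy => by
      rw [hRw w x hx, hRw w y hy, sub_self, abs_zero]
      have := Real.rpow_nonneg (dist_nonneg (x := x) (y := y)) t
      positivity)
  set μ := ∫ x, (R x : ℝ) ∂m with hμ
  have hμ1 : 1 ≤ μ := by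
    have : ∫ _, (1 : ℝ) ∂m ≤ μ := integral_mono (integrable_const _) hRi fun x => by
      show (1 : ℝ) ≤ R x
      exact_mod_cast hR1 x
    simpa using this
  have hμ0 : 0 < μ := by linarith
  have hKpos : ∀ n, (0 : ℝ) < K n := fun n => by exact_mod_cast hK1 n
  have hLpos : ∀ n, (0 : ℝ) < L n := fun n => by exact_mod_cast hL1 n
  have hcast : Tendsto (fun n : ℕ => (n : ℝ)) atTop atTop := tendsto_natCast_atTop_atTop
  have hlog : Tendsto (fun n : ℕ => Real.log n) atTop atTop := Real.tendsto_log_atTop.comp hcast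
  set bb : ℕ → ℝ := fun n => √(n * Real.log n) with hbb
  have hbt : Tendsto bb atTop atTop :=
    Real.tendsto_sqrt_atTop.comp (hcast.atTop_mul_atTop₀ hlog)
  have hb2 : ∀ n, bb n ^ 2 = n * Real.log n := fun n => Real.sq_sqrt
    (mul_nonneg (Nat.cast_nonneg n) (Real.log_natCast_nonneg n))
  -- limits of the scales
  have l_iK : Tendsto (fun n : ℕ => 1 / (K n : ℝ)) atTop (𝓝 0) := by
    refine tendsto_zero_of_sq (squeeze_zero' (Eventually.of_forall fun n => by positivity) ?_ hnK)
    filter_upwards [eventually_ge_atTop 1] with n hn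
    rw [div_pow, one_pow]
    have : (1 : ℝ) ≤ n := by exact_mod_cast hn
    gcongr
  have l_nL4 : Tendsto (fun n : ℕ => (n : ℝ) / (L n) ^ 4) atTop (𝓝 0) := by
    refine squeeze_zero' (Eventually.of_forall fun n => by positivity) ?_ hnL
    filter_upwards [hlog.eventually_ge_atTop 1] with n hn
    gcongr
    exact le_mul_of_one_le_right (Nat.cast_nonneg n) hn
  have l_iL : Tendsto (fun n : ℕ => 1 / (L n : ℝ) ^ 2) atTop (𝓝 0) := by
    refine tendsto_zero_of_sq (squeeze_zero' (Eventually.of_forall fun n => by positivity) ?_ l_nL4)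
    filter_upwards [eventually_ge_atTop 1] with n hn
    rw [div_pow, one_pow, ← pow_mul]
    have : (1 : ℝ) ≤ n := by exact_mod_cast hn
    gcongr
  have l_nKL : Tendsto (fun n : ℕ => (n : ℝ) / (K n * (L n) ^ 2)) atTop (𝓝 0) := by
    refine tendsto_zero_of_sq ?_
    have := hnK.mul l_nL4
    rw [mul_zero] at this
    refine this.congr fun n => ?_
    have := hKpos n; have := hLpos n
    field_simp
  have l_ilog : Tendsto (fun n : ℕ => 1 / Real.log n) atTop (𝓝 0) := hlog.const_div_atTop 1
  have hev : ∀ᶠ n : ℕ in atTop, (1 : ℝ) ≤ n ∧ 1 ≤ Real.log n ∧ 0 < bb n := by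
    filter_upwards [eventually_ge_atTop 1, hlog.eventually_ge_atTop 1] with n h1 h2
    have h1' : (1 : ℝ) ≤ n := by exact_mod_cast h1
    exact ⟨h1', h2, Real.sqrt_pos.2 (by positivity)⟩
  have l_nKb : Tendsto (fun n : ℕ => (n : ℝ) / (K n * bb n)) atTop (𝓝 0) := by
    refine tendsto_zero_of_sq ?_
    have := hnK.mul l_ilog
    rw [mul_zero] at this
    refine this.congr' ?_
    filter_upwards [hev] with n ⟨h1, h2, h3⟩
    rw [div_pow, mul_pow, hb2]
    have := hKpos n
    field_simp
  have l_L2 : Tendsto (fun n : ℕ => (L n : ℝ) ^ 2 / n) atTop (𝓝 0) := by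
    refine squeeze_zero (fun n => by positivity) (fun n => ?_) hLn
    have : (1 : ℝ) ≤ L n := by exact_mod_cast hL1 n
    exact div_le_div_of_nonneg_right (pow_le_pow_right₀ this (by norm_num)) (Nat.cast_nonneg n)
  have l_ℓ : Tendsto (fun n : ℕ => (1 + Real.log (K n)) / Real.log n) atTop (𝓝 (1 / 2)) := by
    have := l_ilog.add hKn
    rw [zero_add] at this
    exact this.congr fun n => by ring
  set k : ℕ → ℕ := fun n => ⌊(n : ℝ) / μ⌋₊ - L n ^ 2 with hk
  have hkreal : ∀ᶠ n : ℕ in atTop, (k n : ℝ) = ⌊(n : ℝ) / μ⌋₊ - (L n : ℝ) ^ 2 := by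
    filter_upwards [l_L2.eventually_lt_const (show 0 < 1 / (2 * μ) by positivity), hev,
      hcast.eventually_ge_atTop (2 * μ)] with n h1 h2 h3
    have h4 : (L n : ℝ) ^ 2 ≤ ⌊(n : ℝ) / μ⌋₊ := by
      have h5 := Nat.sub_one_lt_floor ((n : ℝ) / μ)
      rw [div_lt_div_iff₀ (by linarith) (by positivity)] at h1
      have h6 : (L n : ℝ) ^ 2 ≤ n / μ / 2 := by
        rw [div_div, le_div_iff₀ (by positivity)]; linarith
      have h7 : 2 ≤ (n : ℝ) / μ := by rw [le_div_iff₀ hμ0]; linarith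
      linarith
    rw [hk]; dsimp only
    rw [Nat.cast_sub (by exact_mod_cast h4)]
    push_cast; ring
  have l_k : Tendsto (fun n : ℕ => (k n : ℝ) / n) atTop (𝓝 (1 / μ)) := by
    have h1 := (tendsto_nat_floor_mul_div_atTop (R := ℝ) (a := 1 / μ) (by positivity)).comp hcast
    have h2 := h1.sub l_L2
    rw [sub_zero] at h2
    refine h2.congr' ?_
    filter_upwards [hkreal] with n hn
    rw [hn, sub_div, Function.comp, one_div_mul_eq_div]
  have hkt : Tendsto k atTop atTop := by
    rw [← tendsto_natCast_atTop_iff (R := ℝ)]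
    have := l_k.pos_mul_atTop (by positivity) hcast
    refine this.congr' ?_
    filter_upwards [hev] with n ⟨h1, _⟩
    rw [div_mul_cancel₀ _ (by linarith)]
  choose hb1 hb2' A₁ A₂ hA₁ hA₂ hA₁C hA₂C hT1 hT2 hc1 hc2 using fun n => hbd (K n) (hK1 n)
  set Z : ℕ → X → ℝ := fun n => truncCenter m R u (K n) with hZ
  have hZm : ∀ n, Measurable (Z n) := fun n => measurable_truncCenter hR hu (K n)
  have hℓ1 : ∀ n, 1 ≤ 1 + Real.log (K n) := fun n => by
    have := Real.log_natCast_nonneg (K n); linarith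
  have hmean : ∀ n, |∫ x, truncObs R u (K n) x ∂m| ≤ M * (2 * Cr / K n) := fun n => by
    have := abs_integral_sub_integral_truncObs_le hR hRi hCr htail hu hM huM (hK1 n)
    rwa [hu0, zero_sub, abs_neg] at this
  have hkn : ∀ n : ℕ, (k n : ℝ) ≤ n := fun n => by
    have h1 : (⌊(n : ℝ) / μ⌋₊ : ℝ) ≤ n := (Nat.floor_le (by positivity)).trans
      (div_le_self (Nat.cast_nonneg n) hμ1)
    refine le_trans ?_ h1
    exact_mod_cast Nat.sub_le _ _
  have hℓn : ∀ᶠ n : ℕ in atTop, 1 + Real.log (K n) ≤ Real.log n := by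
    filter_upwards [l_ℓ.eventually_le_const (show (1 / 2 : ℝ) < 1 by norm_num), hev] with n h1 h2
    rwa [div_le_one (by linarith [h2.2.1])] at h1
  have hσ' : Tendsto (fun n => k n * (∫ x, Z n x ^ 2 ∂m) / bb n ^ 2) atTop
      (𝓝 (σ / (2 * μ))) := by
    have hKt : Tendsto K atTop atTop := by
      rw [← tendsto_natCast_atTop_iff (R := ℝ)]
      have : Tendsto (fun n => ((K n : ℝ))⁻¹) atTop (𝓝[>] 0) := tendsto_nhdsWithin_iff.2
        ⟨by simpa using l_iK, Eventually.of_forall fun n => inv_pos.2 (hKpos n)⟩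
      exact this.inv_tendsto_nhdsGT_zero.congr fun n => by simp
    have hsq : Tendsto (fun n => (∫ x, truncObs R u (K n) x ∂m) ^ 2) atTop (𝓝 0) := by
      have h1 : Tendsto (fun n => ∫ x, truncObs R u (K n) x ∂m) atTop (𝓝 0) := by
        refine squeeze_zero_norm hmean ?_
        have := l_iK.const_mul (M * (2 * Cr))
        rw [mul_zero] at this
        exact this.congr fun n => by ring
      simpa using h1.pow 2
    have h1 := l_k.mul (((hσ.comp hKt).mul hKn).sub (hsq.mul l_ilog))
    have e : 1 / μ * (σ * (1 / 2) - 0 * 0) = σ / (2 * μ) := by field_simp; ring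
    rw [e] at h1
    refine h1.congr' ?_
    have hlK : Tendsto (fun n => Real.log (K n)) atTop atTop :=
      hlog.comp hKt
    filter_upwards [hev, hlK.eventually_gt_atTop 0] with n ⟨h1, h2, h3⟩ h4
    have hi := integrable_truncObs (m := m) hR hu hM huM (K n)
    have hi2 : Integrable (fun x => truncObs R u (K n) x ^ 2) m :=
      integrable_of_bdd ((measurable_truncObs hR hu _).pow_const 2) (C := (M * K n) ^ 2)
        fun x => by
          rw [Real.norm_eq_abs, abs_pow]
          gcongr
          refine (abs_truncObs_le hM huM _ x).trans ?_
          gcongr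
          exact min_le_right _ _
    have h5 : ∫ x, Z n x ^ 2 ∂m =
        ∫ x, truncObs R u (K n) x ^ 2 ∂m - (∫ x, truncObs R u (K n) x ∂m) ^ 2 := by
      simp only [hZ, truncCenter, sub_sq]
      rw [integral_add (by exact hi2.sub ((hi.const_mul 2).mul_const _)) (integrable_const _),
        integral_sub hi2 ((hi.const_mul 2).mul_const _), integral_mul_const, integral_const_mul]
      simp
      ring
    rw [h5, hb2, Function.comp]
    field_simp
  -- CLT for the truncated sums
  have hclt := tendsto_charFun_array hF (Z := Z) (A₁ := A₁) (A₂ := A₂) hZm hA₁ hA₂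
    (B := fun n => C₁ * K n) (ℓ := fun n => 1 + Real.log (K n)) (b := bb) (k := k)
    (C := C₁ + 1) (θ := θ) (σ := σ / (2 * μ)) (fun n => by positivity) (by positivity) hℓ1 hθ0 hθ1
    hb1 (fun n x => (hA₁C n x).trans (by linarith))
    (fun n x => (hA₂C n x).trans (mul_le_mul_of_nonneg_right (by linarith) (by linarith [hℓ1 n])))
    hT1 hT2 (fun n j => (hc1 n j).trans (by gcongr; linarith))
    (fun n j => (hc2 n j).trans (by gcongr; linarith)) hbt hkt
    (by
      filter_upwards [hℓn, hev] with n h1 ⟨h2, h3, h4⟩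
      rw [hb2]
      have h5 : (k n : ℝ) * (1 + Real.log (K n)) ≤ n * Real.log n :=
        mul_le_mul (hkn n) h1 (by linarith [hℓ1 n]) (by positivity)
      have h6 : 0 ≤ C₁ * (n * Real.log n) := by positivity
      linarith)
    (by
      have := l_k.mul l_ilog
      rw [mul_zero] at this
      refine this.congr fun n => ?_
      rw [hb2, div_mul_div_comm, mul_one])
    (by
      have := hKb.const_mul C₁
      rw [mul_zero] at this
      exact this.congr fun n => (mul_div_assoc _ _ _).symm) hσ' s
  -- comparison with the flow-time sums
  set N : ℕ → ℕ := fun n => k n + 2 * L n ^ 2 with hN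
  set V : ℕ → ℝ := fun n => (C₁ + C₂) * (1 + Real.log (K n)) with hV
  have hV0 : ∀ n, 0 ≤ V n := fun n => mul_nonneg (by positivity) (by linarith [hℓ1 n])
  set e : ℕ → ℝ := fun n => M * (2 * Cr / K n) with he
  have hNn : ∀ᶠ n : ℕ in atTop, (N n : ℝ) ≤ 3 * n := by
    filter_upwards [l_L2.eventually_le_const one_pos, hev] with n h1 h2
    rw [div_le_one (by linarith)] at h1
    simp only [hN]; push_cast
    linarith [hkn n]
  set E : ℕ → ℝ := fun n => 2 * (N n : ℝ) * (Cr / (K n + 1) ^ 2) + 64 * V n * (N n : ℝ) / L n ^ 4 +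
    |s| / bb n * (M' * K n + (N n : ℝ) * e n + √(18 * V n * L n ^ 3)) with hE
  have hE0 : Tendsto E atTop (𝓝 0) := by
    have t1 := hnK.const_mul (6 * Cr)
    have t2 := hnL.const_mul (192 * (C₁ + C₂))
    have t3 := (hKb.const_mul M').add (l_nKb.const_mul (6 * M * Cr))
    have t4 := (hLn.const_mul (18 * (C₁ + C₂))).sqrt
    have t5 := (t1.add t2).add ((t3.add t4).const_mul |s|)
    simp only [mul_zero, add_zero, Real.sqrt_zero] at t5
    refine squeeze_zero' (Eventually.of_forall fun n => ?_) ?_ t5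
    · have := hV0 n
      simp only [hE, he]
      positivity
    filter_upwards [hNn, hℓn, hev] with n h1 h2 ⟨h3, h4, h5⟩
    have hK0 := hKpos n
    have hL0 := hLpos n
    have hVn : V n ≤ (C₁ + C₂) * Real.log n := by simp only [hV]; gcongr
    have hVn0 := hV0 n
    simp only [hE]
    refine add_le_add (add_le_add ?_ ?_) ?_
    · calc _ ≤ 2 * (3 * n) * (Cr / (K n : ℝ) ^ 2) := by gcongr; linarith
        _ = _ := by ring
    · calc _ ≤ 64 * ((C₁ + C₂) * Real.log n) * (3 * n) / (L n : ℝ) ^ 4 := by gcongr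
        _ = _ := by ring
    · rw [div_mul_eq_mul_div, mul_div_assoc]
      refine mul_le_mul_of_nonneg_left ?_ (abs_nonneg s)
      rw [add_div, add_div]
      refine add_le_add (add_le_add (le_of_eq (mul_div_assoc _ _ _)) ?_) ?_
      · simp only [he]
        calc _ ≤ 3 * n * (M * (2 * Cr / K n)) / bb n := by gcongr
          _ = _ := by field_simp; ring
      · rw [div_le_iff₀ h5]
        refine Real.sqrt_le_iff.2 ⟨by positivity, ?_⟩
        rw [mul_pow, Real.sq_sqrt (by positivity), hb2]
        calc _ ≤ 18 * ((C₁ + C₂) * Real.log n) * (L n : ℝ) ^ 3 := by gcongr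
          _ = _ := by field_simp
  have hmeas : ∀ n, Measurable fun x => Complex.exp ((s / bb n * a n x : ℝ) * Complex.I) :=
    fun n => (Complex.measurable_ofReal.comp ((ham n).const_mul _)).mul_const _ |>.cexp
  have hSm : ∀ n, Measurable fun x => ∑ j ∈ Finset.range (k n), Z n (F^[j] x) := fun n =>
    Finset.measurable_sum _ fun j _ => (hZm n).comp (hFm j)
  have hmeasZ : ∀ n, Measurable fun x => Complex.exp
      ((s / bb n * ∑ j ∈ Finset.range (k n), Z n (F^[j] x) : ℝ) * Complex.I) :=
    fun n => (Complex.measurable_ofReal.comp ((hSm n).const_mul _)).mul_const _ |>.cexp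
  have hgC : Measurable fun x => (g x : ℂ) := Complex.measurable_ofReal.comp hg
  have hge : ∀ {w : X → ℂ} {c : ℝ}, Measurable w → (∀ x, ‖w x‖ ≤ c) →
      Integrable (fun x => (g x : ℂ) * w x) m := fun {w c} hw hc =>
    integrable_of_bdd (hgC.mul hw) (C := c) fun x => by
      rw [norm_mul, Complex.norm_real]
      have h1 := norm_nonneg (w x)
      calc _ ≤ 1 * ‖w x‖ := by gcongr; exact hg1 x
        _ ≤ c := by rw [one_mul]; exact hc x
  have hdiff : ∀ {v w : X → ℂ}, Measurable v → Measurable w → (∀ x, ‖v x‖ ≤ 1) →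
      (∀ x, ‖w x‖ ≤ 1) → ‖∫ x, (g x : ℂ) * v x ∂m - ∫ x, (g x : ℂ) * w x ∂m‖ ≤
        ∫ x, ‖v x - w x‖ ∂m := fun {v w} hv hw hv1 hw1 => by
    rw [← integral_sub (hge hv hv1) (hge hw hw1)]
    refine (norm_integral_le_integral_norm _).trans (integral_mono_of_nonneg
      (ae_of_all _ fun x => norm_nonneg _) ?_ (ae_of_all _ fun x => ?_))
    · exact ((integrable_of_bdd hv hv1).sub (integrable_of_bdd hw hw1)).norm
    · dsimp only
      rw [← mul_sub, norm_mul, Complex.norm_real]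
      exact mul_le_of_le_one_left (norm_nonneg _) (hg1 x)
  have hcmp : ∀ᶠ n : ℕ in atTop, ‖∫ x, (g x : ℂ) *
        Complex.exp ((s / bb n * a n x : ℝ) * Complex.I) ∂m - ∫ x, (g x : ℂ) * Complex.exp
      ((s / bb n * ∑ j ∈ Finset.range (k n), Z n (F^[j] x) : ℝ) * Complex.I) ∂m‖ ≤ E n := by
    filter_upwards [hkreal, hev, l_iL.eventually_le_const (show 0 < 1 / (8 * μ) by positivity),
      (l_nKL.const_mul (2 * Cr)).eventually_le_const (show 2 * Cr * 0 < 1 / 8 by norm_num),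
      (l_iK.const_mul (2 * Cr)).eventually_le_const (show 2 * Cr * 0 < 1 / 8 by norm_num)]
      with n h1 ⟨h2, h3, h4⟩ h5 h6 h7
    refine (hdiff (hmeas n) (hmeasZ n) (fun x => (Complex.norm_exp_ofReal_mul_I _).le)
      (fun x => (Complex.norm_exp_ofReal_mul_I _).le)).trans ?_
    have hK0 := hKpos n
    have hL0 := hLpos n
    have hmR := abs_integral_sub_integral_truncObs_le hR hRi hCr htail hRm zero_le_one
      (fun x => by simp) (hK1 n)
    set eR := ∫ x, truncObs R (fun x => (R x : ℝ)) (K n) x ∂m with heR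
    have heR1 : eR ≤ μ := by
      refine integral_mono (integrable_truncObs hR hRm zero_le_one (fun x => by simp) _) hRi
        fun x => ?_
      unfold truncObs
      split_ifs
      · exact le_rfl
      · exact Nat.cast_nonneg _
    rw [one_mul, abs_le] at hmR
    have hfl1 : (⌊(n : ℝ) / μ⌋₊ : ℝ) ≤ n / μ := Nat.floor_le (by positivity)
    have hfl2 := Nat.sub_one_lt_floor ((n : ℝ) / μ)
    have hnμ : (n : ℝ) / μ * μ = n := div_mul_cancel₀ _ hμ0.ne'
    refine integral_norm_exp_sub_le hF hR hu hM' huM' (n := n) (k := k n) (K := K n) (L := L n)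
      (hL1 n) (ha n) (V := V n) (e := e n) (T := Cr / (K n + 1) ^ 2) (hV0 n) (fun j => ?_)
      (fun j => ?_) (hmean n) (htail _) ?_ ?_ s h4
    · refine (hb2' n j).trans ?_
      simp only [hV]
      have := hℓ1 n
      have h8 : 0 ≤ C₂ * j * (1 + Real.log (K n)) := by positivity
      linarith
    · refine ((hbdR (K n) (hK1 n)).2.1 j).trans ?_
      simp only [hV]
      have := hℓ1 n
      have h8 : 0 ≤ C₁ * j * (1 + Real.log (K n)) := by positivity
      linarith
    · have h8 : (k n : ℝ) * eR ≤ k n * μ := by gcongr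
      have h9 : (k n : ℝ) * μ ≤ (n / μ - (L n : ℝ) ^ 2) * μ := by gcongr; linarith
      have h10 : (L n : ℝ) ^ 2 * 1 ≤ (L n : ℝ) ^ 2 * μ := by gcongr
      nlinarith
    · rw [show ((k n + 2 * L n ^ 2 : ℕ) : ℝ) = ⌊(n : ℝ) / μ⌋₊ + (L n : ℝ) ^ 2 by
        push_cast; rw [h1]; ring]
      have hL1' : (1 : ℝ) ≤ L n := by exact_mod_cast hL1 n
      have heR0 : 0 ≤ eR := integral_nonneg fun x => by
        show (0 : ℝ) ≤ truncObs R (fun x => (R x : ℝ)) (K n) x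
        unfold truncObs
        split_ifs
        · exact Nat.cast_nonneg _
        · exact le_rfl
      have h8 : ((n : ℝ) / μ - 1 + (L n : ℝ) ^ 2) * eR ≤ (⌊(n : ℝ) / μ⌋₊ + (L n : ℝ) ^ 2) * eR := by
        gcongr
      have hx0 : 0 ≤ (n : ℝ) / μ - 1 + (L n : ℝ) ^ 2 := by
        have : (0 : ℝ) ≤ (n : ℝ) / μ := by positivity
        nlinarith
      have h9 : ((n : ℝ) / μ - 1 + (L n : ℝ) ^ 2) * (μ - 2 * Cr / K n) ≤
          ((n : ℝ) / μ - 1 + (L n : ℝ) ^ 2) * eR := by gcongr; linarith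
      have h10 : 2 * Cr / K n * ((n : ℝ) / μ - 1 + (L n : ℝ) ^ 2) ≤
          2 * Cr / K n * (n + (L n : ℝ) ^ 2) := by
        have := div_le_self (Nat.cast_nonneg n) hμ1
        gcongr
        linarith
      have h11 : 2 * Cr / K n * n ≤ (L n : ℝ) ^ 2 / 8 := by
        calc _ = 2 * Cr * ((n : ℝ) / (K n * L n ^ 2)) * L n ^ 2 := by field_simp
          _ ≤ 1 / 8 * (L n : ℝ) ^ 2 := by gcongr
          _ = _ := by ring
      have h12 : 2 * Cr / K n * (L n : ℝ) ^ 2 ≤ 1 / 8 * (L n : ℝ) ^ 2 := by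
        refine mul_le_mul_of_nonneg_right ?_ (sq_nonneg _)
        linarith [show 2 * Cr * (1 / (K n : ℝ)) = 2 * Cr / K n by ring]
      have h13 : μ ≤ (L n : ℝ) ^ 2 / 8 := by
        rw [div_le_div_iff₀ (by positivity) (by positivity)] at h5
        linarith
      have h14 : (L n : ℝ) ^ 2 * 1 ≤ (L n : ℝ) ^ 2 * μ := by gcongr
      have h15 : 0 < (L n : ℝ) ^ 2 := by positivity
      have h16 : ((n : ℝ) / μ - 1 + (L n : ℝ) ^ 2) * (μ - 2 * Cr / K n) =
          n - μ + (L n : ℝ) ^ 2 * μ - 2 * Cr / K n * ((n : ℝ) / μ - 1 + (L n : ℝ) ^ 2) := by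
        linear_combination hnμ
      rw [mul_add] at h10
      linarith
  -- asymptotic independence of the initial weight
  obtain ⟨C₀, θ', hC₀, hθ'0, hθ'1, hdec⟩ := H.exists_decay
  obtain ⟨-, -, -, -, -, hmix⟩ := hdec g (fun _ => 1) 1 1 hg hg1 (fun w y _ => hg1 _)
    (fun w x hx y hy => by
      rw [hgw w x hx y hy, sub_self, abs_zero, one_mul]
      exact Real.rpow_nonneg dist_nonneg _)
    (fun y hy => by
      have := H.hasSum y hy
      simp only [mul_one]
      exact ⟨this.summable, this.tsum_eq.le⟩)
  set w : ℕ → X → ℂ := fun n x => Complex.exp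
    ((s / bb n * ∑ j ∈ Finset.range (k n), Z n (F^[j] x) : ℝ) * Complex.I) with hw
  have hw1 : ∀ n x, ‖w n x‖ ≤ 1 := fun n x => (Complex.norm_exp_ofReal_mul_I _).le
  have hmixn : ∀ r : ℕ, ∀ᶠ n : ℕ in atTop, ‖∫ x, (g x : ℂ) * w n x ∂m -
      (∫ x, (g x : ℂ) ∂m) * ∫ x, w n x ∂m‖ ≤
        |s| * (2 * (r + 1) * C₁) * (K n / bb n) + C₀ * 1 * θ' ^ r := fun r => by
    filter_upwards [hev] with n ⟨h1, h2, h3⟩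
    refine (norm_sub_le_norm_sub_add_norm_sub _ (∫ x, (g x : ℂ) * w n (F^[r + 1] x) ∂m) _).trans
      (add_le_add ?_ (hmix r (w n) (hmeasZ n) (hw1 n)))
    refine (hdiff (hmeasZ n) ((hmeasZ n).comp (hFm (r + 1))) (hw1 n) (fun x => hw1 n _)).trans ?_
    have hpt : ∀ x, ‖w n x - w n (F^[r + 1] x)‖ ≤ |s| * (2 * (r + 1) * C₁) * (K n / bb n) :=
      fun x => by
      refine (norm_exp_mul_I_sub_le _ _).trans ?_
      rw [← mul_sub, abs_mul, abs_div, abs_of_pos h3, abs_sub_comm]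
      have h4 := abs_sum_iterate_shift_le (hb1 n) F x (k n) (r + 1)
      simp only [Function.iterate_add_apply _ _ (r + 1)] at h4
      calc _ ≤ |s| / bb n * (2 * ((r + 1 : ℕ) : ℝ) * (C₁ * K n)) := by gcongr
        _ = _ := by push_cast; ring
    calc _ ≤ ∫ _, |s| * (2 * (r + 1) * C₁) * (K n / bb n) ∂m :=
          integral_mono_of_nonneg (ae_of_all _ fun x => norm_nonneg _) (integrable_const _)
            (ae_of_all _ hpt)
      _ = _ := by simp
  have hfin : Tendsto (fun n => ∫ x, (g x : ℂ) * w n x ∂m -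
      (∫ x, (g x : ℂ) ∂m) * ∫ x, w n x ∂m) atTop (𝓝 0) := by
    rw [Metric.tendsto_atTop']
    intro ε hε
    have hr : Tendsto (fun r : ℕ => C₀ * 1 * θ' ^ r) atTop (𝓝 0) := by
      simpa using (tendsto_pow_atTop_nhds_zero_of_lt_one hθ'0 hθ'1).const_mul (C₀ * 1)
    obtain ⟨r, hr⟩ := (hr.eventually_lt_const (half_pos hε)).exists
    have hKb' := hKb.const_mul (|s| * (2 * (r + 1) * C₁))
    rw [mul_zero] at hKb'
    obtain ⟨n₀, hn₀⟩ := eventually_atTop.1 ((hmixn r).and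
      (hKb'.eventually_lt_const (half_pos hε)))
    refine ⟨n₀, fun n hn => ?_⟩
    obtain ⟨h1, h2⟩ := hn₀ n hn.le
    rw [dist_zero_right]
    exact h1.trans_lt (by linarith)
  have hlast := ((squeeze_zero_norm' hcmp hE0).add hfin).add (hclt.const_mul (∫ x, (g x : ℂ) ∂m))
  rw [zero_add, zero_add] at hlast
  refine hlast.congr fun n => ?_
  simp only [hw]
  ring

end BlockCLT

section Lift

variable {X W : Type*} [PseudoMetricSpace X] [MeasurableSpace X] {S : X → X} {Y : Set X}
  {G : W → X → ℝ} {b : W → X → X} {D t lam : ℝ} {ν : Measure X}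

/-- A nonstandard central limit theorem for a map whose first return map to `Y` is a Markov
system: characteristic functions of Birkhoff sums normalized by `√(n log n)` converge. -/
theorem tendsto_integral_exp_birkhoff [Countable W] [IsProbabilityMeasure ν]
    (hS : MeasurePreserving S ν ν) (hY : MeasurableSet Y)
    (hret : ∀ p ∈ Y, ∃ n, S^[n + 1] p ∈ Y) (hhit : ∀ᵐ p ∂ν, ∃ n, S^[n] p ∈ Y)
    (H : MarkovSystem ((ν Y)⁻¹ • ν.restrict Y) (firstReturn S Y) Y G b D t lam)
    {Rw : W → ℕ} (hRw : ∀ w, ∀ y ∈ Y, returnTime S Y (b w y) = Rw w)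
    {Cr : ℝ} (hCr : 0 ≤ Cr)
    (htail : ∀ n : ℕ, ν.real (Y ∩ {p | n < returnTime S Y p}) ≤ Cr / (n + 1) ^ 2)
    {f : X → ℝ} (hf : Measurable f) {M : ℝ} (hM : ∀ x, |f x| ≤ M) (hf0 : ∫ p, f p ∂ν = 0)
    {M' : ℝ} (hfL : ∀ w, ∀ x ∈ Y, ∀ y ∈ Y,
      |excursionSum S Y f (b w x) - excursionSum S Y f (b w y)| ≤ M' * Rw w * dist x y ^ t)
    {σ : ℝ} (hσ : Tendsto (fun K : ℕ => (∫ x in Y,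
      truncObs (returnTime S Y) (excursionSum S Y f) K x ^ 2 ∂ν) / Real.log K) atTop (𝓝 σ))
    (s : ℝ) :
    Tendsto (fun n : ℕ => ∫ p, Complex.exp ((s / √(n * Real.log n) *
        ∑ l ∈ Finset.range n, f (S^[l] p) : ℝ) * Complex.I) ∂ν) atTop
      (𝓝 (Real.exp (-(s ^ 2 / 2 * (σ / 2))) : ℂ)) := by
  have hY0 : ν Y ≠ 0 := measure_pos_of_tower hS hY hret hhit (by simp)
  set m : Measure X := (ν Y)⁻¹ • ν.restrict Y with hm
  have : IsProbabilityMeasure m := ⟨by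
    rw [hm, Measure.smul_apply, Measure.restrict_apply_univ, smul_eq_mul,
      ENNReal.inv_mul_cancel hY0 (measure_ne_top _ _)]⟩
  have hκ : 0 < ν.real Y := ENNReal.toReal_pos hY0 (measure_ne_top _ _)
  have hint : ∀ {E : Type} [NormedAddCommGroup E] [NormedSpace ℝ E] (v : X → E),
      ∫ x, v x ∂m = (ν.real Y)⁻¹ • ∫ x in Y, v x ∂ν := fun {E} _ _ v => by
    rw [hm, integral_smul_measure, ENNReal.toReal_inv, measureReal_def]
  have hmS : ∀ n, Measurable S^[n] := fun n => hS.measurable.iterate n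
  have hRm := measurable_returnTime hS.measurable hY
  have hset : ∀ n, MeasurableSet {p | n < returnTime S Y p} := fun n =>
    measurableSet_lt measurable_const hRm
  have hM0 : 0 ≤ M := (abs_nonneg _).trans (hM H.nonempty.some)
  have hRi : Integrable (fun x => (returnTime S Y x : ℝ)) m :=
    (integrable_returnTime hS hY hret hhit).smul_measure (by simp [hY0])
  have hμ : ∫ x, (returnTime S Y x : ℝ) ∂m = (ν.real Y)⁻¹ := by
    have h1 := integral_excursionSum hS hY hret hhit (f := fun _ => 1) measurable_const (M := 1)
      (fun _ => by simp)
    simp only [excursionSum, Finset.sum_const, Finset.card_range, nsmul_eq_mul, mul_one,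
      integral_const, probReal_univ, smul_eq_mul] at h1
    rw [hint, h1, smul_eq_mul, mul_one]
  have ham : ∀ n : ℕ, Measurable fun p => ∑ l ∈ Finset.range n, f (S^[l + 1] p) := fun n =>
    Finset.measurable_sum _ fun l _ => hf.comp (hmS _)
  have hblock := fun l : ℕ => tendsto_integral_exp_block H hRm (fun x => one_le_returnTime x) hRw hRi
    (Cr := (ν.real Y)⁻¹ * Cr) (by positivity) (fun n => by
      rw [hm, measureReal_def, Measure.smul_apply, smul_eq_mul, ENNReal.toReal_mul,
        ENNReal.toReal_inv, Measure.restrict_apply (hset n), inter_comm, mul_div_assoc]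
      exact mul_le_mul_of_nonneg_left (htail n) (inv_nonneg.2 hκ.le))
    (measurable_excursionSum hS.measurable hY hf) (M := max M M') (le_max_of_le_left hM0)
    (fun x => (abs_excursionSum_le hM x).trans (by gcongr; exact le_max_left _ _))
    (fun w x hx y hy => (hfL w x hx y hy).trans (by
      have := Real.rpow_nonneg (dist_nonneg (x := x) (y := y)) t
      gcongr; exact le_max_right _ _))
    (by rw [hint, integral_excursionSum hS hY hret hhit hf hM, hf0, smul_zero])
    (σ := (ν.real Y)⁻¹ * σ) (by
      refine (hσ.const_mul (ν.real Y)⁻¹).congr fun K => ?_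
      rw [hint, smul_eq_mul, mul_div_assoc])
    hM0 (fun x => abs_excursionSum_le hM x) ham
    (fun n x j h1 h2 => abs_sum_iterate_sub_sum_excursionSum_le hM x h1 h2)
    (g := {p | l < returnTime S Y p}.indicator fun _ => 1)
    (measurable_const.indicator (hset l))
    (fun x => by
      by_cases h : x ∈ {p | l < returnTime S Y p}
      · rw [indicator_of_mem h, abs_one]
      · rw [indicator_of_notMem h, abs_zero]; exact zero_le_one)
    (fun w x hx y hy => by simp only [indicator, mem_ofPred_eq, hRw w x hx, hRw w y hy]) s
  have hexp : (ν.real Y)⁻¹ * σ / (2 * (ν.real Y)⁻¹) = σ / 2 := by field_simp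
  simp only [hμ, hexp] at hblock
  set E : ℂ := (Real.exp (-(s ^ 2 / 2 * (σ / 2))) : ℂ) with hE
  have hind : ∀ (l : ℕ) (v : X → ℂ),
      ∫ x, ((({p | l < returnTime S Y p}.indicator (fun _ => (1 : ℝ)) x : ℝ) : ℂ) * v x) ∂m =
        (ν.real Y)⁻¹ • ∫ x in Y ∩ {p | l < returnTime S Y p}, v x ∂ν := fun l v => by
    rw [hint, ← setIntegral_indicator (hset l)]
    congr 1
    refine integral_congr_ae (ae_of_all _ fun x => ?_)
    by_cases h : x ∈ {p | l < returnTime S Y p}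
    · simp only [indicator_of_mem h]; simp
    · simp only [indicator_of_notMem h]; simp
  have hblock' : ∀ l : ℕ, Tendsto (fun n : ℕ => ∫ p in Y ∩ {p | l < returnTime S Y p},
      Complex.exp ((s / √(n * Real.log n) * ∑ j ∈ Finset.range n, f (S^[j + 1] p) : ℝ) *
        Complex.I) ∂ν) atTop (𝓝 ((ν.real (Y ∩ {p | l < returnTime S Y p}) : ℂ) * E)) := fun l => by
    have h1 := (hblock l).const_smul (ν.real Y)
    have h2 := hind l (fun _ => 1)
    simp only [mul_one] at h2
    simp only [hind, h2] at h1
    simp only [smul_smul, mul_inv_cancel₀ hκ.ne', one_smul, setIntegral_const, ← smul_mul_assoc]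
      at h1
    rwa [Complex.real_smul, mul_one, mul_inv_cancel_left₀ hκ.ne'] at h1
  have hshift : ∀ l : ℕ, Tendsto (fun n : ℕ => ∫ p in Y ∩ {p | l < returnTime S Y p},
      Complex.exp ((s / √(n * Real.log n) * ∑ j ∈ Finset.range n, f (S^[j] (S^[l + 1] p)) : ℝ) *
        Complex.I) ∂ν) atTop (𝓝 ((ν.real (Y ∩ {p | l < returnTime S Y p}) : ℂ) * E)) := fun l => by
    have hb : Tendsto (fun n : ℕ => |s| / √(n * Real.log n) * (2 * l * M)) atTop (𝓝 0) := by
      have h1 : Tendsto (fun n : ℕ => √(n * Real.log n)) atTop atTop :=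
        Real.tendsto_sqrt_atTop.comp (tendsto_natCast_atTop_atTop.atTop_mul_atTop₀
          (Real.tendsto_log_atTop.comp tendsto_natCast_atTop_atTop))
      simpa using (h1.const_div_atTop |s|).mul_const (2 * l * M)
    have h0 : Tendsto (fun n : ℕ => (∫ p in Y ∩ {p | l < returnTime S Y p},
      Complex.exp ((s / √(n * Real.log n) * ∑ j ∈ Finset.range n, f (S^[j] (S^[l + 1] p)) : ℝ) *
        Complex.I) ∂ν) - ∫ p in Y ∩ {p | l < returnTime S Y p},
      Complex.exp ((s / √(n * Real.log n) * ∑ j ∈ Finset.range n, f (S^[j + 1] p) : ℝ) *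
        Complex.I) ∂ν) atTop (𝓝 0) := by
      refine squeeze_zero_norm (fun n => ?_) hb
      have hme : ∀ v : X → ℝ, Measurable v → Integrable (fun p =>
          Complex.exp ((s / √(n * Real.log n) * v p : ℝ) * Complex.I))
          (ν.restrict (Y ∩ {p | l < returnTime S Y p})) := fun v hv =>
        integrable_of_bdd ((Complex.measurable_ofReal.comp (hv.const_mul _)).mul_const _ |>.cexp)
          (fun x => (Complex.norm_exp_ofReal_mul_I _).le)
      have hm2 : Measurable fun p => ∑ j ∈ Finset.range n, f (S^[j] (S^[l + 1] p)) :=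
        Finset.measurable_sum _ fun j _ => hf.comp ((hmS j).comp (hmS (l + 1)))
      rw [← integral_sub (hme _ hm2) (hme _ (ham n))]
      refine (norm_integral_le_of_norm_le_const (C := |s| / √(n * Real.log n) * (2 * l * M))
        (ae_of_all _ fun p => ?_)).trans ?_
      · refine (norm_exp_mul_I_sub_le _ _).trans ?_
        rw [← mul_sub, abs_mul, abs_div, abs_of_nonneg (Real.sqrt_nonneg _)]
        have h4 := abs_sum_iterate_shift_le hM S (S p) n l
        simp only [← Function.iterate_succ_apply] at h4
        simp only [← Function.iterate_add_apply]
        exact mul_le_mul_of_nonneg_left h4 (by positivity)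
      · refine mul_le_of_le_one_right (by positivity) ?_
        rw [measureReal_restrict_apply_univ]
        exact measureReal_le_one
    simpa using h0.add (hblock' l)
  have htower := hasSum_measureReal_lt_returnTime hS hY hret hhit
  rw [probReal_univ] at htower
  have hlim := tendsto_tsum_of_dominated_convergence htower.summable hshift
    (Eventually.of_forall fun n l => (norm_integral_le_of_norm_le_const
      (ae_of_all _ fun p => (Complex.norm_exp_ofReal_mul_I _).le)).trans (by
        rw [measureReal_restrict_apply_univ, one_mul]))
  have hsum : ∑' l, (ν.real (Y ∩ {p | l < returnTime S Y p}) : ℂ) * E = E := by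
    rw [tsum_mul_right, ← Complex.ofReal_tsum, htower.tsum_eq, Complex.ofReal_one, one_mul]
  rw [hsum] at hlim
  refine hlim.congr fun n => ?_
  refine (hasSum_integral_tower hS hY hret hhit (f := fun p => Complex.exp ((s / √(n * Real.log n) *
        ∑ l ∈ Finset.range n, f (S^[l] p) : ℝ) * Complex.I)) (integrable_of_bdd
    ((Complex.measurable_ofReal.comp ((Finset.measurable_sum _ fun j _ =>
      hf.comp (hmS j)).const_mul _)).mul_const _ |>.cexp)
      (fun x => (Complex.norm_exp_ofReal_mul_I _).le))).tsum_eq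

end Lift

section Symbols

/-- The exponent selected by a noise symbol (`true` for the interval `[0,p₁)`). -/
def symExp (α β : ℝ) (i : Bool) : ℝ := cond i α β

/-- The probability of a noise symbol. -/
def symProb (p₁ : ℝ) (i : Bool) : ℝ := cond i p₁ (1 - p₁)

/-- The inverse branches of the noise map. -/
def noiseInv (p₁ : ℝ) (i : Bool) (ω : ℝ) : ℝ := cond i (p₁ * ω) (p₁ + (1 - p₁) * ω)

/-- The inverse branches of the skew product landing in `x ≤ 1/2`. -/
def leftMap (α β p₁ : ℝ) (i : Bool) (p : ℝ × ℝ) : ℝ × ℝ :=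
  (leftInv (symExp α β i) p.1, noiseInv p₁ i p.2)

/-- The inverse branches of the skew product landing in `x > 1/2`. -/
def rightMap (p₁ : ℝ) (i : Bool) (p : ℝ × ℝ) : ℝ × ℝ := ((1 + p.1) / 2, noiseInv p₁ i p.2)

/-- The Jacobian of `leftMap`. -/
def leftJac (α β p₁ : ℝ) (i : Bool) (p : ℝ × ℝ) : ℝ :=
  symProb p₁ i * (leftDeriv (symExp α β i) (leftInv (symExp α β i) p.1))⁻¹

/-- Composition of left inverse branches along a word. -/
def wordMap (α β p₁ : ℝ) : List Bool → ℝ × ℝ → ℝ × ℝ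
  | [], p => p
  | i :: w, p => leftMap α β p₁ i (wordMap α β p₁ w p)

/-- The Jacobian of `wordMap`. -/
def wordJac (α β p₁ : ℝ) : List Bool → ℝ × ℝ → ℝ
  | [], _ => 1
  | i :: w, p => wordJac α β p₁ w p * leftJac α β p₁ i (wordMap α β p₁ w p)

/-- The inverse branches of the first return map to `x > 1/2`. -/
def returnBranch (α β p₁ : ℝ) (w : Bool × List Bool) (p : ℝ × ℝ) : ℝ × ℝ :=
  rightMap p₁ w.1 (wordMap α β p₁ w.2 p)

/-- The Jacobian of `returnBranch`. -/
def returnJac (α β p₁ : ℝ) (w : Bool × List Bool) (p : ℝ × ℝ) : ℝ :=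
  wordJac α β p₁ w.2 p * (symProb p₁ w.1 / 2)

/-- The invariant strip on which the skew product is full-branched. -/
def strip : Set (ℝ × ℝ) := Ioc 0 1 ×ˢ Ico 0 1

/-- The inducing domain inside the strip. -/
def base : Set (ℝ × ℝ) := Ioc (1 / 2) 1 ×ˢ Ico 0 1

/-- Admissible parameters for the random LSV system. -/
structure LSVParam (α β p₁ : ℝ) : Prop where
  alpha_pos : 0 < α
  alpha_le : α ≤ 1
  beta_pos : 0 < β
  beta_le : β ≤ 1
  prob_pos : 0 < p₁
  prob_lt : p₁ < 1

variable {α β p₁ : ℝ}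

theorem base_subset_strip : base ⊆ strip :=
  prod_mono (Ioc_subset_Ioc_left (by norm_num)) subset_rfl

theorem measurableSet_strip : MeasurableSet strip := measurableSet_Ioc.prod measurableSet_Ico

theorem measurableSet_base : MeasurableSet base := measurableSet_Ioc.prod measurableSet_Ico

theorem measurable_phiMap : Measurable (phiMap p₁) := by
  unfold phiMap
  exact Measurable.ite measurableSet_Iio (by fun_prop) (by fun_prop)

theorem measurable_lsv (a : ℝ) : Measurable (lsv a) := by
  unfold lsv
  exact Measurable.ite measurableSet_Iic (by fun_prop) (by fun_prop)

theorem measurable_skewLSV : Measurable (skewLSV α β p₁) := by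
  have h : skewLSV α β p₁ = fun p => (if p.2 < p₁ then lsv α p.1 else lsv β p.1, phiMap p₁ p.2) := by
    ext p
    · simp only [skewLSV, alphaOf]; split_ifs <;> rfl
    · rfl
  rw [h]
  exact (Measurable.ite (measurableSet_lt measurable_snd measurable_const)
    ((measurable_lsv α).comp measurable_fst) ((measurable_lsv β).comp measurable_fst)).prodMk
    (measurable_phiMap.comp measurable_snd)

theorem measurable_noiseInv (i : Bool) : Measurable (noiseInv p₁ i) := by
  cases i
  · exact (measurable_id.const_mul _).const_add _
  · exact measurable_id.const_mul _

theorem measurable_leftMap (i : Bool) : Measurable (leftMap α β p₁ i) :=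
  (measurable_leftInv.comp measurable_fst).prodMk ((measurable_noiseInv i).comp measurable_snd)

theorem measurable_rightMap (i : Bool) : Measurable (rightMap p₁ i) :=
  ((measurable_fst.const_add 1).div_const 2).prodMk ((measurable_noiseInv i).comp measurable_snd)

theorem measurable_wordMap : ∀ w : List Bool, Measurable (wordMap α β p₁ w)
  | [] => measurable_id
  | i :: w => (measurable_leftMap i).comp (measurable_wordMap w)

theorem measurable_leftDeriv (a : ℝ) : Measurable (leftDeriv a) := by
  unfold leftDeriv
  fun_prop

theorem measurable_leftJac (i : Bool) : Measurable (leftJac α β p₁ i) :=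
  ((measurable_leftDeriv _).comp (measurable_leftInv.comp measurable_fst)).inv.const_mul _

theorem measurable_wordJac : ∀ w : List Bool, Measurable (wordJac α β p₁ w)
  | [] => measurable_const
  | i :: w => (measurable_wordJac w).mul ((measurable_leftJac i).comp (measurable_wordMap w))

theorem measurable_returnBranch (w : Bool × List Bool) : Measurable (returnBranch α β p₁ w) :=
  (measurable_rightMap _).comp (measurable_wordMap _)

theorem measurable_returnJac (w : Bool × List Bool) : Measurable (returnJac α β p₁ w) :=
  (measurable_wordJac _).mul_const _

namespace LSVParam

variable (P : LSVParam α β p₁)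
include P

theorem symExp_pos (i : Bool) : 0 < symExp α β i := by
  cases i
  · exact P.beta_pos
  · exact P.alpha_pos

theorem symExp_le (i : Bool) : symExp α β i ≤ 1 := by
  cases i
  · exact P.beta_le
  · exact P.alpha_le

theorem symProb_pos (i : Bool) : 0 < symProb p₁ i := by
  cases i
  · exact sub_pos.2 P.prob_lt
  · exact P.prob_pos

theorem noiseInv_mem (i : Bool) {ω : ℝ} (h : ω ∈ Ico (0 : ℝ) 1) : noiseInv p₁ i ω ∈ Ico (0 : ℝ) 1 := by
  have h1 := P.prob_pos
  have h2 := P.prob_lt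
  obtain ⟨h3, h4⟩ := h
  cases i <;> simp only [noiseInv, cond_true, cond_false] <;> constructor <;> nlinarith

theorem noiseInv_lt_iff (i : Bool) {ω : ℝ} (h : ω ∈ Ico (0 : ℝ) 1) :
    noiseInv p₁ i ω < p₁ ↔ i = true := by
  have h1 := P.prob_pos
  have h2 := P.prob_lt
  obtain ⟨h3, h4⟩ := h
  cases i <;> simp only [noiseInv, cond_true, cond_false, iff_true, Bool.false_eq_true, iff_false,
    not_lt] <;> nlinarith

theorem phiMap_noiseInv (i : Bool) {ω : ℝ} (h : ω ∈ Ico (0 : ℝ) 1) :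
    phiMap p₁ (noiseInv p₁ i ω) = ω := by
  have h1 := P.prob_pos
  have h2 := sub_pos.2 P.prob_lt
  have h3 := P.noiseInv_lt_iff i h
  unfold phiMap
  cases i
  · rw [if_neg (by simp [h3])]
    simp only [noiseInv, cond_false]
    field_simp
    ring
  · rw [if_pos (h3.2 rfl)]
    simp only [noiseInv, cond_true]
    field_simp

theorem alphaOf_noiseInv (i : Bool) {ω : ℝ} (h : ω ∈ Ico (0 : ℝ) 1) :
    alphaOf α β p₁ (noiseInv p₁ i ω) = symExp α β i := by
  have h3 := P.noiseInv_lt_iff i h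
  unfold alphaOf
  cases i
  · rw [if_neg (by simp [h3])]; rfl
  · rw [if_pos (h3.2 rfl)]; rfl

theorem noiseInv_phiMap {ω : ℝ} : noiseInv p₁ (decide (ω < p₁)) (phiMap p₁ ω) = ω := by
  have h1 := P.prob_pos
  have h2 := sub_pos.2 P.prob_lt
  unfold phiMap
  by_cases h : ω < p₁
  · simp only [h, decide_true, if_true, noiseInv, cond_true]
    field_simp
  · simp only [h, decide_false, if_false, noiseInv, cond_false]
    field_simp
    ring

theorem phiMap_mem {ω : ℝ} (h : ω ∈ Ico (0 : ℝ) 1) : phiMap p₁ ω ∈ Ico (0 : ℝ) 1 := by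
  have h1 := P.prob_pos
  have h2 := sub_pos.2 P.prob_lt
  obtain ⟨h3, h4⟩ := h
  unfold phiMap
  split_ifs with h
  · exact ⟨by positivity, by rwa [div_lt_one h1]⟩
  · exact ⟨div_nonneg (by linarith) h2.le, by rw [div_lt_one h2]; linarith⟩

theorem leftMap_mem (i : Bool) {p : ℝ × ℝ} (h : p ∈ strip) :
    leftMap α β p₁ i p ∈ Ioc (0 : ℝ) (1 / 2) ×ˢ Ico (0 : ℝ) 1 :=
  ⟨⟨leftInv_pos (P.symExp_pos i) h.1,
    (leftInv_mem (P.symExp_pos i) (Ioc_subset_Icc_self h.1)).2⟩, P.noiseInv_mem i h.2⟩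

theorem leftMap_mem_strip (i : Bool) {p : ℝ × ℝ} (h : p ∈ strip) : leftMap α β p₁ i p ∈ strip :=
  prod_mono (Ioc_subset_Ioc_right (by norm_num)) subset_rfl (P.leftMap_mem i h)

theorem leftMap_notMem_base (i : Bool) {p : ℝ × ℝ} (h : p ∈ strip) :
    leftMap α β p₁ i p ∉ base := fun h1 => by
  have := (P.leftMap_mem i h).1.2
  exact absurd h1.1.1 (not_lt.2 this)

theorem rightMap_mem (i : Bool) {p : ℝ × ℝ} (h : p ∈ strip) : rightMap p₁ i p ∈ base :=
  ⟨⟨by have := h.1.1; simp only [rightMap]; linarith,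
    by have := h.1.2; simp only [rightMap]; linarith⟩, P.noiseInv_mem i h.2⟩

theorem skewLSV_leftMap (i : Bool) {p : ℝ × ℝ} (h : p ∈ strip) :
    skewLSV α β p₁ (leftMap α β p₁ i p) = p := by
  have h1 := P.leftMap_mem i h
  refine Prod.ext ?_ (P.phiMap_noiseInv i h.2)
  show lsv (alphaOf α β p₁ (noiseInv p₁ i p.2)) _ = _
  rw [P.alphaOf_noiseInv i h.2, lsv, if_pos h1.1.2]
  exact leftBranch_leftInv (P.symExp_pos i) (Ioc_subset_Icc_self h.1)

theorem skewLSV_rightMap (i : Bool) {p : ℝ × ℝ} (h : p ∈ strip) :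
    skewLSV α β p₁ (rightMap p₁ i p) = p := by
  have h1 := P.rightMap_mem i h
  refine Prod.ext ?_ (P.phiMap_noiseInv i h.2)
  show lsv _ _ = _
  rw [lsv, if_neg (not_le.2 h1.1.1)]
  simp only [rightMap]
  ring

theorem leftMap_skewLSV {p : ℝ × ℝ} (h : p ∈ strip) (hb : p ∉ base) :
    leftMap α β p₁ (decide (p.2 < p₁)) (skewLSV α β p₁ p) = p := by
  have h1 : p.1 ≤ 1 / 2 := not_lt.1 fun h2 => hb ⟨⟨h2, h.1.2⟩, h.2⟩
  refine Prod.ext ?_ P.noiseInv_phiMap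
  show leftInv _ (lsv _ _) = _
  rw [lsv, if_pos h1, show symExp α β (decide (p.2 < p₁)) = alphaOf α β p₁ p.2 by
    unfold alphaOf symExp; by_cases h2 : p.2 < p₁ <;> simp [h2]]
  refine leftInv_leftBranch ?_ ⟨h.1.1.le, h1⟩
  unfold alphaOf
  split_ifs
  exacts [P.alpha_pos, P.beta_pos]

theorem rightMap_skewLSV {p : ℝ × ℝ} (hb : p ∈ base) :
    rightMap p₁ (decide (p.2 < p₁)) (skewLSV α β p₁ p) = p := by
  refine Prod.ext ?_ P.noiseInv_phiMap
  show (1 + lsv _ _) / 2 = _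
  rw [lsv, if_neg (not_le.2 hb.1.1)]
  ring

theorem skewLSV_mem {p : ℝ × ℝ} (h : p ∈ strip) : skewLSV α β p₁ p ∈ strip := by
  refine ⟨?_, P.phiMap_mem h.2⟩
  show lsv _ _ ∈ _
  unfold lsv
  split_ifs with h1
  · refine leftBranch_mem ?_ ⟨h.1.1, h1⟩
    unfold alphaOf
    split_ifs
    exacts [P.alpha_pos, P.beta_pos]
  · have := h.1.2
    constructor <;> linarith

theorem wordMap_mem : ∀ (w : List Bool) {p : ℝ × ℝ}, p ∈ strip → wordMap α β p₁ w p ∈ strip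
  | [], _, h => h
  | i :: w, _, h => P.leftMap_mem_strip i (wordMap_mem w h)

theorem returnBranch_mem (w : Bool × List Bool) {p : ℝ × ℝ} (h : p ∈ strip) :
    returnBranch α β p₁ w p ∈ base := P.rightMap_mem _ (P.wordMap_mem _ h)

theorem iterate_wordMap : ∀ (w : List Bool) (k : ℕ), k ≤ w.length → ∀ {p : ℝ × ℝ}, p ∈ strip →
    (skewLSV α β p₁)^[k] (wordMap α β p₁ w p) = wordMap α β p₁ (w.drop k) p
  | _, 0, _, _, _ => rfl
  | [], k + 1, hk, _, _ => absurd hk (by simp)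
  | i :: w, k + 1, hk, p, h => by
    rw [Function.iterate_succ_apply, wordMap, P.skewLSV_leftMap i (P.wordMap_mem w h),
      List.drop_succ_cons]
    exact iterate_wordMap w k (by simpa using hk) h

theorem iterate_returnBranch (w : Bool × List Bool) {k : ℕ} (hk : k ≤ w.2.length) {p : ℝ × ℝ}
    (h : p ∈ strip) : (skewLSV α β p₁)^[k + 1] (returnBranch α β p₁ w p) =
      wordMap α β p₁ (w.2.drop k) p := by
  rw [Function.iterate_succ_apply, returnBranch, P.skewLSV_rightMap _ (P.wordMap_mem _ h),
    P.iterate_wordMap _ _ hk h]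

theorem wordMap_cons_notMem_base {w : List Bool} (hw : w ≠ []) {p : ℝ × ℝ} (h : p ∈ strip) :
    wordMap α β p₁ w p ∉ base := by
  cases w with
  | nil => exact absurd rfl hw
  | cons i w => exact P.leftMap_notMem_base i (P.wordMap_mem w h)

/-- Every point of the strip reaches the base. -/
theorem exists_iterate_mem_base {p : ℝ × ℝ} (h : p ∈ strip) :
    ∃ n, (skewLSV α β p₁)^[n] p ∈ base := by
  obtain ⟨N, hN⟩ := exists_nat_gt (1 / p.1)
  induction N generalizing p with
  | zero => exact absurd hN (not_lt.2 (by have := h.1.1; simp; positivity))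
  | succ N ih =>
    by_cases hb : p ∈ base
    · exact ⟨0, hb⟩
    · have h1 := P.skewLSV_mem h
      have h2 := one_div_leftInv_ge (P.symExp_pos (decide (p.2 < p₁))) (P.symExp_le _) h1.1
      have h3 : leftInv (symExp α β (decide (p.2 < p₁))) (skewLSV α β p₁ p).1 = p.1 :=
        congrArg Prod.fst (P.leftMap_skewLSV h hb)
      rw [h3] at h2
      push_cast at hN
      obtain ⟨n, hn⟩ := ih h1 (by linarith)
      exact ⟨n + 1, hn⟩

theorem exists_iterate_succ_mem_base {p : ℝ × ℝ} (h : p ∈ strip) :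
    ∃ n, (skewLSV α β p₁)^[n + 1] p ∈ base :=
  P.exists_iterate_mem_base (P.skewLSV_mem h)

theorem returnTime_returnBranch (w : Bool × List Bool) {p : ℝ × ℝ} (h : p ∈ base) :
    returnTime (skewLSV α β p₁) base (returnBranch α β p₁ w p) = w.2.length + 1 := by
  have hs := base_subset_strip h
  have hr := P.exists_iterate_succ_mem_base (base_subset_strip (P.returnBranch_mem w hs))
  refine le_antisymm (not_lt.1 fun h1 => ?_) (Nat.succ_le_of_lt ?_)
  · rw [lt_returnTime_iff hr] at h1
    refine h1 w.2.length (Nat.lt_succ_self _) ?_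
    rw [P.iterate_returnBranch w le_rfl hs, List.drop_length]
    exact h
  · rw [lt_returnTime_iff hr]
    intro k hk
    rw [P.iterate_returnBranch w hk.le hs]
    exact P.wordMap_cons_notMem_base (by simpa using hk) hs

theorem firstReturn_returnBranch (w : Bool × List Bool) {p : ℝ × ℝ} (h : p ∈ base) :
    firstReturn (skewLSV α β p₁) base (returnBranch α β p₁ w p) = p := by
  rw [firstReturn, P.returnTime_returnBranch w h,
    P.iterate_returnBranch w le_rfl (base_subset_strip h), List.drop_length]
  rfl

end LSVParam

end Symbols

section BranchMeasures

theorem map_affine_restrict {c : ℝ} (hc : 0 < c) (d : ℝ) {s t : Set ℝ} (ht : MeasurableSet t)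
    (hst : (fun x => c * x + d) ⁻¹' t = s) :
    (ENNReal.ofReal c • volume.restrict s).map (fun x => c * x + d) = volume.restrict t := by
  have hm : Measurable fun x : ℝ => c * x + d := by fun_prop
  have h1 : (volume : Measure ℝ).map (fun x => c * x + d) = ENNReal.ofReal c⁻¹ • volume := by
    rw [show (fun x => c * x + d) = (fun x => x + d) ∘ (fun x => c * x) from rfl,
      ← Measure.map_map (by fun_prop) (by fun_prop), Real.map_volume_mul_left hc.ne',
      abs_of_pos (inv_pos.2 hc), Measure.map_smul, map_add_right_eq_self]
  rw [Measure.map_smul, ← hst, ← Measure.restrict_map hm ht, h1, Measure.restrict_smul, smul_smul,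
    ← ENNReal.ofReal_mul hc.le, mul_inv_cancel₀ hc.ne', ENNReal.ofReal_one, one_smul]

theorem lintegral_prod_branch {A A' B B' : Set ℝ} {g ψ : ℝ → ℝ} {d : ℝ → ENNReal} {c : ENNReal}
    (hg : Measurable g) (hψ : Measurable ψ) (hd : Measurable d)
    (hA : ((volume.restrict A).withDensity d).map g = volume.restrict A')
    (hB : (c • volume.restrict B).map ψ = volume.restrict B') {u : ℝ × ℝ → ENNReal}
    (hu : Measurable u) : ∫⁻ p in A' ×ˢ B', u p =
      ∫⁻ p in A ×ˢ B, c * d p.1 * u (g p.1, ψ p.2) := by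
  have : SFinite (c • volume.restrict B) := inferInstance
  have hf : Measurable fun p : ℝ × ℝ => d p.1 := hd.comp measurable_fst
  have hug : Measurable fun p => u (Prod.map g ψ p) := hu.comp (hg.prodMap hψ)
  rw [Measure.volume_eq_prod, ← Measure.prod_restrict, ← hA, ← hB,
    Measure.map_prod_map _ _ hg hψ, lintegral_map hu (hg.prodMap hψ),
    Measure.prod_smul_right, lintegral_smul_measure, prod_withDensity_left hd,
    lintegral_withDensity_eq_lintegral_mul _ hf hug, Measure.prod_restrict, smul_eq_mul,
    ← lintegral_const_mul _ (hf.mul hug)]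
  refine lintegral_congr fun p => ?_
  rw [Pi.mul_apply, mul_assoc]
  rfl

/-- The set of noise parameters starting with a given symbol. -/
def noiseCell (p₁ : ℝ) (i : Bool) : Set ℝ := cond i (Ico 0 p₁) (Ico p₁ 1)

variable {α β p₁ : ℝ}

theorem measurableSet_noiseCell (i : Bool) : MeasurableSet (noiseCell p₁ i) := by
  cases i
  exacts [measurableSet_Ico, measurableSet_Ico]

namespace LSVParam

variable (P : LSVParam α β p₁)
include P

omit P in
theorem mem_noiseCell_iff {i : Bool} {ω : ℝ} (h : ω ∈ Ico (0 : ℝ) 1) :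
    ω ∈ noiseCell p₁ i ↔ decide (ω < p₁) = i := by
  obtain ⟨h1, h2⟩ := h
  cases i <;> simp [noiseCell, h1, h2]

theorem noiseCell_subset (i : Bool) : noiseCell p₁ i ⊆ Ico 0 1 := by
  cases i
  · exact Ico_subset_Ico_left P.prob_pos.le
  · exact Ico_subset_Ico_right P.prob_lt.le

theorem map_noiseInv (i : Bool) :
    (ENNReal.ofReal (symProb p₁ i) • volume.restrict (Ico (0 : ℝ) 1)).map (noiseInv p₁ i) =
      volume.restrict (noiseCell p₁ i) := by
  have h1 := P.prob_pos
  have h2 := sub_pos.2 P.prob_lt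
  cases i
  · have h3 : (fun ω => (1 - p₁) * ω + p₁) ⁻¹' noiseCell p₁ false = Ico 0 1 := by
      ext ω
      simp only [noiseCell, cond_false, mem_preimage, mem_Ico]
      constructor <;> rintro ⟨h3, h4⟩ <;> constructor <;> nlinarith
    rw [← map_affine_restrict h2 p₁ (measurableSet_noiseCell false) h3]
    congr 1
    ext ω
    exact add_comm _ _
  · have h3 : (fun ω => p₁ * ω + 0) ⁻¹' noiseCell p₁ true = Ico 0 1 := by
      ext ω
      simp only [noiseCell, cond_true, mem_preimage, mem_Ico]
      constructor <;> rintro ⟨h3, h4⟩ <;> constructor <;> nlinarith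
    rw [← map_affine_restrict h1 0 (measurableSet_noiseCell true) h3]
    congr 1
    ext ω
    exact (add_zero _).symm

theorem leftJac_nonneg (i : Bool) {p : ℝ × ℝ} (h : p ∈ strip) : 0 < leftJac α β p₁ i p :=
  mul_pos (P.symProb_pos i) (inv_pos.2 (one_pos.trans_le
    (one_le_leftDeriv (P.symExp_pos i) (P.leftMap_mem i h).1.1.le)))

theorem lintegral_leftCell (i : Bool) {u : ℝ × ℝ → ENNReal} (hu : Measurable u) :
    ∫⁻ p in Ioc 0 (1 / 2) ×ˢ noiseCell p₁ i, u p =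
      ∫⁻ p in strip, ENNReal.ofReal (leftJac α β p₁ i p) * u (leftMap α β p₁ i p) := by
  rw [lintegral_prod_branch measurable_leftInv (measurable_noiseInv i)
    (((measurable_leftDeriv _).comp measurable_leftInv).inv.ennreal_ofReal)
    (map_leftInv (P.symExp_pos i)) (P.map_noiseInv i) hu]
  refine lintegral_congr fun p => ?_
  rw [leftJac, ENNReal.ofReal_mul (P.symProb_pos i).le]
  rfl

theorem lintegral_rightCell (i : Bool) {u : ℝ × ℝ → ENNReal} (hu : Measurable u) :
    ∫⁻ p in Ioc (1 / 2) 1 ×ˢ noiseCell p₁ i, u p =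
      ∫⁻ p in strip, ENNReal.ofReal (symProb p₁ i / 2) * u (rightMap p₁ i p) := by
  have h1 : ((volume.restrict (Ioc (0 : ℝ) 1)).withDensity fun _ => ENNReal.ofReal (1 / 2)).map
      (fun x => (1 + x) / 2) = volume.restrict (Ioc (1 / 2 : ℝ) 1) := by
    rw [withDensity_const]
    have h3 : (fun x : ℝ => 1 / 2 * x + 1 / 2) ⁻¹' Ioc (1 / 2) 1 = Ioc 0 1 := by
      ext x
      simp only [mem_preimage, mem_Ioc]
      constructor <;> rintro ⟨h3, h4⟩ <;> constructor <;> linarith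
    rw [← map_affine_restrict (c := 1 / 2) (by norm_num) (1 / 2) measurableSet_Ioc h3]
    congr 1
    ext x
    ring
  rw [lintegral_prod_branch (by fun_prop) (measurable_noiseInv i) measurable_const h1
    (P.map_noiseInv i) hu]
  refine lintegral_congr fun p => ?_
  rw [show symProb p₁ i / 2 = symProb p₁ i * (1 / 2) by ring,
    ENNReal.ofReal_mul (P.symProb_pos i).le]
  rfl

/-- The cylinder of points reaching the base after following a word of left symbols. -/
def _root_.wordCell (α β p₁ : ℝ) : List Bool → Set (ℝ × ℝ)
  | [] => base
  | i :: w => (Ioc 0 (1 / 2) ×ˢ noiseCell p₁ i) ∩ skewLSV α β p₁ ⁻¹' wordCell α β p₁ w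

omit P in
theorem _root_.measurableSet_wordCell : ∀ w : List Bool, MeasurableSet (wordCell α β p₁ w)
  | [] => measurableSet_base
  | i :: w => (measurableSet_Ioc.prod (measurableSet_noiseCell i)).inter
      (measurable_skewLSV (measurableSet_wordCell w))

theorem wordCell_subset : ∀ w : List Bool, wordCell α β p₁ w ⊆ strip
  | [] => base_subset_strip
  | i :: w => inter_subset_left.trans
      (prod_mono (Ioc_subset_Ioc_right (by norm_num)) (P.noiseCell_subset i))

theorem wordCell_injective : ∀ {v w : List Bool} {p : ℝ × ℝ}, p ∈ wordCell α β p₁ v →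
    p ∈ wordCell α β p₁ w → v = w
  | [], [], _, _, _ => rfl
  | [], i :: w, p, h1, h2 => absurd h1.1.1 (not_lt.2 h2.1.1.2)
  | i :: v, [], p, h1, h2 => absurd h2.1.1 (not_lt.2 h1.1.1.2)
  | i :: v, j :: w, p, h1, h2 => by
    have h3 := P.noiseCell_subset i h1.1.2
    rw [wordCell_injective h1.2 h2.2, ← (mem_noiseCell_iff h3).1 h1.1.2,
      ← (mem_noiseCell_iff h3).1 h2.1.2]

theorem exists_mem_wordCell {p : ℝ × ℝ} (h : p ∈ strip) : ∃ w, p ∈ wordCell α β p₁ w := by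
  obtain ⟨n, hn⟩ := P.exists_iterate_mem_base h
  induction n generalizing p with
  | zero => exact ⟨[], hn⟩
  | succ n ih =>
    by_cases hb : p ∈ base
    · exact ⟨[], hb⟩
    · obtain ⟨w, hw⟩ := ih (P.skewLSV_mem h) hn
      have h1 : p.1 ≤ 1 / 2 := not_lt.1 fun h2 => hb ⟨⟨h2, h.1.2⟩, h.2⟩
      exact ⟨decide (p.2 < p₁) :: w, ⟨⟨h.1.1, h1⟩, (mem_noiseCell_iff h.2).2 rfl⟩, hw⟩

theorem iUnion_wordCell : ⋃ w, wordCell α β p₁ w = strip :=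
  Subset.antisymm (iUnion_subset P.wordCell_subset) fun _ h => mem_iUnion.2 (P.exists_mem_wordCell h)

theorem wordJac_pos : ∀ (w : List Bool) {p : ℝ × ℝ}, p ∈ strip → 0 < wordJac α β p₁ w p
  | [], _, _ => one_pos
  | i :: w, _, h => mul_pos (wordJac_pos w h) (P.leftJac_nonneg i (P.wordMap_mem w h))

theorem returnJac_pos (w : Bool × List Bool) {p : ℝ × ℝ} (h : p ∈ strip) :
    0 < returnJac α β p₁ w p :=
  mul_pos (P.wordJac_pos _ h) (half_pos (P.symProb_pos _))

theorem lintegral_wordCell : ∀ (w : List Bool) {u : ℝ × ℝ → ENNReal}, Measurable u →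
    ∫⁻ p in wordCell α β p₁ w, u p =
      ∫⁻ p in base, ENNReal.ofReal (wordJac α β p₁ w p) * u (wordMap α β p₁ w p)
  | [], u, _ => by simp [wordCell, wordJac, wordMap]
  | i :: w, u, hu => by
    have hE : MeasurableSet (skewLSV α β p₁ ⁻¹' wordCell α β p₁ w) :=
      measurable_skewLSV (measurableSet_wordCell w)
    have hJ : Measurable fun p => ENNReal.ofReal (leftJac α β p₁ i p) * u (leftMap α β p₁ i p) :=
      (measurable_leftJac i).ennreal_ofReal.mul (hu.comp (measurable_leftMap i))
    have h1 : ∫⁻ p in wordCell α β p₁ (i :: w), u p =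
        ∫⁻ p in wordCell α β p₁ w,
          ENNReal.ofReal (leftJac α β p₁ i p) * u (leftMap α β p₁ i p) := by
      rw [wordCell, inter_comm, ← setLIntegral_indicator hE, P.lintegral_leftCell i (hu.indicator hE)]
      have h2 : wordCell α β p₁ w = wordCell α β p₁ w ∩ strip :=
        (inter_eq_left.2 (P.wordCell_subset w)).symm
      conv_rhs => rw [h2, ← setLIntegral_indicator (measurableSet_wordCell w)]
      refine setLIntegral_congr_fun measurableSet_strip fun p hp => ?_
      by_cases h3 : p ∈ wordCell α β p₁ w
      · simp only [indicator_of_mem h3]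
        rw [indicator_of_mem (by rwa [mem_preimage, P.skewLSV_leftMap i hp])]
      · simp only [indicator_of_notMem h3]
        rw [indicator_of_notMem (by rwa [mem_preimage, P.skewLSV_leftMap i hp]), mul_zero]
    rw [h1, lintegral_wordCell w hJ]
    refine setLIntegral_congr_fun measurableSet_base fun p hp => ?_
    rw [wordJac, ENNReal.ofReal_mul (P.wordJac_pos w (base_subset_strip hp)).le, mul_assoc]
    rfl

/-- Change of variables for the first return map. -/
theorem lintegral_base {u : ℝ × ℝ → ENNReal} (hu : Measurable u) :
    ∫⁻ p in base, u p = ∑' w : Bool × List Bool,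
      ∫⁻ p in base, ENNReal.ofReal (returnJac α β p₁ w p) * u (returnBranch α β p₁ w p) := by
  have h1 : base = ⋃ i : Bool, Ioc (1 / 2 : ℝ) 1 ×ˢ noiseCell p₁ i := by
    rw [← prod_iUnion]
    refine congrArg _ (Subset.antisymm (fun ω hω => mem_iUnion.2 ⟨_, (mem_noiseCell_iff hω).2 rfl⟩)
      (iUnion_subset P.noiseCell_subset))
  have hd : Pairwise (Function.onFun Disjoint fun i : Bool => Ioc (1 / 2 : ℝ) 1 ×ˢ noiseCell p₁ i) := by
    intro i j hij
    refine disjoint_left.2 fun p h2 h3 => hij ?_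
    have h4 := P.noiseCell_subset i h2.2
    rw [← (mem_noiseCell_iff h4).1 h2.2, ← (mem_noiseCell_iff h4).1 h3.2]
  conv_lhs => rw [h1, lintegral_iUnion (fun i => measurableSet_Ioc.prod (measurableSet_noiseCell i)) hd]
  rw [ENNReal.summable.tsum_prod' fun _ => ENNReal.summable]
  refine tsum_congr fun i => ?_
  rw [P.lintegral_rightCell i hu, ← P.iUnion_wordCell, lintegral_iUnion measurableSet_wordCell
    fun v w hvw => disjoint_left.2 fun p h2 h3 => hvw (P.wordCell_injective h2 h3)]
  refine tsum_congr fun w => ?_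
  have hur : Measurable fun p => ENNReal.ofReal (symProb p₁ i / 2) * u (rightMap p₁ i p) :=
    (hu.comp (measurable_rightMap i)).const_mul _
  rw [P.lintegral_wordCell w hur]
  refine setLIntegral_congr_fun measurableSet_base fun p hp => ?_
  rw [returnJac, ENNReal.ofReal_mul (P.wordJac_pos w (base_subset_strip hp)).le, mul_assoc]
  rfl

end LSVParam

end BranchMeasures

section BranchGeometry

variable {α β p₁ : ℝ}

/-- A contraction rate for the inverse branches of the first return map. -/
def contractionRate (p₁ : ℝ) : ℝ := max (1 / 2) (max p₁ (1 - p₁))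

theorem contractionRate_nonneg : 0 ≤ contractionRate p₁ :=
  le_max_of_le_left (by norm_num)

theorem dist_le_one_of_mem_base {p q : ℝ × ℝ} (hp : p ∈ base) (hq : q ∈ base) : dist p q ≤ 1 := by
  rw [Prod.dist_eq, Real.dist_eq, Real.dist_eq]
  obtain ⟨⟨h1, h2⟩, h3, h4⟩ := hp
  obtain ⟨⟨h5, h6⟩, h7, h8⟩ := hq
  refine max_le ?_ ?_ <;> rw [abs_le] <;> constructor <;> linarith

/-- Points with an almost everywhere valid property are dense in the base. -/
theorem exists_mem_base_dist_lt {Q : ℝ × ℝ → Prop} (hQ : ∀ᵐ p ∂volume.restrict base, Q p)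
    {y : ℝ × ℝ} (hy : y ∈ base) {d : ℝ} (hd : 0 < d) : ∃ z ∈ base, dist y z < d ∧ Q z := by
  obtain ⟨⟨h1, h2⟩, h3, h4⟩ := hy
  have hopen : IsOpen (Ioo (max (1 / 2) (y.1 - d)) y.1 ×ˢ Ioo y.2 (min 1 (y.2 + d))) :=
    isOpen_Ioo.prod isOpen_Ioo
  have hne : (Ioo (max (1 / 2) (y.1 - d)) y.1 ×ˢ Ioo y.2 (min 1 (y.2 + d))).Nonempty :=
    (nonempty_Ioo.2 (max_lt h1 (by linarith))).prod (nonempty_Ioo.2 (lt_min h4 (by linarith)))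
  have hpos := hopen.measure_pos volume hne
  have hfr : ∃ᵐ z ∂(volume : Measure (ℝ × ℝ)),
      z ∈ Ioo (max (1 / 2) (y.1 - d)) y.1 ×ˢ Ioo y.2 (min 1 (y.2 + d)) := by
    rw [frequently_ae_iff]
    exact hpos.ne'
  obtain ⟨z, ⟨⟨hz1, hz2⟩, hz3, hz4⟩, hz5⟩ :=
    (hfr.and_eventually ((ae_restrict_iff' measurableSet_base).1 hQ)).exists
  rw [max_lt_iff] at hz1
  rw [lt_min_iff] at hz4
  have hzb : z ∈ base := ⟨⟨hz1.1, hz2.le.trans h2⟩, h3.trans hz3.le, hz4.1⟩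
  refine ⟨z, hzb, ?_, hz5 hzb⟩
  rw [Prod.dist_eq, Real.dist_eq, Real.dist_eq]
  refine max_lt ?_ ?_ <;> rw [abs_lt] <;> constructor <;> linarith

namespace LSVParam

variable (P : LSVParam α β p₁)
include P

theorem contractionRate_lt : contractionRate p₁ < 1 :=
  max_lt (by norm_num) (max_lt P.prob_lt (by linarith [P.prob_pos]))

theorem abs_noiseInv_sub (i : Bool) (x y : ℝ) :
    |noiseInv p₁ i x - noiseInv p₁ i y| = symProb p₁ i * |x - y| := by
  have h : noiseInv p₁ i x - noiseInv p₁ i y = symProb p₁ i * (x - y) := by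
    cases i <;> simp only [noiseInv, symProb, cond_true, cond_false] <;> ring
  rw [h, abs_mul, abs_of_pos (P.symProb_pos i)]

theorem symProb_le_one (i : Bool) : symProb p₁ i ≤ 1 := by
  cases i
  · exact sub_le_self _ P.prob_pos.le
  · exact P.prob_lt.le

theorem dist_leftMap_le (i : Bool) {p q : ℝ × ℝ} (hp : p ∈ strip) (hq : q ∈ strip) :
    dist (leftMap α β p₁ i p) (leftMap α β p₁ i q) ≤ dist p q := by
  rw [Prod.dist_eq, Prod.dist_eq]
  simp only [Real.dist_eq, leftMap]
  refine max_le_max (abs_leftInv_sub_le (P.symExp_pos i) (Ioc_subset_Icc_self hp.1)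
    (Ioc_subset_Icc_self hq.1)) ?_
  rw [P.abs_noiseInv_sub]
  exact mul_le_of_le_one_left (abs_nonneg _) (P.symProb_le_one i)

theorem dist_wordMap_le : ∀ (w : List Bool) {p q : ℝ × ℝ}, p ∈ strip → q ∈ strip →
    dist (wordMap α β p₁ w p) (wordMap α β p₁ w q) ≤ dist p q
  | [], _, _, _, _ => le_rfl
  | i :: w, _, _, hp, hq => (P.dist_leftMap_le i (P.wordMap_mem w hp) (P.wordMap_mem w hq)).trans
      (dist_wordMap_le w hp hq)

theorem dist_rightMap_le (i : Bool) (p q : ℝ × ℝ) :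
    dist (rightMap p₁ i p) (rightMap p₁ i q) ≤ contractionRate p₁ * dist p q := by
  have h0 := contractionRate_nonneg (p₁ := p₁)
  rw [Prod.dist_eq, Prod.dist_eq]
  simp only [Real.dist_eq, rightMap]
  refine max_le ?_ ?_
  · rw [show (1 + p.1) / 2 - (1 + q.1) / 2 = 1 / 2 * (p.1 - q.1) by ring, abs_mul,
      abs_of_pos (by norm_num)]
    exact mul_le_mul (le_max_left _ _) (le_max_left _ _) (abs_nonneg _) h0
  · rw [P.abs_noiseInv_sub]
    refine mul_le_mul ?_ (le_max_right _ _) (abs_nonneg _) h0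
    cases i
    · exact (le_max_right _ _).trans (le_max_right _ _)
    · exact (le_max_left _ _).trans (le_max_right _ _)

theorem dist_returnBranch_le (w : Bool × List Bool) {p q : ℝ × ℝ} (hp : p ∈ strip)
    (hq : q ∈ strip) : dist (returnBranch α β p₁ w p) (returnBranch α β p₁ w q) ≤
      contractionRate p₁ * dist p q :=
  (P.dist_rightMap_le _ _ _).trans
    (mul_le_mul_of_nonneg_left (P.dist_wordMap_le _ hp hq) contractionRate_nonneg)

theorem wordJac_mono : ∀ (w : List Bool) {p q : ℝ × ℝ}, p ∈ strip → q ∈ strip → p.1 ≤ q.1 →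
    (wordMap α β p₁ w p).1 ≤ (wordMap α β p₁ w q).1 ∧ wordJac α β p₁ w q ≤ wordJac α β p₁ w p ∧
    p.1 ^ 2 / (wordMap α β p₁ w p).1 ^ 2 * wordJac α β p₁ w p ≤
      q.1 ^ 2 / (wordMap α β p₁ w q).1 ^ 2 * wordJac α β p₁ w q
  | [], p, q, hp, hq, h => by
    have h1 := hp.1.1
    have h2 := hq.1.1
    simp only [wordMap, wordJac]
    refine ⟨h, le_rfl, ?_⟩
    rw [div_self (by positivity), div_self (by positivity)]
  | i :: w, p, q, hp, hq, h => by
    obtain ⟨h1, h2, h3⟩ := wordJac_mono w hp hq h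
    have hpw := P.wordMap_mem w hp
    have hqw := P.wordMap_mem w hq
    have hJp := P.wordJac_pos w hp
    have hJq := P.wordJac_pos w hq
    set a := wordMap α β p₁ w p with ha
    set c := wordMap α β p₁ w q with hc
    have hm : (leftMap α β p₁ i a).1 ≤ (leftMap α β p₁ i c).1 := monotone_leftInv h1
    have hpa := (P.leftMap_mem i hpw).1.1
    have hqa := (P.leftMap_mem i hqw).1.1
    have hlJ : leftJac α β p₁ i c ≤ leftJac α β p₁ i a := by
      refine mul_le_mul_of_nonneg_left (inv_anti₀ ?_ ?_) (P.symProb_pos i).le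
      · exact one_pos.trans_le (one_le_leftDeriv (P.symExp_pos i) hpa.le)
      · exact leftDeriv_mono (P.symExp_pos i) hpa.le hm
    have hsq : a.1 ^ 2 / (leftMap α β p₁ i a).1 ^ 2 * leftJac α β p₁ i a ≤
        c.1 ^ 2 / (leftMap α β p₁ i c).1 ^ 2 * leftJac α β p₁ i c := by
      have := sq_div_leftDeriv_mono (P.symExp_pos i) (P.symExp_le i) hpa hm
      rw [show leftBranch (symExp α β i) (leftMap α β p₁ i a).1 = a.1 from
        leftBranch_leftInv (P.symExp_pos i) (Ioc_subset_Icc_self hpw.1),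
        show leftBranch (symExp α β i) (leftMap α β p₁ i c).1 = c.1 from
        leftBranch_leftInv (P.symExp_pos i) (Ioc_subset_Icc_self hqw.1)] at this
      have h5 := mul_le_mul_of_nonneg_left this (P.symProb_pos i).le
      have hJ : ∀ z : ℝ × ℝ, leftJac α β p₁ i z =
          symProb p₁ i * (leftDeriv (symExp α β i) (leftMap α β p₁ i z).1)⁻¹ := fun _ => rfl
      rw [hJ, hJ]
      refine (le_of_eq ?_).trans (h5.trans (le_of_eq ?_)) <;>
        rw [← div_div, div_eq_mul_inv (_ / _)] <;> ac_rfl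
    have hapos := hpw.1.1
    have hcpos := hqw.1.1
    have hl := P.leftJac_nonneg i hpw
    have hl' := P.leftJac_nonneg i hqw
    simp only [wordMap, wordJac, ← ha, ← hc]
    refine ⟨hm, by gcongr, ?_⟩
    calc p.1 ^ 2 / (leftMap α β p₁ i a).1 ^ 2 * (wordJac α β p₁ w p * leftJac α β p₁ i a)
        = (p.1 ^ 2 / a.1 ^ 2 * wordJac α β p₁ w p) *
          (a.1 ^ 2 / (leftMap α β p₁ i a).1 ^ 2 * leftJac α β p₁ i a) := by field_simp
      _ ≤ (q.1 ^ 2 / c.1 ^ 2 * wordJac α β p₁ w q) *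
          (c.1 ^ 2 / (leftMap α β p₁ i c).1 ^ 2 * leftJac α β p₁ i c) := by gcongr
      _ = _ := by field_simp

theorem wordJac_le (w : List Bool) {p q : ℝ × ℝ} (hp : p ∈ base) (hq : q ∈ base) :
    wordJac α β p₁ w p ≤ Real.exp (4 * dist p q) * wordJac α β p₁ w q := by
  have hps := base_subset_strip hp
  have hqs := base_subset_strip hq
  have hJq := P.wordJac_pos w hqs
  rcases le_total p.1 q.1 with h | h
  · obtain ⟨h1, -, h3⟩ := P.wordJac_mono w hps hqs h
    have hp1 := hps.1.1
    have hwp := (P.wordMap_mem w hps).1.1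
    have hwq := (P.wordMap_mem w hqs).1.1
    have h4 : wordJac α β p₁ w p ≤ (q.1 / p.1) ^ 2 * wordJac α β p₁ w q := by
      have h5 : p.1 ^ 2 / (wordMap α β p₁ w p).1 ^ 2 * wordJac α β p₁ w p ≤
          q.1 ^ 2 / (wordMap α β p₁ w p).1 ^ 2 * wordJac α β p₁ w q := h3.trans (by gcongr)
      rw [div_mul_eq_mul_div, div_mul_eq_mul_div, div_le_div_iff_of_pos_right (by positivity)] at h5
      rw [div_pow, div_mul_eq_mul_div, le_div_iff₀ (by positivity)]
      linarith
    refine h4.trans (mul_le_mul_of_nonneg_right ?_ hJq.le)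
    have h6 : q.1 / p.1 ≤ Real.exp (2 * dist p q) := by
      have h7 : q.1 - p.1 ≤ dist p q := by
        rw [Prod.dist_eq, Real.dist_eq, abs_sub_comm]
        exact (le_abs_self _).trans (le_max_left _ _)
      refine le_trans ?_ (Real.add_one_le_exp _)
      rw [div_le_iff₀ hp1]
      have h8 : (1 : ℝ) / 2 < p.1 := hp.1.1
      nlinarith
    calc (q.1 / p.1) ^ 2 ≤ Real.exp (2 * dist p q) ^ 2 := by
          have := hqs.1.1
          gcongr
      _ = _ := by rw [← Real.exp_nat_mul]; congr 1; push_cast; ring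
  · refine (P.wordJac_mono w hqs hps h).2.1.trans (le_mul_of_one_le_left hJq.le ?_)
    exact Real.one_le_exp (by positivity)

theorem returnJac_le (w : Bool × List Bool) {p q : ℝ × ℝ} (hp : p ∈ base) (hq : q ∈ base) :
    returnJac α β p₁ w p ≤ Real.exp (4 * dist p q) * returnJac α β p₁ w q := by
  rw [returnJac, returnJac, ← mul_assoc]
  exact mul_le_mul_of_nonneg_right (P.wordJac_le _ hp hq) (half_pos (P.symProb_pos _)).le

theorem wordJac_le_one : ∀ (w : List Bool) {p : ℝ × ℝ}, p ∈ strip → wordJac α β p₁ w p ≤ 1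
  | [], _, _ => le_rfl
  | i :: w, _, hp => mul_le_one₀ (wordJac_le_one w hp)
      (P.leftJac_nonneg i (P.wordMap_mem w hp)).le (mul_le_one₀ (P.symProb_le_one i)
        (inv_nonneg.2 (zero_le_one.trans (one_le_leftDeriv (P.symExp_pos i)
          (P.leftMap_mem i (P.wordMap_mem w hp)).1.1.le)))
        (inv_le_one_of_one_le₀ (one_le_leftDeriv (P.symExp_pos i)
          (P.leftMap_mem i (P.wordMap_mem w hp)).1.1.le)))

theorem returnJac_le_one (w : Bool × List Bool) {p : ℝ × ℝ} (hp : p ∈ strip) :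
    returnJac α β p₁ w p ≤ 1 :=
  mul_le_one₀ (P.wordJac_le_one _ hp) (half_pos (P.symProb_pos _)).le
    (by linarith [P.symProb_le_one w.1])

theorem exists_wordMap_eq : ∀ (w : List Bool) {p : ℝ × ℝ}, p ∈ wordCell α β p₁ w →
    ∃ q ∈ base, wordMap α β p₁ w q = p
  | [], _, h => ⟨_, h, rfl⟩
  | i :: w, p, h => by
    obtain ⟨q, hq, hqp⟩ := exists_wordMap_eq w h.2
    refine ⟨q, hq, ?_⟩
    have hs := P.wordCell_subset _ h
    rw [wordMap, hqp, ← (mem_noiseCell_iff hs.2).1 h.1.2]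
    exact P.leftMap_skewLSV hs fun hb => absurd hb.1.1 (not_lt.2 h.1.1.2)

theorem exists_returnBranch_eq {p : ℝ × ℝ} (h : p ∈ base) :
    ∃ w, ∃ q ∈ base, returnBranch α β p₁ w q = p := by
  obtain ⟨w, hw⟩ := P.exists_mem_wordCell (P.skewLSV_mem (base_subset_strip h))
  obtain ⟨q, hq, hqp⟩ := P.exists_wordMap_eq w hw
  exact ⟨(decide (p.2 < p₁), w), q, hq, by
    rw [returnBranch, hqp]; exact P.rightMap_skewLSV h⟩

end LSVParam

end BranchGeometry

section Density

variable {α β p₁ : ℝ} {ν : Measure (ℝ × ℝ)} {k : ℝ × ℝ → ℝ}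

/-- `ν` is an invariant measure whose density `k` is Lipschitz on the closed base. -/
structure LSVDensity (α β p₁ : ℝ) (ν : Measure (ℝ × ℝ)) (k : ℝ × ℝ → ℝ) : Prop where
  param : LSVParam α β p₁
  measurable : Measurable k
  nonneg : ∀ p, 0 ≤ k p
  eq_withDensity : ν = (volume.restrict strip).withDensity fun p => ENNReal.ofReal (k p)
  measurePreserving : MeasurePreserving (skewLSV α β p₁) ν ν
  lipschitz : ∃ L, 0 ≤ L ∧ ∀ p ∈ Icc (1 / 2 : ℝ) 1 ×ˢ Icc (0 : ℝ) 1,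
    ∀ q ∈ Icc (1 / 2 : ℝ) 1 ×ˢ Icc (0 : ℝ) 1, |k p - k q| ≤ L * dist p q

theorem base_subset_Icc : base ⊆ Icc (1 / 2 : ℝ) 1 ×ˢ Icc (0 : ℝ) 1 :=
  prod_mono Ioc_subset_Icc_self Ico_subset_Icc_self

/-- The transition weights of the first return map. -/
def returnWeight (α β p₁ : ℝ) (k : ℝ × ℝ → ℝ) (w : Bool × List Bool) : ℝ × ℝ → ℝ :=
  base.indicator fun p => returnJac α β p₁ w p * k (returnBranch α β p₁ w p) / k p

namespace LSVDensity

section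

variable (H : LSVDensity α β p₁ ν k)
include H

theorem measure_compl_strip : ν stripᶜ = 0 := by
  rw [H.eq_withDensity, withDensity_apply _ measurableSet_strip.compl,
    Measure.restrict_restrict measurableSet_strip.compl, compl_inter_self,
    Measure.restrict_empty, lintegral_zero_measure]

theorem ae_mem_strip : ∀ᵐ p ∂ν, p ∈ strip := H.measure_compl_strip

theorem ae_exists_iterate_mem_base : ∀ᵐ p ∂ν, ∃ n, (skewLSV α β p₁)^[n] p ∈ base :=
  H.ae_mem_strip.mono fun _ => H.param.exists_iterate_mem_base

theorem exists_iterate_succ_mem_base :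
    ∀ p ∈ base, ∃ n, (skewLSV α β p₁)^[n + 1] p ∈ base := fun _ hp =>
  H.param.exists_iterate_succ_mem_base (base_subset_strip hp)

theorem restrict_base :
    ν.restrict base = (volume.restrict base).withDensity fun p => ENNReal.ofReal (k p) := by
  rw [H.eq_withDensity, restrict_withDensity measurableSet_base,
    Measure.restrict_restrict measurableSet_base, inter_eq_left.2 base_subset_strip]

theorem setLIntegral_base {u : ℝ × ℝ → ENNReal} (hu : Measurable u) :
    ∫⁻ p in base, u p ∂ν = ∫⁻ p in base, ENNReal.ofReal (k p) * u p := by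
  rw [H.restrict_base]
  exact lintegral_withDensity_eq_lintegral_mul _ H.measurable.ennreal_ofReal hu

theorem tsum_branch_ae [IsFiniteMeasure ν] : ∀ᵐ p ∂volume.restrict base,
    ∑' w, ENNReal.ofReal (returnJac α β p₁ w p) * ENNReal.ofReal (k (returnBranch α β p₁ w p)) =
      ENNReal.ofReal (k p) := by
  have hk : Measurable fun p => ENNReal.ofReal (k p) := H.measurable.ennreal_ofReal
  have hw : ∀ w, Measurable fun p => ENNReal.ofReal (returnJac α β p₁ w p) *
      ENNReal.ofReal (k (returnBranch α β p₁ w p)) := fun w =>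
    (measurable_returnJac w).ennreal_ofReal.mul (hk.comp (measurable_returnBranch w))
  have hF : MeasurePreserving (firstReturn (skewLSV α β p₁) base) (ν.restrict base)
      (ν.restrict base) := measurePreserving_firstReturn H.measurePreserving measurableSet_base
    H.exists_iterate_succ_mem_base H.ae_exists_iterate_mem_base
  have : SigmaFinite (volume.restrict base : Measure (ℝ × ℝ)) := inferInstance
  refine ae_eq_of_forall_setLIntegral_eq_of_sigmaFinite (Measurable.tsum hw) hk
    fun s hs _ => ?_
  have hone : Measurable (s.indicator fun _ => (1 : ENNReal)) := measurable_const.indicator hs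
  have hu : Measurable fun p => ENNReal.ofReal (k p) *
      s.indicator (fun _ => (1 : ENNReal)) (firstReturn (skewLSV α β p₁) base p) :=
    hk.mul (hone.comp hF.measurable)
  have h1 := hF.lintegral_comp hone
  have hone' : Measurable fun p =>
      s.indicator (fun _ => (1 : ENNReal)) (firstReturn (skewLSV α β p₁) base p) :=
    hone.comp hF.measurable
  rw [H.setLIntegral_base hone, H.setLIntegral_base hone', H.param.lintegral_base hu,
    ← lintegral_tsum fun w => by
      exact ((measurable_returnJac w).ennreal_ofReal.mul
        (hu.comp (measurable_returnBranch w))).aemeasurable] at h1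
  rw [← lintegral_indicator hs, ← lintegral_indicator hs]
  refine Eq.trans ?_ (h1.trans ?_)
  · refine setLIntegral_congr_fun measurableSet_base fun p hp => ?_
    simp only [H.param.firstReturn_returnBranch _ hp]
    by_cases hps : p ∈ s <;> simp [hps]
  · refine lintegral_congr fun p => ?_
    by_cases hps : p ∈ s <;> simp [hps]

theorem returnJac_mul_le [IsFiniteMeasure ν] (w : Bool × List Bool) {y : ℝ × ℝ} (hy : y ∈ base) :
    returnJac α β p₁ w y * k (returnBranch α β p₁ w y) ≤ k y := by
  obtain ⟨L, hL, hLip⟩ := H.lipschitz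
  have key : ∀ d > 0, returnJac α β p₁ w y * k (returnBranch α β p₁ w y) ≤
      Real.exp (4 * d) * (k y + 2 * L * d) := by
    intro d hd
    obtain ⟨z, hz, hyz, hQ⟩ := exists_mem_base_dist_lt H.tsum_branch_ae hy hd
    have hzs := base_subset_strip hz
    have hys := base_subset_strip hy
    have h1 : returnJac α β p₁ w z * k (returnBranch α β p₁ w z) ≤ k z := by
      have := (ENNReal.le_tsum w).trans_eq hQ
      rwa [← ENNReal.ofReal_mul (H.param.returnJac_pos w hzs).le,
        ENNReal.ofReal_le_ofReal_iff (H.nonneg _)] at this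
    have h2 := H.param.returnJac_le w hy hz
    have h3 := (abs_le.1 (hLip _ (base_subset_Icc hz) _ (base_subset_Icc hy))).2
    have h4 := (abs_le.1 (hLip _ (base_subset_Icc (H.param.returnBranch_mem w hys)) _
      (base_subset_Icc (H.param.returnBranch_mem w hzs)))).2
    have h5 := H.param.dist_returnBranch_le w hys hzs
    have h6 : dist (returnBranch α β p₁ w y) (returnBranch α β p₁ w z) ≤ d :=
      (h5.trans (mul_le_of_le_one_left dist_nonneg H.param.contractionRate_lt.le)).trans hyz.le
    have h7 : k (returnBranch α β p₁ w y) ≤ k (returnBranch α β p₁ w z) + L * d := by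
      have := mul_le_mul_of_nonneg_left h6 hL
      linarith
    have h8 : k z ≤ k y + L * d := by
      have := mul_le_mul_of_nonneg_left ((dist_comm z y).trans_lt hyz).le hL
      linarith
    have hJ1 := H.param.returnJac_le_one w hzs
    have hJ0 := (H.param.returnJac_pos w hzs).le
    have hLd : 0 ≤ L * d := by positivity
    calc returnJac α β p₁ w y * k (returnBranch α β p₁ w y)
        ≤ (Real.exp (4 * d) * returnJac α β p₁ w z) *
          (k (returnBranch α β p₁ w z) + L * d) := by
          refine mul_le_mul (h2.trans ?_) h7 (H.nonneg _) (by positivity)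
          gcongr
      _ = Real.exp (4 * d) * (returnJac α β p₁ w z * k (returnBranch α β p₁ w z) +
          returnJac α β p₁ w z * (L * d)) := by ring
      _ ≤ _ := by
          have h9 := mul_le_of_le_one_left hLd hJ1
          refine mul_le_mul_of_nonneg_left ?_ (Real.exp_pos _).le
          linarith
  have hlim : Tendsto (fun d : ℝ => Real.exp (4 * d) * (k y + 2 * L * d)) (𝓝[>] 0)
      (𝓝 (Real.exp (4 * 0) * (k y + 2 * L * 0))) :=
    ((by fun_prop : Continuous fun d : ℝ => Real.exp (4 * d) * (k y + 2 * L * d)).tendsto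
      0).mono_left nhdsWithin_le_nhds
  have := ge_of_tendsto hlim (eventually_mem_nhdsWithin.mono fun d hd => key d hd)
  simpa using this

theorem exists_pos_le [IsProbabilityMeasure ν] :
    ∃ δ > 0, ∀ p ∈ Icc (1 / 2 : ℝ) 1 ×ˢ Icc (0 : ℝ) 1, δ ≤ k p := by
  obtain ⟨L, hL, hLip⟩ := H.lipschitz
  have hlam0 := contractionRate_nonneg (p₁ := p₁)
  have step : ∀ (n : ℕ), ∀ q ∈ base,
      (∃ η > 0, ∀ p ∈ base, dist p q ≤ contractionRate p₁ ^ n → η ≤ k p) →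
      ∃ δ > 0, ∀ p ∈ base, δ ≤ k p := by
    intro n
    induction n with
    | zero =>
      rintro q hq ⟨η, hη, h⟩
      exact ⟨η, hη, fun p hp => h p hp (by simpa using dist_le_one_of_mem_base hp hq)⟩
    | succ n ih =>
      rintro q hq ⟨η, hη, h⟩
      obtain ⟨w, z, hz, rfl⟩ := H.param.exists_returnBranch_eq hq
      have hzs := base_subset_strip hz
      have hJ := H.param.returnJac_pos w hzs
      refine ih z hz ⟨Real.exp (-4) * returnJac α β p₁ w z * η, by positivity, fun p hp hd => ?_⟩
      have hps := base_subset_strip hp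
      have h1 : η ≤ k (returnBranch α β p₁ w p) := by
        refine h _ (H.param.returnBranch_mem w hps)
          ((H.param.dist_returnBranch_le w hps hzs).trans ?_)
        rw [pow_succ']
        gcongr
      refine le_trans ?_ (H.returnJac_mul_le w hp)
      refine mul_le_mul ?_ h1 hη.le (H.param.returnJac_pos w hps).le
      rw [Real.exp_neg, inv_mul_le_iff₀ (Real.exp_pos _)]
      refine (H.param.returnJac_le w hz hp).trans
        (mul_le_mul_of_nonneg_right (Real.exp_le_exp.2 ?_) (H.param.returnJac_pos w hps).le)
      linarith [dist_le_one_of_mem_base hz hp]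
  have hνb : ν base ≠ 0 := measure_pos_of_tower H.measurePreserving measurableSet_base
    H.exists_iterate_succ_mem_base H.ae_exists_iterate_mem_base (by simp)
  obtain ⟨q, hq, hkq⟩ : ∃ q ∈ base, 0 < k q := by
    by_contra! hcon
    refine hνb ?_
    have := H.setLIntegral_base (u := fun _ => 1) measurable_const
    rw [setLIntegral_one] at this
    rw [this]
    refine (setLIntegral_congr_fun measurableSet_base fun p hp => ?_).trans (lintegral_zero)
    simp [ENNReal.ofReal_of_nonpos (hcon p hp)]
  obtain ⟨n, hn⟩ := exists_pow_lt_of_lt_one (y := contractionRate p₁)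
    (show 0 < k q / (2 * (L + 1)) by positivity) H.param.contractionRate_lt
  obtain ⟨δ, hδ, h⟩ := step n q hq ⟨k q / 2, by positivity, fun p hp hd => by
    have h1 := (abs_le.1 (hLip _ (base_subset_Icc hp) _ (base_subset_Icc hq))).1
    have h2 : L * dist p q ≤ k q / 2 := by
      have h3 : (L + 1) * dist p q ≤ k q / 2 := by
        have := mul_le_mul_of_nonneg_left (hd.trans hn.le) (show 0 ≤ L + 1 by positivity)
        refine this.trans_eq (by field_simp)
      have : 0 ≤ dist p q := dist_nonneg
      linarith
    linarith⟩
  refine ⟨δ, hδ, fun p hp => ?_⟩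
  have hsub : Icc (1 / 2 : ℝ) 1 ×ˢ Icc (0 : ℝ) 1 ⊆ closure base := by
    rw [base, closure_prod_eq, closure_Ioc (by norm_num), closure_Ico (by norm_num)]
  have hcont : ContinuousOn k (Icc (1 / 2 : ℝ) 1 ×ˢ Icc (0 : ℝ) 1) :=
    (LipschitzOnWith.of_dist_le_mul (K := L.toNNReal) fun x hx y hy => by
      rw [Real.dist_eq, Real.coe_toNNReal _ hL]; exact hLip x hx y hy).continuousOn
  have hcl := ((hcont p hp).mono base_subset_Icc).tendsto
  have : (𝓝[base] p).NeBot := mem_closure_iff_nhdsWithin_neBot.1 (hsub hp)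
  exact ge_of_tendsto hcl (eventually_mem_nhdsWithin.mono fun x hx => h x hx)

theorem exists_markov_constants [IsProbabilityMeasure ν] : ∃ D, 0 ≤ D ∧
    (∀ w, ∀ x ∈ base, ∀ y ∈ base, returnWeight α β p₁ k w x ≤
      Real.exp (D * dist x y) * returnWeight α β p₁ k w y) ∧
    ∀ y ∈ base, HasSum (fun w => returnWeight α β p₁ k w y) 1 := by
  obtain ⟨L, hL, hLip⟩ := H.lipschitz
  obtain ⟨δ, hδ, hk⟩ := H.exists_pos_le
  have hk' : ∀ p ∈ base, 0 < k p := fun p hp => hδ.trans_le (hk p (base_subset_Icc hp))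
  have hratio : ∀ x ∈ base, ∀ y ∈ base, k x ≤ Real.exp (L / δ * dist x y) * k y := by
    intro x hx y hy
    have h1 := (abs_le.1 (hLip _ (base_subset_Icc hx) _ (base_subset_Icc hy))).2
    have h2 := mul_le_mul_of_nonneg_left (hk y (base_subset_Icc hy))
      (show 0 ≤ L / δ * dist x y by positivity)
    have h3 : L / δ * dist x y * δ = L * dist x y := by field_simp
    have h4 := mul_le_mul_of_nonneg_right (Real.add_one_le_exp (L / δ * dist x y)) (hk' y hy).le
    linarith
  have hdist : ∀ w, ∀ x ∈ base, ∀ y ∈ base, returnWeight α β p₁ k w x ≤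
      Real.exp ((4 + 2 * (L / δ)) * dist x y) * returnWeight α β p₁ k w y := by
    intro w x hx y hy
    have hxs := base_subset_strip hx
    have hys := base_subset_strip hy
    have hbx := H.param.returnBranch_mem w hxs
    have hby := H.param.returnBranch_mem w hys
    simp only [returnWeight, indicator_of_mem hx, indicator_of_mem hy]
    have h1 := H.param.returnJac_le w hx hy
    have h2 := hratio _ hbx _ hby
    have h2' : k (returnBranch α β p₁ w x) ≤ Real.exp (L / δ * dist x y) *
        k (returnBranch α β p₁ w y) := by
      refine h2.trans (mul_le_mul_of_nonneg_right (Real.exp_le_exp.2 ?_) (H.nonneg _))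
      refine mul_le_mul_of_nonneg_left ?_ (by positivity)
      exact (H.param.dist_returnBranch_le w hxs hys).trans
        (mul_le_of_le_one_left dist_nonneg H.param.contractionRate_lt.le)
    have h3 := hratio y hy x hx
    rw [dist_comm] at h3
    have hJx := H.param.returnJac_pos w hxs
    have hJy := H.param.returnJac_pos w hys
    have hx0 := hk' x hx
    have hy0 := hk' y hy
    have hbx0 := hk' _ hbx
    have hby0 := hk' _ hby
    rw [mul_div_assoc', div_le_div_iff₀ hx0 hy0]
    calc _ ≤ (Real.exp (4 * dist x y) * returnJac α β p₁ w y) * (Real.exp (L / δ * dist x y) *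
          k (returnBranch α β p₁ w y)) * (Real.exp (L / δ * dist x y) * k x) := by gcongr
      _ = _ := by
        rw [show (4 + 2 * (L / δ)) * dist x y =
          4 * dist x y + L / δ * dist x y + L / δ * dist x y by ring, Real.exp_add, Real.exp_add]
        ring
  set D := 4 + 2 * (L / δ) with hD
  have hD0 : 0 ≤ D := by positivity
  have hG0 : ∀ w y, 0 ≤ returnWeight α β p₁ k w y := fun w y => by
    refine indicator_nonneg (fun p hp => ?_) y
    exact div_nonneg (mul_nonneg (H.param.returnJac_pos w (base_subset_strip hp)).le
      (H.nonneg _)) (H.nonneg _)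
  refine ⟨D, hD0, hdist, fun y hy => ?_⟩
  have hgood : ∀ z ∈ base, (∑' w, ENNReal.ofReal (returnJac α β p₁ w z) *
      ENNReal.ofReal (k (returnBranch α β p₁ w z)) = ENNReal.ofReal (k z)) →
      HasSum (fun w => returnWeight α β p₁ k w z) 1 := by
    intro z hz hQ
    have hzs := base_subset_strip hz
    have h1 : ∑' w, ENNReal.ofReal (returnWeight α β p₁ k w z) = 1 := by
      have h2 : ∀ w, ENNReal.ofReal (returnWeight α β p₁ k w z) =
          ENNReal.ofReal (returnJac α β p₁ w z) * ENNReal.ofReal (k (returnBranch α β p₁ w z)) *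
            (ENNReal.ofReal (k z))⁻¹ := fun w => by
        rw [returnWeight, indicator_of_mem hz, ENNReal.ofReal_div_of_pos (hk' z hz),
          ENNReal.ofReal_mul (H.param.returnJac_pos w hzs).le, ENNReal.div_eq_inv_mul, mul_comm]
      simp only [h2]
      rw [ENNReal.tsum_mul_right, hQ, ENNReal.mul_inv_cancel (by simpa using hk' z hz)
        ENNReal.ofReal_ne_top]
    have h3 : Summable fun w => returnWeight α β p₁ k w z := by
      have := ENNReal.summable_toReal (f := fun w => ENNReal.ofReal (returnWeight α β p₁ k w z))
        (by rw [h1]; exact ENNReal.one_ne_top)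
      simpa only [ENNReal.toReal_ofReal (hG0 _ _)] using this
    rw [← ENNReal.ofReal_tsum_of_nonneg (fun w => hG0 w z) h3, ENNReal.ofReal_eq_one] at h1
    exact h1 ▸ h3.hasSum
  have hnear : ∀ d > 0, ∃ z ∈ base, dist y z < d ∧ HasSum (fun w => returnWeight α β p₁ k w z) 1 :=
    fun d hd => (exists_mem_base_dist_lt H.tsum_branch_ae hy hd).imp fun z hz =>
      ⟨hz.1, hz.2.1, hgood z hz.1 hz.2.2⟩
  have hsummable : Summable fun w => returnWeight α β p₁ k w y := by
    obtain ⟨z, hz, -, hs⟩ := hnear 1 one_pos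
    exact Summable.of_nonneg_of_le (fun w => hG0 w y) (fun w => hdist w y hy z hz)
      (hs.summable.mul_left _)
  have hbound : ∀ d > 0, ∑' w, returnWeight α β p₁ k w y ≤ Real.exp (D * d) ∧
      Real.exp (-(D * d)) ≤ ∑' w, returnWeight α β p₁ k w y := by
    intro d hd
    obtain ⟨z, hz, hyz, hs⟩ := hnear d hd
    have he : Real.exp (D * dist y z) ≤ Real.exp (D * d) := Real.exp_le_exp.2 (by gcongr)
    constructor
    · have h1 := hsummable.tsum_le_tsum (fun w => hdist w y hy z hz) (hs.summable.mul_left _)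
      rw [(hs.mul_left _).tsum_eq, mul_one] at h1
      exact h1.trans he
    · have h1 := hs.summable.tsum_le_tsum (fun w => hdist w z hz y hy) (hsummable.mul_left _)
      rw [hs.tsum_eq, tsum_mul_left, dist_comm] at h1
      rw [Real.exp_neg, inv_le_iff_one_le_mul₀' (Real.exp_pos _)]
      exact h1.trans (mul_le_mul_of_nonneg_right he (tsum_nonneg fun w => hG0 w y))
  have hone : ∑' w, returnWeight α β p₁ k w y = 1 := by
    refine le_antisymm ?_ ?_
    · have hlim : Tendsto (fun d : ℝ => Real.exp (D * d)) (𝓝[>] 0) (𝓝 (Real.exp (D * 0))) :=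
        ((by fun_prop : Continuous fun d : ℝ => Real.exp (D * d)).tendsto 0).mono_left
          nhdsWithin_le_nhds
      have := ge_of_tendsto hlim (eventually_mem_nhdsWithin.mono fun d hd => (hbound d hd).1)
      simpa using this
    · have hlim : Tendsto (fun d : ℝ => Real.exp (-(D * d))) (𝓝[>] 0) (𝓝 (Real.exp (-(D * 0)))) :=
        ((by fun_prop : Continuous fun d : ℝ => Real.exp (-(D * d))).tendsto 0).mono_left
          nhdsWithin_le_nhds
      have := le_of_tendsto hlim (eventually_mem_nhdsWithin.mono fun d hd => (hbound d hd).2)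
      simpa using this
  exact hone ▸ hsummable.hasSum

theorem exists_markovSystem [IsProbabilityMeasure ν] : ∃ D, ∀ t, 0 < t → t ≤ 1 →
    MarkovSystem ((ν base)⁻¹ • ν.restrict base) (firstReturn (skewLSV α β p₁) base) base
      (returnWeight α β p₁ k) (returnBranch α β p₁) D t (contractionRate p₁) := by
  obtain ⟨D, hD, hdist, hsum⟩ := H.exists_markov_constants
  obtain ⟨δ, hδ, hk⟩ := H.exists_pos_le
  have hmeas : ∀ w, Measurable (returnWeight α β p₁ k w) := fun w =>
    (((measurable_returnJac w).mul (H.measurable.comp (measurable_returnBranch w))).div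
      H.measurable).indicator measurableSet_base
  refine ⟨D, fun t ht ht1 => ⟨measurableSet_base, ⟨(1, 0), by norm_num [base]⟩, ?_,
    measurable_firstReturn measurable_skewLSV measurableSet_base, measurable_returnBranch, hmeas,
    fun w y hy => H.param.returnBranch_mem w (base_subset_strip hy),
    fun w y hy => H.param.firstReturn_returnBranch w hy, fun w y => ?_, hsum, hD, ht,
    contractionRate_nonneg, H.param.contractionRate_lt, fun w x hx y hy => ?_,
    fun w x hx y hy => H.param.dist_returnBranch_le w (base_subset_strip hx)
      (base_subset_strip hy), fun x hx y hy => dist_le_one_of_mem_base hx hy, ?_⟩⟩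
  · rw [Measure.smul_apply, Measure.restrict_apply measurableSet_base.compl, compl_inter_self,
      measure_empty, smul_zero]
  · refine indicator_nonneg (fun p hp => ?_) y
    exact div_nonneg (mul_nonneg (H.param.returnJac_pos w (base_subset_strip hp)).le
      (H.nonneg _)) (H.nonneg _)
  · refine (hdist w x hx y hy).trans (mul_le_mul_of_nonneg_right (Real.exp_le_exp.2 ?_) ?_)
    · refine mul_le_mul_of_nonneg_left ?_ hD
      exact Real.self_le_rpow_of_le_one dist_nonneg (dist_le_one_of_mem_base hx hy) ht1
    · refine indicator_nonneg (fun p hp => ?_) y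
      exact div_nonneg (mul_nonneg (H.param.returnJac_pos w (base_subset_strip hp)).le
        (H.nonneg _)) (H.nonneg _)
  · ext E hE
    have hone : Measurable (E.indicator fun _ => (1 : ENNReal)) := measurable_const.indicator hE
    have hu : Measurable fun p => ENNReal.ofReal (k p) * E.indicator (fun _ => (1 : ENNReal)) p :=
      H.measurable.ennreal_ofReal.mul hone
    rw [Measure.sum_apply _ hE, Measure.smul_apply, ← lintegral_indicator_one hE]
    erw [H.setLIntegral_base hone]
    rw [H.param.lintegral_base hu, smul_eq_mul, ← ENNReal.tsum_mul_left]
    refine tsum_congr fun w => ?_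
    have hw := (hmeas w).ennreal_ofReal
    have hEw := measurable_returnBranch (α := α) (β := β) (p₁ := p₁) w hE
    have hone' : Measurable fun p =>
        E.indicator (fun _ => (1 : ENNReal)) (returnBranch α β p₁ w p) :=
      hone.comp (measurable_returnBranch w)
    rw [Measure.map_apply (measurable_returnBranch w) hE, withDensity_apply _ hEw,
      ← lintegral_indicator hEw, lintegral_smul_measure, smul_eq_mul]
    congr 1
    rw [H.setLIntegral_base (hw.indicator hEw)]
    refine setLIntegral_congr_fun measurableSet_base fun p hp => ?_
    have hkp : 0 < k p := hδ.trans_le (hk p (base_subset_Icc hp))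
    have hJ := H.param.returnJac_pos w (base_subset_strip hp)
    by_cases hpE : returnBranch α β p₁ w p ∈ E
    · rw [indicator_of_mem (show p ∈ returnBranch α β p₁ w ⁻¹' E from hpE), indicator_of_mem hpE,
        returnWeight, indicator_of_mem hp, ← ENNReal.ofReal_mul hkp.le, mul_one,
        ← ENNReal.ofReal_mul hJ.le]
      congr 1
      field_simp
    · rw [indicator_of_notMem (show p ∉ returnBranch α β p₁ w ⁻¹' E from hpE),
        indicator_of_notMem hpE, mul_zero, mul_zero, mul_zero]

theorem abs_excursionSum_sub_le {f : ℝ × ℝ → ℝ} {C t : ℝ} (hC : 0 ≤ C) (ht : 0 < t)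
    (hf : ∀ p ∈ strip, ∀ q ∈ strip, |f p - f q| ≤ C * dist p q ^ t) (w : Bool × List Bool)
    {x y : ℝ × ℝ} (hx : x ∈ base) (hy : y ∈ base) :
    |excursionSum (skewLSV α β p₁) base f (returnBranch α β p₁ w x) -
      excursionSum (skewLSV α β p₁) base f (returnBranch α β p₁ w y)| ≤
      C * (w.2.length + 1 : ℕ) * dist x y ^ t := by
  have hxs := base_subset_strip hx
  have hys := base_subset_strip hy
  rw [excursionSum, excursionSum, H.param.returnTime_returnBranch w hx,
    H.param.returnTime_returnBranch w hy, ← Finset.sum_sub_distrib]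
  refine (Finset.abs_sum_le_sum_abs _ _).trans
    ((Finset.sum_le_card_nsmul _ _ (C * dist x y ^ t) fun l hl => ?_).trans_eq ?_)
  · have hl' : l ≤ w.2.length := Nat.lt_succ_iff.1 (Finset.mem_range.1 hl)
    rw [H.param.iterate_returnBranch w hl' hxs, H.param.iterate_returnBranch w hl' hys]
    refine (hf _ (H.param.wordMap_mem _ hxs) _ (H.param.wordMap_mem _ hys)).trans ?_
    have := H.param.dist_wordMap_le (w.2.drop l) hxs hys
    gcongr
  · rw [Finset.card_range, nsmul_eq_mul]
    ring

end

end LSVDensity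

end Density

section Noise

variable {α β p₁ : ℝ}

instance isProbabilityMeasure_noise : IsProbabilityMeasure (volume.restrict (Ico (0 : ℝ) 1)) :=
  ⟨by simp⟩

namespace LSVParam

variable (P : LSVParam α β p₁)
include P

theorem markovSystem_noise {t : ℝ} (ht : 0 < t) :
    MarkovSystem (volume.restrict (Ico (0 : ℝ) 1))
      (phiMap p₁) (Ico 0 1) (fun i _ => symProb p₁ i) (noiseInv p₁) 0 t (contractionRate p₁) where
  measurableSet := measurableSet_Ico
  nonempty := ⟨0, by norm_num⟩
  null := by
    rw [Measure.restrict_apply measurableSet_Ico.compl, compl_inter_self, measure_empty]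
  measurable_map := measurable_phiMap
  measurable_branch := measurable_noiseInv
  measurable_weight _ := measurable_const
  mapsTo i y hy := P.noiseInv_mem i hy
  map_branch i y hy := P.phiMap_noiseInv i hy
  weight_nonneg i _ := (P.symProb_pos i).le
  hasSum y _ := by
    have := hasSum_fintype (fun i => symProb p₁ i)
    rwa [Fintype.sum_bool, symProb, symProb, cond_true, cond_false, add_sub_cancel] at this
  D_nonneg := le_rfl
  t_pos := ht
  lam_nonneg := contractionRate_nonneg
  lam_lt := P.contractionRate_lt
  distortion i x _ y _ := by simp
  contraction i x _ y _ := by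
    rw [Real.dist_eq, Real.dist_eq, P.abs_noiseInv_sub]
    refine mul_le_mul_of_nonneg_right ?_ (abs_nonneg _)
    cases i
    · exact (le_max_right _ _).trans (le_max_right _ _)
    · exact (le_max_left _ _).trans (le_max_right _ _)
  dist_le x hx y hy := by
    rw [Real.dist_eq, abs_le]
    constructor <;> linarith [hx.1, hx.2, hy.1, hy.2]
  dual := by
    have h : ∀ i, ((volume.restrict (Ico (0 : ℝ) 1)).withDensity fun _ =>
        ENNReal.ofReal (symProb p₁ i)).map (noiseInv p₁ i) =
        volume.restrict (noiseCell p₁ i) := fun i => by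
      rw [withDensity_const, P.map_noiseInv]
    simp only [h]
    have hU : (⋃ i, noiseCell p₁ i) = Ico 0 1 := by
      rw [← Ico_union_Ico_eq_Ico P.prob_pos.le P.prob_lt.le, union_eq_iUnion]
      rfl
    rw [← hU, Measure.restrict_iUnion ?_ measurableSet_noiseCell]
    intro i j hij
    cases i <;> cases j <;> first | exact absurd rfl hij | skip
    · exact (Ico_disjoint_Ico_same (a := 0) (b := p₁) (c := 1)).symm
    · exact Ico_disjoint_Ico_same

theorem measurePreserving_phiMap : MeasurePreserving (phiMap p₁)
    (volume.restrict (Ico (0 : ℝ) 1)) (volume.restrict (Ico (0 : ℝ) 1)) :=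
  (P.markovSystem_noise one_pos).measurePreserving

/-- Birkhoff averages of the noise converge in mean. -/
theorem tendsto_integral_noise {v : ℝ → ℝ} (hv : Measurable v) {M : ℝ} (hM : ∀ ω, |v ω| ≤ M)
    {C t : ℝ} (hC : 0 ≤ C) (ht : 0 < t)
    (hvC : ∀ i, ∀ x ∈ Ico (0 : ℝ) 1, ∀ y ∈ Ico (0 : ℝ) 1,
      |v (noiseInv p₁ i x) - v (noiseInv p₁ i y)| ≤ C * dist x y ^ t)
    (hv0 : ∫ ω in Ico (0 : ℝ) 1, v ω = 0) :
    Tendsto (fun n : ℕ => (∫ ω in Ico (0 : ℝ) 1,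
      |∑ k ∈ Finset.range n, v ((phiMap p₁)^[k] ω)|) / n) atTop (𝓝 0) := by
  have hM0 : 0 ≤ M := (abs_nonneg _).trans (hM 0)
  have hφ := P.measurePreserving_phiMap
  obtain ⟨C₀, θ, hC₀, hθ0, hθ1, h⟩ := (P.markovSystem_noise ht).exists_decay
  obtain ⟨a, -, -, -, -, hdec⟩ := h v (fun _ => M + C) M (M + C) hv hM
    (fun i y _ => (hM _).trans (le_add_of_nonneg_right hC))
    (fun i x hx y hy => (hvC i x hx y hy).trans (by gcongr; exact le_add_of_nonneg_left hM0))
    (fun y hy => ⟨Summable.of_finite, by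
      rw [tsum_mul_right, (P.markovSystem_noise ht).hasSum y hy |>.tsum_eq, one_mul]⟩)
  have hcor : ∀ n : ℕ, |∫ ω in Ico (0 : ℝ) 1, v ω * v ((phiMap p₁)^[n + 1] ω)| ≤
      ((M + 1) * (C₀ * (M + C))) * θ ^ n := by
    intro n
    have h1 := hdec n (fun ω => ((v ω / (M + 1) : ℝ) : ℂ))
      (Complex.measurable_ofReal.comp (hv.div_const _)) (fun ω => by
        rw [Complex.norm_real, Real.norm_eq_abs, abs_div, abs_of_pos (by positivity : 0 < M + 1),
          div_le_one (by positivity)]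
        linarith [hM ω])
    rw [integral_complex_ofReal, hv0, Complex.ofReal_zero, zero_mul, sub_zero] at h1
    have h2 : ∀ ω, (v ω : ℂ) * ((v ((phiMap p₁)^[n + 1] ω) / (M + 1) : ℝ) : ℂ) =
        ((v ω * v ((phiMap p₁)^[n + 1] ω) / (M + 1) : ℝ) : ℂ) := fun ω => by
      push_cast; ring
    simp only [h2] at h1
    rw [integral_complex_ofReal, Complex.norm_real, Real.norm_eq_abs, integral_div, abs_div,
      abs_of_pos (by positivity : 0 < M + 1), div_le_iff₀ (by positivity)] at h1
    linarith
  have hvar := integral_sum_sq_le hφ hv hM (B := (M + 1) * (C₀ * (M + C))) (by positivity) hθ0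
    hθ1 hcor
  set V := (∫ ω in Ico (0 : ℝ) 1, v ω ^ 2) + 2 * ((M + 1) * (C₀ * (M + C))) / (1 - θ) with hV
  have hSm : ∀ n : ℕ, Measurable fun ω => ∑ k ∈ Finset.range n, v ((phiMap p₁)^[k] ω) := fun n =>
    Finset.measurable_sum _ fun j _ => hv.comp (measurable_phiMap.iterate j)
  have hSb : ∀ (n : ℕ) ω, |∑ k ∈ Finset.range n, v ((phiMap p₁)^[k] ω)| ≤ n * M := fun n ω => by
    refine (Finset.abs_sum_le_sum_abs _ _).trans ?_
    simpa using Finset.sum_le_sum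
      (fun j (_ : j ∈ Finset.range n) => hM ((phiMap p₁)^[j] ω))
  have hbound : ∀ n : ℕ, (∫ ω in Ico (0 : ℝ) 1,
      |∑ k ∈ Finset.range n, v ((phiMap p₁)^[k] ω)|) / n ≤ (V + 1) / 2 / √n := by
    intro n
    rcases n.eq_zero_or_pos with rfl | hn
    · simp
    have hn' : (0 : ℝ) < n := Nat.cast_pos.2 hn
    have hs : 0 < √(n : ℝ) := Real.sqrt_pos.2 hn'
    have hss : √(n : ℝ) * √n = n := Real.mul_self_sqrt hn'.le
    have hi2 : Integrable (fun ω => (∑ k ∈ Finset.range n, v ((phiMap p₁)^[k] ω)) ^ 2)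
        (volume.restrict (Ico (0 : ℝ) 1)) :=
      integrable_of_bdd ((hSm n).pow_const 2) (C := (n * M) ^ 2) fun ω => by
        rw [norm_pow, Real.norm_eq_abs]
        exact pow_le_pow_left₀ (abs_nonneg _) (hSb n ω) 2
    have h1 : ∫ ω in Ico (0 : ℝ) 1, |∑ k ∈ Finset.range n, v ((phiMap p₁)^[k] ω)| ≤
        ∫ ω in Ico (0 : ℝ) 1, ((∑ k ∈ Finset.range n, v ((phiMap p₁)^[k] ω)) ^ 2 / (2 * √n) +
          √n / 2) := by
      refine integral_mono (integrable_of_bdd (hSm n).abs (C := n * M) fun ω => by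
        rw [norm_abs_eq_norm, Real.norm_eq_abs]; exact hSb n ω)
        ((hi2.div_const _).add (integrable_const _)) fun ω => ?_
      show |_| ≤ _
      set s := ∑ k ∈ Finset.range n, v ((phiMap p₁)^[k] ω)
      rw [div_add_div _ _ (by positivity) two_ne_zero, le_div_iff₀ (by positivity)]
      nlinarith [sq_nonneg (|s| - √n), sq_abs s]
    rw [integral_add (hi2.div_const _) (integrable_const _), integral_div, integral_const,
      probReal_univ, one_smul] at h1
    have h2 := hvar n
    rw [div_le_div_iff₀ hn' hs]
    have h3 : (∫ ω in Ico (0 : ℝ) 1, (∑ k ∈ Finset.range n, v ((phiMap p₁)^[k] ω)) ^ 2) /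
        (2 * √n) ≤ V / 2 * √n := by
      rw [div_le_iff₀ (by positivity)]
      calc _ ≤ n * V := h2
        _ = (√n * √n) * V := by rw [hss]
        _ = _ := by ring
    calc _ ≤ (V / 2 * √n + √n / 2) * √n := by
          refine mul_le_mul_of_nonneg_right ?_ hs.le
          linarith
      _ = (V + 1) / 2 * (√n * √n) := by ring
      _ = _ := by rw [hss]
  refine squeeze_zero (fun n => by positivity) hbound ?_
  exact tendsto_const_nhds.div_atTop (Real.tendsto_sqrt_atTop.comp tendsto_natCast_atTop_atTop)

end LSVParam

end Noise

section EscapeLevel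

variable {α β p₁ : ℝ}

/-- Points with first coordinate at most `escapeLevel n ω` avoid the base for `n` steps. -/
def escapeLevel (α β p₁ : ℝ) : ℕ → ℝ → ℝ
  | 0, _ => 1
  | n + 1, ω => leftInv (symExp α β (decide (ω < p₁))) (escapeLevel α β p₁ n (phiMap p₁ ω))

/-- The number of symbols `α` among the first `n`. -/
def symCount (p₁ : ℝ) (n : ℕ) (ω : ℝ) : ℝ :=
  ∑ k ∈ Finset.range n, (Iio p₁).indicator 1 ((phiMap p₁)^[k] ω)

theorem measurable_escapeLevel : ∀ n, Measurable (escapeLevel α β p₁ n)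
  | 0 => measurable_const
  | n + 1 => by
    have h : escapeLevel α β p₁ (n + 1) = fun ω => if ω < p₁ then
        leftInv α (escapeLevel α β p₁ n (phiMap p₁ ω)) else
        leftInv β (escapeLevel α β p₁ n (phiMap p₁ ω)) := by
      ext ω
      by_cases hω : ω < p₁ <;> simp [escapeLevel, symExp, hω]
    have hn := (measurable_escapeLevel n).comp (measurable_phiMap (p₁ := p₁))
    rw [h]
    exact Measurable.ite measurableSet_Iio (measurable_leftInv.comp hn)
      (measurable_leftInv.comp hn)

theorem measurable_symCount (n : ℕ) : Measurable (symCount p₁ n) :=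
  Finset.measurable_sum _ fun k _ =>
    (measurable_one.indicator measurableSet_Iio).comp (measurable_phiMap.iterate k)

theorem symCount_succ (n : ℕ) (ω : ℝ) :
    symCount p₁ (n + 1) ω = (Iio p₁).indicator 1 ω + symCount p₁ n (phiMap p₁ ω) := by
  rw [symCount, Finset.sum_range_succ', add_comm]
  rfl

theorem symCount_nonneg (n : ℕ) (ω : ℝ) : 0 ≤ symCount p₁ n ω :=
  Finset.sum_nonneg fun _ _ => indicator_nonneg (fun _ _ => zero_le_one) _

theorem symCount_le (n : ℕ) (ω : ℝ) : symCount p₁ n ω ≤ n := by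
  refine (Finset.sum_le_card_nsmul _ _ 1 fun k _ => ?_).trans_eq (by simp)
  exact indicator_le_self' (fun _ _ => zero_le_one) _

theorem inv_sqrt_sub_inv_sqrt {x r : ℝ} (hx : 0 < x) (hr : 0 ≤ r) :
    (√x)⁻¹ - (√(x * (1 + r)))⁻¹ = (√x)⁻¹ * (r / (√(1 + r) * (√(1 + r) + 1))) := by
  have hq : √(1 + r) * √(1 + r) = 1 + r := Real.mul_self_sqrt (by positivity)
  have hq0 : 0 < √(1 + r) := Real.sqrt_pos.2 (by positivity)
  have hx0 : 0 < √x := Real.sqrt_pos.2 hx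
  rw [Real.sqrt_mul hx.le]
  field_simp
  linear_combination hq

theorem inv_sqrt_sub_le {x r : ℝ} (hx : 0 < x) (hr : 0 ≤ r) :
    0 ≤ (√x)⁻¹ - (√(x * (1 + r)))⁻¹ ∧ (√x)⁻¹ - (√(x * (1 + r)))⁻¹ ≤ r / (2 * √x) := by
  have hx0 : 0 < √x := Real.sqrt_pos.2 hx
  have hq1 : 1 ≤ √(1 + r) := Real.one_le_sqrt.2 (by linarith)
  rw [inv_sqrt_sub_inv_sqrt hx hr]
  refine ⟨by positivity, ?_⟩
  rw [inv_mul_eq_div, div_div, div_le_div_iff₀ (by positivity) (by positivity)]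
  have : (2 : ℝ) ≤ √(1 + r) * (√(1 + r) + 1) := by nlinarith
  nlinarith [mul_nonneg hr hx0.le]

/-- The increment of `x ↦ x^(-1/2)` along the LSV branch with parameter `1/2`. -/
theorem abs_inv_sqrt_sub_sub_le {x : ℝ} (hx : 0 < x) :
    |(√x)⁻¹ - (√(x * (1 + √(2 * x))))⁻¹ - (√2)⁻¹| ≤ √(2 * x) := by
  have hr := Real.sqrt_nonneg (2 * x)
  rw [inv_sqrt_sub_inv_sqrt hx hr]
  have h2 : √2 * √2 = 2 := Real.mul_self_sqrt zero_le_two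
  have h20 : 0 < √(2 : ℝ) := Real.sqrt_pos.2 two_pos
  have hx0 : 0 < √x := Real.sqrt_pos.2 hx
  have hrx : √(2 * x) = √2 * √x := Real.sqrt_mul zero_le_two _
  set r := √(2 * x) with hrdef
  have hq : √(1 + r) * √(1 + r) = 1 + r := Real.mul_self_sqrt (by positivity)
  have hq1 : 1 ≤ √(1 + r) := Real.one_le_sqrt.2 (by linarith)
  set q := √(1 + r) with hqdef
  have h1 : (√x)⁻¹ * (r / (q * (q + 1))) - (√2)⁻¹ = -(√2 * ((q - 1) * (q + 2) /
      (2 * (q * (q + 1))))) := by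
    have h3 : (√2)⁻¹ = √2 / 2 := by
      rw [eq_div_iff two_ne_zero, inv_mul_eq_iff_eq_mul₀ h20.ne', h2]
    rw [hrx, h3]
    field_simp
    ring
  rw [h1, abs_neg, abs_of_nonneg (by
    have : 0 ≤ q - 1 := by linarith
    positivity)]
  have h4 : √(2 : ℝ) ≤ 3 / 2 := by rw [Real.sqrt_le_left (by norm_num)]; norm_num
  have h5 : (q - 1) * (q + 2) / (2 * (q * (q + 1))) ≤ r / 2 := by
    have : q - 1 ≤ r / 2 := by nlinarith [sq_nonneg (q - 1)]
    rw [div_le_div_iff₀ (by positivity) two_pos]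
    nlinarith [mul_nonneg (sub_nonneg.2 hq1) (by linarith : 0 ≤ q)]
  nlinarith

namespace LSVParam

section

variable (P : LSVParam α β p₁)
include P

theorem escapeLevel_mem : ∀ n ω, escapeLevel α β p₁ n ω ∈ Ioc (0 : ℝ) 1
  | 0, _ => ⟨one_pos, le_rfl⟩
  | n + 1, ω => by
    have h := escapeLevel_mem n (phiMap p₁ ω)
    refine ⟨leftInv_pos (P.symExp_pos _) h, ?_⟩
    have := (leftInv_mem (P.symExp_pos (decide (ω < p₁))) (Ioc_subset_Icc_self h)).2
    exact this.trans (by norm_num)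

theorem escapeLevel_le : ∀ (n : ℕ) ω, escapeLevel α β p₁ n ω ≤ 1 / (n + 1)
  | 0, _ => by simp [escapeLevel]
  | n + 1, ω => by
    have h := P.escapeLevel_mem n (phiMap p₁ ω)
    have h0 := (P.escapeLevel_mem (n + 1) ω).1
    have h1 := one_div_leftInv_ge (P.symExp_pos (decide (ω < p₁))) (P.symExp_le _) h
    have h2 := escapeLevel_le n (phiMap p₁ ω)
    rw [le_one_div h.1 (by positivity)] at h2
    rw [le_one_div h0 (by positivity)]
    push_cast
    change _ ≤ 1 / leftInv _ _
    linarith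

theorem iterate_notMem_base_iff : ∀ (n : ℕ) {q : ℝ × ℝ}, q ∈ strip →
    ((∀ k < n, (skewLSV α β p₁)^[k] q ∉ base) ↔ q.1 ≤ escapeLevel α β p₁ n q.2)
  | 0, q, hq => by simpa [escapeLevel] using hq.1.2
  | n + 1, q, hq => by
    have hS := P.skewLSV_mem hq
    have ih := iterate_notMem_base_iff n hS
    have hlev := P.escapeLevel_mem n (phiMap p₁ q.2)
    set a := symExp α β (decide (q.2 < p₁)) with ha
    have ha0 : 0 < a := P.symExp_pos _
    have hsplit : (∀ k < n + 1, (skewLSV α β p₁)^[k] q ∉ base) ↔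
        q ∉ base ∧ ∀ k < n, (skewLSV α β p₁)^[k] (skewLSV α β p₁ q) ∉ base := by
      constructor
      · exact fun h => ⟨h 0 (Nat.succ_pos _), fun k hk => h (k + 1) (Nat.succ_lt_succ hk)⟩
      · rintro ⟨h0, h⟩ (_ | k) hk
        exacts [h0, h k (Nat.lt_of_succ_lt_succ hk)]
    rw [hsplit, ih]
    change _ ∧ _ ≤ escapeLevel α β p₁ n (phiMap p₁ q.2) ↔
      q.1 ≤ leftInv a (escapeLevel α β p₁ n (phiMap p₁ q.2))
    constructor
    · rintro ⟨hb, hle⟩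
      have h3 : leftInv a (skewLSV α β p₁ q).1 = q.1 := congrArg Prod.fst (P.leftMap_skewLSV hq hb)
      rw [← h3]
      exact monotone_leftInv hle
    · intro hle
      have hmem := leftInv_mem ha0 (Ioc_subset_Icc_self hlev)
      have hb : q ∉ base := fun hb => absurd hb.1.1 (not_lt.2 (hle.trans hmem.2))
      refine ⟨hb, ?_⟩
      by_contra hlt
      have h3 : leftInv a (skewLSV α β p₁ q).1 = q.1 := congrArg Prod.fst (P.leftMap_skewLSV hq hb)
      have h4 := monotone_leftInv (a := a) (not_le.1 hlt).le
      rw [h3] at h4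
      have h5 := le_antisymm hle h4
      have h6 := leftBranch_leftInv ha0 (Ioc_subset_Icc_self hlev)
      have h7 := leftBranch_leftInv ha0 (Ioc_subset_Icc_self hS.1)
      rw [h3, h5, h6] at h7
      exact hlt h7.ge

theorem lt_returnTime_iff_le {p : ℝ × ℝ} (hp : p ∈ base) (n : ℕ) :
    n < returnTime (skewLSV α β p₁) base p ↔
      2 * p.1 - 1 ≤ escapeLevel α β p₁ n (phiMap p₁ p.2) := by
  have hs := base_subset_strip hp
  rw [lt_returnTime_iff (P.exists_iterate_succ_mem_base hs)]
  have := P.iterate_notMem_base_iff n (P.skewLSV_mem hs)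
  simp only [Function.iterate_succ_apply]
  rw [this]
  have h1 : (skewLSV α β p₁ p).1 = 2 * p.1 - 1 := if_neg (not_le.2 hp.1.1)
  rw [h1]
  rfl

/-- Along an excursion, the first coordinate is controlled by the remaining time. -/
theorem iterate_fst_le {p : ℝ × ℝ} (hp : p ∈ base) {l : ℕ}
    (hl : l < returnTime (skewLSV α β p₁) base p) :
    ((skewLSV α β p₁)^[l + 1] p).1 ≤
      1 / ((returnTime (skewLSV α β p₁) base p - 1 - l : ℕ) + 1) := by
  have hs := base_subset_strip hp
  set n := returnTime (skewLSV α β p₁) base p with hn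
  have hlt := (lt_returnTime_iff (P.exists_iterate_succ_mem_base hs) (n - 1)).1
    (by rw [← hn]; omega)
  have hmem : ∀ l, (skewLSV α β p₁)^[l] p ∈ strip := fun l => by
    induction l with
    | zero => exact hs
    | succ l ih => rw [Function.iterate_succ_apply']; exact P.skewLSV_mem ih
  refine ((P.iterate_notMem_base_iff (n - 1 - l) (hmem (l + 1))).1 fun k hk => ?_).trans
    (P.escapeLevel_le _ _)
  rw [← Function.iterate_add_apply, show k + (l + 1) = k + l + 1 by ring]
  exact hlt _ (by omega)

end

theorem abs_inv_sqrt_escapeLevel_sub_le (P : LSVParam (1 / 2) β p₁) (hβ : 1 / 2 < β) :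
    ∀ (n : ℕ) ω, |(√(escapeLevel (1 / 2) β p₁ n ω))⁻¹ - 1 - symCount p₁ n ω * (√2)⁻¹| ≤
      ∑ k ∈ Finset.range n, 2 * (1 / ((k : ℝ) + 1)) ^ (β - 1 / 2)
  | 0, ω => by simp [escapeLevel, symCount]
  | n + 1, ω => by
    have ih := P.abs_inv_sqrt_escapeLevel_sub_le hβ n (phiMap p₁ ω)
    rw [Finset.sum_range_succ, symCount_succ]
    set y := escapeLevel (1 / 2) β p₁ n (phiMap p₁ ω) with hy
    have hymem := P.escapeLevel_mem n (phiMap p₁ ω)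
    have hyle := P.escapeLevel_le n (phiMap p₁ ω)
    set x := escapeLevel (1 / 2) β p₁ (n + 1) ω with hx
    have hx0 : 0 < x := (P.escapeLevel_mem (n + 1) ω).1
    have hxy : leftBranch (symExp (1 / 2) β (decide (ω < p₁))) x = y :=
      leftBranch_leftInv (P.symExp_pos _) (Ioc_subset_Icc_self hymem)
    have hxle : x ≤ y := (le_leftBranch hx0.le).trans_eq hxy
    rw [leftBranch, two_rpow_mul_rpow hx0.le] at hxy
    have hγ : 0 < β - 1 / 2 := sub_pos.2 hβ
    have hyγ : y ^ (β - 1 / 2) ≤ (1 / ((n : ℝ) + 1)) ^ (β - 1 / 2) :=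
      Real.rpow_le_rpow hymem.1.le hyle hγ.le
    have hxγ : x ^ (β - 1 / 2) ≤ y ^ (β - 1 / 2) := Real.rpow_le_rpow hx0.le hxle hγ.le
    have step : |(√x)⁻¹ - (√y)⁻¹ - (Iio p₁).indicator 1 ω * (√2)⁻¹| ≤
        2 * (1 / ((n : ℝ) + 1)) ^ (β - 1 / 2) := by
      by_cases hω : ω < p₁
      · rw [indicator_of_mem (show ω ∈ Iio p₁ from hω), Pi.one_apply, one_mul]
        have hi : decide (ω < p₁) = true := by simpa using hω
        rw [hi, symExp, cond_true, ← Real.sqrt_eq_rpow] at hxy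
        rw [← hxy]
        refine (abs_inv_sqrt_sub_sub_le hx0).trans ?_
        have h1 : √(2 * x) ≤ 2 * √x := by
          rw [Real.sqrt_mul zero_le_two]
          refine mul_le_mul_of_nonneg_right ?_ (Real.sqrt_nonneg _)
          rw [Real.sqrt_le_left zero_le_two]; norm_num
        have h2 : √x ≤ x ^ (β - 1 / 2) := by
          rw [Real.sqrt_eq_rpow]
          refine Real.rpow_le_rpow_of_exponent_ge hx0 (hxle.trans hymem.2) ?_
          have : β ≤ 1 := P.beta_le
          linarith
        linarith
      · rw [indicator_of_notMem (show ω ∉ Iio p₁ from hω), zero_mul, sub_zero]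
        have hi : decide (ω < p₁) = false := by simpa using hω
        rw [hi, symExp, cond_false] at hxy
        rw [← hxy]
        have h3 := inv_sqrt_sub_le hx0 (r := (2 * x) ^ β) (by positivity)
        rw [abs_of_nonneg h3.1]
        refine h3.2.trans ?_
        have h4 : (2 * x) ^ β = 2 ^ β * (x ^ (β - 1 / 2) * √x) := by
          rw [Real.mul_rpow zero_le_two hx0.le, Real.sqrt_eq_rpow, ← Real.rpow_add hx0]
          congr 2; ring
        have h5 : (2 : ℝ) ^ β ≤ 2 := by
          have := Real.rpow_le_rpow_of_exponent_le one_le_two P.beta_le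
          rwa [Real.rpow_one] at this
        have hsx : 0 < √x := Real.sqrt_pos.2 hx0
        have hxg : 0 < x ^ (β - 1 / 2) := by positivity
        rw [h4, div_le_iff₀ (by positivity)]
        calc (2 : ℝ) ^ β * (x ^ (β - 1 / 2) * √x) ≤ 2 * (x ^ (β - 1 / 2) * √x) := by gcongr
          _ ≤ 2 * (1 / ((n : ℝ) + 1)) ^ (β - 1 / 2) * √x := by
            rw [mul_assoc]
            exact mul_le_mul_of_nonneg_left
              (mul_le_mul_of_nonneg_right (hxγ.trans hyγ) hsx.le) zero_le_two
          _ ≤ _ := by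
            refine mul_le_mul_of_nonneg_left ?_ (by positivity)
            linarith
    rw [show (√x)⁻¹ - 1 - ((Iio p₁).indicator 1 ω + symCount p₁ n (phiMap p₁ ω)) * (√2)⁻¹ =
      ((√y)⁻¹ - 1 - symCount p₁ n (phiMap p₁ ω) * (√2)⁻¹) +
      ((√x)⁻¹ - (√y)⁻¹ - (Iio p₁).indicator 1 ω * (√2)⁻¹) by ring]
    exact (abs_add_le _ _).trans (add_le_add ih step)

end LSVParam

end EscapeLevel

section NoiseAsymptotics

variable {α β p₁ : ℝ}

theorem tendsto_sum_div_of_tendsto_zero {u : ℕ → ℝ} (hu : Tendsto u atTop (𝓝 0)) :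
    Tendsto (fun n : ℕ => (∑ k ∈ Finset.range n, u k) / n) atTop (𝓝 0) := by
  simpa only [div_eq_inv_mul] using hu.cesaro

theorem tendsto_one_div_add_one_rpow {t : ℝ} (ht : 0 < t) :
    Tendsto (fun k : ℕ => (1 / ((k : ℝ) + 1)) ^ t) atTop (𝓝 0) := by
  have := (tendsto_one_div_add_atTop_nhds_zero_nat (𝕜 := ℝ)).rpow_const (Or.inr ht.le)
  rwa [Real.zero_rpow ht.ne'] at this

/-- The bound on the drift of `(escapeLevel n)^(-1/2)`. -/
def driftBound (β : ℝ) (n : ℕ) : ℝ :=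
  ∑ k ∈ Finset.range n, 2 * (1 / ((k : ℝ) + 1)) ^ (β - 1 / 2)

theorem tendsto_driftBound_div (hβ : 1 / 2 < β) :
    Tendsto (fun n : ℕ => driftBound β n / n) atTop (𝓝 0) := by
  refine tendsto_sum_div_of_tendsto_zero ?_
  simpa using (tendsto_one_div_add_one_rpow (sub_pos.2 hβ)).const_mul 2

namespace LSVParam

theorem integral_exp_neg_symCount (P : LSVParam α β p₁) (n : ℕ) :
    ∫ ω in Ico (0 : ℝ) 1, Real.exp (-symCount p₁ n ω) =
      (p₁ * Real.exp (-1) + (1 - p₁)) ^ n := by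
  induction n with
  | zero => simp [symCount]
  | succ n ih =>
    have hm : Measurable fun ω => Real.exp (-symCount p₁ (n + 1) ω) :=
      Real.measurable_exp.comp (measurable_symCount (n + 1)).neg
    rw [← (P.markovSystem_noise one_pos).integral_transfer hm (C := 1) fun ω => by
      rw [Real.abs_exp, Real.exp_le_one_iff, neg_nonpos]
      exact symCount_nonneg _ _]
    rw [pow_succ', ← ih, ← integral_const_mul]
    refine setIntegral_congr_fun measurableSet_Ico fun ω hω => ?_
    have h1 : ∀ i, symCount p₁ (n + 1) (noiseInv p₁ i ω) =
        (if i = true then 1 else 0) + symCount p₁ n ω := fun i => by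
      rw [symCount_succ, P.phiMap_noiseInv i hω]
      congr 1
      have := P.noiseInv_lt_iff i hω
      cases i <;> simp_all [indicator]
    simp only [MarkovSystem.transfer_apply hω, tsum_fintype, Fintype.sum_bool, h1]
    simp only [symProb, cond_true, cond_false, if_true, Bool.false_eq_true, if_false, neg_add,
      Real.exp_add, neg_zero, Real.exp_zero]
    ring

/-- A Chernoff bound for the number of symbols `α`. -/
theorem exists_measureReal_symCount_le (P : LSVParam α β p₁) :
    ∃ ε > 0, ∃ r, 0 ≤ r ∧ r < 1 ∧ ∀ n : ℕ,
      (volume.restrict (Ico (0 : ℝ) 1)).real {ω | symCount p₁ n ω ≤ ε * n} ≤ r ^ n := by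
  set κ := p₁ * Real.exp (-1) + (1 - p₁) with hκ
  have he : Real.exp (-1) < 1 := Real.exp_lt_one_iff.2 (by norm_num)
  have hp0 := P.prob_pos
  have hp1 := P.prob_lt
  have hκ0 : 0 < κ := by have := Real.exp_pos (-1); nlinarith [mul_pos hp0 this]
  have hκ1 : κ < 1 := by nlinarith
  have hlog : Real.log κ < 0 := Real.log_neg hκ0 hκ1
  refine ⟨-Real.log κ / 2, by linarith, Real.exp (Real.log κ / 2), (Real.exp_pos _).le,
    Real.exp_lt_one_iff.2 (by linarith), fun n => ?_⟩
  have hm : Measurable fun ω => Real.exp (-symCount p₁ n ω) :=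
    Real.measurable_exp.comp (measurable_symCount n).neg
  have hi : Integrable (fun ω => Real.exp (-symCount p₁ n ω)) (volume.restrict (Ico (0 : ℝ) 1)) :=
    integrable_of_bdd hm (C := 1) fun ω => by
      rw [Real.norm_eq_abs, Real.abs_exp, Real.exp_le_one_iff, neg_nonpos]
      exact symCount_nonneg _ _
  have hmk := mul_meas_ge_le_integral_of_nonneg (ae_of_all _ fun ω => (Real.exp_pos _).le) hi
    (Real.exp (Real.log κ / 2 * n))
  rw [P.integral_exp_neg_symCount] at hmk
  have hset : {ω | symCount p₁ n ω ≤ -Real.log κ / 2 * n} =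
      {ω | Real.exp (Real.log κ / 2 * n) ≤ Real.exp (-symCount p₁ n ω)} := by
    ext ω
    simp only [mem_ofPred_eq, Real.exp_le_exp]
    constructor <;> intro h <;> linarith
  rw [hset]
  have h2 : κ ^ n = Real.exp (Real.log κ / 2 * n) * Real.exp (Real.log κ / 2) ^ n := by
    rw [← Real.exp_nat_mul, ← Real.exp_add]
    conv_lhs => rw [← Real.exp_log hκ0, ← Real.exp_nat_mul]
    congr 1; ring
  rw [← hκ, h2] at hmk
  exact le_of_mul_le_mul_left hmk (Real.exp_pos _)

variable (P : LSVParam (1 / 2) β p₁) (hβ : 1 / 2 < β)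
include P hβ

theorem exists_measureReal_inv_sqrt_lt :
    ∃ δ > 0, ∃ r, 0 ≤ r ∧ r < 1 ∧ ∀ᶠ n : ℕ in atTop,
      (volume.restrict (Ico (0 : ℝ) 1)).real
        {ω | (√(escapeLevel (1 / 2) β p₁ n ω))⁻¹ < δ * n} ≤ r ^ n := by
  obtain ⟨ε, hε, r, hr0, hr1, h⟩ := P.exists_measureReal_symCount_le
  have h2 : 0 < (√(2 : ℝ))⁻¹ := by positivity
  refine ⟨ε * (√2)⁻¹ / 2, by positivity, r, hr0, hr1, ?_⟩
  have hev := (tendsto_driftBound_div hβ).eventually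
    (gt_mem_nhds (by positivity : (0 : ℝ) < ε * (√2)⁻¹ / 2))
  filter_upwards [hev, eventually_gt_atTop 0] with n hn hn0
  have hn' : (0 : ℝ) < n := Nat.cast_pos.2 hn0
  rw [div_lt_iff₀ hn'] at hn
  refine (measureReal_mono fun ω hω => ?_).trans (h n)
  rw [mem_ofPred_eq] at hω ⊢
  have h3 := (abs_le.1 (P.abs_inv_sqrt_escapeLevel_sub_le hβ n ω)).1
  change -driftBound β n ≤ _ at h3
  by_contra! hlt
  have := mul_lt_mul_of_pos_right hlt h2
  linarith

theorem tendsto_integral_mul_escapeLevel {D : ℕ → ℝ → ℝ} (hD : ∀ n, Measurable (D n)) {M : ℝ}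
    (hM : ∀ n ω, |D n ω| ≤ M * n)
    (hlim : Tendsto (fun n : ℕ => (∫ ω in Ico (0 : ℝ) 1, |D n ω|) / n) atTop (𝓝 0)) :
    Tendsto (fun n : ℕ => n * ∫ ω in Ico (0 : ℝ) 1,
      escapeLevel (1 / 2) β p₁ n ω * (|D n ω| + 1)) atTop (𝓝 0) := by
  obtain ⟨δ, hδ, r, hr0, hr1, h⟩ := P.exists_measureReal_inv_sqrt_lt hβ
  have hM0 : 0 ≤ M := by simpa using (abs_nonneg _).trans (hM 1 0)
  have hlim1 : Tendsto (fun n : ℕ => (δ ^ 2)⁻¹ *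
      ((∫ ω in Ico (0 : ℝ) 1, |D n ω|) / n + 1 / n) + (M * (n * r ^ n) + r ^ n))
      atTop (𝓝 0) := by
    have h1 := (hlim.add tendsto_one_div_atTop_nhds_zero_nat).const_mul (δ ^ 2)⁻¹
    have h2 := ((tendsto_self_mul_const_pow_of_lt_one hr0 hr1).const_mul M).add
      (tendsto_pow_atTop_nhds_zero_of_lt_one hr0 hr1)
    simpa using h1.add h2
  refine squeeze_zero' (Eventually.of_forall fun n => mul_nonneg n.cast_nonneg
    (integral_nonneg fun ω => mul_nonneg (P.escapeLevel_mem n ω).1.le (by positivity))) ?_ hlim1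
  filter_upwards [h, eventually_gt_atTop 0] with n hn hn0
  have hn' : (0 : ℝ) < n := Nat.cast_pos.2 hn0
  set B := {ω | (√(escapeLevel (1 / 2) β p₁ n ω))⁻¹ < δ * n} with hB
  have hBm : MeasurableSet B := measurableSet_lt
    (measurable_escapeLevel n).sqrt.inv measurable_const
  have hDi : Integrable (fun ω => |D n ω|) (volume.restrict (Ico (0 : ℝ) 1)) :=
    integrable_of_bdd (hD n).abs (C := M * n) fun ω => by
      rw [norm_abs_eq_norm]; exact hM n ω
  have hpt : ∀ ω, n * (escapeLevel (1 / 2) β p₁ n ω * (|D n ω| + 1)) ≤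
      (δ ^ 2)⁻¹ * ((|D n ω| + 1) / n) + B.indicator (fun _ => M * n + 1) ω := by
    intro ω
    have hξ := P.escapeLevel_mem n ω
    have hξ1 := P.escapeLevel_le n ω
    set ξ := escapeLevel (1 / 2) β p₁ n ω
    by_cases hω : ω ∈ B
    · rw [indicator_of_mem hω]
      have h1 : n * ξ ≤ 1 := by
        calc n * ξ ≤ n * (1 / (n + 1)) := by gcongr
          _ ≤ 1 := by rw [mul_one_div, div_le_one (by positivity)]; linarith
      have h2 := hM n ω
      have h3 : 0 ≤ (δ ^ 2)⁻¹ * ((|D n ω| + 1) / n) := by positivity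
      have h4 : n * ξ * (|D n ω| + 1) ≤ 1 * (M * n + 1) := by gcongr
      linarith
    · rw [indicator_of_notMem hω, add_zero]
      have h1 : δ * n ≤ (√ξ)⁻¹ := not_lt.1 hω
      have hs : 0 < √ξ := Real.sqrt_pos.2 hξ.1
      rw [le_inv_comm₀ (by positivity) hs] at h1
      have h2 : ξ ≤ ((δ * n)⁻¹) ^ 2 := by
        rw [← Real.sq_sqrt hξ.1.le]
        exact pow_le_pow_left₀ hs.le h1 2
      calc n * (ξ * (|D n ω| + 1)) ≤ n * (((δ * n)⁻¹) ^ 2 * (|D n ω| + 1)) := by gcongr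
        _ = _ := by field_simp
  calc _ = ∫ ω in Ico (0 : ℝ) 1, n * (escapeLevel (1 / 2) β p₁ n ω * (|D n ω| + 1)) := by
        rw [integral_const_mul]
    _ ≤ ∫ ω in Ico (0 : ℝ) 1, ((δ ^ 2)⁻¹ * ((|D n ω| + 1) / n) +
          B.indicator (fun _ => M * n + 1) ω) := by
        refine integral_mono_of_nonneg (ae_of_all _ fun ω => mul_nonneg n.cast_nonneg
          (mul_nonneg (P.escapeLevel_mem n ω).1.le (by positivity))) ?_ (ae_of_all _ hpt)
        exact (((hDi.add (integrable_const _)).div_const _).const_mul _).add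
          ((integrable_const _).indicator hBm)
    _ = (δ ^ 2)⁻¹ * ((∫ ω in Ico (0 : ℝ) 1, |D n ω|) / n + 1 / n) +
          (volume.restrict (Ico (0 : ℝ) 1)).real B * (M * n + 1) := by
        have i1 : Integrable (fun ω => (δ ^ 2)⁻¹ * ((|D n ω| + 1) / n))
            (volume.restrict (Ico (0 : ℝ) 1)) :=
          ((hDi.add (integrable_const _)).div_const _).const_mul _
        have i2 : Integrable (B.indicator fun _ => M * n + 1)
            (volume.restrict (Ico (0 : ℝ) 1)) := (integrable_const _).indicator hBm
        rw [integral_add i1 i2, integral_const_mul, integral_div,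
          integral_add hDi (integrable_const _), integral_const, probReal_univ, one_smul,
          integral_indicator_const _ hBm, smul_eq_mul, add_div]
    _ ≤ _ := by
        have : (volume.restrict (Ico (0 : ℝ) 1)).real B * (M * n + 1) ≤ r ^ n * (M * n + 1) := by
          gcongr
        linarith

omit hβ in
theorem tendsto_integral_abs_symCount_sub :
    Tendsto (fun n : ℕ => (∫ ω in Ico (0 : ℝ) 1, |symCount p₁ n ω - n * p₁|) / n)
      atTop (𝓝 0) := by
  have hm : Measurable fun ω => (Iio p₁).indicator (1 : ℝ → ℝ) ω - p₁ :=
    (measurable_one.indicator measurableSet_Iio).sub_const _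
  have hp0 := P.prob_pos
  have hp1 := P.prob_lt
  have hv0 : ∫ ω in Ico (0 : ℝ) 1, ((Iio p₁).indicator (1 : ℝ → ℝ) ω - p₁) = 0 := by
    have hi : Integrable ((Iio p₁).indicator (1 : ℝ → ℝ)) (volume.restrict (Ico (0 : ℝ) 1)) :=
      (integrable_const 1).indicator measurableSet_Iio
    rw [integral_sub hi (integrable_const _), integral_indicator measurableSet_Iio,
      Measure.restrict_restrict measurableSet_Iio]
    have : Iio p₁ ∩ Ico 0 1 = Ico 0 p₁ := by
      ext x; simp only [mem_inter_iff, mem_Iio, mem_Ico]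
      constructor
      · rintro ⟨a, b, -⟩; exact ⟨b, a⟩
      · rintro ⟨a, b⟩; exact ⟨b, a, b.trans hp1⟩
    simp [this, hp0.le]
  have := P.tendsto_integral_noise hm (M := 1) (fun ω => by
    by_cases h : ω ∈ Iio p₁
    · rw [indicator_of_mem h, Pi.one_apply, abs_le]; constructor <;> linarith
    · rw [indicator_of_notMem h, abs_le]; constructor <;> linarith) (C := 0) le_rfl one_pos
    (fun i x hx y hy => by
      have h1 := P.noiseInv_lt_iff i hx
      have h2 := P.noiseInv_lt_iff i hy
      have : noiseInv p₁ i x ∈ Iio p₁ ↔ noiseInv p₁ i y ∈ Iio p₁ := h1.trans h2.symm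
      by_cases h : noiseInv p₁ i x ∈ Iio p₁
      · rw [indicator_of_mem h, indicator_of_mem (this.1 h)]; simp
      · rw [indicator_of_notMem h, indicator_of_notMem (fun h' => h (this.2 h'))]; simp) hv0
  refine this.congr fun n => ?_
  congr 2
  ext ω
  rw [Finset.sum_sub_distrib, Finset.sum_const, Finset.card_range, nsmul_eq_mul]
  rfl

/-- `n² escapeLevel n` converges in mean to `2 / p₁²`. -/
theorem tendsto_integral_abs_sq_mul_escapeLevel_sub :
    Tendsto (fun n : ℕ => ∫ ω in Ico (0 : ℝ) 1,
      |(n : ℝ) ^ 2 * escapeLevel (1 / 2) β p₁ n ω - 2 / p₁ ^ 2|) atTop (𝓝 0) := by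
  obtain ⟨δ, hδ, r, hr0, hr1, h⟩ := P.exists_measureReal_inv_sqrt_lt hβ
  have hp0 := P.prob_pos
  set s := p₁ * (√2)⁻¹ with hs
  have hs0 : 0 < s := by positivity
  have hs2 : 2 / p₁ ^ 2 = 1 / s ^ 2 := by
    rw [hs, mul_pow, inv_pow, Real.sq_sqrt zero_le_two]
    field_simp
  rw [hs2]
  set K := 1 / (δ ^ 2 * s) + 1 / (δ * s ^ 2) with hK
  have hK0 : 0 ≤ K := by positivity
  have hN := P.tendsto_integral_abs_symCount_sub
  have hlim1 : Tendsto (fun n : ℕ => K * (1 / n + (∫ ω in Ico (0 : ℝ) 1,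
      |symCount p₁ n ω - n * p₁|) / n + driftBound β n / n) + (n * r ^ n + 1 / s ^ 2 * r ^ n))
      atTop (𝓝 0) := by
    have h1 := ((tendsto_one_div_atTop_nhds_zero_nat.add hN).add
      (tendsto_driftBound_div hβ)).const_mul K
    have h2 := (tendsto_self_mul_const_pow_of_lt_one hr0 hr1).add
      ((tendsto_pow_atTop_nhds_zero_of_lt_one hr0 hr1).const_mul (1 / s ^ 2))
    simpa using h1.add h2
  refine squeeze_zero' (Eventually.of_forall fun n => integral_nonneg fun ω => abs_nonneg _) ?_
    hlim1
  filter_upwards [h, eventually_gt_atTop 0] with n hn hn0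
  have hn' : (0 : ℝ) < n := Nat.cast_pos.2 hn0
  set B := {ω | (√(escapeLevel (1 / 2) β p₁ n ω))⁻¹ < δ * n} with hB
  have hBm : MeasurableSet B := measurableSet_lt
    (measurable_escapeLevel n).sqrt.inv measurable_const
  have hSi : Integrable (fun ω => |symCount p₁ n ω - n * p₁|)
      (volume.restrict (Ico (0 : ℝ) 1)) :=
    integrable_of_bdd ((measurable_symCount n).sub_const _).abs (C := n + n * p₁) fun ω => by
      rw [norm_abs_eq_norm]
      refine (norm_sub_le _ _).trans ?_
      rw [Real.norm_of_nonneg (symCount_nonneg _ _), Real.norm_of_nonneg (by positivity)]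
      gcongr
      exact symCount_le _ _
  have hpt : ∀ ω, |(n : ℝ) ^ 2 * escapeLevel (1 / 2) β p₁ n ω - 1 / s ^ 2| ≤
      K * ((1 + driftBound β n) / n + |symCount p₁ n ω - n * p₁| / n) +
        B.indicator (fun _ => n + 1 / s ^ 2) ω := by
    intro ω
    have hξ := P.escapeLevel_mem n ω
    have hξ1 := P.escapeLevel_le n ω
    have hdr := P.abs_inv_sqrt_escapeLevel_sub_le hβ n ω
    change _ ≤ driftBound β n at hdr
    have hdb : 0 ≤ driftBound β n := (abs_nonneg _).trans hdr
    set ξ := escapeLevel (1 / 2) β p₁ n ω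
    by_cases hω : ω ∈ B
    · rw [indicator_of_mem hω]
      have h1 : (n : ℝ) ^ 2 * ξ ≤ n := by
        calc (n : ℝ) ^ 2 * ξ ≤ (n : ℝ) ^ 2 * (1 / (n + 1)) := by gcongr
          _ ≤ (n : ℝ) := by rw [mul_one_div, div_le_iff₀ (by positivity)]; nlinarith
      have h3 : 0 ≤ K * ((1 + driftBound β n) / n + |symCount p₁ n ω - n * p₁| / n) := by
        positivity
      have h4 : 0 ≤ (n : ℝ) ^ 2 * ξ := mul_nonneg (by positivity) hξ.1.le
      have h5 : 0 ≤ 1 / s ^ 2 := by positivity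
      rw [abs_le]
      constructor <;> linarith
    · rw [indicator_of_notMem hω, add_zero]
      have h1 : δ * n ≤ (√ξ)⁻¹ := not_lt.1 hω
      have hsq : 0 < √ξ := Real.sqrt_pos.2 hξ.1
      set z := (√ξ)⁻¹ / n with hz
      have hzδ : δ ≤ z := by rwa [hz, le_div_iff₀ hn']
      have hz0 : 0 < z := hδ.trans_le hzδ
      have hzξ : (n : ℝ) ^ 2 * ξ = 1 / z ^ 2 := by
        rw [hz, div_pow, inv_pow, Real.sq_sqrt hξ.1.le]
        have := hξ.1.ne'
        field_simp
      have h2 : 1 / z ^ 2 - 1 / s ^ 2 = (s - z) * (1 / (z ^ 2 * s) + 1 / (z * s ^ 2)) := by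
        field_simp
        ring
      have h3 : |z - s| ≤ (1 + driftBound β n) / n + |symCount p₁ n ω - n * p₁| / n := by
        have h4 : z - s = ((√ξ)⁻¹ - 1 - symCount p₁ n ω * (√2)⁻¹ + 1 +
            (symCount p₁ n ω - n * p₁) * (√2)⁻¹) / n := by
          rw [hz, hs]; field_simp; ring
        rw [h4, abs_div, abs_of_pos hn', ← add_div]
        gcongr
        refine (abs_add_le _ _).trans (add_le_add ((abs_add_le _ _).trans ?_) ?_)
        · rw [abs_one]; linarith
        · rw [abs_mul, abs_of_nonneg (by positivity : (0 : ℝ) ≤ (√2)⁻¹)]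
          refine mul_le_of_le_one_right (abs_nonneg _) (inv_le_one_of_one_le₀ ?_)
          exact Real.one_le_sqrt.2 one_le_two
      rw [hzξ, h2, abs_mul, abs_sub_comm, abs_of_nonneg (by positivity :
        0 ≤ 1 / (z ^ 2 * s) + 1 / (z * s ^ 2)), mul_comm]
      refine mul_le_mul ?_ h3 (abs_nonneg _) hK0
      rw [hK]
      gcongr
  have i1 : Integrable (fun ω => K * ((1 + driftBound β n) / n +
      |symCount p₁ n ω - n * p₁| / n)) (volume.restrict (Ico (0 : ℝ) 1)) :=
    ((integrable_const _).add (hSi.div_const _)).const_mul _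
  have i2 : Integrable (B.indicator fun _ => n + 1 / s ^ 2)
      (volume.restrict (Ico (0 : ℝ) 1)) := (integrable_const _).indicator hBm
  refine (integral_mono_of_nonneg (ae_of_all _ fun ω => abs_nonneg _) (i1.add i2)
    (ae_of_all _ hpt)).trans ?_
  have e1 := integral_add i1 i2
  rw [integral_const_mul, integral_add (integrable_const _) (hSi.div_const _), integral_const,
    probReal_univ, one_smul, integral_div, integral_indicator_const _ hBm, smul_eq_mul] at e1
  refine (show _ = _ from e1).trans_le ?_
  have : (volume.restrict (Ico (0 : ℝ) 1)).real B * (n + 1 / s ^ 2) ≤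
      r ^ n * (n + 1 / s ^ 2) := by gcongr
  have e2 : (1 + driftBound β n) / n = 1 / n + driftBound β n / n := add_div _ _ _
  rw [e2]
  linarith

end LSVParam

end NoiseAsymptotics

section Tails

variable {α β p₁ : ℝ} {ν : Measure (ℝ × ℝ)} {k : ℝ × ℝ → ℝ}

/-- The points of the base that have not returned after `n` steps. -/
def lateSet (α β p₁ : ℝ) (n : ℕ) : Set (ℝ × ℝ) :=
  base ∩ {p | n < returnTime (skewLSV α β p₁) base p}

theorem lateSet_subset {n : ℕ} : lateSet α β p₁ n ⊆ base := inter_subset_left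

theorem measurableSet_lateSet (n : ℕ) : MeasurableSet (lateSet α β p₁ n) :=
  measurableSet_base.inter (measurableSet_lt measurable_const
    (measurable_returnTime measurable_skewLSV measurableSet_base))

/-- The width of the fibres of `lateSet n`. -/
def lateWidth (α β p₁ : ℝ) (n : ℕ) (ω : ℝ) : ℝ := escapeLevel α β p₁ n (phiMap p₁ ω) / 2

theorem measurable_lateWidth (n : ℕ) : Measurable (lateWidth α β p₁ n) :=
  ((measurable_escapeLevel n).comp measurable_phiMap).div_const _

namespace LSVParam

variable (P : LSVParam α β p₁)
include P

theorem lateWidth_pos (n : ℕ) (ω : ℝ) : 0 < lateWidth α β p₁ n ω :=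
  half_pos (P.escapeLevel_mem n _).1

theorem mem_lateSet_iff {n : ℕ} {p : ℝ × ℝ} :
    p ∈ lateSet α β p₁ n ↔ p.2 ∈ Ico (0 : ℝ) 1 ∧ p.1 ∈ Ioc (1 / 2) (1 / 2 + lateWidth α β p₁ n p.2) := by
  have h1 := (P.escapeLevel_mem n (phiMap p₁ p.2)).2
  have hw : lateWidth α β p₁ n p.2 = escapeLevel α β p₁ n (phiMap p₁ p.2) / 2 := rfl
  constructor
  · rintro ⟨hb, hr⟩
    have := (P.lt_returnTime_iff_le hb n).1 hr
    exact ⟨hb.2, hb.1.1, by linarith⟩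
  · rintro ⟨h2, h3, h4⟩
    have hb : p ∈ base := ⟨⟨h3, by linarith⟩, h2⟩
    exact ⟨hb, (P.lt_returnTime_iff_le hb n).2 (by linarith)⟩

theorem map_snd_restrict_lateSet (n : ℕ) :
    ((volume : Measure (ℝ × ℝ)).restrict (lateSet α β p₁ n)).map Prod.snd =
      (volume.restrict (Ico (0 : ℝ) 1)).withDensity
        fun ω => ENNReal.ofReal (lateWidth α β p₁ n ω) := by
  ext s hs
  rw [Measure.map_apply measurable_snd hs, Measure.restrict_apply (measurable_snd hs),
    withDensity_apply _ hs, Measure.restrict_restrict hs,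
    ← lintegral_indicator (hs.inter measurableSet_Ico), Measure.volume_eq_prod,
    Measure.prod_apply_symm ((measurable_snd hs).inter (measurableSet_lateSet n))]
  refine lintegral_congr fun ω => ?_
  by_cases hω : ω ∈ s ∩ Ico 0 1
  · rw [indicator_of_mem hω]
    have : (fun x => (x, ω)) ⁻¹' (Prod.snd ⁻¹' s ∩ lateSet α β p₁ n) =
        Ioc (1 / 2) (1 / 2 + lateWidth α β p₁ n ω) := by
      ext x
      rw [mem_preimage, mem_inter_iff, P.mem_lateSet_iff]
      exact ⟨fun h => h.2.2, fun h => ⟨hω.1, hω.2, h⟩⟩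
    rw [this, Real.volume_Ioc, add_sub_cancel_left]
  · rw [indicator_of_notMem hω]
    have : (fun x => (x, ω)) ⁻¹' (Prod.snd ⁻¹' s ∩ lateSet α β p₁ n) = ∅ := by
      ext x
      rw [mem_preimage, mem_inter_iff, P.mem_lateSet_iff]
      exact ⟨fun h => hω ⟨h.1, h.2.1⟩, fun h => h.elim⟩
    rw [this, measure_empty]

theorem setIntegral_lateSet_snd {g : ℝ → ℝ} (hg : Measurable g) (n : ℕ) :
    ∫ p in lateSet α β p₁ n, g p.2 = ∫ ω in Ico (0 : ℝ) 1, lateWidth α β p₁ n ω * g ω := by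
  rw [← integral_map (φ := Prod.snd) measurable_snd.aemeasurable hg.aestronglyMeasurable,
    P.map_snd_restrict_lateSet, integral_withDensity_eq_integral_toReal_smul
      (measurable_lateWidth n).ennreal_ofReal (ae_of_all _ fun _ => ENNReal.ofReal_lt_top)]
  refine integral_congr_ae (ae_of_all _ fun ω => ?_)
  simp only [ENNReal.toReal_ofReal (P.lateWidth_pos n ω).le, smul_eq_mul]

theorem integral_lateWidth_mul {g : ℝ → ℝ} (hg : Measurable g) (n : ℕ) :
    ∫ ω in Ico (0 : ℝ) 1, lateWidth α β p₁ n ω * g (phiMap p₁ ω) =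
      (∫ ω in Ico (0 : ℝ) 1, escapeLevel α β p₁ n ω * g ω) / 2 := by
  have hm : Measurable fun ω => escapeLevel α β p₁ n ω * g ω / 2 :=
    ((measurable_escapeLevel n).mul hg).div_const 2
  rw [← integral_div, ← P.measurePreserving_phiMap.integral_comp_of_measurable hm]
  refine integral_congr_ae (ae_of_all _ fun ω => ?_)
  simp only [lateWidth]
  ring

end LSVParam

namespace LSVDensity

variable (H : LSVDensity α β p₁ ν k)
include H

theorem setIntegral_eq {A : Set (ℝ × ℝ)} (hA : MeasurableSet A) (hAb : A ⊆ base)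
    (u : ℝ × ℝ → ℝ) : ∫ p in A, u p ∂ν = ∫ p in A, k p * u p := by
  rw [H.eq_withDensity, restrict_withDensity hA, Measure.restrict_restrict hA,
    inter_eq_left.2 (hAb.trans base_subset_strip), integral_withDensity_eq_integral_toReal_smul
      H.measurable.ennreal_ofReal (ae_of_all _ fun _ => ENNReal.ofReal_lt_top)]
  simp only [ENNReal.toReal_ofReal (H.nonneg _), smul_eq_mul]

theorem exists_le_of_mem : ∃ K, 0 ≤ K ∧ ∀ p ∈ Icc (1 / 2 : ℝ) 1 ×ˢ Icc (0 : ℝ) 1, k p ≤ K := by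
  obtain ⟨L, hL, h⟩ := H.lipschitz
  have h1 : ((1 : ℝ), (0 : ℝ)) ∈ Icc (1 / 2 : ℝ) 1 ×ˢ Icc (0 : ℝ) 1 := by norm_num [mem_prod]
  refine ⟨k (1, 0) + L, add_nonneg (H.nonneg _) hL, fun p hp => ?_⟩
  have h2 := (le_abs_self _).trans (h p hp _ h1)
  have h3 : dist p (1, 0) ≤ 1 := by
    rw [Prod.dist_eq, max_le_iff, Real.dist_eq, Real.dist_eq, abs_le, abs_le]
    obtain ⟨⟨a, b⟩, c, d⟩ := hp
    refine ⟨⟨?_, ?_⟩, ?_, ?_⟩ <;> simp only <;> linarith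
  nlinarith

theorem integrableOn_mul {u : ℝ × ℝ → ℝ} (hu : Measurable u) {M : ℝ} (hM : ∀ p, |u p| ≤ M)
    {A : Set (ℝ × ℝ)} (hA : MeasurableSet A) (hAb : A ⊆ base) :
    IntegrableOn (fun p => k p * u p) A := by
  obtain ⟨K, hK, h⟩ := H.exists_le_of_mem
  have hfin : (volume : Measure (ℝ × ℝ)) A ≠ ⊤ := by
    refine ((measure_mono hAb).trans_lt ?_).ne
    rw [base, Measure.volume_eq_prod, Measure.prod_prod, Real.volume_Ioc, Real.volume_Ico]
    exact ENNReal.mul_lt_top ENNReal.ofReal_lt_top ENNReal.ofReal_lt_top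
  have hae : ∀ᵐ p ∂volume.restrict A, ‖k p * u p‖ ≤ K * M :=
    (ae_restrict_mem hA).mono fun p hp => by
      rw [norm_mul, Real.norm_of_nonneg (H.nonneg p)]
      exact mul_le_mul (h p (base_subset_Icc (hAb hp))) (hM p) (norm_nonneg _) hK
  exact Measure.integrableOn_of_bounded hfin (H.measurable.mul hu).aestronglyMeasurable hae

/-- Integrals over `lateSet` are controlled by the noise process. -/
theorem exists_setIntegral_lateSet_le [IsProbabilityMeasure ν] :
    ∃ C, 0 ≤ C ∧ ∀ (n : ℕ) (D : ℝ → ℝ) (M : ℝ), Measurable D → (∀ ω, |D ω| ≤ M) →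
      ∫ p in lateSet α β p₁ n, (|D (phiMap p₁ p.2)| + 1) ∂ν ≤
        C * ∫ ω in Ico (0 : ℝ) 1, escapeLevel α β p₁ n ω * (|D ω| + 1) := by
  obtain ⟨K, hK, h⟩ := H.exists_le_of_mem
  refine ⟨K / 2, by positivity, fun n D M hD hM => ?_⟩
  have hg : Measurable fun ω => |D ω| + 1 := hD.abs.add_const 1
  have hgφ : Measurable fun ω => |D (phiMap p₁ ω)| + 1 := hg.comp measurable_phiMap
  have hgp : Measurable fun p : ℝ × ℝ => |D (phiMap p₁ p.2)| + 1 := hgφ.comp measurable_snd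
  have hb : ∀ p : ℝ × ℝ, |(|D (phiMap p₁ p.2)| + 1)| ≤ M + 1 := fun p => by
    rw [abs_of_nonneg (by positivity)]
    linarith [hM (phiMap p₁ p.2)]
  have hfin : IsFiniteMeasure ((volume : Measure (ℝ × ℝ)).restrict (lateSet α β p₁ n)) := ⟨by
    rw [Measure.restrict_apply_univ]
    refine (measure_mono lateSet_subset).trans_lt ?_
    rw [base, Measure.volume_eq_prod, Measure.prod_prod, Real.volume_Ioc, Real.volume_Ico]
    exact ENNReal.mul_lt_top ENNReal.ofReal_lt_top ENNReal.ofReal_lt_top⟩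
  rw [H.setIntegral_eq (measurableSet_lateSet n) lateSet_subset]
  have hi : Integrable (fun p : ℝ × ℝ => |D (phiMap p₁ p.2)| + 1)
    (volume.restrict (lateSet α β p₁ n)) := integrable_of_bdd hgp hb
  calc ∫ p in lateSet α β p₁ n, k p * (|D (phiMap p₁ p.2)| + 1)
      ≤ ∫ p in lateSet α β p₁ n, K * (|D (phiMap p₁ p.2)| + 1) := by
        refine setIntegral_mono_on
          (H.integrableOn_mul hgp hb (measurableSet_lateSet n) lateSet_subset)
          (hi.const_mul K) (measurableSet_lateSet n) fun p hp => ?_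
        exact mul_le_mul_of_nonneg_right (h p (base_subset_Icc (lateSet_subset hp)))
          (by positivity)
    _ = _ := by
        rw [integral_const_mul, H.param.setIntegral_lateSet_snd hgφ,
          H.param.integral_lateWidth_mul hg]
        ring

end LSVDensity

end Tails

section TailAsymptotics

variable {β p₁ : ℝ} {ν : Measure (ℝ × ℝ)} {k : ℝ × ℝ → ℝ}

namespace LSVDensity

variable (H : LSVDensity (1 / 2) β p₁ ν k) (hβ : 1 / 2 < β)
include H hβ

/-- The tail of the return time. -/
theorem tendsto_sq_mul_measureReal_lateSet [IsProbabilityMeasure ν] :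
    Tendsto (fun n : ℕ => (n : ℝ) ^ 2 * ν.real (lateSet (1 / 2) β p₁ n)) atTop
      (𝓝 (1 / p₁ ^ 2 * ∫ ω in Ico (0 : ℝ) 1, k (1 / 2, ω))) := by
  have P := H.param
  obtain ⟨L, hL, hLip⟩ := H.lipschitz
  obtain ⟨K, hK, hkK⟩ := H.exists_le_of_mem
  have hmem : ∀ ω ∈ Ico (0 : ℝ) 1, ((1 / 2 : ℝ), ω) ∈ Icc (1 / 2 : ℝ) 1 ×ˢ Icc (0 : ℝ) 1 :=
    fun ω hω => ⟨⟨le_rfl, by norm_num⟩, Ico_subset_Icc_self hω⟩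
  set g : ℝ → ℝ := fun ω => min (k (1 / 2, ω)) K with hgdef
  have hg : Measurable g := (H.measurable.comp (by fun_prop)).min measurable_const
  have hgk : ∀ ω ∈ Ico (0 : ℝ) 1, g ω = k (1 / 2, ω) := fun ω hω =>
    min_eq_left (hkK _ (hmem ω hω))
  have hgK : ∀ ω, |g ω| ≤ K := fun ω => by
    rw [abs_of_nonneg (le_min (H.nonneg _) hK)]; exact min_le_right _ _
  have hgi : Integrable g (volume.restrict (Ico (0 : ℝ) 1)) := integrable_of_bdd hg hgK
  have hIg : ∫ ω in Ico (0 : ℝ) 1, k (1 / 2, ω) = ∫ ω in Ico (0 : ℝ) 1, g ω :=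
    setIntegral_congr_fun measurableSet_Ico fun ω hω => (hgk ω hω).symm
  rw [hIg]
  have hD := P.tendsto_integral_mul_escapeLevel hβ (D := fun _ _ => 0) (fun _ => measurable_const)
    (M := 0) (by simp) (by simp)
  simp only [abs_zero, zero_add] at hD
  have hN := P.tendsto_integral_abs_sq_mul_escapeLevel_sub hβ
  have hlim : Tendsto (fun n : ℕ => L * ((n * ∫ ω in Ico (0 : ℝ) 1,
      escapeLevel (1 / 2) β p₁ n ω * 1) / 2) + K / 2 * ∫ ω in Ico (0 : ℝ) 1,
      |(n : ℝ) ^ 2 * escapeLevel (1 / 2) β p₁ n ω - 2 / p₁ ^ 2|) atTop (𝓝 0) := by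
    simpa using ((hD.div_const 2).const_mul L).add (hN.const_mul (K / 2))
  rw [tendsto_iff_norm_sub_tendsto_zero]
  refine squeeze_zero (fun n => norm_nonneg _) (fun n => ?_) hlim
  have hwm := measurable_lateWidth (α := 1 / 2) (β := β) (p₁ := p₁) n
  have hw0 := P.lateWidth_pos n
  have hw1 : ∀ ω, lateWidth (1 / 2) β p₁ n ω ≤ 1 / (n + 1) := fun ω => by
    have h1 := P.escapeLevel_le n (phiMap p₁ ω)
    have h2 := (P.escapeLevel_mem n (phiMap p₁ ω)).1
    unfold lateWidth
    linarith
  have hw1' : ∀ ω, |lateWidth (1 / 2) β p₁ n ω| ≤ 1 / (n + 1) := fun ω => by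
    rw [abs_of_pos (hw0 ω)]; exact hw1 ω
  have hwi : Integrable (lateWidth (1 / 2) β p₁ n) (volume.restrict (Ico (0 : ℝ) 1)) :=
    integrable_of_bdd hwm hw1'
  have hfin : IsFiniteMeasure ((volume : Measure (ℝ × ℝ)).restrict (lateSet (1 / 2) β p₁ n)) := ⟨by
    rw [Measure.restrict_apply_univ]
    refine (measure_mono lateSet_subset).trans_lt ?_
    rw [base, Measure.volume_eq_prod, Measure.prod_prod, Real.volume_Ioc, Real.volume_Ico]
    exact ENNReal.mul_lt_top ENNReal.ofReal_lt_top ENNReal.ofReal_lt_top⟩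
  have hVk : ν.real (lateSet (1 / 2) β p₁ n) = ∫ p in lateSet (1 / 2) β p₁ n, k p * 1 := by
    rw [← H.setIntegral_eq (measurableSet_lateSet n) lateSet_subset fun _ => 1]
    simp
  have hki := H.integrableOn_mul (u := fun _ => 1) measurable_const (M := 1) (by simp)
    (measurableSet_lateSet (α := 1 / 2) (β := β) (p₁ := p₁) n) lateSet_subset
  have hgp : Integrable (fun p : ℝ × ℝ => g p.2) (volume.restrict (lateSet (1 / 2) β p₁ n)) :=
    integrable_of_bdd (hg.comp measurable_snd) fun p => hgK p.2
  have hwp : Integrable (fun p : ℝ × ℝ => L * lateWidth (1 / 2) β p₁ n p.2)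
      (volume.restrict (lateSet (1 / 2) β p₁ n)) :=
    (integrable_of_bdd (hwm.comp measurable_snd) fun p => hw1' p.2).const_mul L
  have e1 : |ν.real (lateSet (1 / 2) β p₁ n) -
      ∫ ω in Ico (0 : ℝ) 1, lateWidth (1 / 2) β p₁ n ω * g ω| ≤
      L * ∫ ω in Ico (0 : ℝ) 1, lateWidth (1 / 2) β p₁ n ω * lateWidth (1 / 2) β p₁ n ω := by
    rw [hVk, ← P.setIntegral_lateSet_snd hg, ← P.setIntegral_lateSet_snd hwm, ← integral_sub hki hgp,
      ← integral_const_mul]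
    refine (abs_integral_le_integral_abs).trans ?_
    refine setIntegral_mono_on (hki.sub hgp).abs hwp (measurableSet_lateSet n) fun p hp => ?_
    have hp' := P.mem_lateSet_iff.1 hp
    rw [mul_one, hgk p.2 hp'.1]
    refine (hLip p (base_subset_Icc (lateSet_subset hp)) _ (hmem p.2 hp'.1)).trans ?_
    refine mul_le_mul_of_nonneg_left ?_ hL
    rw [Prod.dist_eq, dist_self, max_eq_left dist_nonneg, Real.dist_eq,
      abs_of_pos (sub_pos.2 hp'.2.1)]
    linarith [hp'.2.2]
  have e2 : (n : ℝ) ^ 2 * ∫ ω in Ico (0 : ℝ) 1,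
      lateWidth (1 / 2) β p₁ n ω * lateWidth (1 / 2) β p₁ n ω ≤
      (n * ∫ ω in Ico (0 : ℝ) 1, escapeLevel (1 / 2) β p₁ n ω * 1) / 2 := by
    rw [mul_div_assoc, ← P.integral_lateWidth_mul (g := fun _ => 1) measurable_const,
      ← integral_const_mul, ← integral_const_mul]
    refine integral_mono_of_nonneg (ae_of_all _ fun ω => by have := hw0 ω; positivity)
      ((hwi.mul_const 1).const_mul _) (ae_of_all _ fun ω => ?_)
    have h1 : n * lateWidth (1 / 2) β p₁ n ω ≤ 1 := by
      calc _ ≤ n * (1 / ((n : ℝ) + 1)) := by gcongr; exact hw1 ω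
        _ ≤ 1 := by rw [mul_one_div, div_le_one (by positivity)]; linarith
    have h2 : 0 ≤ n * lateWidth (1 / 2) β p₁ n ω := mul_nonneg n.cast_nonneg (hw0 ω).le
    calc _ = (n * lateWidth (1 / 2) β p₁ n ω) * (n * lateWidth (1 / 2) β p₁ n ω) := by ring
      _ ≤ (n * lateWidth (1 / 2) β p₁ n ω) * 1 := by gcongr
      _ = _ := by ring
  have hwgi : Integrable (fun ω => lateWidth (1 / 2) β p₁ n ω * g ω)
      (volume.restrict (Ico (0 : ℝ) 1)) :=
    integrable_of_bdd (hwm.mul hg) (C := 1 / (n + 1) * K) fun ω => by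
      rw [norm_mul]
      exact mul_le_mul (hw1' ω) (hgK ω) (norm_nonneg _) (by positivity)
  have e3 : |(n : ℝ) ^ 2 * (∫ ω in Ico (0 : ℝ) 1, lateWidth (1 / 2) β p₁ n ω * g ω) -
      1 / p₁ ^ 2 * ∫ ω in Ico (0 : ℝ) 1, g ω| ≤ K / 2 * ∫ ω in Ico (0 : ℝ) 1,
      |(n : ℝ) ^ 2 * escapeLevel (1 / 2) β p₁ n ω - 2 / p₁ ^ 2| := by
    have hm : Measurable fun ω => |(n : ℝ) ^ 2 * escapeLevel (1 / 2) β p₁ n ω - 2 / p₁ ^ 2| :=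
      (((measurable_escapeLevel n).const_mul _).sub_const _).abs
    rw [← P.measurePreserving_phiMap.integral_comp_of_measurable hm, ← integral_const_mul,
      ← integral_const_mul, ← integral_const_mul,
      ← integral_sub (hwgi.const_mul _) (hgi.const_mul _)]
    refine abs_integral_le_integral_abs.trans (integral_mono_of_nonneg
      (ae_of_all _ fun ω => abs_nonneg _) (Integrable.const_mul (integrable_of_bdd
        (hm.comp measurable_phiMap) (C := (n : ℝ) ^ 2 * 1 + |2 / p₁ ^ 2|) fun ω => ?_) _)
        (ae_of_all _ fun ω => ?_))
    · have := P.escapeLevel_mem n (phiMap p₁ ω)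
      rw [Function.comp_apply, norm_abs_eq_norm]
      refine (norm_sub_le _ _).trans ?_
      rw [Real.norm_of_nonneg (mul_nonneg (by positivity) this.1.le), Real.norm_eq_abs]
      gcongr
      exact this.2
    · simp only
      have : (n : ℝ) ^ 2 * (lateWidth (1 / 2) β p₁ n ω * g ω) - 1 / p₁ ^ 2 * g ω =
          ((n : ℝ) ^ 2 * escapeLevel (1 / 2) β p₁ n (phiMap p₁ ω) - 2 / p₁ ^ 2) / 2 * g ω := by
        unfold lateWidth; ring
      rw [this, abs_mul, abs_div, abs_two]
      have := mul_le_mul_of_nonneg_left (hgK ω)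
        (abs_nonneg ((n : ℝ) ^ 2 * escapeLevel (1 / 2) β p₁ n (phiMap p₁ ω) - 2 / p₁ ^ 2))
      linarith
  rw [Real.norm_eq_abs]
  have e4 := mul_le_mul_of_nonneg_left e1 (sq_nonneg (n : ℝ))
  rw [← abs_of_nonneg (sq_nonneg (n : ℝ)), ← abs_mul, abs_of_nonneg (sq_nonneg (n : ℝ)),
    mul_sub] at e4
  have e5 := mul_le_mul_of_nonneg_left e2 hL
  refine (abs_sub_le _ ((n : ℝ) ^ 2 * ∫ ω in Ico (0 : ℝ) 1,
    lateWidth (1 / 2) β p₁ n ω * g ω) _).trans (add_le_add (e4.trans ?_) e3)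
  linarith

end LSVDensity

end TailAsymptotics

section LogarithmicSums

theorem tendsto_harmonic_div_log :
    Tendsto (fun K : ℕ => (∑ n ∈ Finset.range K, 1 / ((n : ℝ) + 1)) / Real.log K) atTop (𝓝 1) := by
  have hlog : Tendsto (fun K : ℕ => Real.log K) atTop atTop :=
    Real.tendsto_log_atTop.comp tendsto_natCast_atTop_atTop
  have h1 := (Real.tendsto_harmonic_sub_log.div_atTop hlog).add_const 1
  rw [zero_add] at h1
  refine h1.congr' ?_
  filter_upwards [hlog.eventually_gt_atTop 0] with K hK
  have : ((harmonic K : ℚ) : ℝ) = ∑ n ∈ Finset.range K, 1 / ((n : ℝ) + 1) := by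
    rw [harmonic]
    push_cast
    simp [one_div]
  rw [this]
  field_simp
  ring

theorem tendsto_sum_div_log {a : ℕ → ℝ} {L : ℝ} (h : Tendsto (fun n : ℕ => n * a n) atTop (𝓝 L)) :
    Tendsto (fun K : ℕ => (∑ n ∈ Finset.range K, a n) / Real.log K) atTop (𝓝 L) := by
  set g : ℕ → ℝ := fun n => 1 / ((n : ℝ) + 1) with hg
  have hg0 : ∀ n, 0 < g n := fun n => by positivity
  have ha : Tendsto a atTop (𝓝 0) := by
    have h1 := h.mul tendsto_one_div_atTop_nhds_zero_nat
    rw [mul_zero] at h1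
    refine h1.congr' ?_
    filter_upwards [eventually_gt_atTop 0] with n hn
    have : (n : ℝ) ≠ 0 := Nat.cast_ne_zero.2 hn.ne'
    field_simp
  have hf : (fun n => a n - L * g n) =o[atTop] g := by
    refine (Asymptotics.isLittleO_iff_tendsto fun n hn => absurd hn (hg0 n).ne').2 ?_
    have h1 := (h.add ha).sub_const L
    rw [add_zero, sub_self] at h1
    refine h1.congr fun n => ?_
    rw [hg]
    field_simp
  have hsum := hf.sum_range (fun n => (hg0 n).le) Real.tendsto_sum_range_one_div_nat_succ_atTop
  have h2 := hsum.tendsto_div_nhds_zero.mul tendsto_harmonic_div_log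
  have h3 := h2.add (tendsto_harmonic_div_log.const_mul L)
  rw [zero_mul, zero_add, mul_one] at h3
  refine h3.congr' ?_
  filter_upwards [eventually_gt_atTop 0] with K hK
  have hpos : 0 < ∑ n ∈ Finset.range K, g n :=
    Finset.sum_pos (fun n _ => hg0 n) ⟨0, Finset.mem_range.2 hK⟩
  rw [Finset.sum_sub_distrib, ← Finset.mul_sum]
  change (_ - L * ∑ n ∈ Finset.range K, g n) / (∑ n ∈ Finset.range K, g n) *
    ((∑ n ∈ Finset.range K, g n) / _) + L * ((∑ n ∈ Finset.range K, g n) / _) = _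
  rw [div_mul_div_cancel₀ hpos.ne']
  ring

theorem tendsto_of_abs_sub_le {ι : Type*} {l : Filter ι} {x y z : ι → ℝ} {X : ℝ}
    (hx : Tendsto x l (𝓝 X)) (hy : Tendsto y l (𝓝 0))
    (h : ∀ ε > 0, ∀ᶠ K in l, |z K - x K| ≤ ε * x K + (1 + 1 / ε) * y K) :
    Tendsto z l (𝓝 X) := by
  have hzx : Tendsto (fun K => z K - x K) l (𝓝 0) := by
    rw [Metric.tendsto_nhds]
    intro η hη
    have hX : 0 < |X| + 1 := by positivity
    set ε := η / (2 * (|X| + 1)) with hε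
    have hε0 : 0 < ε := by positivity
    have h1 := ((hx.const_mul ε).add (hy.const_mul (1 + 1 / ε)))
    have h2 : ε * X + (1 + 1 / ε) * 0 < η := by
      rw [mul_zero, add_zero]
      calc ε * X ≤ ε * (|X| + 1) := by
            have := le_abs_self X
            gcongr
            linarith
        _ = η / 2 := by rw [hε]; field_simp
        _ < η := half_lt_self hη
    filter_upwards [h ε hε0, h1.eventually (gt_mem_nhds h2)] with K hK hK'
    rw [dist_zero_right, Real.norm_eq_abs]
    exact hK.trans_lt hK'
  simpa using hzx.add hx

theorem setIntegral_apply_min {X : Type*} [MeasurableSpace X] {ν : Measure X} [IsFiniteMeasure ν]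
    {Y : Set X} {R : X → ℕ} (hR : Measurable R) {ψ : ℕ → X → ℝ}
    (hψ : ∀ n, Measurable (ψ n)) {B : ℕ → ℝ} (hB : ∀ n p, |ψ n p| ≤ B n) (hψ0 : ∀ p, ψ 0 p = 0)
    (K : ℕ) : Integrable (fun p => ψ (min (R p) K) p) (ν.restrict Y) ∧
      ∫ p in Y, ψ (min (R p) K) p ∂ν =
        ∑ n ∈ Finset.range K, ∫ p in Y ∩ {p | n < R p}, (ψ (n + 1) p - ψ n p) ∂ν := by
  have hset : ∀ n, MeasurableSet {p | n < R p} := fun n => measurableSet_lt measurable_const hR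
  have hi : ∀ n, Integrable (fun p => ψ (n + 1) p - ψ n p) (ν.restrict Y) := fun n =>
    (integrable_of_bdd (hψ (n + 1)) (hB (n + 1))).sub (integrable_of_bdd (hψ n) (hB n))
  have e : ∀ p, ψ (min (R p) K) p = ∑ n ∈ Finset.range K,
      {p | n < R p}.indicator (fun p => ψ (n + 1) p - ψ n p) p := fun p => by
    rw [apply_min_eq_sum (fun n => ψ n p), hψ0, zero_add]
    simp only [indicator_apply, mem_ofPred_eq]
  simp only [e]
  refine ⟨integrable_finsetSum _ fun n _ => (hi n).indicator (hset n), ?_⟩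
  rw [integral_finsetSum _ fun n _ => (hi n).indicator (hset n)]
  refine Finset.sum_congr rfl fun n _ => ?_
  rw [integral_indicator (hset n), Measure.restrict_restrict (hset n), inter_comm]

end LogarithmicSums

section Excursions

variable {α β p₁ : ℝ}

theorem iterate_skewLSV_snd (n : ℕ) (p : ℝ × ℝ) :
    ((skewLSV α β p₁)^[n] p).2 = (phiMap p₁)^[n] p.2 := by
  induction n generalizing p with
  | zero => rfl
  | succ n ih => rw [Function.iterate_succ_apply, Function.iterate_succ_apply, ih]; rfl

/-- Birkhoff sums of the noise. -/
def noiseSum (p₁ : ℝ) (u : ℝ → ℝ) (n : ℕ) (ω : ℝ) : ℝ :=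
  ∑ k ∈ Finset.range n, u ((phiMap p₁)^[k] ω)

theorem measurable_noiseSum {u : ℝ → ℝ} (hu : Measurable u) (n : ℕ) :
    Measurable (noiseSum p₁ u n) :=
  Finset.measurable_sum _ fun k _ => hu.comp (measurable_phiMap.iterate k)

theorem abs_noiseSum_le {u : ℝ → ℝ} {M : ℝ} (hu : ∀ ω, |u ω| ≤ M) (n : ℕ) (ω : ℝ) :
    |noiseSum p₁ u n ω| ≤ M * n := by
  refine (Finset.abs_sum_le_sum_abs _ _).trans ((Finset.sum_le_sum fun k _ => hu _).trans ?_)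
  simp [mul_comm]

/-- The cumulative Hölder error along an excursion. -/
def holderSum (C t : ℝ) (n : ℕ) : ℝ := ∑ k ∈ Finset.range n, C * (1 / ((k : ℝ) + 1)) ^ t

theorem tendsto_holderSum_div {C t : ℝ} (ht : 0 < t) :
    Tendsto (fun n : ℕ => holderSum C t n / n) atTop (𝓝 0) :=
  tendsto_sum_div_of_tendsto_zero (by simpa using (tendsto_one_div_add_one_rpow ht).const_mul C)

theorem holderSum_nonneg {C t : ℝ} (hC : 0 ≤ C) (n : ℕ) : 0 ≤ holderSum C t n :=
  Finset.sum_nonneg fun k _ => by positivity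

theorem holderSum_succ_le {C t : ℝ} (hC : 0 ≤ C) (ht : 0 ≤ t) (n : ℕ) :
    holderSum C t (n + 1) ≤ holderSum C t n + C := by
  rw [holderSum, Finset.sum_range_succ]
  refine add_le_add le_rfl (mul_le_of_le_one_right hC (Real.rpow_le_one (by positivity) ?_ ht))
  rw [div_le_one (by positivity)]
  linarith [n.cast_nonneg (α := ℝ)]

/-- An excursion sum is close to the Birkhoff sum over the noise on the neutral fibre. -/
theorem LSVParam.abs_excursionSum_sub_noiseSum_le (P : LSVParam α β p₁) {f : ℝ × ℝ → ℝ} {C t : ℝ}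
    (hC : 0 ≤ C) (ht : 0 < t)
    (hf : ∀ p ∈ Icc (0 : ℝ) 1 ×ˢ Icc (0 : ℝ) 1, ∀ q ∈ Icc (0 : ℝ) 1 ×ˢ Icc (0 : ℝ) 1,
      |f p - f q| ≤ C * dist p q ^ t) (c : ℝ) {p : ℝ × ℝ} (hp : p ∈ base) :
    |excursionSum (skewLSV α β p₁) base f p - (c * returnTime (skewLSV α β p₁) base p +
      noiseSum p₁ (fun ω => f (0, ω) - c) (returnTime (skewLSV α β p₁) base p) (phiMap p₁ p.2))| ≤
      holderSum C t (returnTime (skewLSV α β p₁) base p) := by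
  have hmem : ∀ l, (skewLSV α β p₁)^[l] p ∈ strip := fun l => by
    induction l with
    | zero => exact base_subset_strip hp
    | succ l ih => rw [Function.iterate_succ_apply']; exact P.skewLSV_mem ih
  have hfst := fun l (hl : l < returnTime (skewLSV α β p₁) base p) => P.iterate_fst_le hp hl
  unfold excursionSum
  set r := returnTime (skewLSV α β p₁) base p
  have e : c * r + noiseSum p₁ (fun ω => f (0, ω) - c) r (phiMap p₁ p.2) =
      ∑ l ∈ Finset.range r, f (0, ((skewLSV α β p₁)^[l + 1] p).2) := by
    simp only [noiseSum, Finset.sum_sub_distrib, Finset.sum_const, Finset.card_range, nsmul_eq_mul,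
      iterate_skewLSV_snd, Function.iterate_succ_apply, show (phiMap p₁ p.2) = (skewLSV α β p₁ p).2
        from rfl]
    ring
  rw [e, ← Finset.sum_sub_distrib]
  refine (Finset.abs_sum_le_sum_abs _ _).trans ?_
  rw [holderSum, ← Finset.sum_range_reflect (fun k : ℕ => C * (1 / ((k : ℝ) + 1)) ^ t)]
  refine Finset.sum_le_sum fun l hl => ?_
  have h1 := hmem (l + 1)
  set q := (skewLSV α β p₁)^[l + 1] p with hq
  refine (hf q ⟨Ioc_subset_Icc_self h1.1, Ico_subset_Icc_self h1.2⟩ (0, q.2)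
    ⟨by norm_num, Ico_subset_Icc_self h1.2⟩).trans ?_
  rw [Prod.dist_eq, dist_self, max_eq_left dist_nonneg, Real.dist_eq, sub_zero, abs_of_pos h1.1.1]
  exact mul_le_mul_of_nonneg_left
    (Real.rpow_le_rpow h1.1.1.le (hfst l (Finset.mem_range.1 hl)) ht.le) hC

/-- Mean convergence of the noise sums of a centered Hölder function. -/
theorem LSVParam.tendsto_integral_noiseSum (P : LSVParam α β p₁) {u : ℝ → ℝ} (hu : Measurable u)
    {M : ℝ} (hM : ∀ ω, |u ω| ≤ M) {C t : ℝ} (hC : 0 ≤ C) (ht : 0 < t)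
    (huC : ∀ x ∈ Ico (0 : ℝ) 1, ∀ y ∈ Ico (0 : ℝ) 1, |u x - u y| ≤ C * dist x y ^ t)
    (hu0 : ∫ ω in Ico (0 : ℝ) 1, u ω = 0) :
    Tendsto (fun n : ℕ => (∫ ω in Ico (0 : ℝ) 1, |noiseSum p₁ u n ω|) / n) atTop (𝓝 0) := by
  refine P.tendsto_integral_noise hu hM hC ht (fun i x hx y hy => ?_) hu0
  refine (huC _ (P.noiseInv_mem i hx) _ (P.noiseInv_mem i hy)).trans
    (mul_le_mul_of_nonneg_left (Real.rpow_le_rpow dist_nonneg ?_ ht.le) hC)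
  have h := (P.markovSystem_noise one_pos).contraction i x hx y hy
  exact h.trans (mul_le_of_le_one_left dist_nonneg P.contractionRate_lt.le)

end Excursions

section TruncatedVariance

/-- The truncated second moment of an observable close to a multiple of a return time whose tail is
quadratic grows logarithmically. -/
theorem tendsto_setIntegral_truncObs_sq_div_log {X : Type*} [MeasurableSpace X] {ν : Measure X}
    [IsFiniteMeasure ν] {Y : Set X} (hY : MeasurableSet Y) {R : X → ℕ} (hR : Measurable R) {L : ℝ}
    (hL : Tendsto (fun n : ℕ => (n : ℝ) ^ 2 * ν.real (Y ∩ {p | n < R p})) atTop (𝓝 L))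
    {Φ : X → ℝ} (hΦ : Measurable Φ) {M : ℝ} (hM0 : 0 ≤ M) (hM : ∀ p, |Φ p| ≤ M * R p)
    {ψ : ℕ → X → ℝ} (hψ : ∀ n, Measurable (ψ n)) {B : ℕ → ℝ} (hB : ∀ n p, |ψ n p| ≤ B n)
    (hψ0 : ∀ p, ψ 0 p = 0) (hψn : ∀ n p, 0 ≤ ψ n p) {c : ℝ}
    (hle : ∀ p ∈ Y, (Φ p - c * R p) ^ 2 ≤ ψ (R p) p) {G : ℕ → ℝ}
    (hG : ∀ n, ∫ p in Y ∩ {p | n < R p}, (ψ (n + 1) p - ψ n p) ∂ν ≤ G n)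
    (hG0 : Tendsto (fun n : ℕ => n * G n) atTop (𝓝 0)) :
    Tendsto (fun K : ℕ => (∫ p in Y, truncObs R Φ K p ^ 2 ∂ν) / Real.log K) atTop
      (𝓝 (c ^ 2 * (2 * L))) := by
  have hlog : Tendsto (fun K : ℕ => Real.log K) atTop atTop :=
    Real.tendsto_log_atTop.comp tendsto_natCast_atTop_atTop
  have hRm : Measurable fun p => (R p : ℝ) := measurable_from_nat.comp hR
  have hRle : ∀ p, |(R p : ℝ)| ≤ 1 * R p := fun p => by rw [one_mul, Nat.abs_cast]
  have hisq : ∀ {u : X → ℝ} {m : ℝ} (K : ℕ), Measurable u → 0 ≤ m → (∀ p, |u p| ≤ m * R p) →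
      Integrable (fun p => truncObs R u K p ^ 2) (ν.restrict Y) := fun {u m} K hu hm h =>
    integrable_of_bdd ((measurable_truncObs hR hu K).pow_const 2) (C := (m * K) ^ 2) fun p => by
      rw [norm_pow, Real.norm_eq_abs]
      refine pow_le_pow_left₀ (abs_nonneg _) ((abs_truncObs_le hm h K p).trans ?_) 2
      gcongr
      exact min_le_right _ _
  have hJ : ∀ K : ℕ, ∫ p in Y, truncObs R (fun p => (R p : ℝ)) K p ^ 2 ∂ν =
      ∑ n ∈ Finset.range K, (2 * n + 1) * ν.real (Y ∩ {p | n < R p}) -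
        (K : ℝ) ^ 2 * ν.real (Y ∩ {p | K < R p}) := fun K => by
    have h := (setIntegral_apply_min (ν := ν) (Y := Y) hR (ψ := fun n _ => (n : ℝ) ^ 2)
      (fun n => measurable_const) (fun n p => le_rfl) (fun p => by simp) K).2
    have hs : MeasurableSet {p | K < R p} := measurableSet_lt measurable_const hR
    have e : ∀ p, ((min (R p) K : ℕ) : ℝ) ^ 2 = truncObs R (fun p => (R p : ℝ)) K p ^ 2 +
        {p | K < R p}.indicator (fun _ => (K : ℝ) ^ 2) p := fun p => by
      unfold truncObs
      by_cases hp : R p ≤ K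
      · rw [if_pos hp, min_eq_left hp, indicator_of_notMem (by simpa using hp), add_zero]
      · rw [if_neg hp, min_eq_right (le_of_not_ge hp),
          indicator_of_mem (by simpa using hp)]
        ring
    simp only [e, setIntegral_const, smul_eq_mul] at h
    rw [integral_add (hisq K hRm zero_le_one hRle) ((integrable_const _).indicator hs),
      integral_indicator hs, Measure.restrict_restrict hs, setIntegral_const, inter_comm,
      smul_eq_mul] at h
    rw [eq_sub_iff_add_eq, mul_comm ((K : ℝ) ^ 2), h]
    refine Finset.sum_congr rfl fun n _ => ?_
    push_cast
    ring
  have hx : Tendsto (fun K : ℕ => c ^ 2 * ((∫ p in Y, truncObs R (fun p => (R p : ℝ)) K p ^ 2 ∂ν) /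
      Real.log K)) atTop (𝓝 (c ^ 2 * (2 * L))) := by
    refine Tendsto.const_mul _ ?_
    have h1 : Tendsto (fun n : ℕ => n * ((2 * n + 1) * ν.real (Y ∩ {p | n < R p}))) atTop
        (𝓝 (2 * L)) := by
      have h2 := (hL.const_mul 2).add (hL.mul tendsto_one_div_atTop_nhds_zero_nat)
      rw [mul_zero, add_zero] at h2
      refine h2.congr' ?_
      filter_upwards [eventually_gt_atTop 0] with n hn
      have : (n : ℝ) ≠ 0 := Nat.cast_ne_zero.2 hn.ne'
      field_simp
    have h3 := (tendsto_sum_div_log h1).sub (hL.div_atTop hlog)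
    rw [sub_zero] at h3
    exact h3.congr fun K => by rw [hJ, sub_div]
  refine tendsto_of_abs_sub_le hx (tendsto_sum_div_log hG0) fun ε hε => ?_
  filter_upwards [hlog.eventually_gt_atTop 0] with K hK
  obtain ⟨hiψ, hψe⟩ := setIntegral_apply_min (ν := ν) (Y := Y) hR hψ hB hψ0 K
  have hia := hisq K hΦ hM0 hM
  have hib := (hisq K hRm zero_le_one hRle).const_mul (c ^ 2)
  have hpt : ∀ p ∈ Y, |truncObs R Φ K p ^ 2 - c ^ 2 * truncObs R (fun p => (R p : ℝ)) K p ^ 2| ≤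
      ε * (c ^ 2 * truncObs R (fun p => (R p : ℝ)) K p ^ 2) +
        (1 + 1 / ε) * ψ (min (R p) K) p := fun p hp => by
    unfold truncObs
    split_ifs with h
    · rw [min_eq_left h]
      refine le_trans ?_ (add_le_add le_rfl (mul_le_mul_of_nonneg_left (hle p hp) (by positivity)))
      set b := c * (R p : ℝ)
      set d := Φ p - b with hd
      have e1 : c ^ 2 * (R p : ℝ) ^ 2 = b ^ 2 := by ring
      have e2 : Φ p = b + d := by ring
      have e3 : ε * b ^ 2 + (1 + 1 / ε) * d ^ 2 = ε * b ^ 2 + d ^ 2 / ε + d ^ 2 := by ring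
      have h1 : 2 * |b * d| ≤ ε * b ^ 2 + d ^ 2 / ε := by
        rw [abs_mul, ← sub_nonneg, show ε * b ^ 2 + d ^ 2 / ε - 2 * (|b| * |d|) =
          (ε * |b| - |d|) ^ 2 / ε by rw [← sq_abs b, ← sq_abs d]; field_simp; ring]
        positivity
      rw [e1, e3, e2, show (b + d) ^ 2 - b ^ 2 = 2 * (b * d) + d ^ 2 by ring]
      refine (abs_add_le _ _).trans (add_le_add ?_ (abs_of_nonneg (sq_nonneg d)).le)
      rwa [abs_mul, abs_two]
    · simpa using mul_nonneg (by positivity : (0 : ℝ) ≤ 1 + ε⁻¹) (hψn _ p)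
  have hint : |(∫ p in Y, truncObs R Φ K p ^ 2 ∂ν) -
      c ^ 2 * ∫ p in Y, truncObs R (fun p => (R p : ℝ)) K p ^ 2 ∂ν| ≤
      ε * (c ^ 2 * ∫ p in Y, truncObs R (fun p => (R p : ℝ)) K p ^ 2 ∂ν) +
        (1 + 1 / ε) * ∑ n ∈ Finset.range K, G n := by
    rw [← integral_const_mul, ← integral_sub hia hib]
    refine abs_integral_le_integral_abs.trans ((setIntegral_mono_on (hia.sub hib).abs
      ((hib.const_mul ε).add (hiψ.const_mul (1 + 1 / ε))) hY hpt).trans ?_)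
    rw [integral_add' (hib.const_mul ε) (hiψ.const_mul (1 + 1 / ε)), integral_const_mul,
      integral_const_mul (1 + 1 / ε), hψe]
    have := Finset.sum_le_sum fun n (_ : n ∈ Finset.range K) => hG n
    gcongr
  have h2 := div_le_div_of_nonneg_right hint hK.le
  rw [← abs_of_pos hK, ← abs_div, abs_of_pos hK] at h2
  rwa [sub_div, add_div, mul_div_assoc, mul_div_assoc, mul_div_assoc, mul_div_assoc] at h2

end TruncatedVariance

section ReturnTimes

variable {β p₁ : ℝ} {ν : Measure (ℝ × ℝ)} {k : ℝ × ℝ → ℝ}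

namespace LSVDensity

variable (H : LSVDensity (1 / 2) β p₁ ν k) (hβ : 1 / 2 < β)
include H hβ

theorem exists_measureReal_lateSet_le [IsProbabilityMeasure ν] :
    ∃ Cr, 0 ≤ Cr ∧ ∀ n : ℕ, ν.real (lateSet (1 / 2) β p₁ n) ≤ Cr / (n + 1) ^ 2 := by
  obtain ⟨B, hB⟩ := (H.tendsto_sq_mul_measureReal_lateSet hβ).bddAbove_range
  replace hB : ∀ n : ℕ, (n : ℝ) ^ 2 * ν.real (lateSet (1 / 2) β p₁ n) ≤ B :=
    fun n => hB ⟨n, rfl⟩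
  have hB0 : 0 ≤ B := (by positivity : (0 : ℝ) ≤ _).trans (hB 0)
  refine ⟨2 * B + 2, by positivity, fun n => ?_⟩
  rw [le_div_iff₀ (by positivity)]
  have h1 : ν.real (lateSet (1 / 2) β p₁ n) ≤ 1 := measureReal_le_one
  nlinarith [hB n, mul_nonneg (measureReal_nonneg : 0 ≤ ν.real (lateSet (1 / 2) β p₁ n))
    (sq_nonneg ((n : ℝ) - 1))]

/-- The truncated variance of the excursion sums. -/
theorem tendsto_setIntegral_truncObs_excursionSum [IsProbabilityMeasure ν] {f : ℝ × ℝ → ℝ}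
    (hfm : Measurable f) {M : ℝ} (hM : ∀ p, |f p| ≤ M) {C t : ℝ} (hC : 0 ≤ C) (ht : 0 < t)
    (hf : ∀ p ∈ Icc (0 : ℝ) 1 ×ˢ Icc (0 : ℝ) 1, ∀ q ∈ Icc (0 : ℝ) 1 ×ˢ Icc (0 : ℝ) 1,
      |f p - f q| ≤ C * dist p q ^ t) :
    Tendsto (fun K : ℕ => (∫ p in base, truncObs (returnTime (skewLSV (1 / 2) β p₁) base)
      (excursionSum (skewLSV (1 / 2) β p₁) base f) K p ^ 2 ∂ν) / Real.log K) atTop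
      (𝓝 ((∫ ω in Ico (0 : ℝ) 1, f (0, ω)) ^ 2 *
        (2 * (1 / p₁ ^ 2 * ∫ ω in Ico (0 : ℝ) 1, k (1 / 2, ω))))) := by
  have hL := H.tendsto_sq_mul_measureReal_lateSet hβ
  obtain ⟨C₀, hC₀, hlate⟩ := H.exists_setIntegral_lateSet_le
  set c := ∫ ω in Ico (0 : ℝ) 1, f (0, ω) with hc
  set u : ℝ → ℝ := fun ω => f (0, ω) - c with hu
  set M' := M + |c| with hM'
  have hM0 : 0 ≤ M := (abs_nonneg _).trans (hM 0)
  have hM'0 : 0 ≤ M' := by positivity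
  have hfu : Measurable fun ω : ℝ => f (0, ω) := hfm.comp (by fun_prop)
  have hum : Measurable u := hfu.sub_const c
  have huM : ∀ ω, |u ω| ≤ M' := fun ω => (abs_sub _ _).trans (add_le_add (hM _) le_rfl)
  have huC : ∀ x ∈ Ico (0 : ℝ) 1, ∀ y ∈ Ico (0 : ℝ) 1, |u x - u y| ≤ C * dist x y ^ t :=
    fun x hx y hy => by
      have h := hf (0, x) ⟨by norm_num, Ico_subset_Icc_self hx⟩ (0, y)
        ⟨by norm_num, Ico_subset_Icc_self hy⟩
      rw [Prod.dist_eq, dist_self, max_eq_right dist_nonneg] at h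
      rwa [hu, sub_sub_sub_cancel_right]
  have hu0 : ∫ ω in Ico (0 : ℝ) 1, u ω = 0 := by
    rw [hu, integral_sub (integrable_of_bdd hfu fun ω => hM _) (integrable_const _)]
    simp [hc]
  have hNm : ∀ n, Measurable fun p : ℝ × ℝ => noiseSum p₁ u n (phiMap p₁ p.2) := fun n =>
    (measurable_noiseSum hum n).comp (measurable_phiMap.comp measurable_snd)
  have hN : ∀ n ω, |noiseSum p₁ u n ω| ≤ M' * n := abs_noiseSum_le huM
  have hNlim := H.param.tendsto_integral_mul_escapeLevel hβ (measurable_noiseSum hum) hN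
    (H.param.tendsto_integral_noiseSum hum huM hC ht huC hu0)
  have hS := measurable_skewLSV (α := 1 / 2) (β := β) (p₁ := p₁)
  refine tendsto_setIntegral_truncObs_sq_div_log measurableSet_base
    (measurable_returnTime hS measurableSet_base) hL (measurable_excursionSum hS measurableSet_base hfm)
    hM0 (abs_excursionSum_le hM)
    (ψ := fun n p => 2 * noiseSum p₁ u n (phiMap p₁ p.2) ^ 2 + 2 * holderSum C t n ^ 2)
    (B := fun n => 2 * (M' * n) ^ 2 + 2 * holderSum C t n ^ 2)
    (fun n => (((hNm n).pow_const 2).const_mul 2).add_const _) (fun n p => ?_)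
    (fun p => by simp [noiseSum, holderSum]) (fun n p => by positivity) (c := c) (fun p hp => ?_)
    (G := fun n => (4 * M' + 2 * M' ^ 2) * (C₀ * ∫ ω in Ico (0 : ℝ) 1,
      escapeLevel (1 / 2) β p₁ n ω * (|noiseSum p₁ u n ω| + 1)) +
      2 * C * (2 * holderSum C t n + C) * ν.real (lateSet (1 / 2) β p₁ n)) (fun n => ?_) ?_
  · have h := pow_le_pow_left₀ (abs_nonneg _) (hN n (phiMap p₁ p.2)) 2
    rw [abs_of_nonneg (by positivity), ← sq_abs (noiseSum _ _ _ _)]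
    gcongr
  · have h := H.param.abs_excursionSum_sub_noiseSum_le hC ht hf c hp
    set r := returnTime (skewLSV (1 / 2) β p₁) base p
    have h1 := sq_le_sq' (neg_le_of_abs_le h) (le_of_abs_le h)
    change _ ≤ 2 * noiseSum p₁ u r (phiMap p₁ p.2) ^ 2 + 2 * holderSum C t r ^ 2
    nlinarith [sq_nonneg (excursionSum (skewLSV (1 / 2) β p₁) base f p - c * r -
      2 * noiseSum p₁ u r (phiMap p₁ p.2))]
  · have hpt : ∀ p : ℝ × ℝ, 2 * noiseSum p₁ u (n + 1) (phiMap p₁ p.2) ^ 2 + 2 * holderSum C t (n + 1) ^ 2 -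
        (2 * noiseSum p₁ u n (phiMap p₁ p.2) ^ 2 + 2 * holderSum C t n ^ 2) ≤
        (4 * M' + 2 * M' ^ 2) * (|noiseSum p₁ u n (phiMap p₁ p.2)| + 1) +
          2 * C * (2 * holderSum C t n + C) := fun p => by
      have e : noiseSum p₁ u (n + 1) (phiMap p₁ p.2) = noiseSum p₁ u n (phiMap p₁ p.2) +
        u ((phiMap p₁)^[n] (phiMap p₁ p.2)) := Finset.sum_range_succ _ _
      rw [e]
      set N := noiseSum p₁ u n (phiMap p₁ p.2)
      have h1 := huM ((phiMap p₁)^[n] (phiMap p₁ p.2))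
      set v := u ((phiMap p₁)^[n] (phiMap p₁ p.2))
      have h2 : N * v ≤ |N| * M' := (le_abs_self _).trans
        ((abs_mul N v).le.trans (mul_le_mul_of_nonneg_left h1 (abs_nonneg _)))
      have h3 : v ^ 2 ≤ M' ^ 2 := by
        rw [← sq_abs]; exact pow_le_pow_left₀ (abs_nonneg _) h1 2
      have h4 : holderSum C t (n + 1) ^ 2 ≤ (holderSum C t n + C) ^ 2 :=
        pow_le_pow_left₀ (holderSum_nonneg hC _) (holderSum_succ_le hC ht.le n) 2
      nlinarith [mul_nonneg (sq_nonneg M') (abs_nonneg N)]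
    have hi : ∀ m, Integrable (fun p : ℝ × ℝ => 2 * noiseSum p₁ u m (phiMap p₁ p.2) ^ 2 +
        2 * holderSum C t m ^ 2) (ν.restrict (lateSet (1 / 2) β p₁ n)) := fun m =>
      integrable_of_bdd (C := 2 * (M' * m) ^ 2 + 2 * holderSum C t m ^ 2)
        ((((hNm m).pow_const 2).const_mul 2).add_const _) fun p => by
          have h := pow_le_pow_left₀ (abs_nonneg _) (hN m (phiMap p₁ p.2)) 2
          rw [Real.norm_eq_abs, abs_of_nonneg (by positivity), ← sq_abs (noiseSum _ _ _ _)]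
          gcongr
    have hi' : Integrable (fun p : ℝ × ℝ => (4 * M' + 2 * M' ^ 2) *
        (|noiseSum p₁ u n (phiMap p₁ p.2)| + 1)) (ν.restrict (lateSet (1 / 2) β p₁ n)) :=
      ((integrable_of_bdd (hNm n) fun p => hN n _).abs.add (integrable_const 1)).const_mul _
    refine (integral_mono ((hi (n + 1)).sub (hi n)) (hi'.add (integrable_const _)) hpt).trans ?_
    rw [integral_add' hi' (integrable_const _), integral_const_mul, setIntegral_const, smul_eq_mul,
      mul_comm (ν.real _)]
    gcongr
    exact hlate n _ _ (measurable_noiseSum hum n) (hN n)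
  · have h1 := (tendsto_holderSum_div (C := C) ht).const_mul 2
    have h2 := (h1.add (tendsto_one_div_atTop_nhds_zero_nat.const_mul C)).mul hL
    have h3 := (hNlim.const_mul ((4 * M' + 2 * M' ^ 2) * C₀)).add (h2.const_mul (2 * C))
    simp only [mul_zero, zero_mul, add_zero] at h3
    refine h3.congr' ?_
    filter_upwards [eventually_gt_atTop 0] with n hn
    have : (n : ℝ) ≠ 0 := Nat.cast_ne_zero.2 hn.ne'
    field_simp

end LSVDensity

end ReturnTimes

section Regularity

/-- A density of the invariant measure which is Lipschitz away from the neutral fibre may be replaced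
by a nonnegative measurable one. -/
theorem exists_LSVDensity {α β p₁ : ℝ} (P : LSVParam α β p₁) {ν : Measure (ℝ × ℝ)}
    [IsProbabilityMeasure ν] (hac : ν ≪ volume) (hsupp : ν ((Icc (0 : ℝ) 1 ×ˢ Icc (0 : ℝ) 1)ᶜ) = 0)
    (hinv : ∀ A : Set (ℝ × ℝ), MeasurableSet A → ν (skewLSV α β p₁ ⁻¹' A) = ν A)
    {h : ℝ × ℝ → ℝ} (hden : ν = volume.withDensity (fun p => ENNReal.ofReal (h p)))
    (hLip : ∀ K : Set (ℝ × ℝ), K ⊆ Ioc (0 : ℝ) 1 ×ˢ Icc (0 : ℝ) 1 → IsCompact K →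
      ∃ L : NNReal, LipschitzOnWith L h K) :
    ∃ k, LSVDensity α β p₁ ν k ∧ EqOn k h (Icc (1 / 2 : ℝ) 1 ×ˢ Icc (0 : ℝ) 1) := by
  classical
  set U : Set (ℝ × ℝ) := Ioc (0 : ℝ) 1 ×ˢ Icc (0 : ℝ) 1 with hU
  have hUm : MeasurableSet U := measurableSet_Ioc.prod measurableSet_Icc
  have hsub : ∀ a : ℝ, 0 < a → Icc a 1 ×ˢ Icc (0 : ℝ) 1 ⊆ U := fun a ha =>
    prod_mono (fun x hx => ⟨ha.trans_le hx.1, hx.2⟩) Subset.rfl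
  have hcpt : ∀ a : ℝ, IsCompact (Icc a 1 ×ˢ Icc (0 : ℝ) 1) := fun a => isCompact_Icc.prod isCompact_Icc
  have hcont : ContinuousOn h U := fun p hp => by
    have hp0 : p.1 / 2 < p.1 := half_lt_self hp.1.1
    obtain ⟨L, hL⟩ := hLip _ (hsub _ (half_pos hp.1.1)) (hcpt (p.1 / 2))
    refine (hL.continuousOn p ⟨⟨hp0.le, hp.1.2⟩, hp.2⟩).mono_of_mem_nhdsWithin ?_
    filter_upwards [self_mem_nhdsWithin, mem_nhdsWithin_of_mem_nhds
      ((continuous_fst.isOpen_preimage _ isOpen_Ioi).mem_nhds (show p ∈ Prod.fst ⁻¹' Ioi (p.1 / 2)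
        from hp0))] with q hq hq'
    exact ⟨⟨le_of_lt hq', hq.1.2⟩, hq.2⟩
  set k : ℝ × ℝ → ℝ := fun p => max (U.piecewise h (fun _ => 0) p) 0 with hk
  have hkU : ∀ p ∈ U, k p = max (h p) 0 := fun p hp => by rw [hk]; simp only [piecewise_eq_of_mem _ _ _ hp]
  have hstrip : strip ⊆ U := prod_mono Subset.rfl Ico_subset_Icc_self
  have hae : ∀ᵐ p ∂ν, p ∈ strip := by
    have h1 : ∀ᵐ p : ℝ × ℝ ∂volume, p.1 ≠ 0 :=
      Measure.quasiMeasurePreserving_fst.ae (p := (· ≠ 0)) (by simp [ae_iff])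
    have h2 : ∀ᵐ p : ℝ × ℝ ∂volume, p.2 ≠ 1 :=
      Measure.quasiMeasurePreserving_snd.ae (p := (· ≠ 1)) (by simp [ae_iff])
    filter_upwards [hac.ae_le h1, hac.ae_le h2, compl_mem_ae_iff.2 hsupp] with p hp1 hp2 hp
    rw [compl_compl] at hp
    exact ⟨⟨lt_of_le_of_ne hp.1.1 hp1.symm, hp.1.2⟩, hp.2.1, lt_of_le_of_ne hp.2.2 hp2⟩
  have H : LSVDensity α β p₁ ν k :=
    { param := P
      measurable := (hcont.measurable_piecewise continuousOn_const hUm).max measurable_const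
      nonneg := fun p => le_max_right _ _
      eq_withDensity := by
        rw [← Measure.restrict_eq_self_of_ae_mem hae, hden, restrict_withDensity measurableSet_strip]
        refine withDensity_congr_ae ((ae_restrict_mem measurableSet_strip).mono fun p hp => ?_)
        change _ = ENNReal.ofReal (k p)
        rw [hkU p (hstrip hp), ENNReal.ofReal_max, ENNReal.ofReal_zero]
        exact (max_eq_left bot_le).symm
      measurePreserving := ⟨measurable_skewLSV, Measure.ext fun A hA => by
        rw [Measure.map_apply measurable_skewLSV hA, hinv A hA]⟩
      lipschitz := by
        obtain ⟨L, hL⟩ := hLip _ (hsub (1 / 2) (by norm_num)) (hcpt _)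
        refine ⟨L, L.2, fun p hp q hq => ?_⟩
        rw [hkU p (hsub _ (by norm_num) hp), hkU q (hsub _ (by norm_num) hq)]
        exact (abs_max_sub_max_le_abs _ _ _).trans (hL.dist_le_mul p hp q hq) }
  refine ⟨k, H, fun p hp => ?_⟩
  obtain ⟨δ, hδ, hpos⟩ := H.exists_pos_le
  have h1 := hkU p (hsub _ (by norm_num) hp)
  have h2 : 0 < max (h p) 0 := h1 ▸ hδ.trans_le (hpos p hp)
  rw [h1, max_eq_left]
  exact ((lt_max_iff.1 h2).resolve_right (lt_irrefl _)).le

/-- A Hölder function on the unit square extends to a bounded measurable function. -/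
theorem exists_measurable_eqOn_of_holder {f : ℝ × ℝ → ℝ} {C t : ℝ} (ht : 0 < t)
    (hf : ∀ p ∈ Icc (0 : ℝ) 1 ×ˢ Icc (0 : ℝ) 1, ∀ q ∈ Icc (0 : ℝ) 1 ×ˢ Icc (0 : ℝ) 1,
      |f p - f q| ≤ C * dist p q ^ t) :
    ∃ (g : ℝ × ℝ → ℝ) (M : ℝ), Measurable g ∧ (∀ p, |g p| ≤ M) ∧
      EqOn g f (Icc (0 : ℝ) 1 ×ˢ Icc (0 : ℝ) 1) := by
  classical
  set Q := Icc (0 : ℝ) 1 ×ˢ Icc (0 : ℝ) 1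
  have hcont : ContinuousOn f Q := fun p hp => by
    rw [ContinuousWithinAt, tendsto_iff_dist_tendsto_zero]
    refine squeeze_zero' (Eventually.of_forall fun _ => dist_nonneg)
      (eventually_mem_nhdsWithin.mono fun q hq => hf q hq p hp) ?_
    have h1 : Continuous fun q : ℝ × ℝ => C * dist q p ^ t :=
      continuous_const.mul ((continuous_id.dist continuous_const).rpow_const fun _ => Or.inr ht.le)
    have h2 := (h1.tendsto p).mono_left (nhdsWithin_le_nhds (s := Q))
    rwa [dist_self, Real.zero_rpow ht.ne', mul_zero] at h2
  obtain ⟨M, hM⟩ := (isCompact_Icc.prod isCompact_Icc).exists_bound_of_continuousOn hcont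
  refine ⟨Q.piecewise f fun _ => 0, M, hcont.measurable_piecewise continuousOn_const
    (measurableSet_Icc.prod measurableSet_Icc), fun p => ?_, piecewise_eqOn _ _ _⟩
  by_cases hp : p ∈ Q
  · rw [piecewise_eq_of_mem _ _ _ hp]; exact hM p hp
  · rw [piecewise_eq_of_notMem _ _ _ hp, abs_zero]
    exact (norm_nonneg _).trans (hM (0, 0) (by simp))

end Regularity

/-- Convergence of the normalized characteristic functions to that of the standard Gaussian law. -/
theorem tendsto_integral_boundedContinuous_gaussian {X : Type*} [MeasurableSpace X] {ν : Measure X}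
    [IsProbabilityMeasure ν] {Z : ℕ → X → ℝ} (hZ : ∀ n, Measurable (Z n))
    (h : ∀ s : ℝ, Tendsto (fun n : ℕ => ∫ p, Complex.exp ((s * Z n p : ℝ) * Complex.I) ∂ν) atTop
      (𝓝 (Real.exp (-(s ^ 2 / 2)) : ℂ))) (g : BoundedContinuousFunction ℝ ℝ) :
    Tendsto (fun n => ∫ p, g (Z n p) ∂ν) atTop
      (𝓝 (∫ x, g x ∂(ProbabilityTheory.gaussianReal 0 1))) := by
  let μ : ℕ → ProbabilityMeasure ℝ := fun n =>
    ⟨ν.map (Z n), Measure.isProbabilityMeasure_map (hZ n).aemeasurable⟩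
  let γ : ProbabilityMeasure ℝ := ⟨ProbabilityTheory.gaussianReal 0 1, inferInstance⟩
  have h1 : Tendsto μ atTop (𝓝 γ) := by
    refine ProbabilityMeasure.tendsto_iff_tendsto_charFun.2 fun s => ?_
    have e : charFun (ProbabilityTheory.gaussianReal 0 1) s = (Real.exp (-(s ^ 2 / 2)) : ℂ) := by
      rw [ProbabilityTheory.charFun_gaussianReal]
      push_cast
      congr 1
      simp
    change Tendsto (fun n => charFun (ν.map (Z n)) s) atTop
      (𝓝 (charFun (ProbabilityTheory.gaussianReal 0 1) s))
    rw [e]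
    refine (h s).congr fun n => ?_
    rw [charFun_apply_real, integral_map (hZ n).aemeasurable (by fun_prop)]
    simp
  refine (ProbabilityMeasure.tendsto_iff_forall_integral_tendsto.1 h1 g).congr fun n => ?_
  exact integral_map (hZ n).aemeasurable g.continuous.aestronglyMeasurable

/-- Theorem 3.2 (3): nonstandard CLT at `α = 1/2` when `c ≠ 0`. -/
theorem clt_alpha_one_half (α β p₁ : ℝ) (hα : α = 1 / 2) (hαβ : α < β) (hβ : β < 1)
    (hp₁ : 0 < p₁) (hp₁' : p₁ < 1)
    (ν : Measure (ℝ × ℝ)) (hprob : IsProbabilityMeasure ν)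
    (hac : ν ≪ (volume : Measure (ℝ × ℝ)))
    (hsupp : ν ((Icc (0 : ℝ) 1 ×ˢ Icc (0 : ℝ) 1)ᶜ) = 0)
    (hinv : ∀ A : Set (ℝ × ℝ), MeasurableSet A → ν (skewLSV α β p₁ ⁻¹' A) = ν A)
    (h : ℝ × ℝ → ℝ) (hden : ν = volume.withDensity (fun p => ENNReal.ofReal (h p)))
    (hLip : ∀ K : Set (ℝ × ℝ), K ⊆ Ioc (0 : ℝ) 1 ×ˢ Icc (0 : ℝ) 1 → IsCompact K →
      ∃ L : NNReal, LipschitzOnWith L h K)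
    (f : ℝ × ℝ → ℝ)
    (hf : ∃ C t : ℝ, 0 < t ∧ t ≤ 1 ∧
      ∀ p ∈ Icc (0 : ℝ) 1 ×ˢ Icc (0 : ℝ) 1, ∀ q ∈ Icc (0 : ℝ) 1 ×ˢ Icc (0 : ℝ) 1,
        |f p - f q| ≤ C * dist p q ^ t)
    (hf0 : (∫ p, f p ∂ν) = 0)
    (c : ℝ) (hcdef : c = ∫ ω in Icc (0 : ℝ) 1, f (0, ω)) (hc : c ≠ 0) :
    ∀ g : BoundedContinuousFunction ℝ ℝ,
      Tendsto
        (fun n : ℕ =>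
          ∫ p, g (birkhoff α β p₁ f n p /
            Real.sqrt (c ^ 2 * Aconst α p₁ h * n * Real.log n)) ∂ν)
        atTop (𝓝 (∫ x, g x ∂(ProbabilityTheory.gaussianReal 0 1))) := by

  subst hα
  obtain ⟨C, t, ht, ht1, hfC⟩ := hf
  have hfC' : ∀ p ∈ Icc (0 : ℝ) 1 ×ˢ Icc (0 : ℝ) 1, ∀ q ∈ Icc (0 : ℝ) 1 ×ˢ Icc (0 : ℝ) 1,
      |f p - f q| ≤ max C 0 * dist p q ^ t := fun p hp q hq =>
    (hfC p hp q hq).trans (mul_le_mul_of_nonneg_right (le_max_left _ _) (by positivity))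
  have hC0 : 0 ≤ max C 0 := le_max_right _ _
  have P : LSVParam (1 / 2) β p₁ := ⟨by norm_num, by norm_num, by linarith, hβ.le, hp₁, hp₁'⟩
  obtain ⟨k, H, hkh⟩ := exists_LSVDensity P hac hsupp hinv hden hLip
  obtain ⟨F, M, hFm, hFM, hFf⟩ := exists_measurable_eqOn_of_holder ht hfC'
  have hstrip : strip ⊆ Icc (0 : ℝ) 1 ×ˢ Icc (0 : ℝ) 1 :=
    prod_mono Ioc_subset_Icc_self Ico_subset_Icc_self
  have hFC : ∀ p ∈ Icc (0 : ℝ) 1 ×ˢ Icc (0 : ℝ) 1, ∀ q ∈ Icc (0 : ℝ) 1 ×ˢ Icc (0 : ℝ) 1,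
      |F p - F q| ≤ max C 0 * dist p q ^ t := fun p hp q hq => by
    rw [hFf hp, hFf hq]; exact hfC' p hp q hq
  have hF0 : ∫ p, F p ∂ν = 0 := by
    rw [← hf0]
    exact integral_congr_ae (H.ae_mem_strip.mono fun p hp => hFf (hstrip hp))
  have hFc : ∫ ω in Ico (0 : ℝ) 1, F (0, ω) = c := by
    rw [hcdef, integral_Icc_eq_integral_Ico]
    exact setIntegral_congr_fun measurableSet_Ico fun ω hω =>
      hFf ⟨by norm_num, Ico_subset_Icc_self hω⟩
  have hA : 1 / p₁ ^ 2 * ∫ ω in Ico (0 : ℝ) 1, k (1 / 2, ω) = Aconst (1 / 2) p₁ h := by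
    rw [Aconst, integral_Icc_eq_integral_Ico,
      setIntegral_congr_fun (g := fun ω => h (1 / 2, ω)) measurableSet_Ico fun ω hω =>
        hkh ⟨by norm_num, Ico_subset_Icc_self hω⟩,
      show -(1 / (1 / 2 : ℝ)) = -((2 : ℕ) : ℝ) by norm_num, Real.rpow_neg (by positivity),
      Real.rpow_natCast]
    field_simp
    norm_num
    ring
  set A := Aconst (1 / 2) p₁ h
  have hApos : 0 < A := by
    obtain ⟨δ, hδ, hpos⟩ := H.exists_pos_le
    rw [← hA]
    obtain ⟨B, -, hB⟩ := H.exists_le_of_mem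
    have hmem : ∀ ω ∈ Ico (0 : ℝ) 1, ((1 / 2, ω) : ℝ × ℝ) ∈ Icc (1 / 2 : ℝ) 1 ×ˢ Icc (0 : ℝ) 1 :=
      fun ω hω => ⟨by norm_num, Ico_subset_Icc_self hω⟩
    have hi : IntegrableOn (fun ω => k (1 / 2, ω)) (Ico (0 : ℝ) 1) :=
      Measure.integrableOn_of_bounded (M := B) (by simp)
        (H.measurable.comp (by fun_prop)).aestronglyMeasurable
        ((ae_restrict_mem measurableSet_Ico).mono fun ω hω => by
          rw [Real.norm_eq_abs, abs_of_nonneg (H.nonneg _)]; exact hB _ (hmem ω hω))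
    refine mul_pos (by positivity) (hδ.trans_le ?_)
    simpa using setIntegral_mono_on (integrableOn_const (by simp)) hi measurableSet_Ico
      fun ω hω => hpos _ (hmem ω hω)
  obtain ⟨D, hD⟩ := H.exists_markovSystem
  obtain ⟨Cr, hCr, htail⟩ := H.exists_measureReal_lateSet_le hαβ
  have hvar := H.tendsto_setIntegral_truncObs_excursionSum hαβ hFm hFM hC0 ht hFC
  rw [hFc, hA] at hvar
  have hexp := tendsto_integral_exp_birkhoff H.measurePreserving measurableSet_base
    H.exists_iterate_succ_mem_base H.ae_exists_iterate_mem_base (hD t ht ht1)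
    (Rw := fun w => w.2.length + 1) (fun w y hy => P.returnTime_returnBranch w hy) hCr htail hFm hFM hF0
    (fun w x hx y hy => H.abs_excursionSum_sub_le hC0 ht
      (fun p hp q hq => hFC p (hstrip hp) q (hstrip hq)) w hx hy) hvar
  have hcA : 0 < c ^ 2 * A := by positivity
  intro g
  have hS := measurable_skewLSV (α := 1 / 2) (β := β) (p₁ := p₁)
  refine (tendsto_integral_boundedContinuous_gaussian (ν := ν)
    (Z := fun n p => birkhoff (1 / 2) β p₁ F n p / √(c ^ 2 * A * n * Real.log n))
    (fun n => (Finset.measurable_sum _ fun l _ => hFm.comp (hS.iterate l)).div_const _)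
    (fun s => ?_) g).congr fun n => ?_
  · have h1 := hexp (s / √(c ^ 2 * A))
    rw [div_pow, Real.sq_sqrt hcA.le] at h1
    convert h1 using 1
    · funext n
      refine integral_congr_ae (ae_of_all _ fun p => ?_)
      unfold birkhoff
      rw [mul_assoc (c ^ 2 * A), Real.sqrt_mul hcA.le]
      have e : ∀ x a b : ℝ, s * (x / (a * b)) = s / a / b * x := fun x a b => by
        rw [div_div, div_mul_eq_mul_div, mul_div_assoc]
      simp only [e]
    · congr 4
      field_simp
  · refine integral_congr_ae (H.ae_mem_strip.mono fun p hp => ?_)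
    have hmem : ∀ l, (skewLSV (1 / 2) β p₁)^[l] p ∈ strip := fun l => by
      induction l with
      | zero => exact hp
      | succ l ih => rw [Function.iterate_succ_apply']; exact P.skewLSV_mem ih
    change g (birkhoff _ _ _ F n p / _) = g (birkhoff _ _ _ f n p / _)
    rw [birkhoff, birkhoff, Finset.sum_congr rfl fun l _ => hFf (hstrip (hmem l))]
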